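/- Let $C$ be a smooth non-hyperelliptic complex projective curve of genus $3$, embedded in $\mathbb P^5=\mathbb P H^0(\omega_C^{\otimes 2})^*$ by its bicanonical system, and let $V\subset\mathbb P^5$ be the unique Veronese surface containing $C$. Write $[E]$ for the S-equivalence class of a semistable rank-two vector bundle $E$ on $C$ with $\det E\cong\omega_C^{\otimes 2}$, and put $E_o=\omega_C\oplus\omega_C$. Let $E$ be a stable, globally generated rank-two vector bundle on $C$ with $\det E\cong\omega_C^{\otimes2}$ and $[E]\neq[E_o]$. Let $G=\gamma([E])\subset\mathbb P^5$ be its Plücker quadric, that is, the set of all $[\varphi]\in\mathbb P H^0(\omega_C^{\otimes 2})^*$ such that the alternating form $\beta_\varphi(s,t)=\varphi(s\wedge t)$ on the four-dimensional space $H^0(E)$ satisfies $\beta_\varphi\wedge\beta_\varphi=0$ in $\bigwedge^4H^0(E)^*$. (If $\bigwedge^2H^0(E)\to H^0(\omega_C^{\otimes2})$ is an isomorphism, $G$ is the Grassmannian of lines of $\mathbb P H^0(E)^*$ in its Plücker embedding.) Let $\overline E$ be the dual span of $E$, the dual of the kernel of the evaluation $H^0(E)\otimes\mathcal O_C\to E$,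 so that $\iota([E])=[\overline E]$ for the birational involution $\iota$ associated to the degree-two rational map $\gamma$. Then $V\subset G$ if and only if $\iota([E])=[E_o]$, i.e. if and only if $\overline E$ is strictly semistable with $[\overline E]=[\omega_C\oplus\omega_C]$. -/

import Mathlib

/-!
# Vector bundles on a smooth projective complex curve

A smooth projective (irreducible) complex curve `C` is given by its function field `K`, a finitely
generated field extension of `ℂ` of transcendence degree one. The points of `C` are the valuation
rings of `K/ℂ`, which are the local rings `𝒪_{C,x} ⊆ K`.

A vector bundle `E` on `C` is given by its generic fibre, a finite dimensional `K`-vector space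
`F`, and by its stalks `E_x ⊆ F`: full `𝒪_{C,x}`-lattices of `F` that, for all but finitely many
`x`, are spanned by one and the same basis of `F`. The sections of `E` over an open set `U` are
`⋂_{x ∈ U} E_x`; a homomorphism of bundles is a `K`-linear map of generic fibres that maps stalks
to stalks.
-/

noncomputable section

open scoped TensorProduct

universe u v w

namespace Curve

/-! ### Curves and points -/

/-- `K` is the function field of a smooth projective complex curve. -/
structure IsFunctionField (K : Type u) [Field K] [Algebra ℂ K] : Prop where
  /-- `K` is a finitely generated field extension of `ℂ`. -/
  fg : (⊤ : IntermediateField ℂ K).FG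
  /-- `K` has transcendence degree one over `ℂ`. -/
  trdeg_eq_one : Algebra.trdeg ℂ K = 1

/-- A (closed) point of the curve with function field `K`: a valuation ring of `K` that contains
`ℂ` and is not `K`. -/
structure Point (K : Type u) [Field K] [Algebra ℂ K] where
  /-- The local ring of the curve at the point. -/
  ring : ValuationSubring K
  const_mem : ∀ c : ℂ, algebraMap ℂ K c ∈ ring
  ne_top : ring ≠ ⊤

section General

variable {K : Type u} [Field K] [Algebra ℂ K]
variable {F : Type v} [AddCommGroup F] [Module K F]
variable {F' : Type w} [AddCommGroup F'] [Module K F']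

/-- The local ring `𝒪_{C,x}` of the curve at `x`. -/
abbrev Point.O (x : Point K) : Type u := x.ring

/-! ### Vector bundles -/

variable (K F) in
/-- A family of submodules of the generic fibre `F` over the local rings of the curve: the stalks
of a subsheaf of the constant sheaf `F`. -/
def Stalks : Type (max u v) := (x : Point K) → Submodule x.O F

/-- The family of stalks `E` is a vector bundle with generic fibre `F`. -/
structure IsVectorBundle (E : Stalks K F) : Prop where
  finite : Module.Finite K F
  fg : ∀ x, (E x).FG
  span_eq_top : ∀ x, Submodule.span K (E x : Set F) = ⊤
  generic : ∃ b : Module.Basis (Fin (Module.finrank K F)) K F,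
    {x : Point K | E x ≠ Submodule.span x.O (Set.range b)}.Finite

/-- An isomorphism of vector bundles. -/
structure BundleIso (E : Stalks K F) (E' : Stalks K F') where
  equiv : F ≃ₗ[K] F'
  mem_iff : ∀ x a, equiv a ∈ E' x ↔ a ∈ E x

/-- The space `H⁰(E)` of global sections. -/
def H0 [Module ℂ F] [IsScalarTower ℂ K F] (E : Stalks K F) : Submodule ℂ F where
  carrier := {s | ∀ x, s ∈ E x}
  add_mem' := fun ha hb x => (E x).add_mem (ha x) (hb x)
  zero_mem' := fun x => (E x).zero_mem
  smul_mem' := fun c s hs x => by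
    have h := (E x).smul_mem (⟨algebraMap ℂ K c, x.const_mem c⟩ : x.O) (hs x)
    have e : (⟨algebraMap ℂ K c, x.const_mem c⟩ : x.O) • s = c • s := by
      rw [← algebraMap_smul K c s]; rfl
    rwa [e] at h

/-- `E` is globally generated: every stalk is generated by the global sections. -/
def IsGloballyGenerated [Module ℂ F] [IsScalarTower ℂ K F] (E : Stalks K F) : Prop :=
  ∀ x : Point K, Submodule.span x.O (H0 E : Set F) = E x

/-- The saturated subbundle of `E` with generic fibre the subspace `W ⊆ F`. -/
def sub (E : Stalks K F) (W : Submodule K F) : Stalks K W :=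
  fun x => (E x).comap (W.subtype.restrictScalars x.O)

/-- The quotient of `E` by the saturated subbundle with generic fibre `W`. -/
def quot (E : Stalks K F) (W : Submodule K F) : Stalks K (F ⧸ W) :=
  fun x => (E x).map (W.mkQ.restrictScalars x.O)

/-- The direct sum `E ⊕ E'`. -/
def directSum (E : Stalks K F) (E' : Stalks K F') : Stalks K (F × F') :=
  fun x => (E x).prod (E' x)

/-- The tensor product `E ⊗ E'`. -/
def tensor (E : Stalks K F) (E' : Stalks K F') : Stalks K (F ⊗[K] F') :=
  fun x => Submodule.span x.O {z | ∃ a ∈ E x, ∃ b ∈ E' x, z = a ⊗ₜ[K] b}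

/-- The second exterior power of `E`, which is `det E` if `E` has rank two. -/
def wedgeTwo (E : Stalks K F) : Stalks K (⋀[K]^2 F) :=
  fun x => Submodule.span x.O
    {z | ∃ a ∈ E x, ∃ b ∈ E x, z = exteriorPower.ιMulti K 2 ![a, b]}

/-- The dual bundle `E*`. -/
def dual (E : Stalks K F) : Stalks K (Module.Dual K F) := fun x =>
  { carrier := {f | ∀ a ∈ E x, f a ∈ x.ring}
    add_mem' := fun hf hg a ha => x.ring.add_mem _ _ (hf a ha) (hg a ha)
    zero_mem' := fun _ _ => x.ring.zero_mem
    smul_mem' := fun c _ hf a ha => x.ring.mul_mem _ _ c.2 (hf a ha) }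

variable (K) in
/-- The trivial bundle `H ⊗ 𝒪_C`. -/
def trivialBundle (H : Type v) [AddCommGroup H] [Module ℂ H] : Stalks K (K ⊗[ℂ] H) :=
  fun x => Submodule.span x.O (Set.range fun h : H => (1 : K) ⊗ₜ[ℂ] h)

/-! ### Degree, stability, S-equivalence -/

/-- The relative length `[M : N]` of two lattices over the local ring at `x`, that is
`length (M / M ∩ N) - length (N / M ∩ N)`. -/
def relLength (x : Point K) (M N : Submodule x.O F) : ℤ :=
  ((Module.length x.O (M ⧸ N.submoduleOf M)).toNat : ℤ) -
    ((Module.length x.O (N ⧸ M.submoduleOf N)).toNat : ℤ)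

/-- The degree of a vector bundle: the sum over all points of the relative length of the stalk
and of the lattice spanned by a basis of the generic fibre. (It does not depend on the basis,
since principal divisors have degree zero. For a line bundle it is the degree of the divisor of
a nonzero rational section.) -/
def degree (E : Stalks K F) : ℤ :=
  ∑ᶠ x : Point K,
    relLength x (E x) (Submodule.span x.O (Set.range (Module.Basis.ofVectorSpace K F)))

/-- Slope stability: every proper nonzero subbundle has smaller slope. -/
def IsStable (E : Stalks K F) : Prop :=
  ∀ W : Submodule K F, W ≠ ⊥ → W ≠ ⊤ →
    degree (sub E W) * (Module.finrank K F : ℤ) < degree E * (Module.finrank K W : ℤ)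

/-- Slope semistability. -/
def IsSemistable (E : Stalks K F) : Prop :=
  ∀ W : Submodule K F, W ≠ ⊥ → W ≠ ⊤ →
    degree (sub E W) * (Module.finrank K F : ℤ) ≤ degree E * (Module.finrank K W : ℤ)

/-- Semistable and not stable. -/
def IsStrictlySemistable (E : Stalks K F) : Prop := IsSemistable E ∧ ¬ IsStable E

/-- `W` is the generic fibre of the proper step `L` of a Jordan–Hölder filtration `0 ⊂ L ⊂ E` of
the strictly semistable rank two bundle `E`: a line subbundle with the slope of `E`. -/
def IsJordanHolderStep (E : Stalks K F) (W : Submodule K F) : Prop :=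
  Module.finrank K W = 1 ∧ 2 * degree (sub E W) = degree E

/-- `[E] = [E']` as points of the moduli space of semistable rank two bundles: `E` and `E'` are
S-equivalent, that is, they are isomorphic or they have Jordan–Hölder filtrations `0 ⊂ L ⊂ E` and
`0 ⊂ L' ⊂ E'` whose associated graded bundles `L ⊕ E/L` and `L' ⊕ E'/L'` are isomorphic. -/
def SEquivalent (E : Stalks K F) (E' : Stalks K F') : Prop :=
  Nonempty (BundleIso E E') ∨
    ∃ (W : Submodule K F) (W' : Submodule K F'),
      IsJordanHolderStep E W ∧ IsJordanHolderStep E' W' ∧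
      Nonempty (BundleIso (directSum (sub E W) (quot E W))
        (directSum (sub E' W') (quot E' W')))

/-! ### The dual span -/

/-- The evaluation `H⁰(E) ⊗ 𝒪_C → E` on generic fibres. -/
def evaluation [Module ℂ F] [IsScalarTower ℂ K F] (E : Stalks K F) : K ⊗[ℂ] H0 E →ₗ[K] F :=
  (H0 E).subtype.liftBaseChange K

/-- The dual span `Ē` of `E`: the dual of the kernel of the evaluation `H⁰(E) ⊗ 𝒪_C → E`. -/
def dualSpan [Module ℂ F] [IsScalarTower ℂ K F] (E : Stalks K F) :
    Stalks K (Module.Dual K (LinearMap.ker (evaluation E))) :=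
  dual (sub (trivialBundle K (H0 E)) (LinearMap.ker (evaluation E)))

end General

/-! ### The canonical bundle, genus, hyperelliptic curves -/

section Canonical

variable (K : Type u) [Field K] [Algebra ℂ K]

/-- The canonical bundle `ω_C`: the stalk at `x` is the module of regular differentials,
generated by the `df` with `f` in the local ring at `x`. -/
def canonical : Stalks K (Ω[K⁄ℂ]) :=
  fun x => Submodule.span x.O ((KaehlerDifferential.D ℂ K) '' (x.ring : Set K))

/-- The bicanonical bundle `ω_C ⊗ ω_C`. -/
def bicanonical : Stalks K (Ω[K⁄ℂ] ⊗[K] Ω[K⁄ℂ]) := tensor (canonical K) (canonical K)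

/-- The bundle `E_o = ω_C ⊕ ω_C`. -/
def bundleEo : Stalks K (Ω[K⁄ℂ] × Ω[K⁄ℂ]) := directSum (canonical K) (canonical K)

/-- The genus `h⁰(ω_C)`. -/
def genus : ℕ := Module.finrank ℂ (H0 (canonical K))

/-- The curve has a map of degree two to `ℙ¹`. (For a curve of genus at least two this means that
it is hyperelliptic.) -/
def IsHyperelliptic : Prop :=
  ∃ t : K, Module.finrank (IntermediateField.adjoin ℂ {t}) K = 2

/-! ### The bicanonical space `ℙ⁵` -/

/-- The vector space `H⁰(ω_C^{⊗2})*`. -/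
abbrev BicanonicalDual : Type u := Module.Dual ℂ (H0 (bicanonical K))

/-- The space `ℙ⁵ = ℙH⁰(ω_C^{⊗2})*` of lines of `H⁰(ω_C^{⊗2})*`. -/
abbrev BicanonicalSpace : Type u := Projectivization ℂ (BicanonicalDual K)

/-- The bicanonical curve `C ⊂ ℙ⁵`: the image of the point `x` of `C` is the class of the linear
form on `H⁰(ω_C^{⊗2})` whose kernel consists of the sections that vanish at `x`, that is, that lie
in `𝔪_x ω_C^{⊗2}`. -/
def bicanonicalCurve : Set (BicanonicalSpace K) :=
  {p | ∃ x : Point K, ∀ s : H0 (bicanonical K),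
    p.rep s = 0 ↔ (s : Ω[K⁄ℂ] ⊗[K] Ω[K⁄ℂ]) ∈ IsLocalRing.maximalIdeal x.O • bicanonical K x}

end Canonical

/-- A Veronese surface in a five-dimensional projective space `ℙ(U)`: in suitable coordinates, the
image of `ℙ² → ℙ⁵`, `(w₀ : w₁ : w₂) ↦ (w_i w_j)_{i ≤ j}`. -/
def IsVeroneseSurface {U : Type u} [AddCommGroup U] [Module ℂ U]
    (S : Set (Projectivization ℂ U)) : Prop :=
  ∃ b : Module.Basis (Sym2 (Fin 3)) ℂ U,
    S = {p | ∃ (w : Fin 3 → ℂ) (h : ∑ e : Sym2 (Fin 3), (e.map w).mul • b e ≠ 0),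
      p = Projectivization.mk ℂ (∑ e : Sym2 (Fin 3), (e.map w).mul • b e) h}

/-! ### The Plücker quadric -/

section Quadric

variable {K : Type u} [Field K] [Algebra ℂ K]
variable {F : Type v} [AddCommGroup F] [Module K F] [Module ℂ F] [IsScalarTower ℂ K F]

/-- The determinant map `H⁰(E) × H⁰(E) → H⁰(ω_C^{⊗2})`, `(s, t) ↦ s ∧ t`, of a bundle with an
isomorphism `δ : ⋀² E ≅ ω_C^{⊗2}`. -/
def detMap (E : Stalks K F) (δ : BundleIso (wedgeTwo E) (bicanonical K)) (s t : H0 E) :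
    H0 (bicanonical K) :=
  ⟨δ.equiv (exteriorPower.ιMulti K 2 ![(s : F), (t : F)]), fun x =>
    (δ.mem_iff x _).2 (Submodule.subset_span ⟨s, s.2 x, t, t.2 x, rfl⟩)⟩

/-- The quadric `G = γ([E]) ⊂ ℙ⁵`. A point `[φ]` of `ℙ⁵ = ℙH⁰(ω_C^{⊗2})*` defines the alternating
form `β(s, t) = φ(s ∧ t)` on the four-dimensional space `H⁰(E)`, an element of `⋀² H⁰(E)*`, and `G`
is the zero locus of the quadratic form `φ ↦ β ∧ β ∈ ⋀⁴ H⁰(E)*`. The equation says that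
`½ (β ∧ β)(a, b, c, d) = 0`, and it is the Plücker relation: `β = f ∧ g` for some
`f, g ∈ H⁰(E)*`. If `⋀² H⁰(E) → H⁰(ω_C^{⊗2})` is an isomorphism, then `ℙ⁵ = ℙ(⋀² H⁰(E)*)` and `G`
is the Grassmannian of lines of `ℙH⁰(E)*` in its Plücker embedding. -/
def pluckerQuadric (E : Stalks K F) (δ : BundleIso (wedgeTwo E) (bicanonical K)) :
    Set (BicanonicalSpace K) :=
  {p | ∀ a b c d : H0 E,
    p.rep (detMap E δ a b) * p.rep (detMap E δ c d)
      - p.rep (detMap E δ a c) * p.rep (detMap E δ b d)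
      + p.rep (detMap E δ a d) * p.rep (detMap E δ b c) = 0}

end Quadric

end Curve

end

noncomputable section

open scoped TensorProduct

universe u v w

set_option linter.unusedSectionVars false
set_option linter.style.haveILetI false
set_option linter.overlappingInstances false

namespace Curve

open Polynomial IsDedekindDomain

section Chart

variable {K : Type u} [Field K] [Algebra ℂ K]

theorem Point.ext_ring {x y : Point K} (h : x.ring = y.ring) : x = y := by
  cases x; cases y; simp_all

theorem Point.inv_mem_of_notMem (x : Point K) {f : K} (h : f ∉ x.ring) : f⁻¹ ∈ x.ring :=
  (x.ring.mem_or_inv_mem f).resolve_left h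

theorem Point.aeval_mem (x : Point K) {t : K} (ht : t ∈ x.ring) (p : ℂ[X]) :
    aeval t p ∈ x.ring := by
  induction p using Polynomial.induction_on' with
  | add p q hp hq => rw [map_add]; exact x.ring.add_mem _ _ hp hq
  | monomial n a =>
    rw [aeval_monomial]
    exact x.ring.mul_mem _ _ (x.const_mem a) (pow_mem ht n)

variable [Algebra ℂ[X] K] [IsScalarTower ℂ ℂ[X] K]
  (B : Type u) [CommRing B] [Algebra ℂ[X] B] [Algebra B K] [IsScalarTower ℂ[X] B K]
  [IsFractionRing B K] [IsDedekindDomain B] [IsIntegralClosure B ℂ[X] K]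

theorem algebraMap_poly_eq (p : ℂ[X]) :
    algebraMap ℂ[X] K p = aeval (algebraMap ℂ[X] K X) p := by
  conv_lhs => rw [← aeval_X_left_apply p]
  rw [aeval_algebraMap_apply]

theorem Point.algebraMap_mem (x : Point K) (hx : algebraMap ℂ[X] K X ∈ x.ring) (b : B) :
    algebraMap B K b ∈ x.ring := by
  have hb : IsIntegral ℂ[X] b := IsIntegralClosure.isIntegral ℂ[X] K b
  have hb' : IsIntegral ℂ[X] (algebraMap B K b) := hb.map (IsScalarTower.toAlgHom ℂ[X] B K)
  obtain ⟨p, hp, hpe⟩ := hb'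
  let φ : ℂ[X] →+* x.O := (algebraMap ℂ[X] K).codRestrict x.ring.toSubring fun q => by
    rw [algebraMap_poly_eq]; exact x.aeval_mem hx q
  have : IsIntegral x.O (algebraMap B K b) := by
    refine ⟨p.map φ, hp.map _, ?_⟩
    rw [eval₂_map]
    exact hpe
  obtain ⟨y, hy⟩ := (IsIntegrallyClosed.isIntegral_iff (R := x.O)).mp this
  rw [← hy]
  exact y.2

/-- The inclusion of the coordinate ring of an affine chart into a local ring. -/
def Point.chartHom (x : Point K) (hx : algebraMap ℂ[X] K X ∈ x.ring) : B →+* x.O :=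
  (algebraMap B K).codRestrict x.ring.toSubring (x.algebraMap_mem B hx)

/-- The prime of the coordinate ring of an affine chart given by a point. -/
def Point.chartPrime (x : Point K) (hx : algebraMap ℂ[X] K X ∈ x.ring) : HeightOneSpectrum B where
  asIdeal := (IsLocalRing.maximalIdeal x.O).comap (x.chartHom B hx)
  isPrime := inferInstance
  ne_bot := by
    intro h
    apply x.ne_top
    rw [eq_top_iff]
    intro f _
    obtain ⟨a, b, hb, rfl⟩ := IsFractionRing.div_surjective (A := B) f
    have hb0 : b ≠ 0 := nonZeroDivisors.ne_zero hb
    have : b ∉ (IsLocalRing.maximalIdeal x.O).comap (x.chartHom B hx) := by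
      rw [h]; simpa using hb0
    rw [Ideal.mem_comap, IsLocalRing.mem_maximalIdeal, mem_nonunits_iff, not_not] at this
    obtain ⟨c, hc⟩ := isUnit_iff_exists_inv.mp this
    have hc' : algebraMap B K b * (c : K) = 1 := congrArg Subtype.val hc
    have : (algebraMap B K b)⁻¹ = c := inv_eq_of_mul_eq_one_right hc'
    rw [div_eq_mul_inv, this]
    exact x.ring.mul_mem _ _ (x.algebraMap_mem B hx a) c.2

theorem Point.mem_chartPrime (x : Point K) (hx : algebraMap ℂ[X] K X ∈ x.ring) (b : B) :
    b ∈ (x.chartPrime B hx).asIdeal ↔ algebraMap B K b ∈ x.ring.nonunits :=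
  (ValuationSubring.coe_mem_nonunits_iff (a := x.chartHom B hx b)).symm

theorem Point.ring_eq_chart (x : Point K) (hx : algebraMap ℂ[X] K X ∈ x.ring) :
    HeightOneSpectrum.valuationSubringAtPrime K (x.chartPrime B hx) = x.ring := by
  refine ValuationSubring.eq_of_le_of_ne_top _ ?_ x.ne_top
  rintro _ ⟨a, s, hs, rfl⟩
  have hs' : algebraMap B K s ∉ x.ring.nonunits := fun h => hs ((x.mem_chartPrime B hx s).2 h)
  rw [ValuationSubring.mem_nonunits_iff_or] at hs'
  push Not at hs'
  exact x.ring.mul_mem _ _ (x.algebraMap_mem B hx a) hs'.2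

theorem Point.ring_eq_valuationSubring (x : Point K) (hx : algebraMap ℂ[X] K X ∈ x.ring) :
    ((x.chartPrime B hx).valuation K).valuationSubring = x.ring := by
  rw [← HeightOneSpectrum.valuationSubringAtPrime_eq_valuationSubring, x.ring_eq_chart B hx]

theorem Point.mem_ring_iff_valuation (x : Point K) (hx : algebraMap ℂ[X] K X ∈ x.ring) (f : K) :
    f ∈ x.ring ↔ (x.chartPrime B hx).valuation K f ≤ 1 := by
  rw [← x.ring_eq_valuationSubring B hx, Valuation.mem_valuationSubring_iff]

theorem Point.chartPrime_injective {x y : Point K} (hx : algebraMap ℂ[X] K X ∈ x.ring)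
    (hy : algebraMap ℂ[X] K X ∈ y.ring) (h : x.chartPrime B hx = y.chartPrime B hy) : x = y := by
  apply Point.ext_ring
  rw [← x.ring_eq_chart B hx, ← y.ring_eq_chart B hy, h]

theorem Point.isDiscreteValuationRing_of_chart (B : Type u) [CommRing B] [Algebra ℂ[X] B]
    [Algebra B K] [IsScalarTower ℂ[X] B K] [IsFractionRing B K] [IsDedekindDomain B]
    [IsIntegralClosure B ℂ[X] K] (x : Point K)
    (hx : algebraMap ℂ[X] K X ∈ x.ring) : IsDiscreteValuationRing x.O := by
  have := IsLocalization.AtPrime.isDiscreteValuationRing_of_dedekind_domain B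
    (x.chartPrime B hx).ne_bot (HeightOneSpectrum.valuationSubringAtPrime K (x.chartPrime B hx))
  rw [x.ring_eq_chart B hx] at this
  exact this

/-- The point given by a prime of the coordinate ring of an affine chart. -/
def Point.ofPrime (v : HeightOneSpectrum B) : Point K where
  ring := (v.valuation K).valuationSubring
  const_mem c := by
    rw [Valuation.mem_valuationSubring_iff, IsScalarTower.algebraMap_apply ℂ ℂ[X] K,
      IsScalarTower.algebraMap_apply ℂ[X] B K]
    exact v.valuation_le_one _
  ne_top := by
    rw [ne_eq, Valuation.valuationSubring_eq_top_iff, not_not]; infer_instance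

theorem Point.ofPrime_mem (v : HeightOneSpectrum B) (b : B) :
    algebraMap B K b ∈ (Point.ofPrime B v : Point K).ring := v.valuation_le_one b

theorem Point.ofPrime_X_mem (v : HeightOneSpectrum B) :
    algebraMap ℂ[X] K X ∈ (Point.ofPrime B v : Point K).ring := by
  rw [IsScalarTower.algebraMap_apply ℂ[X] B K]
  exact Point.ofPrime_mem B v _

theorem Point.ofPrime_mem_nonunits (v : HeightOneSpectrum B) (b : B) :
    algebraMap B K b ∈ (Point.ofPrime B v : Point K).ring.nonunits ↔ b ∈ v.asIdeal := by
  have h1 := Point.ofPrime_mem (K := K) B v b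
  rw [← v.valuation_lt_one_iff_mem (K := K), ValuationSubring.mem_nonunits_iff]
  exact ((Valuation.isEquiv_valuation_valuationSubring (v.valuation K)).lt_one_iff_lt_one).symm

theorem exists_eq_of_forall_mem (f : K)
    (h : ∀ x : Point K, algebraMap ℂ[X] K X ∈ x.ring → f ∈ x.ring) :
    ∃ b : B, algebraMap B K b = f :=
  HeightOneSpectrum.mem_integers_of_valuation_le_one K f fun v =>
    h (Point.ofPrime B v) (Point.ofPrime_X_mem B v)

theorem finite_setOf_mem_nonunits (b : B) (hb : b ≠ 0) :
    {x : Point K | algebraMap ℂ[X] K X ∈ x.ring ∧ algebraMap B K b ∈ x.ring.nonunits}.Finite := by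
  classical
  have hI : Ideal.span {b} ≠ 0 := by simpa using hb
  have hfin := Ideal.finite_factors hI
  refine Set.Finite.of_finite_image (f := fun x : Point K =>
    if hx : algebraMap ℂ[X] K X ∈ x.ring then some (x.chartPrime B hx) else none) ?_ ?_
  · refine (hfin.image some).subset ?_
    rintro _ ⟨x, ⟨hx, hxb⟩, rfl⟩
    simp only [hx, dif_pos]
    refine ⟨_, ?_, rfl⟩
    rw [Set.mem_ofPred_eq, Ideal.dvd_span_singleton]
    exact (x.mem_chartPrime B hx b).2 hxb
  · rintro x ⟨hx, -⟩ y ⟨hy, -⟩ h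
    simp only [hx, hy, dif_pos, Option.some.injEq] at h
    exact Point.chartPrime_injective B hx hy h

theorem finite_setOf_notMem (B : Type u) [CommRing B] [Algebra ℂ[X] B]
    [Algebra B K] [IsScalarTower ℂ[X] B K] [IsFractionRing B K] [IsDedekindDomain B]
    [IsIntegralClosure B ℂ[X] K] (f : K) :
    {x : Point K | algebraMap ℂ[X] K X ∈ x.ring ∧ f ∉ x.ring}.Finite := by
  obtain ⟨a, b, hb, rfl⟩ := IsFractionRing.div_surjective (A := B) f
  refine (finite_setOf_mem_nonunits B b (nonZeroDivisors.ne_zero hb)).subset ?_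
  rintro x ⟨hx, hf⟩
  refine ⟨hx, ?_⟩
  by_contra hcon
  rw [ValuationSubring.mem_nonunits_iff_or] at hcon
  push Not at hcon
  exact hf (by rw [div_eq_mul_inv]; exact x.ring.mul_mem _ _ (x.algebraMap_mem B hx a) hcon.2)

theorem exists_separating {x y : Point K} (hxy : x ≠ y) (hx : algebraMap ℂ[X] K X ∈ x.ring)
    (hy : algebraMap ℂ[X] K X ∈ y.ring) :
    ∃ b : B, algebraMap B K b ∈ y.ring.nonunits ∧ algebraMap B K b ∉ x.ring.nonunits := by
  by_contra hcon
  push Not at hcon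
  apply hxy
  refine Point.chartPrime_injective B hx hy (HeightOneSpectrum.ext ?_)
  have hle : (y.chartPrime B hy).asIdeal ≤ (x.chartPrime B hx).asIdeal := fun b hb =>
    (x.mem_chartPrime B hx b).2 (hcon b ((y.mem_chartPrime B hy b).1 hb))
  exact ((y.chartPrime B hy).isMaximal.eq_of_le (x.chartPrime B hx).isPrime.ne_top hle).symm

theorem Point.exists_const_sub_mem_of_chart (B : Type u) [CommRing B] [Algebra ℂ[X] B]
    [Algebra B K] [IsScalarTower ℂ[X] B K] [IsFractionRing B K] [IsDedekindDomain B]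
    [IsIntegralClosure B ℂ[X] K] [Module.Finite ℂ[X] B] (x : Point K)
    (hx : algebraMap ℂ[X] K X ∈ x.ring) {f : K} (hf : f ∈ x.ring) :
    ∃ c : ℂ, f - algebraMap ℂ K c ∈ x.ring.nonunits := by
  letI : Algebra ℂ B := ((algebraMap ℂ[X] B).comp (algebraMap ℂ ℂ[X])).toAlgebra
  haveI : IsScalarTower ℂ ℂ[X] B := IsScalarTower.of_algebraMap_eq' rfl
  haveI : Algebra.FiniteType ℂ B := Algebra.FiniteType.trans (S := ℂ[X]) inferInstance inferInstance
  have hm := (x.chartPrime B hx).isMaximal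
  letI := Ideal.Quotient.field (x.chartPrime B hx).asIdeal
  haveI : Algebra.FiniteType ℂ (B ⧸ (x.chartPrime B hx).asIdeal) :=
    Algebra.FiniteType.of_surjective (Ideal.Quotient.mkₐ ℂ _) (Ideal.Quotient.mkₐ_surjective _ _)
  haveI : Module.Finite ℂ (B ⧸ (x.chartPrime B hx).asIdeal) :=
    finite_of_finite_type_of_isJacobsonRing ℂ _
  have hsurj := (IsAlgClosed.algebraMap_bijective_of_isIntegral (k := ℂ)
    (K := B ⧸ (x.chartPrime B hx).asIdeal)).2
  have hB : ∀ b : B, ∃ c : ℂ, algebraMap B K b - algebraMap ℂ K c ∈ x.ring.nonunits := by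
    intro b
    obtain ⟨c, hc⟩ := hsurj (Ideal.Quotient.mk _ b)
    refine ⟨c, ?_⟩
    have : b - algebraMap ℂ B c ∈ (x.chartPrime B hx).asIdeal := by
      rw [← Ideal.Quotient.eq_zero_iff_mem, map_sub, sub_eq_zero, ← hc]
      rfl
    have := (x.mem_chartPrime B hx _).1 this
    rwa [map_sub, show algebraMap B K (algebraMap ℂ B c) = algebraMap ℂ K c by
      rw [IsScalarTower.algebraMap_apply ℂ ℂ[X] K, IsScalarTower.algebraMap_apply ℂ[X] B K]; rfl]
      at this
  rw [x.mem_ring_iff_valuation B hx] at hf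
  obtain ⟨n, d, hnd⟩ := HeightOneSpectrum.exists_primeCompl_mul_eq_of_integer _ f hf
  have hd : algebraMap B K d ∉ x.ring.nonunits := fun h => d.2 ((x.mem_chartPrime B hx d).2 h)
  obtain ⟨a, ha⟩ := hB n
  obtain ⟨c, hc⟩ := hB d
  have hd0 : algebraMap B K d ≠ 0 := fun h => hd (by rw [h]; exact ZeroMemClass.zero_mem _)
  have hc0 : c ≠ 0 := by
    rintro rfl
    exact hd (by simpa using hc)
  have hc0' : algebraMap ℂ K c ≠ 0 := by simpa using hc0
  refine ⟨a / c, ?_⟩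
  have hdi : (algebraMap B K d)⁻¹ ∈ x.ring := by
    rw [ValuationSubring.mem_nonunits_iff_or] at hd
    push Not at hd
    exact hd.2
  have key : f - algebraMap ℂ K (a / c) = (algebraMap B K d)⁻¹ * (algebraMap ℂ K c⁻¹) *
      (algebraMap ℂ K c * (algebraMap B K n - algebraMap ℂ K a) -
        algebraMap ℂ K a * (algebraMap B K d - algebraMap ℂ K c)) := by
    rw [← hnd, map_div₀, map_inv₀]
    field_simp
    ring
  have mulmem : ∀ p ∈ x.ring, ∀ q ∈ x.ring.nonunits, p * q ∈ x.ring.nonunits := by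
    intro p hp q hq
    obtain ⟨hq', hq2⟩ := ValuationSubring.mem_nonunits_iff_exists_mem_maximalIdeal.1 hq
    exact ValuationSubring.mem_nonunits_iff_exists_mem_maximalIdeal.2
      ⟨x.ring.mul_mem _ _ hp hq', Ideal.mul_mem_left _ (⟨p, hp⟩ : x.O) hq2⟩
  rw [key]
  exact mulmem _ (x.ring.mul_mem _ _ hdi (x.const_mem _)) _
    (sub_mem (mulmem _ (x.const_mem _) _ ha) (mulmem _ (x.const_mem _) _ hc))

end Chart

theorem Point.mem_of_mem_nonunits {K : Type u} [Field K] [Algebra ℂ K] {x : Point K} {f : K}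
    (h : f ∈ x.ring.nonunits) : f ∈ x.ring :=
  x.ring.nonunits_subset h

theorem Point.mul_mem_nonunits {K : Type u} [Field K] [Algebra ℂ K] {x : Point K} {f g : K}
    (hf : f ∈ x.ring) (hg : g ∈ x.ring.nonunits) : f * g ∈ x.ring.nonunits := by
  obtain ⟨hq', hq2⟩ := ValuationSubring.mem_nonunits_iff_exists_mem_maximalIdeal.1 hg
  exact ValuationSubring.mem_nonunits_iff_exists_mem_maximalIdeal.2
    ⟨x.ring.mul_mem _ _ hf hq', Ideal.mul_mem_left _ (⟨f, hf⟩ : x.O) hq2⟩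

theorem Point.inv_mem_of_notMem_nonunits {K : Type u} [Field K] [Algebra ℂ K] {x : Point K} {f : K}
    (hf : f ∉ x.ring.nonunits) : f⁻¹ ∈ x.ring := by
  rw [ValuationSubring.mem_nonunits_iff_or] at hf
  push Not at hf
  exact hf.2

theorem Point.const_notMem_nonunits {K : Type u} [Field K] [Algebra ℂ K] (x : Point K) {c : ℂ}
    (hc : c ≠ 0) : algebraMap ℂ K c ∉ x.ring.nonunits := by
  rw [ValuationSubring.mem_nonunits_iff_or]
  push Not
  exact ⟨by simpa using hc, by rw [← map_inv₀]; exact x.const_mem _⟩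

theorem Point.aeval_mem_nonunits_iff {K : Type u} [Field K] [Algebra ℂ K] {x : Point K} {s : K}
    (hs : s ∈ x.ring.nonunits) (p : ℂ[X]) :
    aeval s p ∈ x.ring.nonunits ↔ p.coeff 0 = 0 := by
  have h1 : aeval s p = s * aeval s p.divX + algebraMap ℂ K (p.coeff 0) := by
    calc aeval s p = aeval s (X * p.divX + C (p.coeff 0)) := by rw [X_mul_divX_add]
      _ = _ := by rw [map_add, map_mul, aeval_X, aeval_C]
  have h2 : s * aeval s p.divX ∈ x.ring.nonunits := by
    rw [mul_comm]
    exact Point.mul_mem_nonunits (x.aeval_mem (Point.mem_of_mem_nonunits hs) _) hs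
  constructor
  · intro h
    by_contra h0
    refine x.const_notMem_nonunits h0 ?_
    have := sub_mem h h2
    rwa [h1, add_sub_cancel_left] at this
  · intro h
    rw [h1, h, map_zero, add_zero]
    exact h2

section Chart

variable {K : Type u} [Field K] [Algebra ℂ K] [Algebra ℂ[X] K] [IsScalarTower ℂ ℂ[X] K]
  (B : Type u) [CommRing B] [Algebra ℂ[X] B] [Algebra B K] [IsScalarTower ℂ[X] B K]
  [IsFractionRing B K] [IsDedekindDomain B] [IsIntegralClosure B ℂ[X] K] [Module.Finite ℂ[X] B]
  [IsLocalization (Algebra.algebraMapSubmonoid B (nonZeroDivisors ℂ[X])) K]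
  (k : Type u) [Field k] [Algebra ℂ[X] k] [IsFractionRing ℂ[X] k] [Algebra k K]
  [IsScalarTower ℂ[X] k K] [FiniteDimensional k K]

theorem exists_poly_mul_mem (z : K)
    (hz : ∀ x : Point K, algebraMap ℂ[X] K X ∈ x.ring.nonunits → z ∈ x.ring) :
    ∃ (q : ℂ[X]) (b : B), q.coeff 0 ≠ 0 ∧ algebraMap B K b = algebraMap ℂ[X] K q * z := by
  obtain ⟨⟨a, ⟨_, p, hp, rfl⟩⟩, h⟩ := IsLocalization.surj
    (Algebra.algebraMapSubmonoid B (nonZeroDivisors ℂ[X])) z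
  have hp0 : p ≠ 0 := nonZeroDivisors.ne_zero hp
  obtain ⟨q, hq, hq'⟩ := Polynomial.exists_eq_pow_rootMultiplicity_mul_and_not_dvd p hp0 0
  rw [C_0, sub_zero] at hq hq'
  have hq0 : q.coeff 0 ≠ 0 := fun h0 => hq' (X_dvd_iff.2 h0)
  simp only [← IsScalarTower.algebraMap_apply ℂ[X] B K] at h
  obtain ⟨b, hb⟩ := exists_eq_of_forall_mem B (algebraMap ℂ[X] K q * z) fun x hx => by
    by_cases hs : algebraMap ℂ[X] K X ∈ x.ring.nonunits
    · refine x.ring.mul_mem _ _ ?_ (hz x hs)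
      rw [algebraMap_poly_eq]
      exact x.aeval_mem hx q
    · have hs0 : algebraMap ℂ[X] K X ≠ 0 := fun h => hs (by rw [h]; exact ZeroMemClass.zero_mem _)
      have : algebraMap ℂ[X] K q * z =
          ((algebraMap ℂ[X] K X)⁻¹) ^ (p.rootMultiplicity 0) * algebraMap B K a := by
        have hpq : algebraMap ℂ[X] K p =
            algebraMap ℂ[X] K X ^ p.rootMultiplicity 0 * algebraMap ℂ[X] K q := by
          rw [← map_pow, ← map_mul, ← hq]
        rw [← h, hpq, inv_pow]
        field_simp
      rw [this]
      exact x.ring.mul_mem _ _ (pow_mem (Point.inv_mem_of_notMem_nonunits hs) _)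
        (x.algebraMap_mem B hx a)
  exact ⟨q, b, hq0, hb⟩

theorem trace_mem_nonunits (B : Type u) [CommRing B] [Algebra ℂ[X] B]
    [Algebra B K] [IsScalarTower ℂ[X] B K] [IsFractionRing B K] [IsDedekindDomain B]
    [IsIntegralClosure B ℂ[X] K] [Module.Finite ℂ[X] B]
    [IsLocalization (Algebra.algebraMapSubmonoid B (nonZeroDivisors ℂ[X])) K] (z : K)
    (hz : ∀ x : Point K, algebraMap ℂ[X] K X ∈ x.ring.nonunits → z ∈ x.ring.nonunits)
    (x : Point K) (hx : algebraMap ℂ[X] K X ∈ x.ring.nonunits) :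
    algebraMap k K (Algebra.trace k K z) ∈ x.ring.nonunits := by
  have hinj : Function.Injective (algebraMap ℂ[X] K) := by
    rw [IsScalarTower.algebraMap_eq ℂ[X] k K]
    exact (algebraMap k K).injective.comp (IsFractionRing.injective ℂ[X] k)
  have hinjB : Function.Injective (algebraMap ℂ[X] B) := by
    rw [IsScalarTower.algebraMap_eq ℂ[X] B K, RingHom.coe_comp] at hinj
    exact hinj.of_comp
  haveI : Module.IsTorsionFree ℂ[X] B :=
    Module.isTorsionFree_iff_algebraMap_injective.2 hinjB
  obtain ⟨q, b, hq, hb⟩ := exists_poly_mul_mem B z fun x hx => Point.mem_of_mem_nonunits (hz x hx)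
  let P : Ideal ℂ[X] := Ideal.span {X}
  haveI : P.IsMaximal := PrincipalIdealRing.isMaximal_of_irreducible irreducible_X
  letI := Ideal.Quotient.field P
  have hnil : IsNilpotent (Ideal.Quotient.mk (P.map (algebraMap ℂ[X] B)) b) := by
    have : b ∈ (P.map (algebraMap ℂ[X] B)).radical := by
      rw [Ideal.radical_eq_sInf, Submodule.mem_sInf]
      rintro J ⟨hJ, hJp⟩
      have hXJ : algebraMap ℂ[X] B X ∈ J :=
        hJ (Ideal.mem_map_of_mem _ (Ideal.mem_span_singleton_self X))
      have hJ0 : J ≠ ⊥ := by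
        rintro rfl
        simp at hXJ
      let v : HeightOneSpectrum B := ⟨J, hJp, hJ0⟩
      have h1 : algebraMap ℂ[X] K X ∈ (Point.ofPrime B v : Point K).ring.nonunits := by
        rw [IsScalarTower.algebraMap_apply ℂ[X] B K]
        exact (Point.ofPrime_mem_nonunits B v _).2 hXJ
      have h2 := hz _ h1
      refine (Point.ofPrime_mem_nonunits (K := K) B v b).1 ?_
      rw [hb]
      refine Point.mul_mem_nonunits ?_ h2
      rw [algebraMap_poly_eq]
      exact Point.aeval_mem _ (Point.mem_of_mem_nonunits h1) _
    obtain ⟨n, hn⟩ := this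
    exact ⟨n, by rw [← map_pow]; exact Ideal.Quotient.eq_zero_iff_mem.2 hn⟩
  have htr : Algebra.trace (ℂ[X] ⧸ P) (B ⧸ P.map (algebraMap ℂ[X] B))
      (Ideal.Quotient.mk (P.map (algebraMap ℂ[X] B)) b) = 0 := by
    rw [Algebra.trace_apply]
    refine (LinearMap.isNilpotent_trace_of_isNilpotent ?_).eq_zero
    exact hnil.map (Algebra.lmul (ℂ[X] ⧸ P) (B ⧸ P.map (algebraMap ℂ[X] B)))
  rw [Algebra.trace_quotient_eq_of_isDedekindDomain, Ideal.Quotient.eq_zero_iff_mem,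
    Ideal.mem_span_singleton] at htr
  obtain ⟨r, hr⟩ := htr
  have h1 := Algebra.algebraMap_intTrace (A := ℂ[X]) (K := k) (L := K) (B := B) b
  rw [hb, ← Algebra.smul_def, ← algebraMap_smul k q z, map_smul, hr, smul_eq_mul] at h1
  have h2 := congrArg (algebraMap k K) h1
  rw [map_mul (algebraMap k K), ← IsScalarTower.algebraMap_apply,
    ← IsScalarTower.algebraMap_apply, map_mul] at h2
  have hqn : algebraMap ℂ[X] K q ∉ x.ring.nonunits := by
    rw [algebraMap_poly_eq, Point.aeval_mem_nonunits_iff hx]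
    exact hq
  have hq0 : algebraMap ℂ[X] K q ≠ 0 := fun h => hqn (by rw [h]; exact ZeroMemClass.zero_mem _)
  have h3 : algebraMap k K (Algebra.trace k K z) =
      ((algebraMap ℂ[X] K q)⁻¹ * algebraMap ℂ[X] K r) * algebraMap ℂ[X] K X := by
    field_simp
    rw [mul_comm, ← h2, mul_comm]
  rw [h3]
  refine Point.mul_mem_nonunits (x.ring.mul_mem _ _ (Point.inv_mem_of_notMem_nonunits hqn) ?_) hx
  rw [algebraMap_poly_eq]
  exact x.aeval_mem (Point.mem_of_mem_nonunits hx) _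

/-- In a nonzero finite dimensional commutative algebra over a field of characteristic zero, the
trace form detects nilpotent elements. -/
theorem isNilpotent_of_forall_trace_mul_eq_zero {F A : Type*} [Field F] [CharZero F] [CommRing A]
    [Algebra F A] [FiniteDimensional F A] (d : A) (h : ∀ a, Algebra.trace F A (d * a) = 0) :
    IsNilpotent d := by
  haveI : IsArtinianRing A := IsArtinianRing.of_finite F A
  obtain ⟨n, c, hc⟩ := IsArtinian.exists_pow_succ_smul_dvd d (1 : A)
  simp only [smul_eq_mul, mul_one] at hc
  have h1 : ∀ m, d ^ n = d ^ (n + m) * c ^ m := by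
    intro m
    induction m with
    | zero => simp
    | succ m ih => rw [ih]; rw [Nat.succ_eq_add_one] at hc; linear_combination (- d ^ m * c ^ m) * hc
  set e := d ^ (n + 1) * c ^ (n + 1) with he
  have hee : e * e = e := by
    have := h1 (n + 1)
    rw [he]
    linear_combination (- d * c ^ (n + 1)) * this
  have hproj : LinearMap.IsProj (LinearMap.range (Algebra.lmul F A e)) (Algebra.lmul F A e) :=
    ⟨fun a => ⟨a, rfl⟩, by
      rintro _ ⟨a, rfl⟩
      simp [← mul_assoc, hee]⟩
  have ht : Algebra.trace F A e = 0 := by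
    rw [he, pow_succ', mul_assoc]
    exact h _
  rw [Algebra.trace_apply, hproj.trace, Nat.cast_eq_zero, Submodule.finrank_eq_zero,
    LinearMap.range_eq_bot] at ht
  have he0 : e = 0 := by simpa using LinearMap.congr_fun ht 1
  refine ⟨n, ?_⟩
  have h4 : d ^ n = d ^ n * e := by
    have h5 := h1 (n + 1)
    rw [he]
    linear_combination h5
  rw [h4, he0, mul_zero]

theorem mul_mem_nonunits_of_trace (y : K)
    (hy : ∀ b : B, ∀ x : Point K, algebraMap ℂ[X] K X ∈ x.ring.nonunits →
      algebraMap k K (Algebra.trace k K (y * algebraMap B K b)) ∈ x.ring)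
    (x : Point K) (hx : algebraMap ℂ[X] K X ∈ x.ring.nonunits) :
    algebraMap ℂ[X] K X * y ∈ x.ring.nonunits := by
  by_contra hcon
  have hinj : Function.Injective (algebraMap ℂ[X] K) := by
    rw [IsScalarTower.algebraMap_eq ℂ[X] k K]
    exact (algebraMap k K).injective.comp (IsFractionRing.injective ℂ[X] k)
  have hinjB : Function.Injective (algebraMap ℂ[X] B) := by
    rw [IsScalarTower.algebraMap_eq ℂ[X] B K, RingHom.coe_comp] at hinj
    exact hinj.of_comp
  haveI : Module.IsTorsionFree ℂ[X] B :=
    Module.isTorsionFree_iff_algebraMap_injective.2 hinjB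
  have hxs := Point.mem_of_mem_nonunits hx
  have hinv := Point.inv_mem_of_notMem_nonunits hcon
  have hne : algebraMap ℂ[X] K X * y ≠ 0 :=
    fun h => hcon (by rw [h]; exact ZeroMemClass.zero_mem _)
  rw [x.mem_ring_iff_valuation B hxs] at hinv
  obtain ⟨n, d, hnd⟩ := HeightOneSpectrum.exists_primeCompl_mul_eq_of_integer _ _ hinv
  have hd : algebraMap ℂ[X] K X * (y * algebraMap B K n) = algebraMap B K d := by
    rw [← hnd, ← mul_assoc, mul_inv_cancel_left₀ hne]
  let P : Ideal ℂ[X] := Ideal.span {X}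
  haveI : P.IsMaximal := PrincipalIdealRing.isMaximal_of_irreducible irreducible_X
  letI := Ideal.Quotient.field P
  haveI : CharZero (ℂ[X] ⧸ P) := charZero_of_injective_algebraMap (R := ℂ)
    (algebraMap ℂ (ℂ[X] ⧸ P)).injective
  haveI : Module.Finite (ℂ[X] ⧸ P) (B ⧸ P.map (algebraMap ℂ[X] B)) := inferInstance
  have key : IsNilpotent (Ideal.Quotient.mk (P.map (algebraMap ℂ[X] B)) (d : B)) := by
    refine isNilpotent_of_forall_trace_mul_eq_zero (F := ℂ[X] ⧸ P) _ fun a => ?_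
    obtain ⟨a, rfl⟩ := Ideal.Quotient.mk_surjective a
    rw [← map_mul, Algebra.trace_quotient_eq_of_isDedekindDomain, Ideal.Quotient.eq_zero_iff_mem,
      Ideal.mem_span_singleton, X_dvd_iff, ← Point.aeval_mem_nonunits_iff hx, ← algebraMap_poly_eq,
      IsScalarTower.algebraMap_apply ℂ[X] k K,
      Algebra.algebraMap_intTrace (A := ℂ[X]) (K := k) (L := K) (B := B), map_mul, ← hd, mul_assoc,
      mul_assoc, ← map_mul, ← Algebra.smul_def, ← algebraMap_smul k (X : ℂ[X]), map_smul,
      smul_eq_mul, map_mul, ← IsScalarTower.algebraMap_apply, mul_comm]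
    exact Point.mul_mem_nonunits (hy _ x hx) hx
  obtain ⟨m, hm⟩ := key
  rw [← map_pow, Ideal.Quotient.eq_zero_iff_mem] at hm
  have hle : P.map (algebraMap ℂ[X] B) ≤ (x.chartPrime B hxs).asIdeal := by
    rw [Ideal.map_span, Set.image_singleton, Ideal.span_singleton_le_iff_mem,
      x.mem_chartPrime B hxs, ← IsScalarTower.algebraMap_apply]
    exact hx
  exact d.2 ((x.chartPrime B hxs).isPrime.mem_of_pow_mem _ (hle hm))

end Chart

open IntermediateField

section Facts

variable {K : Type u} [Field K] [Algebra ℂ K]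

theorem IsFunctionField.exists_transcendental (hK : IsFunctionField K) :
    ∃ t : K, Transcendental ℂ t := by
  by_contra h
  push Not at h
  have : Algebra.IsAlgebraic ℂ K := ⟨fun t => by simpa [Transcendental] using h t⟩
  have h1 := hK.trdeg_eq_one
  rw [trdeg_eq_zero] at h1
  exact zero_ne_one h1

theorem IsFunctionField.finiteDimensional (hK : IsFunctionField K) {t : K}
    (ht : Transcendental ℂ t) : FiniteDimensional ℂ⟮t⟯ K := by
  haveI : Algebra.EssFiniteType ℂ K := IntermediateField.fg_top_iff.1 hK.fg
  haveI : Algebra.EssFiniteType ℂ⟮t⟯ K := Algebra.EssFiniteType.of_comp ℂ ℂ⟮t⟯ K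
  have hb : IsTranscendenceBasis ℂ (fun _ : PUnit.{u + 1} => t) := by
    refine AlgebraicIndependent.isTranscendenceBasis_of_trdeg_le_of_finite
      (algebraicIndependent_unique_type_iff.2 ht) ?_
    rw [hK.trdeg_eq_one]
    simp
  haveI : Algebra.IsAlgebraic ℂ⟮t⟯ K := by
    have := hb.isAlgebraic_field
    rwa [Set.range_const] at this
  exact Algebra.finite_of_essFiniteType_of_isAlgebraic

/-- The `ℂ[X]`-algebra structure of `K` in which `X` acts as `t`. -/
abbrev polyAlgebra (t : K) : Algebra ℂ[X] K := (aeval t).toAlgebra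

theorem chart_induction (hK : IsFunctionField K) {t : K} (ht : Transcendental ℂ t) {p : Prop}
    (h : ∀ [Algebra ℂ[X] K] [IsScalarTower ℂ ℂ[X] K] (B : Type u) [CommRing B] [Algebra ℂ[X] B]
      [Algebra B K] [IsScalarTower ℂ[X] B K] [IsFractionRing B K] [IsDedekindDomain B]
      [IsIntegralClosure B ℂ[X] K] [Module.Finite ℂ[X] B]
      [IsLocalization (Algebra.algebraMapSubmonoid B (nonZeroDivisors ℂ[X])) K]
      [Algebra ℂ[X] ℂ⟮t⟯] [IsFractionRing ℂ[X] ℂ⟮t⟯] [IsScalarTower ℂ[X] ℂ⟮t⟯ K]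
      [FiniteDimensional ℂ⟮t⟯ K], algebraMap ℂ[X] K X = t → p) : p := by
  haveI := hK.finiteDimensional ht
  letI : Algebra ℂ[X] K := polyAlgebra t
  haveI : IsScalarTower ℂ ℂ[X] K := IsScalarTower.of_algebraMap_eq fun c => by
    rw [RingHom.algebraMap_toAlgebra]; simp
  letI : Algebra ℂ[X] ℂ⟮t⟯ := (aeval (AdjoinSimple.gen ℂ t)).toAlgebra
  haveI : IsScalarTower ℂ[X] ℂ⟮t⟯ K := IsScalarTower.of_algebraMap_eq fun q => by
    rw [RingHom.algebraMap_toAlgebra, RingHom.algebraMap_toAlgebra]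
    simp
  haveI : FaithfulSMul ℂ[X] ℂ⟮t⟯ := by
    rw [faithfulSMul_iff_algebraMap_injective]
    have : Function.Injective (algebraMap ℂ[X] K) := transcendental_iff_injective.1 ht
    rw [IsScalarTower.algebraMap_eq ℂ[X] ℂ⟮t⟯ K, RingHom.coe_comp] at this
    exact this.of_comp
  haveI : IsFractionRing ℂ[X] ℂ⟮t⟯ := IsFractionRing.of_field _ _ fun z => by
    obtain ⟨p, q, hpq⟩ := (IntermediateField.mem_adjoin_simple_iff ℂ z.1).1 z.2
    refine ⟨p, q, Subtype.ext ?_⟩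
    rw [hpq]
    have h := map_div₀ (algebraMap ℂ⟮t⟯ K) (algebraMap ℂ[X] ℂ⟮t⟯ p) (algebraMap ℂ[X] ℂ⟮t⟯ q)
    rw [← IsScalarTower.algebraMap_apply, ← IsScalarTower.algebraMap_apply] at h
    exact h.symm
  let B := integralClosure ℂ[X] K
  haveI : IsFractionRing B K :=
    IsIntegralClosure.isFractionRing_of_finite_extension ℂ[X] ℂ⟮t⟯ K B
  haveI : IsDedekindDomain B := integralClosure.isDedekindDomain ℂ[X] ℂ⟮t⟯ K
  haveI : Module.Finite ℂ[X] B := IsIntegralClosure.finite ℂ[X] ℂ⟮t⟯ K B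
  haveI : IsLocalization (Algebra.algebraMapSubmonoid B (nonZeroDivisors ℂ[X])) K :=
    IsIntegralClosure.isLocalization_of_isSeparable ℂ[X] ℂ⟮t⟯ K B
  exact h B (by rw [RingHom.algebraMap_toAlgebra]; simp)

theorem transcendental_inv {t : K} (ht : Transcendental ℂ t) : Transcendental ℂ t⁻¹ := by
  intro h
  exact ht (by simpa using h.inv)

theorem transcendental_sub {t : K} (ht : Transcendental ℂ t) (c : ℂ) :
    Transcendental ℂ (t - algebraMap ℂ K c) := by
  intro h
  apply ht
  have := h.add (isAlgebraic_algebraMap c)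
  simpa using this

theorem exists_const_or_transcendental (f : K) :
    (∃ c : ℂ, f = algebraMap ℂ K c) ∨ Transcendental ℂ f := by
  by_cases h : IsAlgebraic ℂ f
  · left
    have hi : IsIntegral ℂ f := h.isIntegral
    have h1 := IsAlgClosed.degree_eq_one_of_irreducible ℂ (minpoly.irreducible hi)
    obtain ⟨c, hc⟩ := minpoly.mem_range_of_degree_eq_one ℂ f h1
    exact ⟨c, hc.symm⟩
  · exact Or.inr h

theorem Point.isDiscreteValuationRing (hK : IsFunctionField K) (x : Point K) :
    IsDiscreteValuationRing x.O := by
  obtain ⟨t, ht⟩ := hK.exists_transcendental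
  rcases x.ring.mem_or_inv_mem t with h | h
  · exact chart_induction hK ht fun B _ _ _ _ _ _ _ _ _ _ _ _ _ e =>
      x.isDiscreteValuationRing_of_chart B (by rwa [e])
  · exact chart_induction hK (transcendental_inv ht) fun B _ _ _ _ _ _ _ _ _ _ _ _ _ e =>
      x.isDiscreteValuationRing_of_chart B (by rwa [e])

theorem Point.exists_const_sub_mem (hK : IsFunctionField K) (x : Point K) {f : K}
    (hf : f ∈ x.ring) : ∃ c : ℂ, f - algebraMap ℂ K c ∈ x.ring.nonunits := by
  obtain ⟨t, ht⟩ := hK.exists_transcendental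
  rcases x.ring.mem_or_inv_mem t with h | h
  · exact chart_induction hK ht fun B _ _ _ _ _ _ _ _ _ _ _ _ _ e =>
      x.exists_const_sub_mem_of_chart B (by rwa [e]) hf
  · exact chart_induction hK (transcendental_inv ht) fun B _ _ _ _ _ _ _ _ _ _ _ _ _ e =>
      x.exists_const_sub_mem_of_chart B (by rwa [e]) hf

/-- A rational function has finitely many poles. -/
theorem finite_poles (hK : IsFunctionField K) (f : K) : {x : Point K | f ∉ x.ring}.Finite := by
  obtain ⟨t, ht⟩ := hK.exists_transcendental
  have h1 : {x : Point K | t ∈ x.ring ∧ f ∉ x.ring}.Finite :=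
    chart_induction hK ht fun B _ _ _ _ _ _ _ _ _ _ _ _ _ e => by
      have := finite_setOf_notMem (K := K) B f
      rwa [e] at this
  have h2 : {x : Point K | t⁻¹ ∈ x.ring ∧ f ∉ x.ring}.Finite :=
    chart_induction hK (transcendental_inv ht) fun B _ _ _ _ _ _ _ _ _ _ _ _ _ e => by
      have := finite_setOf_notMem (K := K) B f
      rwa [e] at this
  refine (h1.union h2).subset fun x hx => ?_
  rcases x.ring.mem_or_inv_mem t with h | h
  · exact Or.inl ⟨h, hx⟩
  · exact Or.inr ⟨h, hx⟩

/-- A transcendental function has a zero. -/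
theorem exists_mem_nonunits (hK : IsFunctionField K) {t : K} (ht : Transcendental ℂ t) :
    ∃ x : Point K, t ∈ x.ring.nonunits := by
  refine chart_induction hK ht fun B _ _ _ _ _ _ _ _ _ _ _ _ _ e => ?_
  by_contra hcon
  push Not at hcon
  have ht0 : t ≠ 0 := by
    rintro rfl
    exact ht (isAlgebraic_zero)
  obtain ⟨b, hb⟩ := exists_eq_of_forall_mem B (t⁻¹) fun x _ =>
    Point.inv_mem_of_notMem_nonunits (hcon x)
  have hi : IsIntegral ℂ[X] b := IsIntegralClosure.isIntegral ℂ[X] K b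
  have hi' : IsIntegral ℂ[X] (t⁻¹) := by
    rw [← hb]
    exact hi.map (IsScalarTower.toAlgHom ℂ[X] B K)
  have hi2 : IsIntegral ℂ[X] ((AdjoinSimple.gen ℂ t)⁻¹) := by
    have : algebraMap ℂ⟮t⟯ K ((AdjoinSimple.gen ℂ t)⁻¹) = t⁻¹ := by
      rw [map_inv₀]; rfl
    rw [← this] at hi'
    exact (isIntegral_algHom_iff (IsScalarTower.toAlgHom ℂ[X] ℂ⟮t⟯ K)
      (algebraMap ℂ⟮t⟯ K).injective).1 hi'
  obtain ⟨q, hq⟩ := IsIntegrallyClosed.isIntegral_iff.1 hi2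
  have h3 : algebraMap ℂ[X] K (X * q) = algebraMap ℂ[X] K 1 := by
    rw [map_mul, e, IsScalarTower.algebraMap_apply ℂ[X] ℂ⟮t⟯ K, hq, map_inv₀, map_one]
    exact mul_inv_cancel₀ ht0
  have hinj : Function.Injective (algebraMap ℂ[X] K) := by
    rw [IsScalarTower.algebraMap_eq ℂ[X] ℂ⟮t⟯ K]
    exact (algebraMap ℂ⟮t⟯ K).injective.comp (IsFractionRing.injective ℂ[X] ℂ⟮t⟯)
  have h4 := congrArg (fun p => p.coeff 0) (hinj h3)
  simp at h4

theorem exists_point (hK : IsFunctionField K) : Nonempty (Point K) := by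
  obtain ⟨t, ht⟩ := hK.exists_transcendental
  obtain ⟨x, -⟩ := exists_mem_nonunits hK ht
  exact ⟨x⟩

theorem exists_const_of_forall_mem (hK : IsFunctionField K) (f : K)
    (hf : ∀ x : Point K, f ∈ x.ring) : ∃ c : ℂ, f = algebraMap ℂ K c := by
  refine (exists_const_or_transcendental f).resolve_right fun ht => ?_
  obtain ⟨x, hx⟩ := exists_mem_nonunits hK (transcendental_inv ht)
  rw [ValuationSubring.inv_mem_nonunits_iff] at hx
  rcases hx with rfl | hx
  · exact ht isAlgebraic_zero
  · exact hx (hf x)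

theorem finite_zeros (hK : IsFunctionField K) {f : K} (hf : f ≠ 0) :
    {x : Point K | f ∈ x.ring.nonunits}.Finite := by
  refine (finite_poles hK f⁻¹).subset fun x hx => ?_
  rw [Set.mem_ofPred_eq, ValuationSubring.mem_nonunits_iff_or] at hx
  exact hx.resolve_left hf

theorem infinite_points (hK : IsFunctionField K) : Infinite (Point K) := by
  obtain ⟨t, ht⟩ := hK.exists_transcendental
  choose f hf using fun c : ℂ => exists_mem_nonunits hK (transcendental_sub ht c)
  refine Infinite.of_injective f fun c d hcd => ?_
  by_contra hne
  have h1 := hf c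
  have h2 := hf d
  rw [hcd] at h1
  have := sub_mem h2 h1
  refine (f d).const_notMem_nonunits (sub_ne_zero.2 hne) ?_
  rw [map_sub]
  convert this using 1
  ring

theorem exists_separating_of_mem (hK : IsFunctionField K) {t : K} (ht : Transcendental ℂ t)
    {x y : Point K} (hxy : x ≠ y) (hx : t ∈ x.ring) (hy : t ∈ y.ring) :
    ∃ β : K, (∀ z : Point K, t ∈ z.ring → β ∈ z.ring) ∧ β ∈ y.ring.nonunits ∧
      β ∉ x.ring.nonunits :=
  chart_induction hK ht fun B _ _ _ _ _ _ _ _ _ _ _ _ _ e => by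
    obtain ⟨b, hb1, hb2⟩ := exists_separating (K := K) B hxy (by rwa [e]) (by rwa [e])
    exact ⟨_, fun z hz => z.algebraMap_mem B (by rwa [e]) b, hb1, hb2⟩

theorem exists_aeval_eq (hK : IsFunctionField K) {t : K} (ht : Transcendental ℂ t) (f : ℂ⟮t⟯)
    (hf : ∀ x : Point K, t ∈ x.ring → (f : K) ∈ x.ring) : ∃ p : ℂ[X], (f : K) = aeval t p :=
  chart_induction hK ht fun B _ _ _ _ _ _ _ _ _ _ _ _ _ e => by
    obtain ⟨b, hb⟩ := exists_eq_of_forall_mem B (f : K) fun x hx => hf x (by rwa [e] at hx)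
    have hi : IsIntegral ℂ[X] b := IsIntegralClosure.isIntegral ℂ[X] K b
    have hi' : IsIntegral ℂ[X] (f : K) := by
      rw [← hb]
      exact hi.map (IsScalarTower.toAlgHom ℂ[X] B K)
    have hi2 : IsIntegral ℂ[X] f := (isIntegral_algHom_iff (IsScalarTower.toAlgHom ℂ[X] ℂ⟮t⟯ K)
      (algebraMap ℂ⟮t⟯ K).injective).1 hi'
    obtain ⟨q, hq⟩ := IsIntegrallyClosed.isIntegral_iff.1 hi2
    refine ⟨q, ?_⟩
    have h := algebraMap_poly_eq (K := K) q
    rw [e, IsScalarTower.algebraMap_apply ℂ[X] ℂ⟮t⟯ K, hq] at h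
    exact h

theorem trace_mem_nonunits_of_forall (hK : IsFunctionField K) {s : K} (hs : Transcendental ℂ s)
    (z : K) (hz : ∀ x : Point K, s ∈ x.ring.nonunits → z ∈ x.ring.nonunits)
    (x : Point K) (hx : s ∈ x.ring.nonunits) :
    (Algebra.trace ℂ⟮s⟯ K z : K) ∈ x.ring.nonunits :=
  chart_induction hK hs fun B _ _ _ _ _ _ _ _ _ _ _ _ _ e => by
    subst e
    exact trace_mem_nonunits ℂ⟮algebraMap ℂ[X] K X⟯ B z hz x hx

theorem mul_mem_nonunits_of_forall_trace (hK : IsFunctionField K) {s : K}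
    (hs : Transcendental ℂ s) (y : K)
    (hy : ∀ b : K, (∀ x : Point K, s ∈ x.ring → b ∈ x.ring) →
      ∀ x : Point K, s ∈ x.ring.nonunits → (Algebra.trace ℂ⟮s⟯ K (y * b) : K) ∈ x.ring)
    (x : Point K) (hx : s ∈ x.ring.nonunits) : s * y ∈ x.ring.nonunits :=
  chart_induction hK hs fun B _ _ _ _ _ _ _ _ _ _ _ _ _ e => by
    subst e
    exact mul_mem_nonunits_of_trace B ℂ⟮algebraMap ℂ[X] K X⟯ y (fun b => hy _ fun x hx => x.algebraMap_mem B hx b) x hx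

/-- The coordinate ring of an affine chart is a finitely generated algebra, with the local rings
of the points of the chart as localizations. -/
theorem exists_finset_generators (hK : IsFunctionField K) {t : K} (ht : Transcendental ℂ t) :
    ∃ S : Finset K, (∀ x : Point K, t ∈ x.ring → ∀ b ∈ Algebra.adjoin ℂ (S : Set K), b ∈ x.ring) ∧
      ∀ x : Point K, t ∈ x.ring → ∀ f ∈ x.ring, ∃ a ∈ Algebra.adjoin ℂ (S : Set K),
        ∃ b ∈ Algebra.adjoin ℂ (S : Set K), b ∉ x.ring.nonunits ∧ f * b = a :=
  chart_induction hK ht fun B _ _ _ _ _ _ _ _ _ _ _ _ _ e => by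
    classical
    letI : Algebra ℂ B := ((algebraMap ℂ[X] B).comp (algebraMap ℂ ℂ[X])).toAlgebra
    haveI : IsScalarTower ℂ ℂ[X] B := IsScalarTower.of_algebraMap_eq' rfl
    haveI : IsScalarTower ℂ B K := IsScalarTower.of_algebraMap_eq fun c => by
      rw [IsScalarTower.algebraMap_apply ℂ ℂ[X] K, IsScalarTower.algebraMap_apply ℂ[X] B K]; rfl
    haveI : Algebra.FiniteType ℂ B :=
      Algebra.FiniteType.trans (S := ℂ[X]) inferInstance inferInstance
    obtain ⟨S, hS⟩ := (Algebra.FiniteType.out : (⊤ : Subalgebra ℂ B).FG)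
    have hB : ∀ f : K, f ∈ Algebra.adjoin ℂ ((S.image (algebraMap B K) : Finset K) : Set K) ↔
        ∃ b : B, algebraMap B K b = f := by
      intro f
      rw [Finset.coe_image, show (algebraMap B K : B → K) = IsScalarTower.toAlgHom ℂ B K from rfl,
        ← AlgHom.map_adjoin, hS, Algebra.map_top, AlgHom.mem_range]
    refine ⟨S.image (algebraMap B K), fun x hx b hb => ?_, fun x hx f hf => ?_⟩
    · obtain ⟨b, rfl⟩ := (hB b).1 hb
      exact x.algebraMap_mem B (by rwa [e]) b
    · have hx' : algebraMap ℂ[X] K X ∈ x.ring := by rwa [e]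
      rw [x.mem_ring_iff_valuation B hx'] at hf
      obtain ⟨n, d, hnd⟩ := HeightOneSpectrum.exists_primeCompl_mul_eq_of_integer _ _ hf
      exact ⟨_, (hB _).2 ⟨n, rfl⟩, _, (hB _).2 ⟨d, rfl⟩,
        fun h => d.2 ((x.mem_chartPrime B hx' d).2 h), hnd⟩

end Facts

open IntermediateField KaehlerDifferential

section Local

variable {K : Type u} [Field K] [Algebra ℂ K]

theorem exists_kaehlerEquiv (hK : IsFunctionField K) {t : K} (ht : Transcendental ℂ t) :
    ∃ e : Ω[K⁄ℂ] ≃ₗ[K] K, e (D ℂ K t) = 1 :=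
  chart_induction hK ht fun B _ _ _ _ _ _ _ _ _ _ _ _ _ e => by
    haveI : Algebra.FormallyEtale ℂ[X] ℂ⟮t⟯ :=
      Algebra.FormallyEtale.of_isLocalization (nonZeroDivisors ℂ[X])
    haveI : Algebra.FormallyEtale ℂ⟮t⟯ K := Algebra.FormallyEtale.of_isSeparable _ _
    haveI : Algebra.FormallyEtale ℂ[X] K := Algebra.FormallyEtale.comp ℂ[X] ℂ⟮t⟯ K
    let e1 := (tensorKaehlerEquivOfFormallyEtale ℂ ℂ[X] K).symm
    let e2 : K ⊗[ℂ[X]] Ω[ℂ[X]⁄ℂ] ≃ₗ[K] K ⊗[ℂ[X]] ℂ[X] :=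
      (polynomialEquiv ℂ).baseChange ℂ[X] K _ _
    let e3 : K ⊗[ℂ[X]] ℂ[X] ≃ₗ[K] K := TensorProduct.AlgebraTensorModule.rid ℂ[X] K K
    refine ⟨e1.trans (e2.trans e3), ?_⟩
    have h := tensorKaehlerEquivOfFormallyEtale_symm_D_algebraMap ℂ ℂ[X] K X
    rw [e] at h
    simp only [LinearEquiv.trans_apply]
    rw [show e1 (D ℂ K t) = _ from h]
    simp [e2, e3]

variable [hK : Fact (IsFunctionField K)]

instance Point.instDVR (x : Point K) : IsDiscreteValuationRing x.O :=
  x.isDiscreteValuationRing hK.out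

/-- The order of vanishing of a nonzero rational function at a point. -/
def Point.ord (x : Point K) (f : K) : ℤ := WithZero.log (Ring.ordFrac x.O f)

variable (x : Point K)

theorem Point.ordFrac_ne_zero {f : K} (hf : f ≠ 0) : Ring.ordFrac x.O f ≠ 0 :=
  (_root_.map_ne_zero _).2 hf

theorem Point.ord_mul {f g : K} (hf : f ≠ 0) (hg : g ≠ 0) : x.ord (f * g) = x.ord f + x.ord g := by
  rw [Point.ord, map_mul, WithZero.log_mul (x.ordFrac_ne_zero hf) (x.ordFrac_ne_zero hg)]; rfl

@[simp] theorem Point.ord_one : x.ord 1 = 0 := by simp [Point.ord]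

@[simp] theorem Point.ord_zero : x.ord 0 = 0 := by simp [Point.ord]

@[simp] theorem Point.ord_inv (f : K) : x.ord f⁻¹ = - x.ord f := by
  simp [Point.ord]

theorem Point.ord_eq_length {f : x.O} (hf : f ≠ 0) :
    (x.ord (f : K) : ℤ) = (Module.length x.O (x.O ⧸ Ideal.span {f})).toNat := by
  have h1 := Ring.ordFrac_eq_ord (R := x.O) (K := K) hf
  obtain ⟨n, hn⟩ := ENat.ne_top_iff_exists.1 (Ring.ord_ne_top (mem_nonZeroDivisors_of_ne_zero hf))
  rw [Ring.ordMonoidWithZeroHom_eq_coe _ (mem_nonZeroDivisors_of_ne_zero hf) hn.symm] at h1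
  rw [← Ring.ord, ← hn, Point.ord]
  change WithZero.log (Ring.ordFrac x.O (algebraMap x.O K f)) = _
  rw [h1]
  rfl

theorem Point.mem_ring_iff_ord {f : K} (hf : f ≠ 0) : f ∈ x.ring ↔ 0 ≤ x.ord f := by
  have key : ∀ g : K, g ≠ 0 → g ∈ x.ring → 0 ≤ x.ord g := by
    intro g hg hgx
    have := x.ord_eq_length (f := ⟨g, hgx⟩) (by simpa [Subtype.ext_iff] using hg)
    simp only at this
    omega
  refine ⟨key f hf, fun h => ?_⟩
  by_contra hcon
  have h1 := x.inv_mem_of_notMem hcon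
  have h2 := key _ (inv_ne_zero hf) h1
  rw [Point.ord_inv] at h2
  have h3 : x.ord f⁻¹ = 0 := by rw [Point.ord_inv]; omega
  have h4 : Ring.ordFrac x.O (algebraMap x.O K ⟨f⁻¹, h1⟩) = 1 := by
    rw [← WithZero.exp_log (x.ordFrac_ne_zero (f := algebraMap x.O K ⟨f⁻¹, h1⟩)
      (inv_ne_zero hf))]
    change WithZero.exp (x.ord f⁻¹) = 1
    rw [h3, WithZero.exp_zero]
  obtain ⟨c, hc⟩ := isUnit_iff_exists_inv.1
    (Ring.isUnit_iff_ordFrac_one_of_isDiscreteValuationRing.2 h4)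
  have hc' : f⁻¹ * (c : K) = 1 := congrArg Subtype.val hc
  have : f = c := by
    rw [inv_mul_eq_one₀ hf] at hc'
    exact hc'
  exact hcon (this ▸ c.2)

theorem Point.mem_nonunits_iff_ord {f : K} (hf : f ≠ 0) : f ∈ x.ring.nonunits ↔ 0 < x.ord f := by
  rw [ValuationSubring.mem_nonunits_iff_or, or_iff_right hf, x.mem_ring_iff_ord (inv_ne_zero hf),
    Point.ord_inv]
  omega

theorem Point.exists_ord_eq_one : ∃ π : K, π ≠ 0 ∧ x.ord π = 1 := by
  obtain ⟨π, hπ⟩ := IsDiscreteValuationRing.exists_irreducible x.O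
  refine ⟨π, by simpa using hπ.ne_zero, ?_⟩
  change WithZero.log (Ring.ordFrac x.O (algebraMap x.O K π)) = _
  rw [Ring.ordFrac_irreducible hπ, WithZero.log_exp]

theorem Point.ord_zpow (f : K) (n : ℤ) : x.ord (f ^ n) = n * x.ord f := by
  simp [Point.ord]

theorem Point.exists_ord_eq (n : ℤ) : ∃ f : K, f ≠ 0 ∧ x.ord f = n := by
  obtain ⟨π, h0, h1⟩ := x.exists_ord_eq_one
  exact ⟨π ^ n, zpow_ne_zero _ h0, by rw [x.ord_zpow, h1, mul_one]⟩

theorem Point.div_mem_ring_iff {f g : K} (hf : f ≠ 0) (hg : g ≠ 0) :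
    f / g ∈ x.ring ↔ x.ord g ≤ x.ord f := by
  rw [x.mem_ring_iff_ord (div_ne_zero hf hg), div_eq_mul_inv, x.ord_mul hf (inv_ne_zero hg),
    Point.ord_inv]
  omega

theorem Point.ord_const {c : ℂ} (hc : c ≠ 0) : x.ord (algebraMap ℂ K c) = 0 := by
  have h0 : algebraMap ℂ K c ≠ 0 := by simpa using hc
  have h1 := (x.mem_ring_iff_ord h0).1 (x.const_mem c)
  have h2 := mt (x.mem_nonunits_iff_ord h0).2 (x.const_notMem_nonunits hc)
  omega

end Local

section SpanAt

variable {K : Type u} [Field K] [Algebra ℂ K] {F : Type v} [AddCommGroup F] [Module K F]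
  {x : Point K}

/-- The submodule over the local ring at `x` spanned by a subset of the generic fibre. -/
def spanAt (x : Point K) (S : Set F) : Submodule x.O F := Submodule.span x.O S

theorem subset_spanAt (S : Set F) : S ⊆ spanAt x S := Submodule.subset_span

theorem spanAt_le {S : Set F} {M : Submodule x.O F} : spanAt x S ≤ M ↔ S ⊆ M := Submodule.span_le

theorem spanAt_mono {S T : Set F} (h : S ⊆ T) : spanAt x S ≤ spanAt x T := Submodule.span_mono h

theorem spanAt_fg {S : Set F} (h : S.Finite) : (spanAt x S).FG := Submodule.fg_span h

theorem smul_mem_stalk (M : Submodule x.O F) {g : K} (hg : g ∈ x.ring) {a : F} (ha : a ∈ M) :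
    g • a ∈ M := M.smul_mem (⟨g, hg⟩ : x.O) ha

theorem mem_spanAt_singleton {a e : F} : a ∈ spanAt x {e} ↔ ∃ g ∈ x.ring, a = g • e := by
  rw [spanAt, Submodule.mem_span_singleton]
  exact ⟨fun ⟨g, h⟩ => ⟨g, g.2, h.symm⟩, fun ⟨g, hg, h⟩ => ⟨⟨g, hg⟩, h.symm⟩⟩

/-- Nakayama's lemma. -/
theorem spanAt_le_of_forall {S : Set F} {N : Submodule x.O F} (hfg : (spanAt x S).FG)
    (h : ∀ a ∈ S, ∃ b ∈ N, ∃ g ∈ x.ring.nonunits, ∃ c ∈ spanAt x S, a = b + g • c) :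
    spanAt x S ≤ N := by
  refine Submodule.le_of_le_smul_of_le_jacobson_bot (I := IsLocalRing.maximalIdeal x.O)
    hfg (IsLocalRing.maximalIdeal_le_jacobson _) (spanAt_le.2 fun a ha => ?_)
  obtain ⟨b, hb, g, hg, c, hc, rfl⟩ := h a ha
  exact Submodule.add_mem_sup hb (Submodule.smul_mem_smul
    (r := (⟨g, Point.mem_of_mem_nonunits hg⟩ : x.O))
    (ValuationSubring.coe_mem_nonunits_iff.1 hg) hc)

end SpanAt

section Kaehler

variable {K : Type u} [Field K] [Algebra ℂ K] [hK : Fact (IsFunctionField K)]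

theorem D_ne_zero {t : K} (ht : Transcendental ℂ t) : D ℂ K t ≠ 0 := by
  obtain ⟨e, he⟩ := exists_kaehlerEquiv hK.out ht
  intro h
  rw [h, map_zero] at he
  exact zero_ne_one he

theorem finrank_kaehler : Module.finrank K Ω[K⁄ℂ] = 1 := by
  obtain ⟨t, ht⟩ := hK.out.exists_transcendental
  obtain ⟨e, -⟩ := exists_kaehlerEquiv hK.out ht
  rw [e.finrank_eq, Module.finrank_self]

theorem transcendental_of_ord_ne_zero (x : Point K) {f : K} (h : x.ord f ≠ 0) :
    Transcendental ℂ f := by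
  refine (exists_const_or_transcendental f).resolve_left ?_
  rintro ⟨c, rfl⟩
  rcases eq_or_ne c 0 with rfl | hc
  · simp at h
  · exact h (x.ord_const hc)

theorem canonical_fg_of_mem {t : K} (ht : Transcendental ℂ t) : ∃ S : Finset K,
    ∀ x : Point K, t ∈ x.ring → (∀ b ∈ S, b ∈ x.ring) ∧
      canonical K x = spanAt x (D ℂ K '' (S : Set K)) := by
  obtain ⟨S, h1, h2⟩ := exists_finset_generators hK.out ht
  refine ⟨S, fun x hx => ⟨fun b hb => h1 x hx b (Algebra.subset_adjoin hb), ?_⟩⟩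
  apply le_antisymm
  · refine spanAt_le.2 ?_
    rintro _ ⟨f, hf, rfl⟩
    have hadj : ∀ b ∈ Algebra.adjoin ℂ (S : Set K), D ℂ K b ∈
        spanAt x (D ℂ K '' (S : Set K)) := by
      intro b hb
      induction hb using Algebra.adjoin_induction with
      | mem b hb => exact subset_spanAt _ ⟨b, hb, rfl⟩
      | algebraMap c => simp
      | add a b _ _ ha hb => rw [map_add]; exact add_mem ha hb
      | mul a b ha' hb' ha hb =>
        rw [Derivation.leibniz]
        exact add_mem (smul_mem_stalk _ (h1 x hx a ha') hb) (smul_mem_stalk _ (h1 x hx b hb') ha)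
    obtain ⟨a, ha, b, hb, hbn, hab⟩ := h2 x hx f hf
    have hb0 : b ≠ 0 := fun h => hbn (by rw [h]; exact ZeroMemClass.zero_mem _)
    have hD : D ℂ K f = b⁻¹ • (D ℂ K a - f • D ℂ K b) := by
      rw [← hab, Derivation.leibniz, add_sub_cancel_left, smul_smul, inv_mul_cancel₀ hb0, one_smul]
    rw [hD]
    exact smul_mem_stalk _ (Point.inv_mem_of_notMem_nonunits hbn)
      (sub_mem (hadj a ha) (smul_mem_stalk _ hf (hadj b hb)))
  · refine spanAt_mono (Set.image_mono fun b hb => h1 x hx b (Algebra.subset_adjoin hb))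

theorem canonical_fg (x : Point K) : (canonical K x).FG := by
  classical
  obtain ⟨t, ht⟩ := hK.out.exists_transcendental
  rcases x.ring.mem_or_inv_mem t with h | h
  · obtain ⟨S, hS⟩ := canonical_fg_of_mem ht
    rw [(hS x h).2]
    exact spanAt_fg (S.finite_toSet.image _)
  · obtain ⟨S, hS⟩ := canonical_fg_of_mem (transcendental_inv ht)
    rw [(hS x h).2]
    exact spanAt_fg (S.finite_toSet.image _)

theorem canonical_eq_span (x : Point K) {π : K} (hπ : x.ord π = 1) :
    canonical K x = spanAt x {D ℂ K π} := by
  have hπ0 : π ≠ 0 := by rintro rfl; simp at hπ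
  have hπm : π ∈ x.ring.nonunits := (x.mem_nonunits_iff_ord hπ0).2 (by omega)
  have hπx := Point.mem_of_mem_nonunits hπm
  apply le_antisymm
  · refine spanAt_le_of_forall (canonical_fg x) ?_
    rintro _ ⟨f, hf, rfl⟩
    obtain ⟨c, hc⟩ := x.exists_const_sub_mem hK.out hf
    set g := (f - algebraMap ℂ K c) / π with hg
    have hgx : g ∈ x.ring := by
      rcases eq_or_ne (f - algebraMap ℂ K c) 0 with h0 | h0
      · rw [hg, h0, zero_div]; exact x.ring.zero_mem
      · rw [hg, x.div_mem_ring_iff h0 hπ0, hπ]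
        have := (x.mem_nonunits_iff_ord h0).1 hc
        omega
    have hf' : f = algebraMap ℂ K c + π * g := by
      rw [hg]; field_simp; ring
    have hD : D ℂ K f = π • D ℂ K g + g • D ℂ K π := by
      rw [hf', map_add, Derivation.map_algebraMap, zero_add, Derivation.leibniz]
    rw [hD, add_comm]
    exact ⟨_, smul_mem_stalk _ hgx (subset_spanAt _ rfl), π, hπm, _,
      subset_spanAt _ ⟨g, hgx, rfl⟩, rfl⟩
  · rw [spanAt_le, Set.singleton_subset_iff]
    exact subset_spanAt _ ⟨π, hπx, rfl⟩

/-- If `s` has a zero of order `e` at `x`, then `ds` has a zero of order `e - 1`. -/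
theorem smul_D_mem_canonical_iff (x : Point K) {s : K} (hs : s ∈ x.ring.nonunits) (hs0 : s ≠ 0)
    (y : K) : y • D ℂ K s ∈ canonical K x ↔ s * y ∈ x.ring.nonunits := by
  obtain ⟨π, hπ0, hπ⟩ := x.exists_ord_eq_one
  have hπm : π ∈ x.ring.nonunits := (x.mem_nonunits_iff_ord hπ0).2 (by omega)
  have hpos := (x.mem_nonunits_iff_ord hs0).1 hs
  obtain ⟨e, he⟩ := Int.eq_ofNat_of_zero_le hpos.le
  have he0 : e ≠ 0 := by omega
  set w := s / π ^ e with hw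
  have hw0 : w ≠ 0 := div_ne_zero hs0 (pow_ne_zero _ hπ0)
  have hsw : s = w * π ^ e := by rw [hw]; field_simp
  have hπe : x.ord (π ^ e) = e := by rw [← zpow_natCast, x.ord_zpow, hπ, mul_one]
  have hwo : x.ord w = 0 := by
    have := x.ord_mul hw0 (pow_ne_zero e hπ0)
    rw [← hsw, hπe] at this
    omega
  have hwx : w ∈ x.ring := (x.mem_ring_iff_ord hw0).2 hwo.ge
  obtain ⟨w', hw'⟩ : ∃ w' : x.O, D ℂ K w = (w' : K) • D ℂ K π := by
    have : D ℂ K w ∈ canonical K x := subset_spanAt _ ⟨w, hwx, rfl⟩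
    rw [canonical_eq_span x hπ, mem_spanAt_singleton] at this
    obtain ⟨w', hw1, hw2⟩ := this
    exact ⟨⟨w', hw1⟩, hw2⟩
  set a := w * e + w' * π with ha
  have hDs : D ℂ K s = (a * π ^ (e - 1)) • D ℂ K π := by
    obtain ⟨m, rfl⟩ := Nat.exists_eq_succ_of_ne_zero he0
    rw [hsw, Derivation.leibniz, Derivation.leibniz_pow, hw', smul_smul, ← Nat.cast_smul_eq_nsmul K,
      smul_smul, smul_smul, ← add_smul]
    congr 1
    rw [ha, Nat.succ_eq_add_one, Nat.add_sub_cancel]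
    ring
  have ha' : a ∉ x.ring.nonunits := by
    intro h
    have h1 : (w' : K) * π ∈ x.ring.nonunits := Point.mul_mem_nonunits w'.2 hπm
    have h2 := sub_mem h h1
    rw [ha, add_sub_cancel_right] at h2
    have hne : w * (e : K) ≠ 0 := mul_ne_zero hw0 (by
      haveI : CharZero K := charZero_of_injective_algebraMap (algebraMap ℂ K).injective
      exact_mod_cast he0)
    have h3 := (x.mem_nonunits_iff_ord hne).1 h2
    have h4 : (e : K) = algebraMap ℂ K (e : ℂ) := by simp
    rw [x.ord_mul hw0 (right_ne_zero_of_mul hne), hwo, h4, x.ord_const (by exact_mod_cast he0)] at h3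
    omega
  have ha0 : a ≠ 0 := fun h => ha' (by rw [h]; exact ZeroMemClass.zero_mem _)
  have hax : a ∈ x.ring := by
    refine x.ring.add_mem _ _ (x.ring.mul_mem _ _ hwx (natCast_mem _ _))
      (x.ring.mul_mem _ _ w'.2 (Point.mem_of_mem_nonunits hπm))
  have hao : x.ord a = 0 := by
    have h1 := (x.mem_ring_iff_ord ha0).1 hax
    have h2 := mt (x.mem_nonunits_iff_ord ha0).2 ha'
    omega
  have hDπ : D ℂ K π ≠ 0 := D_ne_zero (transcendental_of_ord_ne_zero x (by rw [hπ]; exact one_ne_zero))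
  have hmem : ∀ z : K, z • D ℂ K π ∈ canonical K x ↔ z ∈ x.ring := by
    intro z
    rw [canonical_eq_span x hπ, mem_spanAt_singleton]
    constructor
    · rintro ⟨c, hc, h⟩
      rwa [smul_left_injective K hDπ h]
    · exact fun hz => ⟨z, hz, rfl⟩
  rw [hDs, smul_smul, hmem]
  rcases eq_or_ne y 0 with rfl | hy
  · simp only [zero_mul, mul_zero, x.ring.zero_mem, true_iff]
    exact ZeroMemClass.zero_mem _
  · have hπe1 : x.ord (π ^ (e - 1)) = e - 1 := by
      rw [← zpow_natCast, x.ord_zpow, hπ, mul_one]; omega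
    rw [x.mem_ring_iff_ord (mul_ne_zero hy (mul_ne_zero ha0 (pow_ne_zero _ hπ0))),
      x.mem_nonunits_iff_ord (mul_ne_zero hs0 hy), x.ord_mul hy (mul_ne_zero ha0 (pow_ne_zero _ hπ0)),
      x.ord_mul ha0 (pow_ne_zero _ hπ0), x.ord_mul hs0 hy, hao, hπe1, he]
    omega

theorem span_canonical (x : Point K) : Submodule.span K (canonical K x : Set Ω[K⁄ℂ]) = ⊤ := by
  obtain ⟨π, hπ0, hπ⟩ := x.exists_ord_eq_one
  have ht := transcendental_of_ord_ne_zero x (f := π) (by rw [hπ]; exact one_ne_zero)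
  refine top_le_iff.1 ?_
  rw [← (finrank_eq_one_iff_of_nonzero _ (D_ne_zero ht)).1 finrank_kaehler]
  refine Submodule.span_mono ?_
  rw [Set.singleton_subset_iff, canonical_eq_span x hπ]
  exact subset_spanAt _ rfl

theorem canonical_isVectorBundle : IsVectorBundle (canonical K) where
  finite := Module.finite_of_finrank_pos (by rw [finrank_kaehler]; exact one_pos)
  fg := canonical_fg
  span_eq_top := span_canonical
  generic := by
    obtain ⟨t, ht⟩ := hK.out.exists_transcendental
    obtain ⟨S, hS⟩ := canonical_fg_of_mem ht
    obtain ⟨e, he⟩ := exists_kaehlerEquiv hK.out ht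
    let b : Module.Basis (Fin (Module.finrank K Ω[K⁄ℂ])) K Ω[K⁄ℂ] :=
      ((Module.Basis.singleton Unit K).map e.symm).reindex
        (Fintype.equivOfCardEq (by simp [finrank_kaehler]))
    have hb : Set.range b = {D ℂ K t} := by
      have hbi : ∀ i, b i = D ℂ K t := fun i => by
        simp [b, ← he]
      ext z
      haveI : Nonempty (Fin (Module.finrank K Ω[K⁄ℂ])) := by
        rw [finrank_kaehler]; infer_instance
      simp [hbi, eq_comm]
    refine ⟨b, (((finite_poles hK.out t).union (S.finite_toSet.biUnion fun s _ =>
      finite_poles hK.out (e (D ℂ K s))))).subset fun x hx => ?_⟩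
    by_contra hcon
    simp only [Set.mem_union, Set.mem_ofPred_eq, Set.mem_iUnion, not_or, not_exists, not_not] at hcon
    obtain ⟨h1, h2⟩ := hcon
    apply hx
    change _ = spanAt x (Set.range b)
    rw [hb]
    apply le_antisymm
    · rw [(hS x h1).2, spanAt_le]
      rintro _ ⟨s, hs, rfl⟩
      refine mem_spanAt_singleton.2 ⟨_, h2 s hs, ?_⟩
      apply e.injective
      rw [map_smul, he, smul_eq_mul, mul_one]
    · rw [spanAt_le, Set.singleton_subset_iff]
      exact subset_spanAt _ ⟨t, h1, rfl⟩

end Kaehler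

section Length

variable {R : Type*} [CommRing R] {A M C : Type*} [AddCommGroup A] [Module R A]
  [AddCommGroup M] [Module R M] [AddCommGroup C] [Module R C]

theorem length_quotient_of_exact (i : A →ₗ[R] M) (p : M →ₗ[R] C) (hp : Function.Surjective p)
    (hex : Function.Exact i p) (T : Submodule R M) :
    Module.length R (M ⧸ T) = Module.length R (A ⧸ T.comap i) +
      Module.length R (C ⧸ T.map p) := by
  refine Module.length_eq_add_of_exact ((T.comap i).mapQ T i le_rfl)
    (T.mapQ (T.map p) p (Submodule.le_comap_map _ _)) ?_ ?_ ?_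
  · rw [← LinearMap.ker_eq_bot, LinearMap.ker_eq_bot']
    intro a
    obtain ⟨a, rfl⟩ := Submodule.Quotient.mk_surjective _ a
    rw [Submodule.mapQ_apply, Submodule.Quotient.mk_eq_zero, Submodule.Quotient.mk_eq_zero]
    exact id
  · intro c
    obtain ⟨c, rfl⟩ := Submodule.Quotient.mk_surjective _ c
    obtain ⟨m, rfl⟩ := hp c
    exact ⟨Submodule.Quotient.mk m, by rw [Submodule.mapQ_apply]⟩
  · intro m
    obtain ⟨m, rfl⟩ := Submodule.Quotient.mk_surjective _ m
    rw [Submodule.mapQ_apply, Submodule.Quotient.mk_eq_zero]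
    constructor
    · rintro ⟨t, ht, h⟩
      obtain ⟨a, ha⟩ := (hex (m - t)).1 (by rw [map_sub, h, sub_self])
      refine ⟨Submodule.Quotient.mk a, ?_⟩
      rw [Submodule.mapQ_apply, ha, Submodule.Quotient.eq, sub_sub_cancel_left]
      exact T.neg_mem ht
    · rintro ⟨a, h⟩
      obtain ⟨a, rfl⟩ := Submodule.Quotient.mk_surjective _ a
      rw [Submodule.mapQ_apply, Submodule.Quotient.eq] at h
      refine ⟨m - i a, ?_, ?_⟩
      · rw [← neg_sub]; exact T.neg_mem h
      · rw [map_sub, (hex (i a)).2 ⟨a, rfl⟩, sub_zero]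

theorem length_quotient_add (T N M : Submodule R C) (hTN : T ≤ N) (hNM : N ≤ M) :
    Module.length R (M ⧸ T.submoduleOf M) =
      Module.length R (N ⧸ T.submoduleOf N) + Module.length R (M ⧸ N.submoduleOf M) := by
  rw [length_quotient_of_exact (Submodule.inclusion hNM) (N.submoduleOf M).mkQ
    (Submodule.mkQ_surjective _) ?_ (T.submoduleOf M)]
  · congr 1
    have h : (T.submoduleOf M).map (N.submoduleOf M).mkQ = ⊥ := by
      rw [eq_bot_iff, Submodule.map_le_iff_le_comap, Submodule.comap_bot, Submodule.ker_mkQ]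
      exact Submodule.comap_mono hTN
    exact (Submodule.quotEquivOfEqBot _ h).length_eq
  · intro m
    rw [← LinearMap.mem_ker, Submodule.ker_mkQ]
    exact ⟨fun h => ⟨⟨m, h⟩, rfl⟩, by rintro ⟨n, rfl⟩; exact n.2⟩

theorem isFiniteLength_of_smul_eq_zero [IsDomain R] [IsNoetherianRing R] [Ring.KrullDimLE 1 R]
    [Module.Finite R M] {h : R} (h0 : h ≠ 0) (hM : ∀ m : M, h • m = 0) : IsFiniteLength R M := by
  obtain ⟨k, s, hs⟩ := Module.Finite.exists_fin (R := R) (M := M)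
  have hfl := isFiniteLength_quotient_span_singleton R (mem_nonZeroDivisors_of_ne_zero h0)
  rw [isFiniteLength_iff_isNoetherian_isArtinian] at hfl
  obtain ⟨_, _⟩ := hfl
  have hfl : IsFiniteLength R (Fin k → R ⧸ Ideal.span {h}) := by
    rw [isFiniteLength_iff_isNoetherian_isArtinian]
    exact ⟨inferInstance, inferInstance⟩
  let g : (Fin k → R ⧸ Ideal.span {h}) →ₗ[R] M := LinearMap.lsum R _ R fun i =>
    Submodule.liftQ (Ideal.span {h}) (LinearMap.toSpanSingleton R M (s i)) (by
      rw [Ideal.span, Submodule.span_singleton_le_iff_mem, LinearMap.mem_ker,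
        LinearMap.toSpanSingleton_apply, hM])
  refine hfl.of_surjective (f := g) ?_
  rw [← LinearMap.range_eq_top, eq_top_iff, ← hs, Submodule.span_le]
  rintro _ ⟨i, rfl⟩
  refine ⟨Pi.single i (Submodule.Quotient.mk 1), ?_⟩
  simp only [g]
  rw [LinearMap.lsum_piSingle, Submodule.liftQ_apply, LinearMap.toSpanSingleton_apply, one_smul]

end Length

section Lattice

variable {K : Type u} [Field K] [Algebra ℂ K] {F : Type v} [AddCommGroup F] [Module K F]
  {F' : Type w} [AddCommGroup F'] [Module K F'] {x : Point K}

/-- `M` is a full lattice of the generic fibre. -/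
structure IsLattice (M : Submodule x.O F) : Prop where
  fg : M.FG
  span_eq_top : Submodule.span K (M : Set F) = ⊤

theorem IsVectorBundle.isLattice {E : Stalks K F} (hE : IsVectorBundle E) (x : Point K) :
    IsLattice (E x) := ⟨hE.fg x, hE.span_eq_top x⟩

theorem mem_spanAt_basis {ι : Type*} (b : Module.Basis ι K F) {a : F} :
    a ∈ spanAt x (Set.range b) ↔ ∀ i, b.repr a i ∈ x.ring := by
  rw [spanAt, b.mem_span_iff_repr_mem x.O]
  refine forall_congr' fun i => ?_
  exact ⟨fun ⟨z, hz⟩ => hz ▸ z.2, fun h => ⟨⟨_, h⟩, rfl⟩⟩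

theorem isLattice_basis {ι : Type*} [Finite ι] (b : Module.Basis ι K F) :
    IsLattice (spanAt x (Set.range b)) :=
  ⟨spanAt_fg (Set.finite_range b), top_le_iff.1 (by
    rw [← b.span_eq]
    exact Submodule.span_mono (subset_spanAt _))⟩

variable [hK : Fact (IsFunctionField K)]

theorem exists_ord_smul_mem {M : Submodule x.O F} (hM : Submodule.span K (M : Set F) = ⊤)
    (f : F) : ∃ n : ℕ, ∀ h : K, (n : ℤ) ≤ x.ord h → h ≠ 0 → h • f ∈ M := by
  have hf : f ∈ Submodule.span K (M : Set F) := hM ▸ Submodule.mem_top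
  induction hf using Submodule.span_induction with
  | mem f hf => exact ⟨0, fun h hh h0 => smul_mem_stalk M ((x.mem_ring_iff_ord h0).2 hh) hf⟩
  | zero => exact ⟨0, fun h _ _ => by rw [smul_zero]; exact M.zero_mem⟩
  | add f g _ _ hf hg =>
    obtain ⟨n, hn⟩ := hf
    obtain ⟨m, hm⟩ := hg
    refine ⟨n + m, fun h hh h0 => ?_⟩
    rw [smul_add]
    exact add_mem (hn h (by omega) h0) (hm h (by omega) h0)
  | smul c f _ hf =>
    obtain ⟨n, hn⟩ := hf
    rcases eq_or_ne c 0 with rfl | hc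
    · exact ⟨0, fun h _ _ => by simp⟩
    · refine ⟨((n : ℤ) - x.ord c).toNat, fun h hh h0 => ?_⟩
      rw [smul_smul]
      refine hn _ ?_ (mul_ne_zero h0 hc)
      rw [x.ord_mul h0 hc]
      omega

theorem exists_ord_smul_mem_of_fg {M N : Submodule x.O F}
    (hM : Submodule.span K (M : Set F) = ⊤) (hN : N.FG) :
    ∃ n : ℕ, ∀ h : K, (n : ℤ) ≤ x.ord h → h ≠ 0 → ∀ f ∈ N, h • f ∈ M := by
  obtain ⟨S, rfl⟩ := hN
  choose n hn using exists_ord_smul_mem hM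
  refine ⟨S.sup n, fun h hh h0 f hf => ?_⟩
  induction hf using Submodule.span_induction with
  | mem f hf =>
    exact hn f h (le_trans (by exact_mod_cast Finset.le_sup (f := n) hf) hh) h0
  | zero => rw [smul_zero]; exact M.zero_mem
  | add f g _ _ hf hg => rw [smul_add]; exact add_mem hf hg
  | smul c f _ hf =>
    have : h • c • f = c • h • f := by
      change h • (c : K) • f = (c : K) • h • f
      rw [smul_comm]
    rw [this]
    exact M.smul_mem c hf

theorem IsLattice.of_le {M N : Submodule x.O F} (hM : IsLattice M) (hNM : N ≤ M)
    (hN : Submodule.span K (N : Set F) = ⊤) : IsLattice N := by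
  haveI := isNoetherian_of_fg_of_noetherian M hM.fg
  exact ⟨Submodule.FG.of_le_of_isNoetherian hNM, hN⟩

theorem IsLattice.inf {M N : Submodule x.O F} (hM : IsLattice M) (hN : IsLattice N) :
    IsLattice (M ⊓ N) := by
  refine hM.of_le inf_le_left (top_le_iff.1 fun f _ => ?_)
  obtain ⟨n, hn⟩ := exists_ord_smul_mem hM.span_eq_top f
  obtain ⟨m, hm⟩ := exists_ord_smul_mem hN.span_eq_top f
  obtain ⟨h, h0, hh⟩ := x.exists_ord_eq (n + m : ℕ)
  have h1 : h • f ∈ M ⊓ N := ⟨hn h (by omega) h0, hm h (by omega) h0⟩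
  have := Submodule.smul_mem _ h⁻¹ (Submodule.subset_span (R := K) h1)
  rwa [smul_smul, inv_mul_cancel₀ h0, one_smul] at this

/-- The length of `M / M ∩ N`. -/
def len (M N : Submodule x.O F) : ℕ := (Module.length x.O (M ⧸ N.submoduleOf M)).toNat

theorem relLength_eq_len (M N : Submodule x.O F) : relLength x M N = len M N - len N M := rfl

theorem IsLattice.isFiniteLength {M N : Submodule x.O F} (hM : IsLattice M) (hN : IsLattice N) :
    IsFiniteLength x.O (M ⧸ N.submoduleOf M) := by
  obtain ⟨n, hn⟩ := exists_ord_smul_mem_of_fg hN.span_eq_top hM.fg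
  obtain ⟨h, h0, hh⟩ := x.exists_ord_eq n
  have hx : h ∈ x.ring := (x.mem_ring_iff_ord h0).2 (by omega)
  haveI : Module.Finite x.O M := Module.Finite.iff_fg.2 hM.fg
  refine isFiniteLength_of_smul_eq_zero (h := (⟨h, hx⟩ : x.O))
    (by simpa [Subtype.ext_iff] using h0) fun m => ?_
  obtain ⟨m, rfl⟩ := Submodule.Quotient.mk_surjective _ m
  rw [← Submodule.Quotient.mk_smul, Submodule.Quotient.mk_eq_zero]
  exact hn h hh.ge h0 m m.2

theorem coe_len {M N : Submodule x.O F} (hM : IsLattice M) (hN : IsLattice N) :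
    (len M N : ℕ∞) = Module.length x.O (M ⧸ N.submoduleOf M) :=
  ENat.natCast_toNat (Module.length_ne_top_iff.2 (hM.isFiniteLength hN))

theorem len_add {T N M : Submodule x.O F} (hM : IsLattice M) (hT : IsLattice T)
    (hTN : T ≤ N) (hNM : N ≤ M) (hN : IsLattice N) : len M T = len N T + len M N := by
  have := length_quotient_add T N M hTN hNM
  rw [← coe_len hM hT, ← coe_len hN hT, ← coe_len hM hN] at this
  exact_mod_cast this

theorem len_eq_zero_iff {M N : Submodule x.O F} (hM : IsLattice M) (hN : IsLattice N) :
    len M N = 0 ↔ M ≤ N := by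
  rw [← Nat.cast_eq_zero (R := ℕ∞), coe_len hM hN, Module.length_eq_zero_iff,
    Submodule.Quotient.subsingleton_iff, Submodule.submoduleOf, Submodule.comap_subtype_eq_top]

theorem len_inf (M N : Submodule x.O F) : len M (M ⊓ N) = len M N := by
  have h : (M ⊓ N).submoduleOf M = N.submoduleOf M := by
    ext m
    simp [Submodule.submoduleOf]
  rw [len, h]; rfl

theorem relLength_eq_of_le {T M N : Submodule x.O F} (hT : IsLattice T) (hM : IsLattice M)
    (hN : IsLattice N) (hTM : T ≤ M) (hTN : T ≤ N) : relLength x M N = len M T - len N T := by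
  have h1 := len_add hM hT (le_inf hTM hTN) inf_le_left (hM.inf hN)
  have h2 := len_add hN hT (le_inf hTM hTN) inf_le_right (hM.inf hN)
  rw [len_inf] at h1
  rw [inf_comm M N, len_inf] at h2
  rw [relLength_eq_len]
  have h3 : len (M ⊓ N) T = len (N ⊓ M) T := by rw [inf_comm]
  omega

theorem relLength_self (M : Submodule x.O F) : relLength x M M = 0 := by
  rw [relLength_eq_len, sub_self]

theorem len_congr (e : F ≃ₗ[K] F') {M N : Submodule x.O F} {M' N' : Submodule x.O F'}
    (hM : ∀ a, e a ∈ M' ↔ a ∈ M) (hN : ∀ a, e a ∈ N' ↔ a ∈ N) : len M N = len M' N' := by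
  let i : M ≃ₗ[x.O] M' := (e.restrictScalars x.O).ofSubmodules M M' (by
    ext a
    constructor
    · rintro ⟨b, hb, rfl⟩
      exact (hM b).2 hb
    · intro h
      exact ⟨e.symm a, (hM _).1 (by rwa [e.apply_symm_apply]), e.apply_symm_apply a⟩)
  have hi : ∀ m, ((i m : M') : F') = e m := fun m => rfl
  have := (Submodule.Quotient.equiv (N.submoduleOf M) (N'.submoduleOf M') i (by
    ext a
    constructor
    · rintro ⟨b, hb, rfl⟩
      exact (hN _).2 hb
    · intro h
      refine ⟨i.symm a, ?_, i.apply_symm_apply a⟩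
      change ((i.symm a : M) : F) ∈ N
      rw [← hN, ← hi, i.apply_symm_apply]
      exact h)).length_eq
  rw [len, len, this]

theorem relLength_congr (e : F ≃ₗ[K] F') {M N : Submodule x.O F} {M' N' : Submodule x.O F'}
    (hM : ∀ a, e a ∈ M' ↔ a ∈ M) (hN : ∀ a, e a ∈ N' ↔ a ∈ N) :
    relLength x M N = relLength x M' N' := by
  rw [relLength_eq_len, relLength_eq_len, len_congr e hM hN, len_congr e hN hM]

/-- The intersection of a lattice with a subspace of the generic fibre. -/
def subAt (W : Submodule K F) (M : Submodule x.O F) : Submodule x.O W :=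
  M.comap (W.subtype.restrictScalars x.O)

/-- The image of a lattice in a quotient space of the generic fibre. -/
def quotAt (W : Submodule K F) (M : Submodule x.O F) : Submodule x.O (F ⧸ W) :=
  M.map (W.mkQ.restrictScalars x.O)

theorem mem_subAt {W : Submodule K F} {M : Submodule x.O F} {a : W} :
    a ∈ subAt W M ↔ (a : F) ∈ M := Iff.rfl

theorem IsLattice.subAt (W : Submodule K F) {M : Submodule x.O F} (hM : IsLattice M) :
    IsLattice (subAt W M) := by
  constructor
  · haveI := isNoetherian_of_fg_of_noetherian M hM.fg
    have h : ((Curve.subAt W M).map (W.subtype.restrictScalars x.O)).FG :=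
      Submodule.FG.of_le_of_isNoetherian (T := M) (Submodule.map_comap_le _ _)
    exact Submodule.fg_of_fg_map_injective _ Subtype.val_injective h
  · refine top_le_iff.1 fun w _ => ?_
    obtain ⟨n, hn⟩ := exists_ord_smul_mem hM.span_eq_top (w : F)
    obtain ⟨h, h0, hh⟩ := x.exists_ord_eq n
    have h1 : h • w ∈ Curve.subAt W M := hn h hh.ge h0
    have := Submodule.smul_mem _ h⁻¹ (Submodule.subset_span (R := K) h1)
    rwa [smul_smul, inv_mul_cancel₀ h0, one_smul] at this

theorem IsLattice.quotAt (W : Submodule K F) {M : Submodule x.O F} (hM : IsLattice M) :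
    IsLattice (quotAt W M) := by
  refine ⟨hM.fg.map _, ?_⟩
  have : (Curve.quotAt W M : Set (F ⧸ W)) = W.mkQ '' (M : Set F) := rfl
  rw [this, ← Submodule.map_span, hM.span_eq_top, Submodule.map_top, Submodule.range_mkQ]

theorem len_eq_sub_add_quot (W : Submodule K F) {M T : Submodule x.O F} (hM : IsLattice M)
    (hT : IsLattice T) (hTM : T ≤ M) :
    len M T = len (subAt W M) (subAt W T) + len (quotAt W M) (quotAt W T) := by
  let i : subAt W M →ₗ[x.O] M :=
    ((W.subtype.restrictScalars x.O).comp (subAt W M).subtype).codRestrict M fun a => a.2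
  let p : M →ₗ[x.O] quotAt W M :=
    ((W.mkQ.restrictScalars x.O).comp M.subtype).codRestrict (quotAt W M) fun a => ⟨a, a.2, rfl⟩
  have h := length_quotient_of_exact i p ?_ ?_ (T.submoduleOf M)
  · have h2 : (T.submoduleOf M).map p = (quotAt W T).submoduleOf (quotAt W M) := by
      ext a
      constructor
      · rintro ⟨m, hm, rfl⟩
        exact ⟨m, hm, rfl⟩
      · rintro ⟨m, hm, h⟩
        exact ⟨⟨m, hTM hm⟩, hm, Subtype.ext h⟩
    rw [h2, ← coe_len hM hT] at h
    change _ = Module.length x.O (subAt W M ⧸ (subAt W T).submoduleOf (subAt W M)) + _ at h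
    rw [← coe_len (hM.subAt W) (hT.subAt W), ← coe_len (hM.quotAt W) (hT.quotAt W)] at h
    exact_mod_cast h
  · rintro ⟨_, m, hm, rfl⟩
    exact ⟨⟨m, hm⟩, rfl⟩
  · intro m
    have : p m = 0 ↔ (m : F) ∈ W := by
      rw [← Subtype.coe_inj]
      exact Submodule.Quotient.mk_eq_zero W
    rw [this]
    exact ⟨fun h => ⟨⟨⟨m, h⟩, m.2⟩, rfl⟩, by rintro ⟨a, rfl⟩; exact a.1.2⟩

theorem relLength_eq_sub_add_quot (W : Submodule K F) {M N : Submodule x.O F} (hM : IsLattice M)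
    (hN : IsLattice N) : relLength x M N =
      relLength x (subAt W M) (subAt W N) + relLength x (quotAt W M) (quotAt W N) := by
  have hT := hM.inf hN
  have h1 : subAt W (M ⊓ N) ≤ subAt W M := Submodule.comap_mono inf_le_left
  have h2 : subAt W (M ⊓ N) ≤ subAt W N := Submodule.comap_mono inf_le_right
  have h3 : quotAt W (M ⊓ N) ≤ quotAt W M := Submodule.map_mono inf_le_left
  have h4 : quotAt W (M ⊓ N) ≤ quotAt W N := Submodule.map_mono inf_le_right
  rw [relLength_eq_of_le hT hM hN inf_le_left inf_le_right,
    relLength_eq_of_le (hT.subAt W) (hM.subAt W) (hN.subAt W) h1 h2,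
    relLength_eq_of_le (hT.quotAt W) (hM.quotAt W) (hN.quotAt W) h3 h4,
    len_eq_sub_add_quot W hM hT inf_le_left, len_eq_sub_add_quot W hN hT inf_le_right]
  push_cast
  ring

/-- A lattice in a one-dimensional space is generated by one element. -/
theorem IsLattice.exists_eq_spanAt_singleton (hF : Module.finrank K F = 1) {M : Submodule x.O F}
    (hM : IsLattice M) : ∃ e : F, e ≠ 0 ∧ M = spanAt x {e} := by
  classical
  obtain ⟨f, hf0, hf⟩ := finrank_eq_one_iff'.1 hF
  have hfull : Submodule.span K (spanAt x {f} : Set F) = ⊤ := by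
    refine top_le_iff.1 fun a _ => ?_
    obtain ⟨c, rfl⟩ := hf a
    exact Submodule.smul_mem _ _ (Submodule.subset_span (subset_spanAt _ rfl))
  obtain ⟨n, hn⟩ := exists_ord_smul_mem_of_fg hfull hM.fg
  obtain ⟨h, h0, hh⟩ := x.exists_ord_eq n
  have hbd : ∀ g : K, g ≠ 0 → g • f ∈ M → -(n : ℤ) ≤ x.ord g := by
    intro g hg hgf
    obtain ⟨c, hc, h1⟩ := mem_spanAt_singleton.1 (hn h hh.ge h0 _ hgf)
    rw [smul_smul] at h1
    have h2 : h * g = c := smul_left_injective K hf0 h1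
    rw [← h2, x.mem_ring_iff_ord (mul_ne_zero h0 hg), x.ord_mul h0 hg] at hc
    omega
  have hex : ∃ z : ℤ, ∃ g : K, g ≠ 0 ∧ g • f ∈ M ∧ x.ord g = z := by
    obtain ⟨m, hm⟩ := exists_ord_smul_mem hM.span_eq_top f
    obtain ⟨g, h0, hg⟩ := x.exists_ord_eq m
    exact ⟨_, g, h0, hm g hg.ge h0, rfl⟩
  obtain ⟨z, ⟨g, hg0, hgM, rfl⟩, hmin⟩ := Int.exists_least_of_bdd
    (P := fun z => ∃ g : K, g ≠ 0 ∧ g • f ∈ M ∧ x.ord g = z)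
    ⟨-n, fun z ⟨g, h1, h2, h3⟩ => h3 ▸ hbd g h1 h2⟩ hex
  refine ⟨g • f, smul_ne_zero hg0 hf0, le_antisymm (fun a ha => ?_) ?_⟩
  · obtain ⟨c, rfl⟩ := hf a
    rcases eq_or_ne c 0 with rfl | hc
    · rw [zero_smul]; exact Submodule.zero_mem _
    · refine mem_spanAt_singleton.2 ⟨c / g, (x.div_mem_ring_iff hc hg0).2 (hmin _ ⟨c, hc, ha, rfl⟩), ?_⟩
      rw [smul_smul, div_mul_cancel₀ _ hg0]
  · rw [spanAt_le, Set.singleton_subset_iff]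
    exact hgM

theorem isLattice_singleton (hF : Module.finrank K F = 1) {e : F} (he : e ≠ 0) :
    IsLattice (spanAt x {e}) :=
  ⟨spanAt_fg (Set.finite_singleton e), top_le_iff.1 (by
    rw [← (finrank_eq_one_iff_of_nonzero e he).1 hF]
    exact Submodule.span_mono (subset_spanAt _))⟩

theorem relLength_singleton {e : F} (he : e ≠ 0) (hF : Module.finrank K F = 1) {g : K}
    (hg : g ≠ 0) : relLength x (spanAt x {g • e}) (spanAt x {e}) = - x.ord g := by
  have key : ∀ {e : F} {g : K}, e ≠ 0 → g ≠ 0 → g ∈ x.ring →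
      relLength x (spanAt x {g • e}) (spanAt x {e}) = - x.ord g := by
    intro e g he hg hgx
    have hle : spanAt x {g • e} ≤ spanAt x {e} := by
      rw [spanAt_le, Set.singleton_subset_iff]
      exact mem_spanAt_singleton.2 ⟨g, hgx, rfl⟩
    have h0 := (len_eq_zero_iff (isLattice_singleton hF (smul_ne_zero hg he))
      (isLattice_singleton hF he)).2 hle
    rw [relLength_eq_len, h0, x.ord_eq_length (f := ⟨g, hgx⟩) (by simpa [Subtype.ext_iff] using hg)]
    let i : x.O ≃ₗ[x.O] spanAt x {e} := LinearEquiv.ofBijective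
      ((LinearMap.toSpanSingleton x.O F e).codRestrict (spanAt x {e})
        fun c => mem_spanAt_singleton.2 ⟨c, c.2, rfl⟩) (by
      constructor
      · intro a b hab
        have : (a : K) • e = (b : K) • e := congrArg Subtype.val hab
        exact Subtype.ext (smul_left_injective K he this)
      · rintro ⟨a, ha⟩
        obtain ⟨c, hc, rfl⟩ := mem_spanAt_singleton.1 ha
        exact ⟨⟨c, hc⟩, rfl⟩)
    have := (Submodule.Quotient.equiv (Ideal.span {(⟨g, hgx⟩ : x.O)})
      ((spanAt x {g • e}).submoduleOf (spanAt x {e})) i (by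
        ext ⟨a, ha⟩
        constructor
        · rintro ⟨c, hc, h⟩
          obtain ⟨d, rfl⟩ := Ideal.mem_span_singleton'.1 hc
          refine mem_spanAt_singleton.2 ⟨d, d.2, ?_⟩
          rw [smul_smul]
          exact (congrArg Subtype.val h).symm
        · intro h
          obtain ⟨c, hc, h'⟩ := mem_spanAt_singleton.1 h
          refine ⟨⟨c, hc⟩ * ⟨g, hgx⟩, Ideal.mul_mem_left _ _ (Ideal.mem_span_singleton_self _), ?_⟩
          apply Subtype.ext
          rw [smul_smul] at h'
          exact h'.symm)).length_eq
    rw [len, ← this]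
    simp
  by_cases hgx : g ∈ x.ring
  · exact key he hg hgx
  · have h1 := key (smul_ne_zero hg he) (inv_ne_zero hg) (x.inv_mem_of_notMem hgx)
    rw [smul_smul, inv_mul_cancel₀ hg, one_smul, Point.ord_inv] at h1
    rw [relLength_eq_len] at h1 ⊢
    omega

end Lattice

section Bundles

variable {K : Type u} [Field K] [Algebra ℂ K] {F : Type v} [AddCommGroup F] [Module K F]
  [hK : Fact (IsFunctionField K)]

/-- The free bundle with a given basis of the generic fibre. -/
def freeBundle {ι : Type*} (b : ι → F) : Stalks K F := fun x => spanAt x (Set.range b)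

theorem finite_notMem_freeBundle {ι : Type*} [Finite ι] (b : Module.Basis ι K F) (f : F) :
    {x : Point K | f ∉ freeBundle (K := K) b x}.Finite := by
  refine (Set.finite_iUnion fun i => finite_poles hK.out (b.repr f i)).subset fun x hx => ?_
  by_contra hcon
  simp only [Set.mem_iUnion, not_exists, Set.mem_ofPred_eq, not_not] at hcon
  exact hx ((mem_spanAt_basis b).2 hcon)

theorem finite_freeBundle_ne {ι ι' : Type*} [Finite ι] [Finite ι'] (b : Module.Basis ι K F)
    (b' : Module.Basis ι' K F) :
    {x : Point K | freeBundle (K := K) b x ≠ freeBundle (K := K) b' x}.Finite := by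
  refine ((Set.finite_iUnion fun i => finite_notMem_freeBundle b' (b i)).union
    (Set.finite_iUnion fun i => finite_notMem_freeBundle b (b' i))).subset fun x hx => ?_
  by_contra hcon
  simp only [Set.mem_union, Set.mem_iUnion, not_exists, Set.mem_ofPred_eq, not_not, not_or] at hcon
  refine hx (le_antisymm (spanAt_le.2 ?_) (spanAt_le.2 ?_))
  · rintro _ ⟨i, rfl⟩; exact hcon.1 i
  · rintro _ ⟨i, rfl⟩; exact hcon.2 i

theorem IsVectorBundle.finite_ne_basis {E : Stalks K F} (hE : IsVectorBundle E) {ι : Type*}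
    [Finite ι] (b : Module.Basis ι K F) : {x : Point K | E x ≠ freeBundle (K := K) b x}.Finite := by
  obtain ⟨b', hb'⟩ := hE.generic
  refine (hb'.union (finite_freeBundle_ne b' b)).subset fun x hx => ?_
  by_contra hcon
  simp only [Set.mem_union, Set.mem_ofPred_eq, not_not, not_or] at hcon
  exact hx (hcon.1.trans hcon.2)

theorem IsVectorBundle.of_basis {E : Stalks K F} {ι : Type*} [Finite ι] (b : Module.Basis ι K F)
    (h : ∀ x, IsLattice (E x)) (hb : {x : Point K | E x ≠ freeBundle (K := K) b x}.Finite) :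
    IsVectorBundle E where
  finite := Module.Finite.of_basis b
  fg x := (h x).fg
  span_eq_top x := (h x).span_eq_top
  generic := by
    haveI := Fintype.ofFinite ι
    refine ⟨b.reindex (Fintype.equivFinOfCardEq (Module.finrank_eq_card_basis b).symm), ?_⟩
    rw [Module.Basis.range_reindex]
    exact hb

theorem isVectorBundle_freeBundle {ι : Type*} [Finite ι] (b : Module.Basis ι K F) :
    IsVectorBundle (freeBundle (K := K) b) :=
  .of_basis b (fun _ => isLattice_basis b) (by simp)

theorem IsVectorBundle.exists_basis {E : Stalks K F} (hE : IsVectorBundle E) :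
    ∃ b : Module.Basis (Fin (Module.finrank K F)) K F,
      {x : Point K | E x ≠ freeBundle (K := K) b x}.Finite := hE.generic

theorem IsVectorBundle.finite_ne {E E' : Stalks K F} (hE : IsVectorBundle E)
    (hE' : IsVectorBundle E') : {x : Point K | E x ≠ E' x}.Finite := by
  obtain ⟨b, hb⟩ := hE'.exists_basis
  refine (hb.union (hE.finite_ne_basis b)).subset fun x hx => ?_
  by_contra hcon
  simp only [Set.mem_union, Set.mem_ofPred_eq, not_not, not_or] at hcon
  exact hx (hcon.2.trans hcon.1.symm)

theorem IsVectorBundle.of_finite_ne {E E' : Stalks K F} (hE : IsVectorBundle E)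
    (h : ∀ x, IsLattice (E' x)) (hne : {x : Point K | E' x ≠ E x}.Finite) : IsVectorBundle E' := by
  obtain ⟨b, hb⟩ := hE.exists_basis
  refine .of_basis b h ((hne.union hb).subset fun x hx => ?_)
  by_contra hcon
  simp only [Set.mem_union, Set.mem_ofPred_eq, not_not, not_or] at hcon
  exact hx (hcon.1.trans hcon.2)

theorem IsVectorBundle.finite_notMem {E : Stalks K F} (hE : IsVectorBundle E) (f : F) :
    {x : Point K | f ∉ E x}.Finite := by
  obtain ⟨b, hb⟩ := hE.exists_basis
  refine (hb.union (finite_notMem_freeBundle b f)).subset fun x hx => ?_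
  by_contra hcon
  simp only [Set.mem_union, Set.mem_ofPred_eq, not_not, not_or] at hcon
  exact hx (hcon.1 ▸ hcon.2)

theorem IsVectorBundle.inf {E E' : Stalks K F} (hE : IsVectorBundle E) (hE' : IsVectorBundle E') :
    IsVectorBundle (fun x => E x ⊓ E' x : Stalks K F) := by
  refine hE.of_finite_ne (fun x => (hE.isLattice x).inf (hE'.isLattice x))
    ((hE.finite_ne hE').subset fun x hx => ?_)
  intro h
  exact hx (by rw [← h, inf_idem])

theorem subAt_freeBundle {ι ι' : Type*} [Finite ι] [Finite ι'] (W : Submodule K F)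
    (b : Module.Basis ι K W) (b' : Module.Basis ι' K (F ⧸ W)) (x : Point K) :
    subAt W (freeBundle (K := K) (Module.Basis.sumQuot b b') x) = freeBundle (K := K) b x := by
  haveI := Fintype.ofFinite ι
  ext w
  have h : (Module.Basis.sumQuot b b').repr (w : F) = (b.repr w).mapDomain Sum.inl := by
    conv_lhs => rw [← b.sum_repr w]
    rw [Submodule.coe_sum, map_sum, Finsupp.mapDomain,
      Finsupp.sum_fintype _ _ (fun i => by simp)]
    refine Finset.sum_congr rfl fun i _ => ?_
    rw [Submodule.coe_smul, map_smul, Module.Basis.sumQuot_repr_left]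
    simp
  rw [mem_subAt, freeBundle, freeBundle, mem_spanAt_basis, mem_spanAt_basis, h]
  constructor
  · intro hw i
    have := hw (Sum.inl i)
    rwa [Finsupp.mapDomain_apply Sum.inl_injective] at this
  · rintro hw (i | i)
    · rw [Finsupp.mapDomain_apply Sum.inl_injective]; exact hw i
    · rw [Finsupp.mapDomain_of_notMem_range _ _ (by simp)]; exact x.ring.zero_mem

theorem quotAt_freeBundle {ι ι' : Type*} [Finite ι] [Finite ι'] (W : Submodule K F)
    (b : Module.Basis ι K W) (b' : Module.Basis ι' K (F ⧸ W)) (x : Point K) :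
    quotAt W (freeBundle (K := K) (Module.Basis.sumQuot b b') x) = freeBundle (K := K) b' x := by
  apply le_antisymm
  · refine Submodule.map_le_iff_le_comap.2 (spanAt_le.2 ?_)
    rintro _ ⟨i | i, rfl⟩
    · change W.mkQ (Module.Basis.sumQuot b b' (Sum.inl i)) ∈ freeBundle (K := K) b' x
      rw [Module.Basis.sumQuot_inl, Submodule.mkQ_apply,
        (Submodule.Quotient.mk_eq_zero W).2 (b i).2]
      exact Submodule.zero_mem _
    · exact subset_spanAt _ ⟨i, (Module.Basis.sumQuot_inr b b' i).symm⟩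
  · refine spanAt_le.2 ?_
    rintro _ ⟨i, rfl⟩
    exact ⟨_, subset_spanAt _ ⟨Sum.inr i, rfl⟩, Module.Basis.sumQuot_inr b b' i⟩

theorem IsVectorBundle.sub {E : Stalks K F} (hE : IsVectorBundle E) (W : Submodule K F) :
    IsVectorBundle (sub E W) := by
  haveI := hE.finite
  let b := Module.finBasis K W
  let b' := Module.finBasis K (F ⧸ W)
  refine .of_basis b (fun x => (hE.isLattice x).subAt W)
    ((hE.finite_ne_basis (Module.Basis.sumQuot b b')).subset fun x hx h => ?_)
  exact hx (by rw [← subAt_freeBundle W b b', ← h]; rfl)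

theorem IsVectorBundle.quot {E : Stalks K F} (hE : IsVectorBundle E) (W : Submodule K F) :
    IsVectorBundle (quot E W) := by
  haveI := hE.finite
  let b := Module.finBasis K W
  let b' := Module.finBasis K (F ⧸ W)
  refine .of_basis b' (fun x => (hE.isLattice x).quotAt W)
    ((hE.finite_ne_basis (Module.Basis.sumQuot b b')).subset fun x hx h => ?_)
  exact hx (by rw [← quotAt_freeBundle W b b', ← h]; rfl)

theorem pow_smul_mem {x : Point K} {M : Submodule x.O F}
    (hM : Submodule.span K (M : Set F) = ⊤) {β : K} (hβ : β ∈ x.ring.nonunits) (f : F) :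
    ∃ n : ℕ, ∀ m, n ≤ m → β ^ m • f ∈ M := by
  rcases eq_or_ne β 0 with rfl | h0
  · exact ⟨1, fun m hm => by rw [zero_pow (by omega), zero_smul]; exact M.zero_mem⟩
  · obtain ⟨n, hn⟩ := exists_ord_smul_mem hM f
    refine ⟨n, fun m hm => hn _ ?_ (pow_ne_zero m h0)⟩
    have := (x.mem_nonunits_iff_ord h0).1 hβ
    rw [← zpow_natCast, x.ord_zpow]
    nlinarith

theorem Point.pow_notMem_nonunits {x : Point K} {β : K} (h : β ∉ x.ring.nonunits) (n : ℕ) :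
    β ^ n ∉ x.ring.nonunits := by
  have h0 : β ≠ 0 := fun h0 => h (by rw [h0]; exact ZeroMemClass.zero_mem _)
  rw [x.mem_nonunits_iff_ord (pow_ne_zero n h0), ← zpow_natCast, x.ord_zpow]
  rw [x.mem_nonunits_iff_ord h0] at h
  nlinarith

theorem Point.mul_notMem_nonunits {x : Point K} {a b : K} (ha : a ∉ x.ring.nonunits)
    (hb : b ∉ x.ring.nonunits) : a * b ∉ x.ring.nonunits := by
  have ha0 : a ≠ 0 := fun h0 => ha (by rw [h0]; exact ZeroMemClass.zero_mem _)
  have hb0 : b ≠ 0 := fun h0 => hb (by rw [h0]; exact ZeroMemClass.zero_mem _)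
  rw [x.mem_nonunits_iff_ord (mul_ne_zero ha0 hb0), x.ord_mul ha0 hb0]
  rw [x.mem_nonunits_iff_ord ha0] at ha
  rw [x.mem_nonunits_iff_ord hb0] at hb
  omega

/-- A germ at `x` of a section of `E` extends over the affine chart of `t` after multiplication
by a regular function that does not vanish at `x`. -/
theorem IsVectorBundle.exists_smul_mem {E : Stalks K F} (hE : IsVectorBundle E) {t : K}
    (ht : Transcendental ℂ t) {x : Point K} (hx : t ∈ x.ring) {e : F} (he : e ∈ E x) :
    ∃ β : K, (∀ y : Point K, t ∈ y.ring → β ∈ y.ring) ∧ β ∉ x.ring.nonunits ∧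
      ∀ y : Point K, t ∈ y.ring → β • e ∈ E y := by
  classical
  have key : ∀ s : Finset (Point K), ∃ β : K, (∀ y : Point K, t ∈ y.ring → β ∈ y.ring) ∧
      β ∉ x.ring.nonunits ∧ ∀ y ∈ s, t ∈ y.ring → β • e ∈ E y := by
    intro s
    induction s using Finset.induction_on with
    | empty =>
      exact ⟨1, fun y _ => y.ring.one_mem, fun h => by
        rw [x.mem_nonunits_iff_ord one_ne_zero] at h; simp at h, by simp⟩
    | insert y s hy ih =>
      obtain ⟨β, h1, h2, h3⟩ := ih
      by_cases hty : t ∈ y.ring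
      swap
      · refine ⟨β, h1, h2, fun z hz htz => ?_⟩
        rcases Finset.mem_insert.1 hz with rfl | hz
        · exact absurd htz hty
        · exact h3 z hz htz
      rcases eq_or_ne x y with rfl | hxy
      · refine ⟨β, h1, h2, fun z hz htz => ?_⟩
        rcases Finset.mem_insert.1 hz with rfl | hz
        · exact smul_mem_stalk _ (h1 _ htz) he
        · exact h3 z hz htz
      · obtain ⟨γ, g1, g2, g3⟩ := exists_separating_of_mem hK.out ht hxy hx hty
        obtain ⟨n, hn⟩ := pow_smul_mem (hE.span_eq_top y) g2 (β • e)
        refine ⟨γ ^ n * β, fun z hz => z.ring.mul_mem _ _ (pow_mem (g1 z hz) n) (h1 z hz),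
          Point.mul_notMem_nonunits (Point.pow_notMem_nonunits g3 n) h2, fun z hz htz => ?_⟩
        rw [mul_smul]
        rcases Finset.mem_insert.1 hz with rfl | hz
        · exact hn n le_rfl
        · exact smul_mem_stalk _ (pow_mem (g1 z htz) n) (h3 z hz htz)
  obtain ⟨β, h1, h2, h3⟩ := key (hE.finite_notMem e).toFinset
  refine ⟨β, h1, h2, fun y hy => ?_⟩
  by_cases hey : e ∈ E y
  · exact smul_mem_stalk _ (h1 y hy) hey
  · exact h3 y (by simpa using hey) hy

/-- The next step of a composition series. -/
theorem exists_step {x : Point K} {T M : Submodule x.O F} (hT : IsLattice T)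
    (hlt : T < M) : ∃ m ∈ M, m ∉ T ∧ ∀ h ∈ x.ring.nonunits, h • m ∈ T := by
  classical
  obtain ⟨m, hm, hmT⟩ := SetLike.exists_of_lt hlt
  obtain ⟨π, hπ0, hπ⟩ := x.exists_ord_eq_one
  have hπm : π ∈ x.ring.nonunits := (x.mem_nonunits_iff_ord hπ0).2 (by omega)
  have hex : ∃ n : ℕ, π ^ n • m ∈ T := by
    obtain ⟨n, hn⟩ := pow_smul_mem hT.span_eq_top hπm m
    exact ⟨n, hn n le_rfl⟩
  have hn := Nat.find_spec hex
  set n := Nat.find hex with hdef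
  have hn0 : n ≠ 0 := by
    intro h0
    rw [h0, pow_zero, one_smul] at hn
    exact hmT hn
  obtain ⟨k, hk⟩ := Nat.exists_eq_succ_of_ne_zero hn0
  refine ⟨π ^ k • m, smul_mem_stalk _ (pow_mem (Point.mem_of_mem_nonunits hπm) k) hm,
    Nat.find_min hex (by omega), fun h hh => ?_⟩
  rcases eq_or_ne h 0 with rfl | h0
  · rw [zero_smul]; exact T.zero_mem
  · have : h • π ^ k • m = (h / π) • π ^ n • m := by
      rw [hk, pow_succ', smul_smul, smul_smul]
      congr 1
      field_simp
    rw [this]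
    refine smul_mem_stalk _ ((x.div_mem_ring_iff h0 hπ0).2 ?_) hn
    have := (x.mem_nonunits_iff_ord h0).1 hh
    omega

theorem exists_sub_const_smul_mem {x : Point K} {T : Submodule x.O F} {m a : F}
    (hm : ∀ h ∈ x.ring.nonunits, h • m ∈ T) (ha : a ∈ T ⊔ spanAt x {m}) :
    ∃ c : ℂ, a - algebraMap ℂ K c • m ∈ T := by
  obtain ⟨t, ht, b, hb, rfl⟩ := Submodule.mem_sup.1 ha
  obtain ⟨g, hg, rfl⟩ := mem_spanAt_singleton.1 hb
  obtain ⟨c, hc⟩ := x.exists_const_sub_mem hK.out hg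
  refine ⟨c, ?_⟩
  rw [add_sub_assoc, ← sub_smul]
  exact add_mem ht (hm _ hc)

theorem len_sup_spanAt {x : Point K} {T : Submodule x.O F} {m : F} (hmT : m ∉ T)
    (hm : ∀ h ∈ x.ring.nonunits, h • m ∈ T) : len (T ⊔ spanAt x {m}) T = 1 := by
  have hcov : T ⋖ T ⊔ spanAt x {m} := by
    refine ⟨lt_of_le_of_ne le_sup_left fun h => hmT (h ▸ Submodule.mem_sup_right
      (subset_spanAt _ rfl)), fun S hTS hS => ?_⟩
    obtain ⟨s, hs, hsT⟩ := SetLike.exists_of_lt hTS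
    obtain ⟨c, hc⟩ := exists_sub_const_smul_mem hm (hS.le hs)
    have hc0 : c ≠ 0 := by
      rintro rfl
      rw [map_zero, zero_smul, sub_zero] at hc
      exact hsT hc
    have h1 : algebraMap ℂ K c • m ∈ S := by
      have := sub_mem hs (hTS.le hc)
      rwa [sub_sub_cancel] at this
    have h2 : m ∈ S := by
      have := smul_mem_stalk S (x.const_mem c⁻¹) h1
      rwa [smul_smul, ← map_mul, inv_mul_cancel₀ hc0, map_one, one_smul] at this
    exact hS.not_ge (sup_le hTS.le (spanAt_le.2 (Set.singleton_subset_iff.2 h2)))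
  haveI := (covBy_iff_quot_is_simple le_sup_left).1 hcov
  have : Module.length x.O ((T ⊔ spanAt x {m} : Submodule x.O F) ⧸
      T.submoduleOf (T ⊔ spanAt x {m})) = 1 := Module.length_eq_one_iff.2 this
  rw [len, this]; rfl

end Bundles

section Index

variable {k V : Type*} [Field k] [AddCommGroup V] [Module k V]

/-- The intersection of two subspaces is finite dimensional, and so is the cokernel of their sum. -/
def IsFredholmPair (A N : Submodule k V) : Prop :=
  FiniteDimensional k ↥(A ⊓ N) ∧ FiniteDimensional k (V ⧸ (A ⊔ N))

/-- The index of a Fredholm pair of subspaces. -/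
def pairIndex (A N : Submodule k V) : ℤ :=
  Module.finrank k ↥(A ⊓ N) - Module.finrank k (V ⧸ (A ⊔ N))

theorem finrank_sup_span {B : Submodule k V} {v : V} (hv : v ∉ B) :
    (FiniteDimensional k ↥(B ⊔ k ∙ v) ↔ FiniteDimensional k B) ∧
      (FiniteDimensional k B → Module.finrank k ↥(B ⊔ k ∙ v) = Module.finrank k B + 1) := by
  have hv0 : v ≠ 0 := fun h => hv (h ▸ B.zero_mem)
  refine ⟨⟨fun h => Submodule.finiteDimensional_of_le (le_sup_left : B ≤ B ⊔ k ∙ v),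
    fun h => inferInstance⟩, fun h => ?_⟩
  have h1 := Submodule.finrank_sup_add_finrank_inf_eq B (k ∙ v)
  have h2 : B ⊓ k ∙ v = ⊥ := by
    rw [← disjoint_iff, Submodule.disjoint_span_singleton' hv0]
    exact hv
  rw [h2, finrank_bot, finrank_span_singleton hv0] at h1
  omega

theorem finrank_quotient_sup_span {B : Submodule k V} {v : V} (hv : v ∉ B) :
    (FiniteDimensional k (V ⧸ (B ⊔ k ∙ v)) ↔ FiniteDimensional k (V ⧸ B)) ∧
      (FiniteDimensional k (V ⧸ B) →
        Module.finrank k (V ⧸ B) = Module.finrank k (V ⧸ (B ⊔ k ∙ v)) + 1) := by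
  have hv' : B.mkQ v ≠ 0 := by
    rw [Submodule.mkQ_apply, Ne, Submodule.Quotient.mk_eq_zero]; exact hv
  let e := Submodule.quotientQuotientEquivQuotient B (B ⊔ k ∙ v) le_sup_left
  have hmap : (B ⊔ k ∙ v).map B.mkQ = k ∙ B.mkQ v := by
    rw [Submodule.map_sup, Submodule.map_span, Set.image_singleton]
    have : B.map B.mkQ = ⊥ := by
      rw [eq_bot_iff, Submodule.map_le_iff_le_comap, Submodule.comap_bot, Submodule.ker_mkQ]
    rw [this, bot_sup_eq]
  haveI : FiniteDimensional k ↥((B ⊔ k ∙ v).map B.mkQ) := by rw [hmap]; infer_instance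
  constructor
  · constructor
    · intro h
      haveI : FiniteDimensional k ((V ⧸ B) ⧸ (B ⊔ k ∙ v).map B.mkQ) := e.symm.finiteDimensional
      exact Module.Finite.of_submodule_quotient ((B ⊔ k ∙ v).map B.mkQ)
    · intro h
      exact e.finiteDimensional
  · intro h
    have h1 := Submodule.finrank_quotient_add_finrank ((B ⊔ k ∙ v).map B.mkQ)
    rw [e.finrank_eq, hmap, finrank_span_singleton hv'] at h1
    exact h1.symm

theorem isFredholmPair_sup_span {A N : Submodule k V} {v : V} (hv : v ∉ A) :
    (IsFredholmPair (A ⊔ k ∙ v) N ↔ IsFredholmPair A N) ∧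
      (IsFredholmPair A N → pairIndex (A ⊔ k ∙ v) N = pairIndex A N + 1) := by
  by_cases hvN : v ∈ A ⊔ N
  · obtain ⟨a, ha, n, hn, rfl⟩ := Submodule.mem_sup.1 hvN
    have hnA : n ∉ A := fun h => hv (add_mem ha h)
    have h1 : A ⊔ k ∙ (a + n) = A ⊔ k ∙ n := by
      apply le_antisymm <;> refine sup_le le_sup_left ?_ <;>
        rw [Submodule.span_singleton_le_iff_mem]
      · exact add_mem (Submodule.mem_sup_left ha)
          (Submodule.mem_sup_right (Submodule.mem_span_singleton_self n))
      · have := sub_mem (Submodule.mem_sup_right (S := A) (Submodule.mem_span_singleton_self (a + n)))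
          (Submodule.mem_sup_left (T := k ∙ (a + n)) ha)
        rwa [add_sub_cancel_left] at this
    have h2 : A ⊔ k ∙ n ⊔ N = A ⊔ N := by
      rw [sup_assoc, sup_eq_right.2 ((Submodule.span_singleton_le_iff_mem _ _).2 hn)]
    have h3 : (A ⊔ k ∙ n) ⊓ N = A ⊓ N ⊔ k ∙ n := by
      rw [sup_comm A, sup_inf_assoc_of_le A ((Submodule.span_singleton_le_iff_mem _ _).2 hn),
        sup_comm]
    have hn' : n ∉ A ⊓ N := fun h => hnA h.1
    obtain ⟨h4, h5⟩ := finrank_sup_span hn'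
    rw [h1]
    refine ⟨?_, fun h => ?_⟩
    · rw [IsFredholmPair, IsFredholmPair, h2, h3, h4]
    · rw [pairIndex, pairIndex, h2, h3, h5 h.1]
      push_cast
      ring
  · have h1 : A ⊔ k ∙ v ⊔ N = A ⊔ N ⊔ k ∙ v := by rw [sup_right_comm]
    have h2 : (A ⊔ k ∙ v) ⊓ N = A ⊓ N := by
      apply le_antisymm _ (inf_le_inf_right _ le_sup_left)
      rintro z ⟨hz, hzN⟩
      refine ⟨?_, hzN⟩
      obtain ⟨a, ha, b, hb, rfl⟩ := Submodule.mem_sup.1 hz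
      obtain ⟨c, rfl⟩ := Submodule.mem_span_singleton.1 hb
      rcases eq_or_ne c 0 with rfl | hc
      · simpa using ha
      · exfalso
        apply hvN
        have : v = c⁻¹ • ((a + c • v) - a) := by
          rw [add_sub_cancel_left, smul_smul, inv_mul_cancel₀ hc, one_smul]
        rw [this]
        exact Submodule.smul_mem _ _ (sub_mem (Submodule.mem_sup_right hzN)
          (Submodule.mem_sup_left ha))
    obtain ⟨h4, h5⟩ := finrank_quotient_sup_span hvN
    refine ⟨?_, fun h => ?_⟩
    · rw [IsFredholmPair, IsFredholmPair, h1, h2, h4]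
    · rw [pairIndex, pairIndex, h1, h2, h5 h.2]
      push_cast
      ring

theorem isFredholmPair_comm (A N : Submodule k V) : IsFredholmPair A N ↔ IsFredholmPair N A := by
  rw [IsFredholmPair, IsFredholmPair, inf_comm, sup_comm]

theorem pairIndex_comm (A N : Submodule k V) : pairIndex A N = pairIndex N A := by
  rw [pairIndex, pairIndex, inf_comm, sup_comm]

end Index

section Euler

variable {K : Type u} [Field K] [Algebra ℂ K] {F : Type v} [AddCommGroup F] [Module K F]
  [Module ℂ F] [IsScalarTower ℂ K F]

theorem const_smul_mem_stalk {x : Point K} (M : Submodule x.O F) (c : ℂ) {a : F} (ha : a ∈ M) :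
    c • a ∈ M := by
  rw [← algebraMap_smul K c a]
  exact smul_mem_stalk M (x.const_mem c) ha

/-- The sections of `E` over a set of points. -/
def secs (P : Point K → Prop) (E : Stalks K F) : Submodule ℂ F where
  carrier := {s | ∀ x, P x → s ∈ E x}
  add_mem' := fun ha hb x hx => (E x).add_mem (ha x hx) (hb x hx)
  zero_mem' := fun x _ => (E x).zero_mem
  smul_mem' := fun c _ hs x hx => const_smul_mem_stalk (E x) c (hs x hx)

theorem secs_inf_secs_not (P : Point K → Prop) (E : Stalks K F) :
    secs P E ⊓ secs (fun x => ¬ P x) E = H0 E := by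
  ext s
  exact ⟨fun h x => (em (P x)).elim (h.1 x) (h.2 x), fun h => ⟨fun x _ => h x, fun x _ => h x⟩⟩

variable [hK : Fact (IsFunctionField K)]

theorem secs_step {P : Point K → Prop} {t : K} (ht : Transcendental ℂ t)
    (hP : ∀ x, P x → t ∈ x.ring) {T E : Stalks K F} (hE : IsVectorBundle E) {x : Point K}
    (hx : P x) (hTE : ∀ y, y ≠ x → E y = T y) {m : F} (hmT : m ∉ T x)
    (hm : ∀ h ∈ x.ring.nonunits, h • m ∈ T x) (hEx : E x = T x ⊔ spanAt x {m}) :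
    ∃ v ∉ secs P T, secs P E = secs P T ⊔ ℂ ∙ v := by
  have hmE : m ∈ E x := hEx ▸ Submodule.mem_sup_right (subset_spanAt _ rfl)
  obtain ⟨β, h1, h2, h3⟩ := hE.exists_smul_mem ht (hP x hx) hmE
  have hβT : β • m ∉ T x := by
    intro h
    apply hmT
    have := smul_mem_stalk _ (Point.inv_mem_of_notMem_nonunits h2) h
    rwa [smul_smul, inv_mul_cancel₀ (fun h0 => h2 (by rw [h0]; exact ZeroMemClass.zero_mem _)),
      one_smul] at this
  refine ⟨β • m, fun h => hβT (h x hx), le_antisymm (fun a ha => ?_) (sup_le ?_ ?_)⟩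
  · obtain ⟨c, hc⟩ := exists_sub_const_smul_mem hm (hEx ▸ ha x hx)
    obtain ⟨d, hd⟩ := exists_sub_const_smul_mem hm (hEx ▸ h3 x (hP x hx))
    have hd0 : d ≠ 0 := by
      rintro rfl
      rw [map_zero, zero_smul, sub_zero] at hd
      exact hβT hd
    have key : a - (c / d) • β • m ∈ secs P T := by
      intro y hy
      by_cases hyx : y = x
      · subst hyx
        have := sub_mem hc (const_smul_mem_stalk _ (c / d) hd)
        rw [algebraMap_smul, algebraMap_smul, smul_sub, smul_smul, div_mul_cancel₀ _ hd0,
          sub_sub_sub_cancel_right] at this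
        exact this
      · rw [← hTE y hyx]
        exact sub_mem (ha y hy) (const_smul_mem_stalk _ _ (h3 y (hP y hy)))
    rw [← sub_add_cancel a ((c / d) • β • m)]
    exact add_mem (Submodule.mem_sup_left key) (Submodule.mem_sup_right
      (Submodule.smul_mem _ _ (Submodule.mem_span_singleton_self _)))
  · intro a ha y hy
    by_cases hyx : y = x
    · subst hyx
      rw [hEx]
      exact Submodule.mem_sup_left (ha y hy)
    · rw [hTE y hyx]; exact ha y hy
  · rw [Submodule.span_singleton_le_iff_mem]
    exact fun y hy => h3 y (hP y hy)

theorem secs_congr {P : Point K → Prop} {T E : Stalks K F} (h : ∀ x, P x → E x = T x) :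
    secs P E = secs P T := by
  ext s
  exact ⟨fun hs x hx => h x hx ▸ hs x hx, fun hs x hx => (h x hx).symm ▸ hs x hx⟩

/-- The pair of spaces of sections over two affine charts. -/
def IsFredholm (t : K) (E : Stalks K F) : Prop :=
  IsFredholmPair (secs (fun x => t ∈ x.ring) E) (secs (fun x => ¬ t ∈ x.ring) E)

/-- The Euler characteristic. -/
def chi (t : K) (E : Stalks K F) : ℤ :=
  pairIndex (secs (fun x => t ∈ x.ring) E) (secs (fun x => ¬ t ∈ x.ring) E)

theorem chi_step {t : K} (ht : Transcendental ℂ t) {T E : Stalks K F} (hE : IsVectorBundle E)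
    {x : Point K} (hTE : ∀ y, y ≠ x → E y = T y) {m : F} (hmT : m ∉ T x)
    (hm : ∀ h ∈ x.ring.nonunits, h • m ∈ T x) (hEx : E x = T x ⊔ spanAt x {m}) :
    (IsFredholm t E ↔ IsFredholm t T) ∧ (IsFredholm t T → chi t E = chi t T + 1) := by
  by_cases hx : t ∈ x.ring
  · obtain ⟨v, hv, h⟩ := secs_step (P := fun x => t ∈ x.ring) ht (fun _ h => h) hE hx hTE hmT hm hEx
    have h' : secs (fun x => ¬ t ∈ x.ring) E = secs (fun x => ¬ t ∈ x.ring) T :=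
      secs_congr fun y hy => hTE y (by rintro rfl; exact hy hx)
    rw [IsFredholm, IsFredholm, chi, chi, h, h']
    exact isFredholmPair_sup_span hv
  · obtain ⟨v, hv, h⟩ := secs_step (P := fun x => ¬ t ∈ x.ring) (transcendental_inv ht)
      (fun x h => x.inv_mem_of_notMem h) hE hx hTE hmT hm hEx
    have h' : secs (fun x => t ∈ x.ring) E = secs (fun x => t ∈ x.ring) T :=
      secs_congr fun y hy => hTE y (by rintro rfl; exact hx hy)
    have key := isFredholmPair_sup_span (N := secs (fun x => t ∈ x.ring) T) hv
    rw [isFredholmPair_comm (_ ⊔ _), isFredholmPair_comm (secs (fun x => ¬ t ∈ x.ring) T),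
      pairIndex_comm (_ ⊔ _), pairIndex_comm (secs (fun x => ¬ t ∈ x.ring) T)] at key
    rw [IsFredholm, IsFredholm, chi, chi, h, h']
    exact key

theorem chi_eq_add_sum {t : K} (ht : Transcendental ℂ t) (s : Finset (Point K)) (n : ℕ)
    {E : Stalks K F} (hE : IsVectorBundle E) : ∀ {T : Stalks K F} (_ : IsVectorBundle T)
    (_ : ∀ x, T x ≤ E x) (_ : ∀ x ∉ s, T x = E x) (_ : ∑ x ∈ s, len (E x) (T x) = n),
    (IsFredholm t E ↔ IsFredholm t T) ∧ (IsFredholm t T → chi t E = chi t T + n) := by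
  classical
  induction n with
  | zero =>
    intro T hT hle hs hn
    have : T = E := by
      funext x
      by_cases hx : x ∈ s
      · exact le_antisymm (hle x) ((len_eq_zero_iff (hE.isLattice x) (hT.isLattice x)).1
          (Finset.sum_eq_zero_iff.1 hn x hx))
      · exact hs x hx
    subst this
    simp
  | succ n ih =>
    intro T hT hle hs hn
    obtain ⟨x, hx, hlen⟩ : ∃ x ∈ s, len (E x) (T x) ≠ 0 := by
      by_contra hcon
      push Not at hcon
      rw [Finset.sum_eq_zero hcon] at hn
      omega
    have hlt : T x < E x := lt_of_le_of_ne (hle x) fun h => hlen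
      ((len_eq_zero_iff (hE.isLattice x) (hT.isLattice x)).2 h.ge)
    obtain ⟨m, hmE, hmT, hm⟩ := exists_step (hT.isLattice x) hlt
    let T' : Stalks K F := Function.update T x (T x ⊔ spanAt x {m})
    have hT'x : T' x = T x ⊔ spanAt x {m} := Function.update_self ..
    have hT'y : ∀ y, y ≠ x → T' y = T y := fun y hy => Function.update_of_ne hy ..
    have hle' : ∀ y, T' y ≤ E y := by
      intro y
      by_cases hyx : y = x
      · subst hyx
        rw [hT'x]
        exact sup_le (hle y) (spanAt_le.2 (Set.singleton_subset_iff.2 hmE))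
      · rw [hT'y y hyx]; exact hle y
    have hTT' : ∀ y, T y ≤ T' y := by
      intro y
      by_cases hyx : y = x
      · subst hyx
        rw [hT'x]
        exact le_sup_left
      · rw [hT'y y hyx]
    have hT' : IsVectorBundle T' := by
      refine hT.of_finite_ne (fun y => (hE.isLattice y).of_le (hle' y) (top_le_iff.1 ?_))
        ((Set.finite_singleton x).subset fun y hy => ?_)
      · rw [← hT.span_eq_top y]
        exact Submodule.span_mono (hTT' y)
      · by_contra hyx
        exact hy (hT'y y hyx)
    have hsum : ∑ y ∈ s, len (E y) (T' y) = n := by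
      have h1 : ∀ y ∈ s, len (E y) (T y) = len (E y) (T' y) + if y = x then 1 else 0 := by
        intro y _
        by_cases hyx : y = x
        · subst hyx
          rw [if_pos rfl, len_add (hE.isLattice y) (hT.isLattice y) (hTT' y) (hle' y)
            (hT'.isLattice y), hT'x, len_sup_spanAt hmT hm, add_comm]
        · rw [if_neg hyx, hT'y y hyx, add_zero]
      rw [Finset.sum_congr rfl h1, Finset.sum_add_distrib, Finset.sum_ite_eq', if_pos hx] at hn
      omega
    have hs' : ∀ y ∉ s, T' y = E y := by
      intro y hy
      rw [hT'y y (by rintro rfl; exact hy hx)]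
      exact hs y hy
    obtain ⟨h1, h2⟩ := ih hT' hle' hs' hsum
    obtain ⟨h3, h4⟩ := chi_step ht hT' hT'y hmT hm hT'x
    refine ⟨h1.trans h3, fun h => ?_⟩
    rw [h2 (h3.2 h), h4 h]
    push_cast
    ring

theorem isFredholm_iff_of_le {t : K} (ht : Transcendental ℂ t) {T E : Stalks K F}
    (hE : IsVectorBundle E) (hT : IsVectorBundle T) (hle : ∀ x, T x ≤ E x) :
    (IsFredholm t E ↔ IsFredholm t T) ∧ (IsFredholm t T →
      chi t E = chi t T + ∑ᶠ x, (len (E x) (T x) : ℤ)) := by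
  have hfin := hE.finite_ne hT
  have hs : ∀ x ∉ hfin.toFinset, T x = E x := fun x hx => by
    simpa [eq_comm] using hx
  obtain ⟨h1, h2⟩ := chi_eq_add_sum ht hfin.toFinset _ hE hT hle hs rfl
  refine ⟨h1, fun h => ?_⟩
  rw [h2 h, finsum_eq_sum_of_support_subset (s := hfin.toFinset)]
  · push_cast; rfl
  · intro x hx
    by_contra hcon
    have := hs x (by simpa using hcon)
    apply hx
    simp only [Nat.cast_eq_zero]
    exact (len_eq_zero_iff (hE.isLattice x) (hT.isLattice x)).2 this.ge

theorem finite_support_len {E E' : Stalks K F} (hE : IsVectorBundle E) (hE' : IsVectorBundle E') :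
    (Function.support fun x => (len (E x) (E' x) : ℤ)).Finite := by
  refine (hE.finite_ne hE').subset fun x hx h => hx ?_
  simp only [Nat.cast_eq_zero]
  exact (len_eq_zero_iff (hE.isLattice x) (hE'.isLattice x)).2 h.le

theorem finite_support_relLength {E E' : Stalks K F} (hE : IsVectorBundle E)
    (hE' : IsVectorBundle E') :
    (Function.support fun x => relLength x (E x) (E' x)).Finite := by
  refine (hE.finite_ne hE').subset fun x hx h => hx ?_
  simp only [h, relLength_self]

theorem isFredholm_iff {t : K} (ht : Transcendental ℂ t) {E E' : Stalks K F}
    (hE : IsVectorBundle E) (hE' : IsVectorBundle E') :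
    (IsFredholm t E ↔ IsFredholm t E') ∧ (IsFredholm t E' →
      chi t E = chi t E' + ∑ᶠ x, relLength x (E x) (E' x)) := by
  have hT := hE.inf hE'
  obtain ⟨h1, h2⟩ := isFredholm_iff_of_le ht hE hT (fun x => inf_le_left)
  obtain ⟨h3, h4⟩ := isFredholm_iff_of_le ht hE' hT (fun x => inf_le_right)
  refine ⟨h1.trans h3.symm, fun h => ?_⟩
  have h5 := h2 (h3.1 h)
  have h6 := h4 (h3.1 h)
  have h7 : ∑ᶠ x, relLength x (E x) (E' x) = ∑ᶠ x, (len (E x) (E x ⊓ E' x) : ℤ) -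
      ∑ᶠ x, (len (E' x) (E x ⊓ E' x) : ℤ) := by
    rw [← finsum_sub_distrib (finite_support_len hE hT) (finite_support_len hE' hT)]
    refine finsum_congr fun x => ?_
    exact relLength_eq_of_le (hT.isLattice x) (hE.isLattice x) (hE'.isLattice x) inf_le_left
      inf_le_right
  rw [h7]
  linarith

end Euler

section Trace

variable {K : Type u} [Field K] [Algebra ℂ K]

theorem Point.inv_mem_nonunits_iff {x : Point K} {t : K} (h0 : t ≠ 0) :
    t⁻¹ ∈ x.ring.nonunits ↔ t ∉ x.ring := by
  rw [ValuationSubring.mem_nonunits_iff_or, inv_inv, or_iff_right (inv_ne_zero h0)]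

theorem transcendental_ne_zero {t : K} (ht : Transcendental ℂ t) : t ≠ 0 := by
  rintro rfl
  exact ht isAlgebraic_zero

theorem aeval_ne_zero {t : K} (ht : Transcendental ℂ t) {p : ℂ[X]} (hp : p ≠ 0) :
    aeval t p ≠ 0 := fun h => ht ⟨p, hp, h⟩

theorem aeval_mem_adjoin (t : K) (p : ℂ[X]) : aeval t p ∈ ℂ⟮t⟯ :=
  (mem_adjoin_simple_iff ℂ _).2 ⟨p, 1, by simp⟩

theorem adjoin_sub_const (t : K) (c : ℂ) : ℂ⟮t - algebraMap ℂ K c⟯ = ℂ⟮t⟯ := by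
  apply le_antisymm <;> rw [adjoin_simple_le_iff]
  · exact sub_mem (mem_adjoin_simple_self ℂ t) (IntermediateField.algebraMap_mem _ c)
  · have := add_mem (mem_adjoin_simple_self ℂ (t - algebraMap ℂ K c))
      (IntermediateField.algebraMap_mem ℂ⟮t - algebraMap ℂ K c⟯ c)
    rwa [sub_add_cancel] at this

theorem adjoin_inv (t : K) : ℂ⟮t⁻¹⟯ = ℂ⟮t⟯ := by
  apply le_antisymm <;> rw [adjoin_simple_le_iff]
  · exact inv_mem (mem_adjoin_simple_self ℂ t)
  · have := inv_mem (mem_adjoin_simple_self ℂ t⁻¹)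
    rwa [inv_inv] at this

/-- The trace to the field of rational functions of `t`, with values in the function field. -/
def trK (t : K) : K →ₗ[ℂ] K :=
  ℂ⟮t⟯.val.toLinearMap.comp ((Algebra.trace ℂ⟮t⟯ K).restrictScalars ℂ)

theorem trK_apply (t z : K) : trK t z = (Algebra.trace ℂ⟮t⟯ K z : K) := rfl

theorem trK_mem (t z : K) : trK t z ∈ ℂ⟮t⟯ := (Algebra.trace ℂ⟮t⟯ K z).2

theorem trK_mul {t c : K} (hc : c ∈ ℂ⟮t⟯) (z : K) : trK t (c * z) = c * trK t z := by
  have : c * z = (⟨c, hc⟩ : ℂ⟮t⟯) • z := rfl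
  rw [trK_apply, this, map_smul]
  rfl

theorem trK_congr {s t : K} (h : ℂ⟮s⟯ = ℂ⟮t⟯) : trK s = trK t := by
  have key : ∀ k₁ k₂ : IntermediateField ℂ K, k₁ = k₂ → ∀ z : K,
      (Algebra.trace k₁ K z : K) = Algebra.trace k₂ K z := by
    rintro k₁ _ rfl z; rfl
  ext z
  exact key _ _ h z

variable [hK : Fact (IsFunctionField K)]

theorem ord_aeval {t : K} {x : Point K} (hx : t ∉ x.ring) {p : ℂ[X]} (hp : p ≠ 0) :
    x.ord (aeval t p) = p.natDegree * x.ord t := by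
  have h0 : t ≠ 0 := by rintro rfl; exact hx x.ring.zero_mem
  have hs := (Point.inv_mem_nonunits_iff h0).2 hx
  letI : Invertible t := invertibleOfNonzero h0
  have h1 := eval₂_reverse_mul_pow (algebraMap ℂ K) t p
  rw [invOf_eq_inv] at h1
  change aeval t⁻¹ p.reverse * t ^ p.natDegree = aeval t p at h1
  have h2 : aeval t⁻¹ p.reverse ∉ x.ring.nonunits := by
    rw [Point.aeval_mem_nonunits_iff hs, coeff_zero_reverse, leadingCoeff_eq_zero]
    exact hp
  have h3 : aeval t⁻¹ p.reverse ∈ x.ring := x.aeval_mem (Point.mem_of_mem_nonunits hs) _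
  have h4 : aeval t⁻¹ p.reverse ≠ 0 := fun h => h2 (by rw [h]; exact ZeroMemClass.zero_mem _)
  rw [x.mem_nonunits_iff_ord h4] at h2
  rw [x.mem_ring_iff_ord h4] at h3
  rw [← h1, x.ord_mul h4 (pow_ne_zero _ h0), ← zpow_natCast, x.ord_zpow]
  have : x.ord (aeval t⁻¹ p.reverse) = 0 := by omega
  rw [this, zero_add]

/-- A rational function of `t` has the same relative order at all poles of `t`. -/
theorem exists_ord_eq_mul {t g : K} (ht : Transcendental ℂ t) (hg : g ∈ ℂ⟮t⟯) (h0 : g ≠ 0) :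
    ∃ d : ℤ, ∀ x : Point K, t ∉ x.ring → x.ord g = d * x.ord t := by
  obtain ⟨p, q, rfl⟩ := (mem_adjoin_simple_iff ℂ _).1 hg
  have hp : p ≠ 0 := by rintro rfl; simp at h0
  have hq : q ≠ 0 := by rintro rfl; simp at h0
  refine ⟨p.natDegree - q.natDegree, fun x hx => ?_⟩
  rw [div_eq_mul_inv, x.ord_mul (aeval_ne_zero ht hp) (inv_ne_zero (aeval_ne_zero ht hq)),
    Point.ord_inv, ord_aeval hx hp, ord_aeval hx hq]
  ring

theorem ord_neg_of_notMem {x : Point K} {t : K} (hx : t ∉ x.ring) : x.ord t < 0 := by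
  have h0 : t ≠ 0 := by rintro rfl; exact hx x.ring.zero_mem
  rw [x.mem_ring_iff_ord h0] at hx
  omega

theorem exists_pow_mul_eq_add {t g : K} (ht : Transcendental ℂ t) (hg : g ∈ ℂ⟮t⟯) (N : ℕ) :
    ∃ (Q : ℂ[X]) (r : K), r ∈ ℂ⟮t⟯ ∧ t ^ N * g = aeval t Q + r ∧
      ∀ x : Point K, t ∉ x.ring → r ∈ x.ring := by
  obtain ⟨p, q, rfl⟩ := (mem_adjoin_simple_iff ℂ _).1 hg
  rcases eq_or_ne q 0 with rfl | hq
  · exact ⟨0, 0, zero_mem _, by simp, fun x _ => x.ring.zero_mem⟩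
  have hq' := aeval_ne_zero ht hq
  refine ⟨X ^ N * p / q, aeval t (X ^ N * p % q) / aeval t q,
    div_mem (aeval_mem_adjoin _ _) (aeval_mem_adjoin _ _), ?_, fun x hx => ?_⟩
  · have h := congrArg (aeval t) (EuclideanDomain.div_add_mod (X ^ N * p) q)
    simp only [map_add, map_mul, map_pow, aeval_X] at h
    field_simp
    rw [h]
  · rcases eq_or_ne (X ^ N * p % q) 0 with h0 | h0
    · rw [h0, map_zero, zero_div]; exact x.ring.zero_mem
    · rw [x.div_mem_ring_iff (aeval_ne_zero ht h0) hq', ord_aeval hx h0, ord_aeval hx hq]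
      have h1 := ord_neg_of_notMem hx
      have h2 : (X ^ N * p % q).natDegree ≤ q.natDegree :=
        natDegree_le_natDegree (le_of_lt (EuclideanDomain.mod_lt _ hq))
      nlinarith [(Nat.cast_le (α := ℤ)).2 h2]

/-- The residue at infinity of a rational function of `t` (extended to the function field). -/
theorem exists_res {t : K} (ht : Transcendental ℂ t) : ∃ res : K →ₗ[ℂ] ℂ,
    (∀ p : ℂ[X], res (aeval t p) = 0) ∧
    (∀ r : K, (∀ x : Point K, t ∉ x.ring → t ^ 2 * r ∈ x.ring) → res r = 0) ∧
    res t⁻¹ = 1 := by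
  have h0 := transcendental_ne_zero ht
  let A : Submodule ℂ K := LinearMap.range (aeval (R := ℂ) t).toLinearMap
  let B : Submodule ℂ K :=
    { carrier := {r | ∀ x : Point K, t ∉ x.ring → t ^ 2 * r ∈ x.ring}
      add_mem' := fun ha hb x hx => by
        rw [mul_add]; exact x.ring.add_mem _ _ (ha x hx) (hb x hx)
      zero_mem' := fun x _ => by rw [mul_zero]; exact x.ring.zero_mem
      smul_mem' := fun c r hr x hx => by
        rw [Algebra.smul_def, mul_left_comm]
        exact x.ring.mul_mem _ _ (x.const_mem c) (hr x hx) }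
  have hnot : t⁻¹ ∉ A ⊔ B := by
    intro h
    obtain ⟨_, ⟨p, rfl⟩, r, hr, h⟩ := Submodule.mem_sup.1 h
    change aeval t p + r = t⁻¹ at h
    obtain ⟨x, hx⟩ := exists_mem_nonunits hK.out (transcendental_inv ht)
    have hx' := (Point.inv_mem_nonunits_iff h0).1 hx
    have hr' : r ∈ x.ring.nonunits := by
      have := Point.mul_mem_nonunits (hr x hx') (Point.mul_mem_nonunits
        (Point.mem_of_mem_nonunits hx) hx)
      have e : t ^ 2 * r * (t⁻¹ * t⁻¹) = r := by field_simp
      rwa [e] at this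
    have hp0 : p = 0 := by
      by_contra hp
      have h1 : aeval t p ∈ x.ring.nonunits := by
        have := sub_mem hx hr'
        rwa [← h, add_sub_cancel_right] at this
      rw [x.mem_nonunits_iff_ord (aeval_ne_zero ht hp), ord_aeval hx' hp] at h1
      have := ord_neg_of_notMem hx'
      nlinarith [(Nat.cast_nonneg p.natDegree : (0 : ℤ) ≤ _)]
    rw [hp0, map_zero, zero_add] at h
    have h2 := hr x hx'
    rw [h] at h2
    apply hx'
    have e : t ^ 2 * t⁻¹ = t := by field_simp
    rwa [e] at h2
  obtain ⟨f, hf, hker⟩ := Submodule.exists_le_ker_of_notMem hnot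
  refine ⟨(f t⁻¹)⁻¹ • f, fun p => ?_, fun r hr => ?_, ?_⟩
  · have : f (aeval t p) = 0 := hker (Submodule.mem_sup_left ⟨p, rfl⟩)
    simp [this]
  · have : f r = 0 := hker (Submodule.mem_sup_right hr)
    simp [this]
  · simp [hf]

theorem zpow_mem_ring_of_nonpos {t : K} {x : Point K} (hx : t ∉ x.ring) {z : ℤ} (hz : z ≤ 0) :
    t ^ z ∈ x.ring := by
  have h0 : t ≠ 0 := by rintro rfl; exact hx x.ring.zero_mem
  rw [x.mem_ring_iff_ord (zpow_ne_zero _ h0), x.ord_zpow]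
  have := ord_neg_of_notMem hx
  nlinarith

theorem res_zpow {t : K} (ht : Transcendental ℂ t) {res : K →ₗ[ℂ] ℂ}
    (h1 : ∀ p : ℂ[X], res (aeval t p) = 0)
    (h2 : ∀ r : K, (∀ x : Point K, t ∉ x.ring → t ^ 2 * r ∈ x.ring) → res r = 0)
    (h3 : res t⁻¹ = 1) (z : ℤ) : res (t ^ z) = if z = -1 then 1 else 0 := by
  have h0 := transcendental_ne_zero ht
  split_ifs with hz
  · rw [hz, zpow_neg_one, h3]
  · rcases le_or_gt 0 z with h | h
    · obtain ⟨n, rfl⟩ := Int.eq_ofNat_of_zero_le h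
      have := h1 (X ^ n)
      simpa using this
    · refine h2 _ fun x hx => ?_
      rw [← zpow_natCast, ← zpow_add₀ h0]
      exact zpow_mem_ring_of_nonpos hx (by push_cast; omega)

theorem exists_trK_eq_aeval {t z : K} (ht : Transcendental ℂ t)
    (hz : ∀ x : Point K, t ∈ x.ring → z • D ℂ K t ∈ canonical K x) :
    ∃ p : ℂ[X], trK t z = aeval t p := by
  refine exists_aeval_eq hK.out ht ⟨_, trK_mem t z⟩ fun x hx => ?_
  change trK t z ∈ x.ring
  rcases eq_or_ne (trK t z) 0 with h0 | h0
  · rw [h0]; exact x.ring.zero_mem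
  obtain ⟨c, hc⟩ := x.exists_const_sub_mem hK.out hx
  set s := t - algebraMap ℂ K c with hs
  have hst : Transcendental ℂ s := transcendental_sub ht c
  have hs0 := transcendental_ne_zero hst
  have hD : D ℂ K s = D ℂ K t := by rw [hs, map_sub, Derivation.map_algebraMap, sub_zero]
  have hsx : ∀ y : Point K, s ∈ y.ring → t ∈ y.ring := fun y hy => by
    have := y.ring.add_mem _ _ hy (y.const_mem c)
    rwa [hs, sub_add_cancel] at this
  have h1 := trace_mem_nonunits_of_forall hK.out hst (s * z) (fun y hy => by
    rw [← smul_D_mem_canonical_iff y hy hs0, hD]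
    exact hz y (hsx y (Point.mem_of_mem_nonunits hy))) x hc
  rw [← trK_apply, trK_mul (mem_adjoin_simple_self ℂ s), trK_congr (adjoin_sub_const t c)] at h1
  have hmem : trK t z ∈ ℂ⟮s⁻¹⟯ := by
    rw [adjoin_inv, hs, adjoin_sub_const]; exact trK_mem t z
  obtain ⟨d, hd⟩ := exists_ord_eq_mul (transcendental_inv hst) hmem h0
  have hsx' : s⁻¹ ∉ x.ring := by
    rw [← Point.inv_mem_nonunits_iff (inv_ne_zero hs0), inv_inv]; exact hc
  have h2 := hd x hsx'
  have h3 := ord_neg_of_notMem hsx'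
  rw [x.mem_nonunits_iff_ord (mul_ne_zero hs0 h0), x.ord_mul hs0 h0] at h1
  rw [x.mem_ring_iff_ord h0]
  rw [x.ord_inv] at h2 h3
  have h4 : 0 < (1 - d) * x.ord s := by linarith
  have h5 : 0 < 1 - d := pos_of_mul_pos_left h4 (by omega)
  rw [h2]
  nlinarith

theorem smul_D_inv {t : K} (h0 : t ≠ 0) (z : K) :
    z • D ℂ K t = (-(t ^ 2 * z)) • D ℂ K t⁻¹ := by
  have h : D ℂ K (t * t⁻¹) = 0 := by rw [mul_inv_cancel₀ h0]; simp
  rw [Derivation.leibniz] at h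
  have h' : D ℂ K t = (-t ^ 2) • D ℂ K t⁻¹ := by
    have : t • (t • D ℂ K t⁻¹ + t⁻¹ • D ℂ K t) = 0 := by rw [h, smul_zero]
    rw [smul_add, smul_smul, smul_smul, mul_inv_cancel₀ h0, one_smul] at this
    rw [neg_smul, pow_two]
    exact eq_neg_of_add_eq_zero_right this
  rw [h', smul_smul]
  congr 1
  ring

theorem pow_two_mul_trK_mem {t z : K} (ht : Transcendental ℂ t)
    (hz : ∀ x : Point K, t ∉ x.ring → z • D ℂ K t ∈ canonical K x) (x : Point K)
    (hx : t ∉ x.ring) : t ^ 2 * trK t z ∈ x.ring := by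
  have h0 := transcendental_ne_zero ht
  rcases eq_or_ne (trK t z) 0 with hg | hg
  · rw [hg, mul_zero]; exact x.ring.zero_mem
  have hx' := (Point.inv_mem_nonunits_iff h0).2 hx
  have h1 := trace_mem_nonunits_of_forall hK.out (transcendental_inv ht) (t * z) (fun y hy => by
    have := hz y ((Point.inv_mem_nonunits_iff h0).1 hy)
    rw [smul_D_inv h0, smul_D_mem_canonical_iff y hy (inv_ne_zero h0)] at this
    have e : t⁻¹ * -(t ^ 2 * z) = -(t * z) := by field_simp
    rw [e] at this
    have := neg_mem this
    rwa [neg_neg] at this) x hx'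
  rw [← trK_apply, trK_congr (adjoin_inv t), trK_mul (mem_adjoin_simple_self ℂ t)] at h1
  obtain ⟨d, hd⟩ := exists_ord_eq_mul ht (trK_mem t z) hg
  have h2 := hd x hx
  have h3 := ord_neg_of_notMem hx
  rw [x.mem_nonunits_iff_ord (mul_ne_zero h0 hg), x.ord_mul h0 hg, h2] at h1
  rw [x.mem_ring_iff_ord (mul_ne_zero (pow_ne_zero 2 h0) hg), x.ord_mul (pow_ne_zero 2 h0) hg,
    ← zpow_natCast, x.ord_zpow, h2]
  have h5 : d + 1 < 0 := by
    by_contra hcon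
    nlinarith
  push_cast
  nlinarith

theorem smul_D_mem_of_trK {t y : K} (ht : Transcendental ℂ t)
    (hy : ∀ b : K, (∀ x : Point K, t ∈ x.ring → b ∈ x.ring) → ∃ p : ℂ[X], trK t (y * b) = aeval t p)
    (x : Point K) (hx : t ∈ x.ring) : y • D ℂ K t ∈ canonical K x := by
  obtain ⟨c, hc⟩ := x.exists_const_sub_mem hK.out hx
  set s := t - algebraMap ℂ K c with hs
  have hst : Transcendental ℂ s := transcendental_sub ht c
  have hD : D ℂ K s = D ℂ K t := by rw [hs, map_sub, Derivation.map_algebraMap, sub_zero]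
  have hsx : ∀ y : Point K, s ∈ y.ring → t ∈ y.ring := fun y hy => by
    have := y.ring.add_mem _ _ hy (y.const_mem c)
    rwa [hs, sub_add_cancel] at this
  rw [← hD, smul_D_mem_canonical_iff x hc (transcendental_ne_zero hst)]
  refine mul_mem_nonunits_of_forall_trace hK.out hst y (fun b hb z hz => ?_) x hc
  obtain ⟨p, hp⟩ := hy b fun w hw => hb w (sub_mem hw (w.const_mem c))
  rw [← trK_apply, trK_congr (adjoin_sub_const t c), hp]
  exact z.aeval_mem (hsx z (Point.mem_of_mem_nonunits hz)) p

theorem smul_D_mem_of_trK_inv {t y : K} (ht : Transcendental ℂ t)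
    (hy : ∀ b : K, (∀ x : Point K, t ∉ x.ring → b ∈ x.ring) →
      ∀ x : Point K, t ∉ x.ring → t ^ 2 * trK t (y * b) ∈ x.ring)
    (x : Point K) (hx : t ∉ x.ring) : y • D ℂ K t ∈ canonical K x := by
  have h0 := transcendental_ne_zero ht
  have hx' := (Point.inv_mem_nonunits_iff h0).2 hx
  rw [smul_D_inv h0, smul_D_mem_canonical_iff x hx' (inv_ne_zero h0)]
  refine mul_mem_nonunits_of_forall_trace hK.out (transcendental_inv ht) _ (fun b hb z hz => ?_) x hx'
  have h1 := hy b (fun w hw => hb w (w.inv_mem_of_notMem hw)) z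
    ((Point.inv_mem_nonunits_iff h0).1 hz)
  have e : -(t ^ 2 * y) * b = (-t ^ 2) * (y * b) := by ring
  rw [← trK_apply, trK_congr (adjoin_inv t), e,
    trK_mul (neg_mem (pow_mem (mem_adjoin_simple_self ℂ t) 2)), neg_mul]
  exact z.ring.neg_mem _ h1

end Trace

section Duality

variable {K : Type u} [Field K] [Algebra ℂ K] {F : Type v} [AddCommGroup F] [Module K F]
  [Module ℂ F] [IsScalarTower ℂ K F]

/-- The space `Hom(E, ω_C)`. -/
def homCanonical (E : Stalks K F) : Submodule ℂ (F →ₗ[K] Ω[K⁄ℂ]) where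
  carrier := {ψ | ∀ x, ∀ a ∈ E x, ψ a ∈ canonical K x}
  add_mem' := fun hf hg x a ha => add_mem (hf x a ha) (hg x a ha)
  zero_mem' := fun x _ _ => (canonical K x).zero_mem
  smul_mem' := fun c _ hf x a ha => const_smul_mem_stalk (canonical K x) c (hf x a ha)

theorem mem_homCanonical {E : Stalks K F} {ψ : F →ₗ[K] Ω[K⁄ℂ]} :
    ψ ∈ homCanonical E ↔ ∀ x, ∀ a ∈ E x, ψ a ∈ canonical K x := Iff.rfl

variable [hK : Fact (IsFunctionField K)]

theorem IsVectorBundle.exists_aeval_smul_mem {E : Stalks K F} (hE : IsVectorBundle E) {t : K}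
    (f : F) : ∃ p : ℂ[X], p ≠ 0 ∧ aeval t p • f ∈ secs (fun x => t ∈ x.ring) E := by
  classical
  have key : ∀ s : Finset (Point K), ∃ p : ℂ[X], p ≠ 0 ∧
      ∀ x ∈ s, t ∈ x.ring → aeval t p • f ∈ E x := by
    intro s
    induction s using Finset.induction_on with
    | empty => exact ⟨1, one_ne_zero, by simp⟩
    | insert y s hy ih =>
      obtain ⟨p, hp, h⟩ := ih
      by_cases hty : t ∈ y.ring
      swap
      · refine ⟨p, hp, fun z hz htz => ?_⟩
        rcases Finset.mem_insert.1 hz with rfl | hz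
        · exact absurd htz hty
        · exact h z hz htz
      obtain ⟨c, hc⟩ := y.exists_const_sub_mem hK.out hty
      obtain ⟨n, hn⟩ := pow_smul_mem (hE.span_eq_top y) hc (aeval t p • f)
      refine ⟨(X - C c) ^ n * p, mul_ne_zero (pow_ne_zero _ (X_sub_C_ne_zero c)) hp,
        fun z hz htz => ?_⟩
      have e : aeval t ((X - C c) ^ n * p) • f =
          (t - algebraMap ℂ K c) ^ n • aeval t p • f := by
        rw [map_mul, mul_smul, map_pow, map_sub, aeval_X, aeval_C]
      rw [e]
      rcases Finset.mem_insert.1 hz with rfl | hz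
      · exact hn n le_rfl
      · exact smul_mem_stalk _ (pow_mem (sub_mem htz (z.const_mem c)) n) (h z hz htz)
  obtain ⟨p, hp, h⟩ := key (hE.finite_notMem f).toFinset
  refine ⟨p, hp, fun x hx => ?_⟩
  by_cases hf : f ∈ E x
  · exact smul_mem_stalk _ (x.aeval_mem hx p) hf
  · exact h x (by simpa using hf) hx

theorem IsVectorBundle.exists_nat_smul_mem {E : Stalks K F} (hE : IsVectorBundle E) {t : K}
    (f : F) : ∃ N : ℕ, ∀ r : K, (∀ x : Point K, t ∉ x.ring → t ^ N * r ∈ x.ring) →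
      r • f ∈ secs (fun x => ¬ t ∈ x.ring) E := by
  choose n hn using fun x => exists_ord_smul_mem (hE.span_eq_top x) f
  refine ⟨(finite_poles hK.out t).toFinset.sup n, fun r hr x hx => ?_⟩
  rcases eq_or_ne r 0 with rfl | h0
  · rw [zero_smul]; exact (E x).zero_mem
  have ht0 : t ≠ 0 := by rintro rfl; exact hx x.ring.zero_mem
  refine hn x r ?_ h0
  have h1 := hr x hx
  rw [x.mem_ring_iff_ord (mul_ne_zero (pow_ne_zero _ ht0) h0), x.ord_mul (pow_ne_zero _ ht0) h0,
    ← zpow_natCast, x.ord_zpow] at h1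
  have h2 := ord_neg_of_notMem hx
  have h3 : n x ≤ (finite_poles hK.out t).toFinset.sup n :=
    Finset.le_sup (f := n) (by simpa using hx)
  zify at h3
  nlinarith

/-- A linear form on the generic fibre that kills the sections over both charts is, along every
`ℂ(t)`-line, a residue. -/
theorem exists_res_mul_eq {E : Stalks K F} (hE : IsVectorBundle E) {t : K}
    (ht : Transcendental ℂ t) {res : K →ₗ[ℂ] ℂ} (h1 : ∀ p : ℂ[X], res (aeval t p) = 0)
    (h2 : ∀ r : K, (∀ x : Point K, t ∉ x.ring → t ^ 2 * r ∈ x.ring) → res r = 0)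
    (h3 : res t⁻¹ = 1) {lam : F →ₗ[ℂ] ℂ}
    (hl0 : ∀ m ∈ secs (fun x => t ∈ x.ring) E, lam m = 0)
    (hl1 : ∀ m ∈ secs (fun x => ¬ t ∈ x.ring) E, lam m = 0) {m : F}
    (hm : m ∈ secs (fun x => t ∈ x.ring) E) :
    ∃ p : ℂ[X], ∀ c ∈ ℂ⟮t⟯, res (c * aeval t p) = lam (c • m) := by
  have h0 := transcendental_ne_zero ht
  obtain ⟨N, hN⟩ := hE.exists_nat_smul_mem (t := t) m
  let a : ℕ → ℂ := fun j => lam (t ^ (-(j : ℤ) - 1) • m)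
  let p : ℂ[X] := ∑ j ∈ Finset.range N, C (a j) * X ^ j
  have hp : aeval t p = ∑ j ∈ Finset.range N, a j • t ^ (j : ℤ) := by
    simp [p, Algebra.smul_def]
  have hz : ∀ z : ℤ, res (t ^ z * aeval t p) = lam (t ^ z • m) := by
    intro z
    rw [hp, Finset.mul_sum, map_sum]
    simp only [mul_smul_comm, map_smul, ← zpow_add₀ h0, res_zpow ht h1 h2 h3]
    rcases le_or_gt 0 z with h | h
    · rw [hl0 _ (fun x hx => smul_mem_stalk _ ?_ (hm x hx))]
      · refine Finset.sum_eq_zero fun j _ => ?_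
        rw [if_neg (by omega), smul_zero]
      · obtain ⟨n, rfl⟩ := Int.eq_ofNat_of_zero_le h
        rw [zpow_natCast]
        exact pow_mem hx n
    · obtain ⟨j, rfl⟩ : ∃ j : ℕ, z = -(j : ℤ) - 1 := ⟨(-z - 1).toNat, by omega⟩
      have e : ∀ i : ℕ, (-(j : ℤ) - 1 + i = -1) ↔ j = i := fun i => by omega
      simp only [e, smul_eq_mul, mul_ite, mul_one, mul_zero]
      rw [Finset.sum_ite_eq]
      split_ifs with hj
      · rfl
      · rw [Finset.mem_range, not_lt] at hj
        refine (hl1 _ (hN _ fun x hx => ?_)).symm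
        rw [← zpow_natCast, ← zpow_add₀ h0]
        exact zpow_mem_ring_of_nonpos hx (by omega)
  have hQ : ∀ (Q : ℂ[X]) (M : ℕ), res (t ^ (-(M : ℤ)) * aeval t Q * aeval t p) =
      lam ((t ^ (-(M : ℤ)) * aeval t Q) • m) := by
    intro Q M
    induction Q using Polynomial.induction_on' with
    | add P Q hP hQ => rw [map_add, mul_add, add_mul, map_add, hP, hQ, add_smul, map_add]
    | monomial n b =>
      have e : t ^ (-(M : ℤ)) * aeval t (monomial n b) = b • t ^ (-(M : ℤ) + n) := by
        rw [aeval_monomial, zpow_add₀ h0, zpow_natCast, Algebra.smul_def]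
        ring
      rw [e, smul_mul_assoc, LinearMap.map_smul, hz, smul_assoc, LinearMap.map_smul]
  refine ⟨p, fun c hc => ?_⟩
  obtain ⟨Q, r, hr, hQr, hrx⟩ := exists_pow_mul_eq_add ht hc (N + 2)
  have hc' : c = t ^ (-((N + 2 : ℕ) : ℤ)) * aeval t Q + t ^ (-((N + 2 : ℕ) : ℤ)) * r := by
    rw [← mul_add, ← hQr, zpow_neg, zpow_natCast, inv_mul_cancel_left₀ (pow_ne_zero _ h0)]
  rw [hc', add_mul, map_add, hQ, add_smul, map_add]
  congr 1
  rw [h2, hl1 _ (hN _ fun x hx => ?_)]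
  · rw [← mul_assoc, ← zpow_natCast, ← zpow_add₀ h0]
    exact x.ring.mul_mem _ _ (zpow_mem_ring_of_nonpos hx (by push_cast; omega)) (hrx x hx)
  · intro x hx
    have e : t ^ 2 * (t ^ (-((N + 2 : ℕ) : ℤ)) * r * aeval t p) =
        r * ∑ j ∈ Finset.range N, a j • t ^ ((j : ℤ) - N) := by
      rw [hp]
      have : ∀ j : ℕ, t ^ ((j : ℤ) - N) = t ^ 2 * t ^ (-((N + 2 : ℕ) : ℤ)) * t ^ (j : ℤ) := by
        intro j
        rw [← zpow_natCast, ← zpow_add₀ h0, ← zpow_add₀ h0]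
        congr 1
        push_cast
        ring
      simp only [this, ← mul_smul_comm, ← Finset.mul_sum]
      ring
    rw [e]
    refine x.ring.mul_mem _ _ (hrx x hx) (sum_mem fun j hj => ?_)
    rw [Algebra.smul_def]
    exact x.ring.mul_mem _ _ (x.const_mem _) (zpow_mem_ring_of_nonpos hx (by
      rw [Finset.mem_range] at hj; omega))

theorem eq_zero_of_forall_res {t : K} {res : K →ₗ[ℂ] ℂ}
    (h3 : res t⁻¹ = 1) {g : K} (hg : g ∈ ℂ⟮t⟯) (h : ∀ c ∈ ℂ⟮t⟯, res (c * g) = 0) : g = 0 := by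
  by_contra h0
  have := h (t⁻¹ * g⁻¹) (mul_mem (inv_mem (mem_adjoin_simple_self ℂ t)) (inv_mem hg))
  rw [inv_mul_cancel_right₀ h0, h3] at this
  exact one_ne_zero this

/-- Every linear form that kills the sections over both charts is given by residues. -/
theorem exists_res_trK_eq {E : Stalks K F} (hE : IsVectorBundle E) {t : K}
    (ht : Transcendental ℂ t) {res : K →ₗ[ℂ] ℂ} (h1 : ∀ p : ℂ[X], res (aeval t p) = 0)
    (h2 : ∀ r : K, (∀ x : Point K, t ∉ x.ring → t ^ 2 * r ∈ x.ring) → res r = 0)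
    (h3 : res t⁻¹ = 1) {lam : F →ₗ[ℂ] ℂ}
    (hl0 : ∀ m ∈ secs (fun x => t ∈ x.ring) E, lam m = 0)
    (hl1 : ∀ m ∈ secs (fun x => ¬ t ∈ x.ring) E, lam m = 0) (f : F) :
    ∃ y : K, ∀ z : K, res (trK t (y * z)) = lam (z • f) := by
  have hφ : ∀ f : F, ∃ g : ℂ⟮t⟯, ∀ c ∈ ℂ⟮t⟯, res (c * g) = lam (c • f) := by
    intro f
    obtain ⟨q, hq, hqf⟩ := hE.exists_aeval_smul_mem (t := t) f
    obtain ⟨p, hp⟩ := exists_res_mul_eq hE ht h1 h2 h3 hl0 hl1 hqf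
    refine ⟨⟨aeval t p / aeval t q, div_mem (aeval_mem_adjoin t p) (aeval_mem_adjoin t q)⟩,
      fun c hc => ?_⟩
    have hq0 := aeval_ne_zero ht hq
    have := hp (c / aeval t q) (div_mem hc (aeval_mem_adjoin t q))
    rw [smul_smul, div_mul_cancel₀ _ hq0] at this
    rw [← this]
    congr 1
    field_simp
  choose φ hφ using hφ
  have huniq : ∀ (f : F) (g : ℂ⟮t⟯), (∀ c ∈ ℂ⟮t⟯, res (c * g) = lam (c • f)) → g = φ f := by
    intro f g hg
    rw [← sub_eq_zero]
    apply Subtype.ext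
    refine eq_zero_of_forall_res h3 (g - φ f).2 fun c hc => ?_
    rw [AddSubgroupClass.coe_sub, mul_sub, map_sub, hg c hc, hφ f c hc, sub_self]
  haveI := hK.out.finiteDimensional ht
  let ℓ : Module.Dual ℂ⟮t⟯ K :=
    { toFun := fun z => φ (z • f)
      map_add' := fun z w => by
        refine (huniq _ _ fun c hc => ?_).symm
        rw [AddMemClass.coe_add, mul_add, map_add, hφ _ c hc, hφ _ c hc, add_smul, smul_add, map_add]
      map_smul' := fun d z => by
        refine (huniq _ _ fun c hc => ?_).symm
        have e : c * ((d * φ (z • f) : ℂ⟮t⟯) : K) = (c * d) * φ (z • f) := by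
          push_cast; ring
        rw [RingHom.id_apply, smul_eq_mul, e, hφ _ _ (mul_mem hc d.2), mul_smul]
        congr 2
        rw [← smul_assoc]
        rfl }
  let y := ((Algebra.traceForm ℂ⟮t⟯ K).toDual (traceForm_nondegenerate ℂ⟮t⟯ K)).symm ℓ
  refine ⟨y, fun z => ?_⟩
  have h : Algebra.trace ℂ⟮t⟯ K (y * z) = φ (z • f) := by
    have := LinearMap.BilinForm.toDual_def (traceForm_nondegenerate ℂ⟮t⟯ K) (m := y) (n := z)
    rw [Algebra.traceForm_apply] at this
    rw [← this]
    simp only [y, LinearEquiv.apply_symm_apply]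
    rfl
  rw [trK_apply, h]
  have := hφ (z • f) 1 (one_mem _)
  rwa [one_mul, one_smul] at this

theorem eq_zero_of_forall_res_trK {t : K} (ht : Transcendental ℂ t) {res : K →ₗ[ℂ] ℂ}
    (h3 : res t⁻¹ = 1) {y : K} (h : ∀ z, res (trK t (y * z)) = 0) : y = 0 := by
  haveI := hK.out.finiteDimensional ht
  have h' : ∀ z, trK t (y * z) = 0 := fun z => by
    refine eq_zero_of_forall_res h3 (trK_mem t _) fun c hc => ?_
    rw [← trK_mul hc, mul_left_comm]
    exact h _
  refine (traceForm_nondegenerate ℂ⟮t⟯ K).1 y fun z => ?_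
  rw [Algebra.traceForm_apply]
  exact Subtype.ext (h' z)

/-- Serre duality. -/
theorem exists_dualityEquiv {E : Stalks K F} (hE : IsVectorBundle E) {t : K}
    (ht : Transcendental ℂ t) : Nonempty (homCanonical E ≃ₗ[ℂ] Submodule.dualAnnihilator
      (secs (fun x => t ∈ x.ring) E ⊔ secs (fun x => ¬ t ∈ x.ring) E)) := by
  have h0 := transcendental_ne_zero ht
  obtain ⟨e, he⟩ := exists_kaehlerEquiv hK.out ht
  obtain ⟨res, h1, h2, h3⟩ := exists_res ht
  have heD : ∀ w : Ω[K⁄ℂ], e w • D ℂ K t = w := fun w => by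
    apply e.injective
    rw [map_smul, he, smul_eq_mul, mul_one]
  let L : (F →ₗ[K] Ω[K⁄ℂ]) →ₗ[ℂ] (F →ₗ[ℂ] ℂ) :=
    { toFun := fun ψ => res.comp ((trK t).comp ((e.toLinearMap.comp ψ).restrictScalars ℂ))
      map_add' := fun a b => by ext f; simp
      map_smul' := fun c a => by
        ext f
        have : e (c • a f) = c • e (a f) := (e.toLinearMap.restrictScalars ℂ).map_smul c _
        simp [this] }
  have hL : ∀ ψ f, L ψ f = res (trK t (e (ψ f))) := fun ψ f => rfl
  let L' : homCanonical E →ₗ[ℂ] Submodule.dualAnnihilator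
      (secs (fun x => t ∈ x.ring) E ⊔ secs (fun x => ¬ t ∈ x.ring) E) :=
    (L.comp (homCanonical E).subtype).codRestrict _ (by
      rintro ⟨ψ, hψ⟩
      rw [Submodule.dualAnnihilator_sup_eq, Submodule.mem_inf, Submodule.mem_dualAnnihilator,
        Submodule.mem_dualAnnihilator]
      refine ⟨fun m hm => ?_, fun m hm => ?_⟩
      · obtain ⟨p, hp⟩ := exists_trK_eq_aeval (z := e (ψ m)) ht fun x hx => by
          rw [heD]; exact hψ x m (hm x hx)
        change res (trK t (e (ψ m))) = 0
        rw [hp, h1]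
      · change res (trK t (e (ψ m))) = 0
        refine h2 _ (pow_two_mul_trK_mem ht fun x hx => ?_)
        rw [heD]; exact hψ x m (hm x hx))
  have hL' : ∀ (ψ : homCanonical E) (f : F),
      (L' ψ : F →ₗ[ℂ] ℂ) f = res (trK t (e ((ψ : F →ₗ[K] Ω[K⁄ℂ]) f))) := fun ψ f => rfl
  refine ⟨LinearEquiv.ofBijective L' ⟨?_, ?_⟩⟩
  · rw [← LinearMap.ker_eq_bot, LinearMap.ker_eq_bot']
    intro ψ hψ
    apply Subtype.ext
    ext f
    apply e.injective
    change e ((ψ : F →ₗ[K] Ω[K⁄ℂ]) f) = e 0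
    rw [map_zero]
    refine eq_zero_of_forall_res_trK ht h3 fun z => ?_
    have := hL' ψ (z • f)
    rw [hψ, LinearMap.map_smul (ψ : F →ₗ[K] Ω[K⁄ℂ]), LinearEquiv.map_smul, smul_eq_mul,
      mul_comm] at this
    exact this.symm
  · rintro ⟨lam, hlam⟩
    rw [Submodule.dualAnnihilator_sup_eq, Submodule.mem_inf, Submodule.mem_dualAnnihilator,
        Submodule.mem_dualAnnihilator] at hlam
    obtain ⟨hl0, hl1⟩ := hlam
    choose y hy using exists_res_trK_eq hE ht h1 h2 h3 hl0 hl1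
    have huniq : ∀ (f : F) (w : K), (∀ z : K, res (trK t (w * z)) = lam (z • f)) → w = y f := by
      intro f w hw
      rw [← sub_eq_zero]
      refine eq_zero_of_forall_res_trK ht h3 fun z => ?_
      rw [sub_mul, map_sub, map_sub, hw, hy, sub_self]
    let ψ : F →ₗ[K] Ω[K⁄ℂ] := e.symm.toLinearMap.comp
      { toFun := y
        map_add' := fun a b => by
          refine (huniq _ _ fun z => ?_).symm
          rw [add_mul, map_add, map_add, hy, hy, smul_add, map_add]
        map_smul' := fun c a => by
          refine (huniq _ _ fun z => ?_).symm
          rw [RingHom.id_apply, smul_eq_mul, mul_comm c, mul_assoc, hy, mul_comm, mul_smul,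
            smul_comm] }
    have hψ : ∀ f, e (ψ f) = y f := fun f => e.apply_symm_apply _
    have hψ' : ∀ f, ψ f = y f • D ℂ K t := fun f => by rw [← hψ, heD]
    have hsmul : ∀ (c : K) f, y (c • f) = c * y f := fun c f => by
      rw [← hψ, map_smul, map_smul, hψ, smul_eq_mul]
    have huniq2 : ∀ (f : F) (g : K), g ∈ ℂ⟮t⟯ → (∀ c ∈ ℂ⟮t⟯, res (c * g) = lam (c • f)) →
        g = trK t (y f) := by
      intro f g hg h
      rw [← sub_eq_zero]
      refine eq_zero_of_forall_res h3 (sub_mem hg (trK_mem t _)) fun c hc => ?_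
      rw [mul_sub, map_sub, h c hc, ← trK_mul hc, mul_comm c, hy, sub_self]
    have hM0 : ∀ m ∈ secs (fun x => t ∈ x.ring) E, ∀ x : Point K, t ∈ x.ring →
        ψ m ∈ canonical K x := by
      intro m hm x hx
      rw [hψ']
      refine smul_D_mem_of_trK ht (fun b hb => ?_) x hx
      obtain ⟨p, hp⟩ := exists_res_mul_eq hE ht h1 h2 h3 hl0 hl1 (m := b • m)
        (fun z hz => smul_mem_stalk _ (hb z hz) (hm z hz))
      refine ⟨p, ?_⟩
      rw [huniq2 (b • m) _ (aeval_mem_adjoin t p) hp, hsmul, mul_comm]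
    have hMinf : ∀ m ∈ secs (fun x => ¬ t ∈ x.ring) E, ∀ x : Point K, t ∉ x.ring →
        ψ m ∈ canonical K x := by
      intro m hm x hx
      rw [hψ']
      refine smul_D_mem_of_trK_inv ht (fun b hb z hz => ?_) x hx
      set g := trK t (y m * b) with hg
      rcases eq_or_ne g 0 with hg0 | hg0
      · rw [hg0, mul_zero]; exact z.ring.zero_mem
      have hgk : g ∈ ℂ⟮t⟯ := trK_mem t _
      obtain ⟨d, hd⟩ := exists_ord_eq_mul ht hgk hg0
      have hd2 : d ≤ -2 := by
        by_contra hcon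
        let c := t⁻¹ * g⁻¹
        have hc : c ∈ ℂ⟮t⟯ := mul_mem (inv_mem (mem_adjoin_simple_self ℂ t)) (inv_mem hgk)
        have hz1 : lam (c • b • m) = 0 := by
          refine hl1 _ fun w hw => smul_mem_stalk _ ?_ (smul_mem_stalk _ (hb w hw) (hm w hw))
          rw [w.mem_ring_iff_ord (mul_ne_zero (inv_ne_zero h0) (inv_ne_zero hg0)),
            w.ord_mul (inv_ne_zero h0) (inv_ne_zero hg0), w.ord_inv, w.ord_inv, hd w hw]
          have := ord_neg_of_notMem hw
          have h5 : -1 ≤ d := by omega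
          nlinarith
        have h6 : c * g = t⁻¹ := inv_mul_cancel_right₀ hg0 _
        have h7 : res (c * g) = lam (c • b • m) := by
          rw [hg, ← trK_mul hc, smul_smul, ← hy]
          congr 2
          ring
        rw [h6, h3, hz1] at h7
        exact one_ne_zero h7
      have h8 := ord_neg_of_notMem hz
      rw [z.mem_ring_iff_ord (mul_ne_zero (pow_ne_zero 2 h0) hg0), z.ord_mul (pow_ne_zero 2 h0) hg0,
        ← zpow_natCast, z.ord_zpow, hd z hz]
      push_cast
      nlinarith
    have hmem : ψ ∈ homCanonical E := by
      intro x a ha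
      have key : ∀ (β : K), β ∉ x.ring.nonunits → ψ (β • a) ∈ canonical K x →
          ψ a ∈ canonical K x := by
        intro β hβ h
        have hβ0 : β ≠ 0 := fun h0 => hβ (by rw [h0]; exact ZeroMemClass.zero_mem _)
        have := smul_mem_stalk _ (Point.inv_mem_of_notMem_nonunits hβ) h
        rwa [map_smul, smul_smul, inv_mul_cancel₀ hβ0, one_smul] at this
      by_cases hx : t ∈ x.ring
      · obtain ⟨β, -, hβ, h⟩ := hE.exists_smul_mem ht hx ha
        exact key β hβ (hM0 _ h x hx)
      · obtain ⟨β, -, hβ, h⟩ := hE.exists_smul_mem (transcendental_inv ht)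
          (x.inv_mem_of_notMem hx) ha
        exact key β hβ (hMinf _ (fun z hz => h z (z.inv_mem_of_notMem hz)) x hx)
    refine ⟨⟨ψ, hmem⟩, ?_⟩
    apply Subtype.ext
    ext f
    rw [hL']
    change res (trK t (e (ψ f))) = lam f
    rw [hψ]
    have := hy f 1
    rwa [mul_one, one_smul] at this

end Duality

section RiemannRoch

variable {K : Type u} [Field K] [Algebra ℂ K] {F : Type v} [AddCommGroup F] [Module K F]
  {F' : Type w} [AddCommGroup F'] [Module K F'] [hK : Fact (IsFunctionField K)]

/-! ### Isomorphisms -/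

/-- The inverse image of a bundle under a linear map of generic fibres. -/
def pullback (e : F →ₗ[K] F') (E : Stalks K F') : Stalks K F :=
  fun x => (E x).comap (e.restrictScalars x.O)

theorem IsLattice.congr (e : F ≃ₗ[K] F') {x : Point K} {M : Submodule x.O F}
    {M' : Submodule x.O F'} (h : ∀ a, e a ∈ M' ↔ a ∈ M) (hM : IsLattice M') : IsLattice M := by
  have h1 : M = M'.map (e.symm.toLinearMap.restrictScalars x.O) := by
    ext a
    constructor
    · intro ha
      exact ⟨e a, (h a).2 ha, e.symm_apply_apply a⟩
    · rintro ⟨b, hb, rfl⟩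
      exact (h _).1 ((e.apply_symm_apply b).symm ▸ hb)
  have h2 : (M : Set F) = e.symm.toLinearMap '' (M' : Set F') := by rw [h1]; rfl
  refine ⟨h1 ▸ hM.fg.map _, ?_⟩
  rw [h2, ← Submodule.map_span, hM.span_eq_top, Submodule.map_top, LinearEquiv.range]

theorem mem_freeBundle {ι : Type*} (b : Module.Basis ι K F) {x : Point K} {a : F} :
    a ∈ freeBundle (K := K) b x ↔ ∀ i, b.repr a i ∈ x.ring := mem_spanAt_basis b

theorem IsVectorBundle.congr {E : Stalks K F} {E' : Stalks K F'} (i : BundleIso E E')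
    (hE' : IsVectorBundle E') : IsVectorBundle E := by
  obtain ⟨b, hb⟩ := hE'.exists_basis
  refine .of_basis (b.map i.equiv.symm)
    (fun x => (hE'.isLattice x).congr i.equiv (i.mem_iff x)) (hb.subset fun x hx h => hx ?_)
  ext a
  rw [← i.mem_iff, h, mem_freeBundle, mem_freeBundle]
  simp

/-- The inverse of an isomorphism of bundles. -/
def BundleIso.symm {E : Stalks K F} {E' : Stalks K F'} (i : BundleIso E E') : BundleIso E' E where
  equiv := i.equiv.symm
  mem_iff x a := by rw [← i.mem_iff, i.equiv.apply_symm_apply]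

/-! ### The free bundle -/

variable [Module ℂ F] [IsScalarTower ℂ K F] [Module ℂ F'] [IsScalarTower ℂ K F']

theorem exists_H0_freeBundle_equiv {ι : Type*} [Finite ι] (b : Module.Basis ι K F) :
    Nonempty (H0 (freeBundle (K := K) b) ≃ₗ[ℂ] (ι → ℂ)) := by
  haveI := Fintype.ofFinite ι
  let f : (ι → ℂ) →ₗ[ℂ] F := Fintype.linearCombination ℂ b
  have hf : ∀ c, f c = ∑ i, algebraMap ℂ K (c i) • b i := fun c => by
    simp [f, Fintype.linearCombination_apply]
  have hrange : LinearMap.range f = H0 (freeBundle (K := K) b) := by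
    ext s
    constructor
    · rintro ⟨c, rfl⟩ x
      rw [hf]
      exact sum_mem fun i _ => smul_mem_stalk _ (x.const_mem _) (subset_spanAt _ ⟨i, rfl⟩)
    · intro hs
      have := fun i => exists_const_of_forall_mem hK.out (b.repr s i)
        fun x => (mem_freeBundle b).1 (hs x) i
      choose c hc using this
      refine ⟨c, ?_⟩
      rw [hf, ← b.sum_repr s]
      simp [hc]
  have hinj : Function.Injective f := by
    rw [← LinearMap.ker_eq_bot, LinearMap.ker_eq_bot']
    intro c hc
    rw [hf] at hc
    funext i
    have := Fintype.linearIndependent_iff.1 b.linearIndependent _ hc i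
    simpa using this
  exact ⟨((LinearEquiv.ofInjective f hinj).trans (LinearEquiv.ofEq _ _ hrange)).symm⟩

theorem exists_homCanonical_freeBundle_equiv {ι : Type*} [Finite ι] (b : Module.Basis ι K F) :
    Nonempty (homCanonical (freeBundle (K := K) b) ≃ₗ[ℂ] (ι → H0 (canonical K))) := by
  haveI := Fintype.ofFinite ι
  let f : homCanonical (freeBundle (K := K) b) →ₗ[ℂ] (ι → H0 (canonical K)) :=
    LinearMap.pi fun i =>
      { toFun := fun ψ => ⟨(ψ : F →ₗ[K] Ω[K⁄ℂ]) (b i), fun x => ψ.2 x _ (subset_spanAt _ ⟨i, rfl⟩)⟩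
        map_add' := fun _ _ => rfl
        map_smul' := fun _ _ => rfl }
  have hf : ∀ ψ i, ((f ψ i : H0 (canonical K)) : Ω[K⁄ℂ]) = (ψ : F →ₗ[K] Ω[K⁄ℂ]) (b i) :=
    fun ψ i => rfl
  refine ⟨LinearEquiv.ofBijective f ⟨?_, ?_⟩⟩
  · intro ψ φ h
    apply Subtype.ext
    refine b.ext fun i => ?_
    rw [← hf, ← hf, h]
  · intro w
    refine ⟨⟨b.constr K fun i => (w i : Ω[K⁄ℂ]), fun x a ha => ?_⟩, ?_⟩
    · rw [Module.Basis.constr_apply_fintype]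
      exact sum_mem fun i _ => smul_mem_stalk _ ((mem_freeBundle b).1 ha i) ((w i).2 x)
    · funext i
      apply Subtype.ext
      rw [hf]
      exact b.constr_basis K _ i

theorem finrank_quotient_secs {E : Stalks K F} (hE : IsVectorBundle E) {t : K}
    (ht : Transcendental ℂ t) :
    Module.finrank ℂ (F ⧸ (secs (fun x => t ∈ x.ring) E ⊔ secs (fun x => ¬ t ∈ x.ring) E)) =
      Module.finrank ℂ (homCanonical E) := by
  obtain ⟨e⟩ := exists_dualityEquiv hE ht
  rw [e.finrank_eq, ← (Submodule.dualQuotEquivDualAnnihilator _).finrank_eq,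
    Subspace.dual_finrank_eq]

theorem finite_quotient_secs_iff {E : Stalks K F} (hE : IsVectorBundle E) {t : K}
    (ht : Transcendental ℂ t) :
    FiniteDimensional ℂ
      (F ⧸ (secs (fun x => t ∈ x.ring) E ⊔ secs (fun x => ¬ t ∈ x.ring) E)) ↔
      FiniteDimensional ℂ (homCanonical E) := by
  obtain ⟨e⟩ := exists_dualityEquiv hE ht
  have e' := e.trans (Submodule.dualQuotEquivDualAnnihilator _).symm
  refine (Module.finite_dual_iff ℂ).symm.trans ?_
  exact ⟨fun h => e'.symm.finiteDimensional, fun h => e'.finiteDimensional⟩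

variable [hg : FiniteDimensional ℂ (H0 (canonical K))]

theorem isFredholm_freeBundle {ι : Type*} [Finite ι] (b : Module.Basis ι K F) {t : K}
    (ht : Transcendental ℂ t) : IsFredholm t (freeBundle (K := K) b) := by
  obtain ⟨e⟩ := exists_H0_freeBundle_equiv b
  obtain ⟨e'⟩ := exists_homCanonical_freeBundle_equiv b
  refine ⟨?_, (finite_quotient_secs_iff (isVectorBundle_freeBundle b) ht).2
    e'.symm.finiteDimensional⟩
  rw [secs_inf_secs_not]
  exact e.symm.finiteDimensional

theorem IsVectorBundle.isFredholm {E : Stalks K F} (hE : IsVectorBundle E) {t : K}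
    (ht : Transcendental ℂ t) : IsFredholm t E := by
  haveI := hE.finite
  exact (isFredholm_iff ht hE (isVectorBundle_freeBundle (Module.finBasis K F))).1.2
    (isFredholm_freeBundle _ ht)

theorem IsVectorBundle.finiteDimensional_H0 {E : Stalks K F} (hE : IsVectorBundle E) :
    FiniteDimensional ℂ (H0 E) := by
  obtain ⟨t, ht⟩ := hK.out.exists_transcendental
  have := (hE.isFredholm ht).1
  rwa [secs_inf_secs_not] at this

theorem IsVectorBundle.chi_eq {E : Stalks K F} (hE : IsVectorBundle E) {t : K}
    (ht : Transcendental ℂ t) :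
    chi t E = Module.finrank ℂ (H0 E) - Module.finrank ℂ (homCanonical E) := by
  rw [chi, pairIndex, secs_inf_secs_not, finrank_quotient_secs hE ht]

theorem chi_freeBundle {ι : Type*} [Finite ι] (b : Module.Basis ι K F) {t : K}
    (ht : Transcendental ℂ t) :
    chi t (freeBundle (K := K) b) = Module.finrank K F * (1 - genus K) := by
  haveI := Fintype.ofFinite ι
  obtain ⟨e⟩ := exists_H0_freeBundle_equiv b
  obtain ⟨e'⟩ := exists_homCanonical_freeBundle_equiv b
  rw [(isVectorBundle_freeBundle b).chi_eq ht, e.finrank_eq, e'.finrank_eq,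
    Module.finrank_pi, Module.finrank_pi_fintype, Module.finrank_eq_card_basis b]
  simp only [Finset.sum_const, Finset.card_univ, smul_eq_mul, Nat.cast_mul, genus]
  ring

theorem finsum_relLength {E E' : Stalks K F} (hE : IsVectorBundle E) (hE' : IsVectorBundle E')
    {t : K} (ht : Transcendental ℂ t) :
    ∑ᶠ x, relLength x (E x) (E' x) = chi t E - chi t E' := by
  rw [(isFredholm_iff ht hE hE').2 (hE'.isFredholm ht)]
  ring

theorem IsVectorBundle.degree_eq_chi {E : Stalks K F} (hE : IsVectorBundle E) {t : K}
    (ht : Transcendental ℂ t) : degree E = chi t E - Module.finrank K F * (1 - genus K) := by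
  haveI := hE.finite
  haveI := Module.Finite.finite_basis (Module.Basis.ofVectorSpace K F)
  rw [← chi_freeBundle (Module.Basis.ofVectorSpace K F) ht,
    ← finsum_relLength hE (isVectorBundle_freeBundle _) ht]
  rfl

/-- The Riemann–Roch theorem. -/
theorem IsVectorBundle.riemannRoch {E : Stalks K F} (hE : IsVectorBundle E) :
    (Module.finrank ℂ (H0 E) : ℤ) - Module.finrank ℂ (homCanonical E) =
      degree E + Module.finrank K F * (1 - genus K) := by
  obtain ⟨t, ht⟩ := hK.out.exists_transcendental
  rw [hE.degree_eq_chi ht, hE.chi_eq ht]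
  ring

theorem degree_sub_degree {E E' : Stalks K F} (hE : IsVectorBundle E) (hE' : IsVectorBundle E') :
    degree E - degree E' = ∑ᶠ x, relLength x (E x) (E' x) := by
  obtain ⟨t, ht⟩ := hK.out.exists_transcendental
  rw [finsum_relLength hE hE' ht, hE.degree_eq_chi ht, hE'.degree_eq_chi ht]
  ring

theorem degree_freeBundle {ι : Type*} [Finite ι] (b : Module.Basis ι K F) :
    degree (freeBundle (K := K) b) = 0 := by
  obtain ⟨t, ht⟩ := hK.out.exists_transcendental
  rw [(isVectorBundle_freeBundle b).degree_eq_chi ht, chi_freeBundle b ht, sub_self]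

theorem IsVectorBundle.degree_eq_finsum {E : Stalks K F} (hE : IsVectorBundle E) {ι : Type*}
    [Finite ι] (b : Module.Basis ι K F) :
    degree E = ∑ᶠ x, relLength x (E x) (freeBundle (K := K) b x) := by
  rw [← degree_sub_degree hE (isVectorBundle_freeBundle b), degree_freeBundle, sub_zero]

theorem degree_congr {E : Stalks K F} {E' : Stalks K F'} (i : BundleIso E E')
    (hE' : IsVectorBundle E') : degree E = degree E' := by
  have hE := hE'.congr i
  haveI := hE'.finite
  let b := Module.finBasis K F'
  rw [hE.degree_eq_finsum (b.map i.equiv.symm), hE'.degree_eq_finsum b]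
  refine finsum_congr fun x => relLength_congr i.equiv (i.mem_iff x) fun a => ?_
  rw [mem_freeBundle, mem_freeBundle]
  simp

theorem degree_mono {T E : Stalks K F} (hT : IsVectorBundle T) (hE : IsVectorBundle E)
    (hle : ∀ x, T x ≤ E x) : degree T ≤ degree E ∧ (degree T = degree E → T = E) := by
  have h1 := degree_sub_degree hE hT
  have h2 : ∀ x, relLength x (E x) (T x) = len (E x) (T x) := fun x => by
    rw [relLength_eq_len, (len_eq_zero_iff (hT.isLattice x) (hE.isLattice x)).2 (hle x)]
    simp
  have h3 : (Function.support fun x => relLength x (E x) (T x)).Finite :=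
    finite_support_relLength hE hT
  rw [finsum_eq_sum_of_support_subset _ (s := h3.toFinset) (by simp)] at h1
  constructor
  · have : 0 ≤ ∑ x ∈ h3.toFinset, relLength x (E x) (T x) :=
      Finset.sum_nonneg fun x _ => by rw [h2]; positivity
    linarith
  · intro h
    rw [h, sub_self, eq_comm, Finset.sum_eq_zero_iff_of_nonneg
      (fun x _ => by rw [h2]; positivity)] at h1
    funext x
    refine le_antisymm (hle x) ((len_eq_zero_iff (hE.isLattice x) (hT.isLattice x)).1 ?_)
    have h4 : relLength x (E x) (T x) = 0 := by
      by_contra hcon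
      exact hcon (h1 x (by simpa using hcon))
    rw [h2] at h4
    exact_mod_cast h4

theorem degree_sub_add_degree_quot {E : Stalks K F} (hE : IsVectorBundle E) (W : Submodule K F) :
    degree (sub E W) + degree (quot E W) = degree E := by
  haveI := hE.finite
  let b := Module.finBasis K W
  let b' := Module.finBasis K (F ⧸ W)
  have hΛ := isVectorBundle_freeBundle (K := K) (Module.Basis.sumQuot b b')
  rw [(hE.sub W).degree_eq_finsum b, (hE.quot W).degree_eq_finsum b',
    hE.degree_eq_finsum (Module.Basis.sumQuot b b'),
    ← finsum_add_distrib (finite_support_relLength (hE.sub W) (isVectorBundle_freeBundle b))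
      (finite_support_relLength (hE.quot W) (isVectorBundle_freeBundle b'))]
  refine finsum_congr fun x => ?_
  rw [relLength_eq_sub_add_quot W (hE.isLattice x) (hΛ.isLattice x), subAt_freeBundle,
    quotAt_freeBundle]
  rfl

theorem finrank_H0_le_sub_add_quot {E : Stalks K F} (hE : IsVectorBundle E) (W : Submodule K F) :
    Module.finrank ℂ (H0 E) ≤ Module.finrank ℂ (H0 (sub E W)) +
      Module.finrank ℂ (H0 (quot E W)) := by
  haveI := hE.finiteDimensional_H0
  haveI := (hE.sub W).finiteDimensional_H0
  haveI := (hE.quot W).finiteDimensional_H0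
  let f : H0 E →ₗ[ℂ] H0 (quot E W) :=
    ((W.mkQ.restrictScalars ℂ).comp (H0 E).subtype).codRestrict _ fun s x => ⟨s, s.2 x, rfl⟩
  let g : LinearMap.ker f →ₗ[ℂ] H0 (sub E W) :=
    { toFun := fun s => ⟨⟨s.1.1, by
        have h : W.mkQ (s.1.1 : F) = 0 := congrArg Subtype.val (LinearMap.mem_ker.1 s.2)
        exact (Submodule.Quotient.mk_eq_zero W).1 h⟩, fun x => s.1.2 x⟩
      map_add' := fun _ _ => rfl
      map_smul' := fun _ _ => rfl }
  have hg' : Function.Injective g := fun a b h =>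
    Subtype.ext (Subtype.ext (congrArg (fun z : H0 (sub E W) => ((z : W) : F)) h))
  have h1 := LinearMap.finrank_range_add_finrank_ker f
  have h2 := LinearMap.finrank_le_finrank_of_injective hg'
  have h3 := Submodule.finrank_le (LinearMap.range f)
  omega

/-- The degree of a line bundle is the degree of the divisor of a rational section. -/
theorem degree_eq_finsum_ord {L : Stalks K F} (hL : IsVectorBundle L)
    (hF : Module.finrank K F = 1) {f : F} (hf : f ≠ 0) (g : Point K → K) (hg : ∀ x, g x ≠ 0)
    (h : ∀ x, L x = spanAt x {g x • f}) : degree L = - ∑ᶠ x : Point K, x.ord (g x) := by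
  let b : Module.Basis Unit K F := Module.basisUnique Unit hF
  obtain ⟨e, he0, he⟩ : ∃ e : F, e ≠ 0 ∧ ∀ i, b i = e := ⟨b (), b.ne_zero (), fun _ => rfl⟩
  obtain ⟨c, hc⟩ := (finrank_eq_one_iff_of_nonzero' f hf).1 hF e
  have hc0 : c ≠ 0 := by rintro rfl; exact he0 (by rw [← hc, zero_smul])
  let b' : Module.Basis Unit K F := b.isUnitSMul (w := fun _ => c⁻¹) fun _ =>
    (inv_ne_zero hc0).isUnit
  have hb' : Set.range b' = {f} := by
    have : ∀ i, b' i = f := fun i => by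
      rw [Module.Basis.isUnitSMul_apply, he, ← hc, smul_smul, inv_mul_cancel₀ hc0, one_smul]
    ext z
    simp [this, eq_comm]
  rw [hL.degree_eq_finsum b', ← finsum_neg_distrib]
  refine finsum_congr fun x => ?_
  rw [h, freeBundle, hb', relLength_singleton hf hF (hg x)]

theorem finsum_ord_eq_zero {g : K} (hg : g ≠ 0) : ∑ᶠ x : Point K, x.ord g = 0 := by
  let b : Module.Basis Unit K K := Module.Basis.singleton Unit K
  have h1 := degree_freeBundle (b.isUnitSMul (w := fun _ => g) fun _ => hg.isUnit)
  rw [degree_eq_finsum_ord (isVectorBundle_freeBundle _) (Module.finrank_self K) (one_ne_zero)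
    (fun _ => g) (fun _ => hg) (fun x => ?_)] at h1
  · linarith
  · rw [freeBundle]
    congr 1
    ext z
    simp [Module.Basis.isUnitSMul_apply, b, eq_comm]

end RiemannRoch

section Divisors

variable {K : Type u} [Field K] [Algebra ℂ K] {F : Type v} [AddCommGroup F] [Module K F]

/-- The subsheaf of the constant sheaf `K` generated by `κ x` at the point `x`. -/
def lb (κ : Point K → K) : Stalks K K := fun x => spanAt x {κ x}

variable [hK : Fact (IsFunctionField K)]

/-- Local equations of a divisor: `lb κ` is the line bundle of the divisor `-∑ ord_x(κ x) x`. -/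
structure IsDiv (κ : Point K → K) : Prop where
  ne_zero : ∀ x, κ x ≠ 0
  finite : {x : Point K | x.ord (κ x) ≠ 0}.Finite

variable {κ μ ν : Point K → K}

theorem mem_lb (hκ : IsDiv κ) {x : Point K} {a : K} : a ∈ lb κ x ↔ a / κ x ∈ x.ring := by
  rw [lb, mem_spanAt_singleton]
  constructor
  · rintro ⟨g, hg, rfl⟩
    rwa [smul_eq_mul, mul_div_cancel_right₀ _ (hκ.ne_zero x)]
  · exact fun h => ⟨_, h, by rw [smul_eq_mul, div_mul_cancel₀ _ (hκ.ne_zero x)]⟩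

theorem mem_lb_iff_ord (hκ : IsDiv κ) {x : Point K} {a : K} (ha : a ≠ 0) :
    a ∈ lb κ x ↔ x.ord (κ x) ≤ x.ord a := by
  rw [mem_lb hκ, x.div_mem_ring_iff ha (hκ.ne_zero x)]

theorem IsDiv.mul (hκ : IsDiv κ) (hμ : IsDiv μ) : IsDiv (κ * μ) where
  ne_zero x := mul_ne_zero (hκ.ne_zero x) (hμ.ne_zero x)
  finite := (hκ.finite.union hμ.finite).subset fun x hx => by
    by_contra hcon
    simp only [Set.mem_union, Set.mem_ofPred_eq, not_or, not_not] at hcon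
    apply hx
    rw [Pi.mul_apply, x.ord_mul (hκ.ne_zero x) (hμ.ne_zero x), hcon.1, hcon.2, add_zero]

theorem IsDiv.inv (hκ : IsDiv κ) : IsDiv κ⁻¹ where
  ne_zero x := inv_ne_zero (hκ.ne_zero x)
  finite := hκ.finite.subset fun x hx => by
    simpa using hx

theorem IsDiv.div (hκ : IsDiv κ) (hμ : IsDiv μ) : IsDiv (κ / μ) := by
  rw [div_eq_mul_inv]; exact hκ.mul hμ.inv

theorem finite_ord_ne_zero {g : K} (hg : g ≠ 0) : {x : Point K | x.ord g ≠ 0}.Finite := by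
  refine ((finite_poles hK.out g).union (finite_zeros hK.out hg)).subset fun x hx => ?_
  by_contra hcon
  simp only [Set.mem_union, Set.mem_ofPred_eq, not_or, not_not] at hcon
  rw [x.mem_ring_iff_ord hg, x.mem_nonunits_iff_ord hg] at hcon
  apply hx
  omega

theorem isDiv_const {g : K} (hg : g ≠ 0) : IsDiv (fun _ : Point K => g) :=
  ⟨fun _ => hg, finite_ord_ne_zero hg⟩

theorem spanAt_singleton_eq_of_ord {x : Point K} {a b : K} (ha : a ≠ 0) (hb : b ≠ 0)
    (h : x.ord a = x.ord b) (f : F) : spanAt x {a • f} = spanAt x {b • f} := by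
  apply le_antisymm <;> rw [spanAt_le, Set.singleton_subset_iff] <;> apply mem_spanAt_singleton.2
  · exact ⟨a / b, (x.div_mem_ring_iff ha hb).2 h.ge, by rw [smul_smul, div_mul_cancel₀ _ hb]⟩
  · exact ⟨b / a, (x.div_mem_ring_iff hb ha).2 h.le, by rw [smul_smul, div_mul_cancel₀ _ ha]⟩

theorem lb_apply_eq_of_ord {x : Point K} (hκ : κ x ≠ 0) (hμ : μ x ≠ 0)
    (h : x.ord (κ x) = x.ord (μ x)) : lb κ x = lb μ x := by
  have := spanAt_singleton_eq_of_ord hκ hμ h (1 : K)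
  simpa [lb] using this

theorem IsDiv.isVectorBundle (hκ : IsDiv κ) : IsVectorBundle (lb κ) := by
  refine .of_basis (Module.Basis.singleton Unit K)
    (fun x => isLattice_singleton (Module.finrank_self K) (hκ.ne_zero x))
    (hκ.finite.subset fun x hx h => hx ?_)
  have : Set.range (Module.Basis.singleton Unit K) = {(1 : K)} := by
    ext z
    simp
  rw [freeBundle, this]
  have := lb_apply_eq_of_ord (κ := κ) (μ := 1) (x := x) (hκ.ne_zero x) one_ne_zero (by simpa using h)
  simpa [lb] using this

/-- A line bundle with a nonzero rational section is the line bundle of a divisor. -/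
theorem IsVectorBundle.exists_isDiv {L : Stalks K F} (hL : IsVectorBundle L)
    (hF : Module.finrank K F = 1) {f : F} (hf : f ≠ 0) :
    ∃ κ : Point K → K, IsDiv κ ∧ (∀ x, L x = spanAt x {κ x • f}) ∧
      ∀ x a, a • f ∈ L x ↔ a ∈ lb κ x := by
  have h1 : ∀ x, ∃ g : K, g ≠ 0 ∧ L x = spanAt x {g • f} := by
    intro x
    obtain ⟨e, he0, he⟩ := (hL.isLattice x).exists_eq_spanAt_singleton hF
    obtain ⟨g, rfl⟩ := (finrank_eq_one_iff_of_nonzero' f hf).1 hF e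
    exact ⟨g, left_ne_zero_of_smul he0, he⟩
  choose κ hκ0 hκ using h1
  have h2 : ∀ x a, a • f ∈ L x ↔ a ∈ lb κ x := by
    intro x a
    rw [hκ, lb, mem_spanAt_singleton, mem_spanAt_singleton]
    refine exists_congr fun g => and_congr_right fun _ => ?_
    rw [smul_smul]
    exact ⟨fun h => smul_left_injective K hf h, fun h => by rw [h, smul_eq_mul]⟩
  refine ⟨κ, ⟨hκ0, ?_⟩, hκ, h2⟩
  let b : Module.Basis Unit K F := Module.Basis.mk (v := fun _ => f)
    (LinearIndependent.of_subsingleton () hf)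
    (by
      rw [Set.range_const, (finrank_eq_one_iff_of_nonzero f hf).1 hF])
  refine (hL.finite_ne_basis b).subset fun x hx h => hx ?_
  have hb : Set.range b = {f} := by
    ext z; simp [b]
  rw [hκ, freeBundle, hb] at h
  have h3 : κ x • f ∈ spanAt x {f} := h ▸ subset_spanAt _ rfl
  have h4 : f ∈ spanAt x {κ x • f} := h.symm ▸ subset_spanAt _ rfl
  obtain ⟨g, hg, h3⟩ := mem_spanAt_singleton.1 h3
  obtain ⟨g', hg', h4⟩ := mem_spanAt_singleton.1 h4
  have h3 : κ x = g := smul_left_injective K hf h3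
  rw [smul_smul] at h4
  have h4 : 1 = g' * κ x := smul_left_injective K hf (show (1 : K) • f = _ by rw [one_smul]; exact h4)
  have hg0 : g' ≠ 0 := by rintro rfl; simp at h4
  rw [← h3, x.mem_ring_iff_ord (hκ0 x)] at hg
  rw [x.mem_ring_iff_ord hg0] at hg'
  have h5 := x.ord_mul hg0 (hκ0 x)
  rw [← h4, x.ord_one] at h5
  omega

theorem mul_mem_lb {a b : K} {x : Point K} (ha : a ∈ lb κ x) (hb : b ∈ lb μ x) :
    a * b ∈ lb (κ * μ) x := by
  rw [lb, mem_spanAt_singleton] at *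
  obtain ⟨g, hg, rfl⟩ := ha
  obtain ⟨h, hh, rfl⟩ := hb
  exact ⟨g * h, x.ring.mul_mem _ _ hg hh, by simp only [smul_eq_mul, Pi.mul_apply]; ring⟩

theorem mem_lb_self (κ : Point K → K) (x : Point K) : κ x ∈ lb κ x := subset_spanAt _ rfl

/-- The local equations of the divisor `x`. -/
def pt (x : Point K) : Point K → K :=
  open Classical in fun y => if y = x then (Classical.choose x.exists_ord_eq_one)⁻¹ else 1

theorem pt_ne_zero (x y : Point K) : pt x y ≠ 0 := by
  unfold pt
  split_ifs
  · exact inv_ne_zero (Classical.choose_spec x.exists_ord_eq_one).1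
  · exact one_ne_zero

theorem ord_pt_self (x : Point K) : x.ord (pt x x) = -1 := by
  unfold pt
  rw [if_pos rfl, Point.ord_inv, (Classical.choose_spec x.exists_ord_eq_one).2]

theorem ord_pt_of_ne {x y : Point K} (h : y ≠ x) : y.ord (pt x y) = 0 := by
  unfold pt
  rw [if_neg h, Point.ord_one]

theorem isDiv_pt (x : Point K) : IsDiv (pt x) :=
  ⟨pt_ne_zero x, (Set.finite_singleton x).subset fun y hy => by
    by_contra hcon
    exact hy (ord_pt_of_ne hcon)⟩

/-! ### Degrees -/

variable [hg : FiniteDimensional ℂ (H0 (canonical K))]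

theorem degree_lb (hκ : IsDiv κ) : degree (lb κ) = - ∑ᶠ x : Point K, x.ord (κ x) :=
  degree_eq_finsum_ord hκ.isVectorBundle (Module.finrank_self K) one_ne_zero κ hκ.ne_zero
    fun x => by simp [lb]

theorem degree_lb_mul (hκ : IsDiv κ) (hμ : IsDiv μ) :
    degree (lb (κ * μ)) = degree (lb κ) + degree (lb μ) := by
  rw [degree_lb (hκ.mul hμ), degree_lb hκ, degree_lb hμ, ← neg_add,
    ← finsum_add_distrib hκ.finite hμ.finite]
  congr 1
  exact finsum_congr fun x => x.ord_mul (hκ.ne_zero x) (hμ.ne_zero x)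

theorem degree_lb_inv (hκ : IsDiv κ) : degree (lb κ⁻¹) = - degree (lb κ) := by
  rw [degree_lb hκ.inv, degree_lb hκ, neg_neg, ← finsum_neg_distrib]
  refine finsum_congr fun x => ?_
  rw [Pi.inv_apply, x.ord_inv, neg_neg]

theorem degree_lb_div (hκ : IsDiv κ) (hμ : IsDiv μ) :
    degree (lb (κ / μ)) = degree (lb κ) - degree (lb μ) := by
  rw [div_eq_mul_inv, degree_lb_mul hκ hμ.inv, degree_lb_inv hμ, sub_eq_add_neg]

theorem degree_lb_const {g : K} (hg0 : g ≠ 0) : degree (lb fun _ : Point K => g) = 0 := by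
  rw [degree_lb (isDiv_const hg0), finsum_ord_eq_zero hg0, neg_zero]

theorem degree_lb_pt (x : Point K) : degree (lb (pt x)) = 1 := by
  rw [degree_lb (isDiv_pt x), finsum_eq_single _ x fun y hy => ord_pt_of_ne hy, ord_pt_self, neg_neg]

theorem degree_lb_le {a : K} (ha : a ≠ 0) (hκ : IsDiv κ) (hμ : IsDiv μ)
    (h : ∀ x : Point K, x.ord (μ x) ≤ x.ord (a * κ x)) : degree (lb κ) ≤ degree (lb μ) ∧
      (degree (lb κ) = degree (lb μ) → ∀ x : Point K, x.ord (μ x) = x.ord (a * κ x)) := by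
  have ha' := isDiv_const ha
  have h1 := degree_lb_mul ha' hκ
  rw [degree_lb_const ha, zero_add] at h1
  obtain ⟨h2, h3⟩ := degree_mono (ha'.mul hκ).isVectorBundle hμ.isVectorBundle fun x => by
    rw [lb, spanAt_le, Set.singleton_subset_iff]
    exact (mem_lb_iff_ord hμ ((ha'.mul hκ).ne_zero x)).2 (h x)
  rw [h1] at h2 h3
  refine ⟨h2, fun h4 x => le_antisymm (h x) ?_⟩
  have h5 := congrFun (h3 h4) x
  have h6 : μ x ∈ lb ((fun _ => a) * κ) x := h5 ▸ mem_lb_self μ x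
  exact (mem_lb_iff_ord (ha'.mul hκ) (hμ.ne_zero x)).1 h6

theorem degree_nonneg_of_mem_H0 {a : K} (ha : a ≠ 0) (hκ : IsDiv κ) (h : a ∈ H0 (lb κ)) :
    0 ≤ degree (lb κ) ∧ (degree (lb κ) = 0 → ∀ x : Point K, x.ord (κ x) = x.ord a) := by
  have h1 : IsDiv (1 : Point K → K) := isDiv_const (one_ne_zero)
  have h2 : degree (lb (1 : Point K → K)) = 0 := degree_lb_const one_ne_zero
  have h3 := degree_lb_le ha h1 hκ fun x => by
    rw [Pi.one_apply, mul_one]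
    exact (mem_lb_iff_ord hκ ha).1 (h x)
  rw [h2] at h3
  refine ⟨h3.1, fun h4 x => ?_⟩
  have := h3.2 h4.symm x
  rwa [Pi.one_apply, mul_one] at this

end Divisors

section Gonality

variable {K : Type u} [Field K] [Algebra ℂ K] [hK : Fact (IsFunctionField K)]
  {κ μ ν : Point K → K}

/-- A coordinate on the generic fibre of the canonical bundle, and local equations of the
corresponding canonical divisor. -/
structure Coord (K : Type u) [Field K] [Algebra ℂ K] [hK : Fact (IsFunctionField K)] where
  e : Ω[K⁄ℂ] ≃ₗ[K] K
  κ : Point K → K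
  isDiv : IsDiv κ
  mem_iff : ∀ x w, w ∈ canonical K x ↔ e w ∈ lb κ x

theorem exists_coord : Nonempty (Coord K) := by
  obtain ⟨t, ht⟩ := hK.out.exists_transcendental
  obtain ⟨e, he⟩ := exists_kaehlerEquiv hK.out ht
  obtain ⟨κ, h1, -, h2⟩ := canonical_isVectorBundle.exists_isDiv finrank_kaehler (D_ne_zero ht)
  refine ⟨⟨e, κ, h1, fun x w => ?_⟩⟩
  rw [← h2]
  have : e w • D ℂ K t = w := by
    apply e.injective
    rw [map_smul, he, smul_eq_mul, mul_one]
  rw [this]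

theorem e_smul_const (e : Ω[K⁄ℂ] →ₗ[K] K) (c : ℂ) (w : Ω[K⁄ℂ]) : e (c • w) = c • e w :=
  (e.restrictScalars ℂ).map_smul c w

variable (co : Coord K)

theorem Coord.exists_H0_equiv : Nonempty (H0 (canonical K) ≃ₗ[ℂ] H0 (lb co.κ)) :=
  ⟨LinearEquiv.ofBijective
    (((co.e.toLinearMap.restrictScalars ℂ).comp (H0 (canonical K)).subtype).codRestrict
      (H0 (lb co.κ)) fun s x => (co.mem_iff x _).1 (s.2 x))
    ⟨fun a b h => Subtype.ext (co.e.injective (congrArg Subtype.val h)), fun a =>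
      ⟨⟨co.e.symm a, fun x => (co.mem_iff x _).2 (by rw [LinearEquiv.apply_symm_apply]; exact a.2 x)⟩,
        Subtype.ext (co.e.apply_symm_apply _)⟩⟩⟩

theorem IsDiv.mul_div_cancel (hμ : IsDiv μ) (κ : Point K → K) : μ * (κ / μ) = κ := by
  funext y
  exact mul_div_cancel₀ _ (hμ.ne_zero y)

theorem mem_lb_div_iff (hκ : IsDiv κ) (hμ : IsDiv μ) {x : Point K} {y : K} :
    y ∈ lb (κ / μ) x ↔ ∀ a ∈ lb μ x, a * y ∈ lb κ x := by
  constructor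
  · intro hy a ha
    have := mul_mem_lb ha hy
    rwa [hμ.mul_div_cancel] at this
  · intro h
    have := h _ (mem_lb_self μ x)
    rw [mem_lb hκ] at this
    rw [mem_lb (hκ.div hμ)]
    have e : y / (κ / μ) x = μ x * y / κ x := by
      have := hκ.ne_zero x
      have := hμ.ne_zero x
      rw [Pi.div_apply]
      field_simp
    rwa [e]

theorem Coord.exists_homCanonical_equiv (hμ : IsDiv μ) :
    Nonempty (homCanonical (lb μ) ≃ₗ[ℂ] H0 (lb (co.κ / μ))) := by
  have hsm : ∀ (ψ : K →ₗ[K] Ω[K⁄ℂ]) (a : K), co.e (ψ a) = a * co.e (ψ 1) := fun ψ a => by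
    rw [← smul_eq_mul, ← map_smul, ← map_smul, smul_eq_mul, mul_one]
  let f : homCanonical (lb μ) →ₗ[ℂ] H0 (lb (co.κ / μ)) :=
    { toFun := fun ψ => ⟨co.e ((ψ : K →ₗ[K] Ω[K⁄ℂ]) 1), fun x => by
        rw [mem_lb_div_iff co.isDiv hμ]
        intro a ha
        rw [← hsm, ← co.mem_iff]
        exact ψ.2 x a ha⟩
      map_add' := fun a b => Subtype.ext (map_add co.e _ _)
      map_smul' := fun c a => Subtype.ext (e_smul_const co.e.toLinearMap c _) }
  refine ⟨LinearEquiv.ofBijective f ⟨fun a b h => ?_, fun y => ?_⟩⟩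
  · apply Subtype.ext
    apply LinearMap.ext_ring
    exact co.e.injective (congrArg Subtype.val h)
  · refine ⟨⟨LinearMap.toSpanSingleton K _ (co.e.symm (y : K)), fun x a ha => ?_⟩, ?_⟩
    · rw [co.mem_iff, hsm]
      simp only [LinearMap.toSpanSingleton_apply, one_smul, LinearEquiv.apply_symm_apply]
      exact (mem_lb_div_iff co.isDiv hμ).1 (y.2 x) a ha
    · apply Subtype.ext
      change co.e (LinearMap.toSpanSingleton K _ (co.e.symm (y : K)) 1) = y
      rw [LinearMap.toSpanSingleton_apply, one_smul, LinearEquiv.apply_symm_apply]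

/-- The dimension of the space of sections of the line bundle of a divisor. -/
def h0 (κ : Point K → K) : ℕ := Module.finrank ℂ (H0 (lb κ))

theorem H0_lb_mono (hκ : IsDiv κ) (hμ : IsDiv μ)
    (h : ∀ x : Point K, x.ord (κ x) ≤ x.ord (μ x)) : H0 (lb μ) ≤ H0 (lb κ) := by
  intro a ha x
  rcases eq_or_ne a 0 with rfl | h0
  · exact (lb κ x).zero_mem
  · exact (mem_lb_iff_ord hκ h0).2 ((h x).trans ((mem_lb_iff_ord hμ h0).1 (ha x)))

theorem isDiv_one : IsDiv (1 : Point K → K) := isDiv_const one_ne_zero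

theorem mem_lb_one {x : Point K} {a : K} : a ∈ lb 1 x ↔ a ∈ x.ring := by
  rw [mem_lb isDiv_one, Pi.one_apply, div_one]

theorem h0_one : h0 (1 : Point K → K) = 1 := by
  refine finrank_eq_one (⟨1, fun x => mem_lb_one.2 x.ring.one_mem⟩ : H0 (lb (1 : Point K → K)))
    (fun h => one_ne_zero (congrArg Subtype.val h)) fun a => ?_
  obtain ⟨c, hc⟩ := exists_const_of_forall_mem hK.out (a : K) fun x => mem_lb_one.1 (a.2 x)
  refine ⟨c, Subtype.ext ?_⟩
  rw [hc, Submodule.coe_smul, Algebra.smul_def, mul_one]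

variable [hg : FiniteDimensional ℂ (H0 (canonical K))]

theorem Coord.h0_eq_genus : h0 co.κ = genus K := by
  obtain ⟨e⟩ := co.exists_H0_equiv
  rw [h0, genus, e.finrank_eq]

theorem Coord.riemannRoch (hμ : IsDiv μ) :
    (h0 μ : ℤ) - h0 (co.κ / μ) = degree (lb μ) + 1 - genus K := by
  obtain ⟨e⟩ := co.exists_homCanonical_equiv hμ
  have := hμ.isVectorBundle.riemannRoch
  rw [e.finrank_eq, Module.finrank_self] at this
  rw [h0, h0, this]
  ring

theorem IsDiv.div_self (hκ : IsDiv κ) : κ / κ = 1 := by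
  funext x
  exact _root_.div_self (hκ.ne_zero x)

theorem Coord.degree_eq : degree (lb co.κ) = 2 * genus K - 2 := by
  have := co.riemannRoch co.isDiv
  rw [co.isDiv.div_self, h0_one, co.h0_eq_genus] at this
  push_cast at this
  linarith

theorem IsDiv.finite_H0 (hκ : IsDiv κ) : FiniteDimensional ℂ (H0 (lb κ)) :=
  hκ.isVectorBundle.finiteDimensional_H0

theorem h0_le_of_le (hκ : IsDiv κ) (hμ : IsDiv μ)
    (h : ∀ x : Point K, x.ord (κ x) ≤ x.ord (μ x)) :
    (h0 κ : ℤ) ≤ h0 μ + (degree (lb κ) - degree (lb μ)) := by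
  obtain ⟨co⟩ := exists_coord (K := K)
  have h1 := co.riemannRoch hκ
  have h2 := co.riemannRoch hμ
  haveI := (co.isDiv.div hμ).finite_H0
  have h3 : h0 (co.κ / κ) ≤ h0 (co.κ / μ) :=
    Submodule.finrank_mono (H0_lb_mono (co.isDiv.div hμ) (co.isDiv.div hκ) fun x => by
      simp only [Pi.div_apply, div_eq_mul_inv]
      rw [x.ord_mul (co.isDiv.ne_zero x) (inv_ne_zero (hκ.ne_zero x)),
        x.ord_mul (co.isDiv.ne_zero x) (inv_ne_zero (hμ.ne_zero x)), x.ord_inv, x.ord_inv]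
      linarith [h x])
  zify at h3
  linarith

theorem h0_eq_of_ord (hκ : IsDiv κ) (hμ : IsDiv μ) {a : K} (ha : a ≠ 0)
    (h : ∀ x : Point K, x.ord (κ x) = x.ord (a * μ x)) : h0 κ = h0 μ := by
  have ha' := (isDiv_const ha).mul hμ
  have h1 : lb κ = lb ((fun _ => a) * μ) := by
    funext x
    exact lb_apply_eq_of_ord (hκ.ne_zero x) (ha'.ne_zero x) (h x)
  rw [h0, h1, h0]
  symm
  refine LinearEquiv.finrank_eq (LinearEquiv.ofBijective
    (((LinearMap.mulLeft ℂ a).comp (H0 (lb μ)).subtype).codRestrict (H0 (lb ((fun _ => a) * μ)))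
      fun s x => mul_mem_lb (mem_lb_self (fun _ => a) x) (s.2 x)) ⟨fun s t hst => ?_, fun s => ?_⟩)
  · exact Subtype.ext (mul_left_cancel₀ ha (congrArg Subtype.val hst))
  · have key : ∀ x, (s : K) / a ∈ lb μ x := fun x => by
      have h2 := s.2 x
      rw [mem_lb ha', Pi.mul_apply] at h2
      rwa [mem_lb hμ, div_div]
    exact ⟨⟨(s : K) / a, key⟩, Subtype.ext (mul_div_cancel₀ _ ha)⟩

theorem degree_lb_pow (hκ : IsDiv κ) (n : ℕ) : IsDiv (κ ^ n) ∧
    degree (lb (κ ^ n)) = n * degree (lb κ) := by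
  induction n with
  | zero =>
    rw [pow_zero]
    refine ⟨isDiv_one, ?_⟩
    have : degree (lb (1 : Point K → K)) = 0 := degree_lb_const one_ne_zero
    rw [this]; simp
  | succ n ih =>
    rw [pow_succ]
    refine ⟨ih.1.mul hκ, ?_⟩
    rw [degree_lb_mul ih.1 hκ, ih.2]
    push_cast
    ring

/-- The local equations of the polar divisor of `t`. -/
def polar (t : K) : Point K → K := open Classical in fun x => if t ∈ x.ring then 1 else t

theorem isDiv_polar {t : K} (h0 : t ≠ 0) : IsDiv (polar t) where
  ne_zero x := by unfold polar; split_ifs <;> simp [h0]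
  finite := (finite_ord_ne_zero h0).subset fun x hx => by
    intro h
    apply hx
    unfold polar
    split_ifs
    · simp
    · exact h

/-- The degree of the polar divisor of `t` is at least the degree of the map `t`. -/
theorem finrank_le_degree_polar {t : K} (ht : Transcendental ℂ t) :
    (Module.finrank ℂ⟮t⟯ K : ℤ) ≤ degree (lb (polar t)) := by
  have ht0 := transcendental_ne_zero ht
  haveI := hK.out.finiteDimensional ht
  set n := Module.finrank ℂ⟮t⟯ K with hn
  have hO := (isDiv_one (K := K)).isVectorBundle
  let b := Module.finBasis ℂ⟮t⟯ K
  choose q hq hqb using fun i => hO.exists_aeval_smul_mem (t := t) (b i)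
  choose N hN using fun i => hO.exists_nat_smul_mem (t := t) (aeval t (q i) • b i)
  let M := Finset.univ.sup N
  have hd := isDiv_polar ht0
  have key : ∀ m : ℕ, (n * m : ℤ) ≤ 1 + (m + M) * degree (lb (polar t)) := by
    intro m
    obtain ⟨hd1, hd2⟩ := degree_lb_pow hd (m + M)
    have h1 : (h0 (polar t ^ (m + M)) : ℤ) ≤ 1 + (m + M) * degree (lb (polar t)) := by
      have := h0_le_of_le hd1 (isDiv_one (K := K)) fun x => by
        rw [Pi.one_apply, x.ord_one, Pi.pow_apply, ← zpow_natCast, x.ord_zpow]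
        unfold polar
        split_ifs with h
        · simp
        · have := ord_neg_of_notMem h
          push_cast
          nlinarith
      rw [h0_one, hd2, show degree (lb (1 : Point K → K)) = 0 from degree_lb_const one_ne_zero] at this
      push_cast at this
      linarith
    refine le_trans ?_ h1
    let Φ : (Fin n → degreeLT ℂ m) →ₗ[ℂ] K := ∑ i,
      (LinearMap.mulRight ℂ (aeval t (q i) • b i)).comp ((aeval t).toLinearMap.comp
        ((degreeLT ℂ m).subtype.comp (LinearMap.proj i)))
    have hΦ : ∀ p, Φ p = ∑ i, aeval t (p i : ℂ[X]) * (aeval t (q i) * b i) := fun p => by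
      simp [Φ, mul_assoc]
      rfl
    have hmem : ∀ p, Φ p ∈ H0 (lb (polar t ^ (m + M))) := by
      intro p x
      rw [hΦ]
      refine sum_mem fun i _ => ?_
      rw [mem_lb hd1, Pi.pow_apply]
      unfold polar
      split_ifs with h
      · rw [one_pow, div_one]
        exact x.ring.mul_mem _ _ (x.aeval_mem h _) (mem_lb_one.1 (hqb i x h))
      · have h2 := hN i (t ^ (-(M : ℤ))) (fun y hy => by
          rw [← zpow_natCast, ← zpow_add₀ ht0]
          have : N i ≤ M := Finset.le_sup (f := N) (Finset.mem_univ i)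
          exact zpow_mem_ring_of_nonpos hy (by omega)) x h
        rw [mem_lb_one, smul_eq_mul, smul_eq_mul] at h2
        have h3 : aeval t (p i : ℂ[X]) / t ^ m ∈ x.ring := by
          rcases eq_or_ne (p i : ℂ[X]) 0 with h0 | h0
          · rw [h0, map_zero, zero_div]; exact x.ring.zero_mem
          · rw [x.div_mem_ring_iff (aeval_ne_zero ht h0) (pow_ne_zero _ ht0), ord_aeval h h0,
              ← zpow_natCast, x.ord_zpow]
            have h4 : (p i : ℂ[X]).natDegree ≤ m :=
              natDegree_le_of_degree_le (le_of_lt (mem_degreeLT.1 (p i).2))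
            have h5 := ord_neg_of_notMem h
            zify at h4
            nlinarith
        have := x.ring.mul_mem _ _ h3 h2
        rw [zpow_neg, zpow_natCast] at this
        have e : aeval t (p i : ℂ[X]) * (aeval t (q i) * b i) / t ^ (m + M) =
            aeval t (p i : ℂ[X]) / t ^ m * ((t ^ M)⁻¹ * (aeval t (q i) * b i)) := by
          field_simp
          ring
        rwa [e]
    have hinj : Function.Injective (Φ.codRestrict _ hmem) := by
      rw [← LinearMap.ker_eq_bot, LinearMap.ker_eq_bot']
      intro p hp
      have h0 : Φ p = 0 := congrArg Subtype.val hp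
      rw [hΦ] at h0
      have h5 : ∑ i, (⟨aeval t (p i : ℂ[X]) * aeval t (q i),
          mul_mem (aeval_mem_adjoin t _) (aeval_mem_adjoin t _)⟩ : ℂ⟮t⟯) • b i = 0 := by
        rw [← h0]
        refine Finset.sum_congr rfl fun i _ => ?_
        rw [← mul_assoc]
        rfl
      have h6 := Fintype.linearIndependent_iff.1 b.linearIndependent _ h5
      funext i
      have h7 : aeval t (p i : ℂ[X]) * aeval t (q i) = 0 := congrArg Subtype.val (h6 i)
      rw [mul_eq_zero, or_iff_left (aeval_ne_zero ht (hq i))] at h7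
      apply Subtype.ext
      by_contra hcon
      exact aeval_ne_zero ht hcon h7
    haveI := hd1.finite_H0
    have h8 := LinearMap.finrank_le_finrank_of_injective hinj
    rw [Module.finrank_pi_fintype] at h8
    simp only [(degreeLTEquiv ℂ m).finrank_eq, Module.finrank_fin_fun, Finset.sum_const,
      Finset.card_univ, Fintype.card_fin, smul_eq_mul] at h8
    rw [h0]
    exact_mod_cast h8
  by_contra hcon
  set d := degree (lb (polar t)) with hdd
  have hd0 : 0 ≤ d := by
    refine (degree_nonneg_of_mem_H0 (a := 1) one_ne_zero hd fun x => ?_).1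
    rw [mem_lb_iff_ord hd one_ne_zero, x.ord_one]
    unfold polar
    split_ifs with h
    · simp
    · exact (ord_neg_of_notMem h).le
  have h9 := key (2 + M * d.toNat)
  push_cast at h9
  rw [Int.toNat_of_nonneg hd0] at h9
  have h10 : d + 1 ≤ n := by omega
  have h11 : (0 : ℤ) ≤ 2 + M * d := by positivity
  nlinarith

theorem finrank_adjoin_ne_one (hnh : ¬ IsHyperelliptic K) {t : K} (ht : Transcendental ℂ t) :
    Module.finrank ℂ⟮t⟯ K ≠ 1 := by
  intro h1
  have htop : ℂ⟮t⟯ = ⊤ := by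
    haveI := hK.out.finiteDimensional ht
    rw [IntermediateField.finrank_eq_one_iff_eq_top] at h1
    exact h1
  have ht2 : Transcendental ℂ (t ^ 2) := ht.pow two_pos
  apply hnh
  refine ⟨t ^ 2, ?_⟩
  haveI := hK.out.finiteDimensional ht2
  have hne : t ∉ ℂ⟮t ^ 2⟯ := by
    intro h
    obtain ⟨p, q, hpq⟩ := (mem_adjoin_simple_iff ℂ _).1 h
    have ht0 := transcendental_ne_zero ht
    have hq0 : aeval (t ^ 2) q ≠ 0 := by
      intro h0
      rw [h0, div_zero] at hpq
      exact ht0 hpq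
    have h2 : aeval t (X * expand ℂ 2 q - expand ℂ 2 p) = 0 := by
      rw [map_sub, map_mul, aeval_X, expand_aeval, expand_aeval, sub_eq_zero]
      rwa [eq_div_iff hq0] at hpq
    have h3 : X * expand ℂ 2 q = expand ℂ 2 p := by
      by_contra hcon
      exact aeval_ne_zero ht (sub_ne_zero.2 hcon) h2
    have hq : q ≠ 0 := by rintro rfl; simp at hq0
    have h4 := congrArg natDegree h3
    rw [natDegree_X_mul ((expand_ne_zero two_pos).2 hq), natDegree_expand, natDegree_expand] at h4
    omega
  have hti : IsIntegral ℂ⟮t ^ 2⟯ t := Algebra.IsIntegral.isIntegral t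
  have hadj : ℂ⟮t ^ 2⟯⟮t⟯ = ⊤ := by
    rw [eq_top_iff]
    intro z _
    have hz : z ∈ ℂ⟮t⟯ := htop ▸ mem_top
    have : ℂ⟮t⟯ ≤ ℂ⟮t ^ 2⟯⟮t⟯.restrictScalars ℂ := by
      rw [adjoin_simple_le_iff]
      exact mem_adjoin_simple_self _ t
    exact this hz
  have h5 := IntermediateField.adjoin.finrank hti
  rw [hadj, IntermediateField.finrank_top'] at h5
  have h6 : (minpoly ℂ⟮t ^ 2⟯ t).natDegree ≤ 2 := by
    let r : Polynomial ℂ⟮t ^ 2⟯ := X ^ 2 - C (AdjoinSimple.gen ℂ (t ^ 2))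
    have hr : r.Monic := monic_X_pow_sub_C _ two_ne_zero
    have h7 := minpoly.min ℂ⟮t ^ 2⟯ t hr (by simp [r])
    have h8 := natDegree_le_natDegree h7
    rwa [natDegree_X_pow_sub_C] at h8
  have h9 : Module.finrank ℂ⟮t ^ 2⟯ K ≠ 1 := by
    intro h
    rw [IntermediateField.finrank_eq_one_iff_eq_top] at h
    exact hne (h ▸ mem_top)
  have h10 : 0 < Module.finrank ℂ⟮t ^ 2⟯ K := Module.finrank_pos
  omega

theorem three_le_degree_of_two_le_h0 (hnh : ¬ IsHyperelliptic K) (hκ : IsDiv κ)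
    (h : 2 ≤ h0 κ) : 3 ≤ degree (lb κ) := by
  haveI := hκ.finite_H0
  haveI : Nontrivial (H0 (lb κ)) := Module.nontrivial_of_finrank_pos (R := ℂ) (by
    change 0 < h0 κ; omega)
  obtain ⟨f, hf⟩ := exists_ne (0 : H0 (lb κ))
  obtain ⟨g, hg⟩ := exists_linearIndependent_pair_of_one_lt_finrank (R := ℂ)
    (show 1 < Module.finrank ℂ (H0 (lb κ)) from h) hf
  have hf0 : (f : K) ≠ 0 := fun h => hf (Subtype.ext h)
  have ht : Transcendental ℂ ((g : K) / f) := by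
    refine (exists_const_or_transcendental _).resolve_left ?_
    rintro ⟨c, hc⟩
    rw [LinearIndependent.pair_iff] at hg
    rw [div_eq_iff hf0] at hc
    have := hg c (-1) (Subtype.ext (by
      change c • (f : K) + (-1 : ℂ) • (g : K) = 0
      rw [hc, Algebra.smul_def, neg_one_smul, add_neg_cancel]))
    simp at this
  have ht0 := transcendental_ne_zero ht
  have hg0 : (g : K) ≠ 0 := left_ne_zero_of_mul (div_eq_mul_inv (g : K) f ▸ ht0)
  haveI := hK.out.finiteDimensional ht
  have h1 : 0 < Module.finrank ℂ⟮(g : K) / f⟯ K := Module.finrank_pos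
  have h2 := finrank_adjoin_ne_one hnh ht
  have h3 : Module.finrank ℂ⟮(g : K) / f⟯ K ≠ 2 := fun h => hnh ⟨_, h⟩
  have h4 := finrank_le_degree_polar ht
  have h5 := (degree_lb_le hf0 (isDiv_polar ht0) hκ fun x => by
    unfold polar
    split_ifs
    · rw [mul_one]
      exact (mem_lb_iff_ord hκ hf0).1 (f.2 x)
    · rw [mul_div_cancel₀ _ hf0]
      exact (mem_lb_iff_ord hκ hg0).1 (g.2 x)).1
  omega

theorem ord_div_pt_ge (κ : Point K → K) (hκ : IsDiv κ) (x y : Point K) :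
    y.ord (κ y) ≤ y.ord ((κ / pt x) y) := by
  rw [Pi.div_apply, div_eq_mul_inv, y.ord_mul (hκ.ne_zero y) (inv_ne_zero (pt_ne_zero x y)),
    y.ord_inv]
  rcases eq_or_ne y x with rfl | h
  · rw [ord_pt_self]; omega
  · rw [ord_pt_of_ne h]; omega

theorem four_le_degree_of_three_le_h0 (hnh : ¬ IsHyperelliptic K) (hκ : IsDiv κ)
    (h : 3 ≤ h0 κ) : 4 ≤ degree (lb κ) := by
  obtain ⟨x⟩ := exists_point hK.out
  have hx := isDiv_pt x
  have h1 := degree_lb_div hκ hx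
  rw [degree_lb_pt] at h1
  have h2 := h0_le_of_le hκ (hκ.div hx) (ord_div_pt_ge κ hκ x)
  have h3 := three_le_degree_of_two_le_h0 hnh (hκ.div hx) (by omega)
  omega

end Gonality

section RankTwo

variable {K : Type u} [Field K] [Algebra ℂ K] [hK : Fact (IsFunctionField K)]
  {F : Type v} [AddCommGroup F] [Module K F]

/-- The coordinate on the generic fibre of the bicanonical bundle. -/
def Coord.e₂ (co : Coord K) : Ω[K⁄ℂ] ⊗[K] Ω[K⁄ℂ] ≃ₗ[K] K :=
  (TensorProduct.congr co.e co.e).trans (TensorProduct.lid K K)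

theorem Coord.e₂_tmul (co : Coord K) (w w' : Ω[K⁄ℂ]) : co.e₂ (w ⊗ₜ w') = co.e w * co.e w' := by
  simp [Coord.e₂]

theorem Coord.mem_bicanonical_iff (co : Coord K) (x : Point K) (z : Ω[K⁄ℂ] ⊗[K] Ω[K⁄ℂ]) :
    z ∈ bicanonical K x ↔ co.e₂ z ∈ lb (co.κ * co.κ) x := by
  constructor
  · have h : bicanonical K x ≤ pullback co.e₂.toLinearMap (lb (co.κ * co.κ)) x := by
      refine spanAt_le.2 ?_
      rintro _ ⟨a, ha, b, hb, rfl⟩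
      change co.e₂ _ ∈ lb (co.κ * co.κ) x
      rw [co.e₂_tmul]
      exact mul_mem_lb ((co.mem_iff x a).1 ha) ((co.mem_iff x b).1 hb)
    exact fun hz => h hz
  · intro hz
    obtain ⟨g, hg, h⟩ := mem_spanAt_singleton.1 hz
    have hw : co.e.symm (co.κ x) ∈ canonical K x := by
      rw [co.mem_iff, LinearEquiv.apply_symm_apply]; exact mem_lb_self _ x
    have : z = (g • co.e.symm (co.κ x)) ⊗ₜ co.e.symm (co.κ x) := by
      apply co.e₂.injective
      rw [h, co.e₂_tmul, map_smul, LinearEquiv.apply_symm_apply, smul_eq_mul, smul_eq_mul,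
        Pi.mul_apply]
      ring
    rw [this]
    exact subset_spanAt _ ⟨_, smul_mem_stalk _ hg hw, _, hw, rfl⟩

/-- A rank two bundle with determinant `ω_C^{⊗2}`, in coordinates: the determinant is an
alternating form on the generic fibre. -/
structure DetForm (co : Coord K) (E : Stalks K F) where
  isVectorBundle : IsVectorBundle E
  finrank_eq : Module.finrank K F = 2
  det : F →ₗ[K] F →ₗ[K] K
  det_self : ∀ a, det a a = 0
  det_mem : ∀ x, ∀ a ∈ E x, ∀ b ∈ E x, det a b ∈ lb (co.κ * co.κ) x
  exists_gen : ∀ x, ∃ a ∈ E x, ∃ b ∈ E x, det a b ≠ 0 ∧ lb (co.κ * co.κ) x = spanAt x {det a b}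

/-- The determinant form given by an isomorphism `⋀² E ≅ ω_C^{⊗2}`. -/
def altForm (co : Coord K) {E : Stalks K F} (δ : BundleIso (wedgeTwo E) (bicanonical K)) :
    F [⋀^Fin 2]→ₗ[K] K :=
  (co.e₂.toLinearMap.comp δ.equiv.toLinearMap).compAlternatingMap (exteriorPower.ιMulti K 2)

theorem altForm_apply (co : Coord K) {E : Stalks K F} (δ : BundleIso (wedgeTwo E) (bicanonical K))
    (a b : F) : altForm co δ ![a, b] =
      co.e₂ (δ.equiv (exteriorPower.ιMulti K 2 ![a, b])) := rfl

theorem AlternatingMap.pair_swap (f : F [⋀^Fin 2]→ₗ[K] K) (a b : F) : f ![b, a] = - f ![a, b] := by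
  have h := f.map_swap ![a, b] (show (0 : Fin 2) ≠ 1 by decide)
  rw [← h]
  congr 1
  funext i
  fin_cases i <;> simp

theorem AlternatingMap.pair_add (f : F [⋀^Fin 2]→ₗ[K] K) (a a' b : F) :
    f ![a + a', b] = f ![a, b] + f ![a', b] := f.map_vecCons_add ..

theorem AlternatingMap.pair_smul (f : F [⋀^Fin 2]→ₗ[K] K) (c : K) (a b : F) :
    f ![c • a, b] = c • f ![a, b] := f.map_vecCons_smul ..

/-- The determinant form in coordinates. -/
def DetForm.ofIso (co : Coord K) {E : Stalks K F} (hE : IsVectorBundle E)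
    (hF : Module.finrank K F = 2) (δ : BundleIso (wedgeTwo E) (bicanonical K)) : DetForm co E where
  isVectorBundle := hE
  finrank_eq := hF
  det := LinearMap.mk₂ K (fun a b => altForm co δ ![a, b])
    (fun a a' b => AlternatingMap.pair_add ..) (fun c a b => AlternatingMap.pair_smul ..)
    (fun a b b' => by
      rw [AlternatingMap.pair_swap _ (b + b'), AlternatingMap.pair_add,
        AlternatingMap.pair_swap _ b, AlternatingMap.pair_swap _ b']
      ring)
    (fun c a b => by
      rw [AlternatingMap.pair_swap _ (c • b), AlternatingMap.pair_smul,
        AlternatingMap.pair_swap _ b]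
      simp)
  det_self a := (altForm co δ).map_eq_zero_of_eq ![a, a] (i := 0) (j := 1) rfl (by decide)
  det_mem x a ha b hb := by
    rw [LinearMap.mk₂_apply, altForm_apply, ← co.mem_bicanonical_iff, δ.mem_iff]
    exact subset_spanAt _ ⟨a, ha, b, hb, rfl⟩
  exists_gen x := by
    by_contra hcon
    push Not at hcon
    have hκ := co.isDiv.mul co.isDiv
    have hν := hκ.div (isDiv_pt x)
    have hle : wedgeTwo E x ≤ pullback (co.e₂.toLinearMap.comp δ.equiv.toLinearMap)
        (lb (co.κ * co.κ / pt x)) x := by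
      refine spanAt_le.2 ?_
      rintro _ ⟨a, ha, b, hb, rfl⟩
      change altForm co δ ![a, b] ∈ lb (co.κ * co.κ / pt x) x
      have h1 := hcon a ha b hb
      rw [LinearMap.mk₂_apply] at h1
      rcases eq_or_ne (altForm co δ ![a, b]) 0 with h0 | h0
      · rw [h0]; exact Submodule.zero_mem _
      · have h2 := h1 h0
        have h3 : altForm co δ ![a, b] ∈ lb (co.κ * co.κ) x := by
          rw [altForm_apply, ← co.mem_bicanonical_iff, δ.mem_iff]
          exact subset_spanAt _ ⟨a, ha, b, hb, rfl⟩
        rw [mem_lb_iff_ord hκ h0] at h3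
        rw [mem_lb_iff_ord hν h0, Pi.div_apply, div_eq_mul_inv, x.ord_mul (hκ.ne_zero x)
          (inv_ne_zero (pt_ne_zero x x)), x.ord_inv, ord_pt_self]
        by_contra hlt
        refine h2 ?_
        have := lb_apply_eq_of_ord (κ := co.κ * co.κ) (μ := fun _ => altForm co δ ![a, b])
          (hκ.ne_zero x) h0 (by omega)
        exact this
    let z := δ.equiv.symm (co.e₂.symm ((co.κ * co.κ) x))
    have hz : z ∈ wedgeTwo E x := by
      rw [← δ.mem_iff, co.mem_bicanonical_iff]
      simp only [z, LinearEquiv.apply_symm_apply]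
      exact mem_lb_self _ x
    have h4 : co.e₂ (δ.equiv z) ∈ lb (co.κ * co.κ / pt x) x := hle hz
    simp only [z, LinearEquiv.apply_symm_apply] at h4
    rw [mem_lb_iff_ord hν (hκ.ne_zero x), Pi.div_apply, div_eq_mul_inv, x.ord_mul (hκ.ne_zero x)
          (inv_ne_zero (pt_ne_zero x x)), x.ord_inv, ord_pt_self] at h4
    omega

namespace DetForm

variable {co : Coord K} {E : Stalks K F} (d : DetForm co E)

theorem det_swap (a b : F) : d.det b a = - d.det a b := by
  have h := d.det_self (a + b)
  simp only [map_add, LinearMap.add_apply, d.det_self] at h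
  linear_combination h

/-- The three-term relation in a two-dimensional space. -/
theorem cramer (a b c : F) : d.det b c • a - d.det a c • b + d.det a b • c = 0 := by
  haveI : Module.Finite K F := d.isVectorBundle.finite
  let v := Module.finBasisOfFinrankEq K F d.finrank_eq
  have hv : ∀ a : F, a = v.repr a 0 • v 0 + v.repr a 1 • v 1 := fun a => by
    conv_lhs => rw [← v.sum_repr a]
    rw [Fin.sum_univ_two]
  have hd : ∀ a b : F, d.det a b =
      (v.repr a 0 * v.repr b 1 - v.repr a 1 * v.repr b 0) * d.det (v 0) (v 1) := by
    intro a b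
    conv_lhs => rw [hv a, hv b]
    simp only [map_add, map_smul, LinearMap.add_apply, LinearMap.smul_apply, d.det_self,
      d.det_swap (v 0) (v 1), smul_eq_mul]
    ring
  rw [hd b c, hd a c, hd a b]
  refine v.ext_elem fun i => ?_
  simp only [map_add, map_sub, map_smul, map_zero, Finsupp.add_apply, Finsupp.sub_apply,
    Finsupp.smul_apply, Finsupp.zero_apply, smul_eq_mul]
  fin_cases i
  · change _ * v.repr a 0 - _ * v.repr b 0 + _ * v.repr c 0 = 0
    ring
  · change _ * v.repr a 1 - _ * v.repr b 1 + _ * v.repr c 1 = 0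
    ring

/-- The determinant identifies `E` with the dual of `E` twisted by `ω_C^{⊗2}`. -/
theorem mem_of_forall_det {x : Point K} {f : F}
    (h : ∀ a ∈ E x, d.det a f ∈ lb (co.κ * co.κ) x) : f ∈ E x := by
  obtain ⟨a, ha, b, hb, hab, hgen⟩ := d.exists_gen x
  have h1 := h a ha
  have h2 := h b hb
  rw [hgen] at h1 h2
  obtain ⟨g, hg, h1⟩ := mem_spanAt_singleton.1 h1
  obtain ⟨g', hg', h2⟩ := mem_spanAt_singleton.1 h2
  have h3 := d.cramer a b f
  rw [h1, h2, smul_eq_mul, smul_eq_mul, mul_comm, mul_smul, mul_comm g, mul_smul, ← smul_sub,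
    ← smul_add, smul_eq_zero, or_iff_right hab] at h3
  have h4 : f = g • b - g' • a := by
    rw [sub_add_eq_add_sub, sub_eq_zero] at h3
    rw [← h3, add_sub_cancel_left]
  rw [h4]
  exact sub_mem (smul_mem_stalk _ hg hb) (smul_mem_stalk _ hg' ha)

theorem exists_det_ne_zero {a : F} (ha : a ≠ 0) : ∃ b, d.det a b ≠ 0 := by
  by_contra hcon
  push Not at hcon
  obtain ⟨x⟩ := exists_point hK.out
  obtain ⟨b, -, c, -, hbc, -⟩ := d.exists_gen x
  have := d.cramer a b c
  rw [hcon b, hcon c, zero_smul, zero_smul, sub_zero, add_zero, smul_eq_zero] at this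
  exact this.elim hbc ha

theorem mem_ker_det {a b : F} (ha : a ≠ 0) (h : d.det a b = 0) : ∃ c : K, b = c • a := by
  obtain ⟨f, hf⟩ := d.exists_det_ne_zero ha
  have := d.cramer a b f
  rw [h, zero_smul, add_zero, sub_eq_zero] at this
  refine ⟨d.det b f / d.det a f, ?_⟩
  rw [div_eq_inv_mul, mul_smul, this, smul_smul, inv_mul_cancel₀ hf, one_smul]

theorem surjective_det {a : F} (ha : a ≠ 0) : Function.Surjective (d.det a) := by
  obtain ⟨f, hf⟩ := d.exists_det_ne_zero ha
  exact fun y => ⟨(y / d.det a f) • f, by rw [map_smul, smul_eq_mul, div_mul_cancel₀ _ hf]⟩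

theorem finrank_ker_det {a : F} (ha : a ≠ 0) : Module.finrank K (LinearMap.ker (d.det a)) = 1 := by
  refine finrank_eq_one (⟨a, d.det_self a⟩ : LinearMap.ker (d.det a))
    (fun h => ha (congrArg Subtype.val h)) fun b => ?_
  obtain ⟨c, hc⟩ := d.mem_ker_det ha b.2
  exact ⟨c, Subtype.ext hc.symm⟩

/-- The line subbundle generated by a vector of the generic fibre. -/
theorem exists_isDiv (d : DetForm co E) {a : F} (ha : a ≠ 0) : ∃ lam : Point K → K, IsDiv lam ∧
    ∀ x c, c • a ∈ E x ↔ c ∈ lb lam x := by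
  have ha' : (⟨a, d.det_self a⟩ : LinearMap.ker (d.det a)) ≠ 0 :=
    fun h => ha (congrArg Subtype.val h)
  obtain ⟨lam, h1, -, h2⟩ := (d.isVectorBundle.sub _).exists_isDiv (d.finrank_ker_det ha) ha'
  exact ⟨lam, h1, fun x c => h2 x c⟩

/-- The line subbundle generated by a vector of the generic fibre, as a line bundle of a
divisor. -/
def subIso {a : F} (ha : a ≠ 0) {lam : Point K → K} (h : ∀ x c, c • a ∈ E x ↔ c ∈ lb lam x) :
    BundleIso (lb lam) (sub E (LinearMap.ker (d.det a))) where
  equiv := LinearEquiv.ofBijective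
    (LinearMap.toSpanSingleton K _ (⟨a, d.det_self a⟩ : LinearMap.ker (d.det a)))
    ⟨fun c c' hc => smul_left_injective K ha (congrArg Subtype.val hc), fun b => by
      obtain ⟨c, hc⟩ := d.mem_ker_det ha b.2
      exact ⟨c, Subtype.ext hc.symm⟩⟩
  mem_iff x c := h x c

theorem exists_det_eq {a : F} {lam : Point K → K} (hlam : IsDiv lam)
    (h : ∀ x c, c • a ∈ E x ↔ c ∈ lb lam x) (x : Point K) (y : K) :
    y ∈ lb (co.κ * co.κ / lam) x ↔ ∃ f ∈ E x, d.det a f = y := by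
  have hκ := co.isDiv.mul co.isDiv
  constructor
  · intro hy
    obtain ⟨p, hp, q, hq, hpq, hgen⟩ := d.exists_gen x
    have hmem : lam x • a ∈ E x := (h x _).2 (mem_lb_self lam x)
    have h1 := d.det_mem x _ hmem p hp
    have h2 := d.det_mem x _ hmem q hq
    rw [hgen] at h1 h2
    obtain ⟨g, hg, h1⟩ := mem_spanAt_singleton.1 h1
    obtain ⟨g', hg', h2⟩ := mem_spanAt_singleton.1 h2
    have h3 := d.cramer (lam x • a) p q
    rw [h1, h2, smul_eq_mul, smul_eq_mul, mul_comm g', mul_comm g, mul_smul, mul_smul, ← smul_sub,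
      ← smul_add, smul_eq_zero, or_iff_right hpq] at h3
    have hunit : g ∉ x.ring.nonunits ∨ g' ∉ x.ring.nonunits := by
      by_contra hcon
      push Not at hcon
      obtain ⟨π, hπ0, hπ⟩ := x.exists_ord_eq_one
      have hdiv : ∀ g ∈ x.ring.nonunits, π⁻¹ * g ∈ x.ring := by
        intro g hg
        rcases eq_or_ne g 0 with rfl | h0
        · rw [mul_zero]; exact x.ring.zero_mem
        · rw [mul_comm, ← div_eq_mul_inv, x.div_mem_ring_iff h0 hπ0]
          have := (x.mem_nonunits_iff_ord h0).1 hg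
          omega
      have h4 : (π⁻¹ * lam x) • a ∈ E x := by
        have : (π⁻¹ * lam x) • a = (π⁻¹ * g') • p - (π⁻¹ * g) • q := by
          rw [mul_smul, mul_smul, mul_smul, ← smul_sub]
          congr 1
          rw [sub_add_eq_add_sub, sub_eq_zero] at h3
          rw [← h3, add_sub_cancel_right]
        rw [this]
        exact sub_mem (smul_mem_stalk _ (hdiv _ hcon.2) hp) (smul_mem_stalk _ (hdiv _ hcon.1) hq)
      rw [h, mem_lb_iff_ord hlam (mul_ne_zero (inv_ne_zero hπ0) (hlam.ne_zero x)),
        x.ord_mul (inv_ne_zero hπ0) (hlam.ne_zero x), x.ord_inv] at h4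
      omega
    have key : ∀ r ∈ E x, ∀ u : K, u ∉ x.ring.nonunits →
        d.det (lam x • a) r = u • d.det p q → ∃ f ∈ E x, d.det a f = y := by
      intro r hr u hu hru
      have hu0 : u ≠ 0 := fun h0 => hu (by rw [h0]; exact ZeroMemClass.zero_mem _)
      have h5 := (mem_lb_div_iff hκ hlam).1 hy _ (mem_lb_self lam x)
      rw [hgen] at h5
      obtain ⟨v, hv, h5⟩ := mem_spanAt_singleton.1 h5
      refine ⟨(u⁻¹ * v) • r, smul_mem_stalk _
        (x.ring.mul_mem _ _ (Point.inv_mem_of_notMem_nonunits hu) hv) hr, ?_⟩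
      apply mul_left_cancel₀ (hlam.ne_zero x)
      rw [map_smul, LinearMap.smul_apply, smul_eq_mul, smul_eq_mul] at hru
      rw [smul_eq_mul] at h5
      rw [h5, map_smul, smul_eq_mul, mul_left_comm, hru]
      field_simp
    exact hunit.elim (fun hu => key p hp g hu h1) fun hu => key q hq g' hu h2
  · rintro ⟨f, hf, rfl⟩
    rw [mem_lb_div_iff hκ hlam]
    intro c hc
    have := d.det_mem x _ ((h x c).2 hc) f hf
    rwa [map_smul, LinearMap.smul_apply, smul_eq_mul] at this

/-- The quotient by the line subbundle generated by `a`, identified by means of the determinant. -/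
def quotIso {a : F} (ha : a ≠ 0) {lam : Point K → K} (hlam : IsDiv lam)
    (h : ∀ x c, c • a ∈ E x ↔ c ∈ lb lam x) :
    BundleIso (quot E (LinearMap.ker (d.det a))) (lb (co.κ * co.κ / lam)) where
  equiv := (d.det a).quotKerEquivOfSurjective (d.surjective_det ha)
  mem_iff x z := by
    rw [d.exists_det_eq hlam h]
    constructor
    · rintro ⟨f, hf, h⟩
      refine ⟨f, hf, ((d.det a).quotKerEquivOfSurjective (d.surjective_det ha)).injective ?_⟩
      rw [← h]
      rfl
    · rintro ⟨f, hf, rfl⟩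
      exact ⟨f, hf, rfl⟩

end DetForm
end RankTwo

section Global

variable {K : Type u} [Field K] [Algebra ℂ K] [hK : Fact (IsFunctionField K)]
  {F : Type v} [AddCommGroup F] [Module K F] [hg : FiniteDimensional ℂ (H0 (canonical K))]

theorem h0_eq_zero_of_degree_neg {κ : Point K → K} (hκ : IsDiv κ) (h : degree (lb κ) < 0) :
    h0 κ = 0 := by
  have : H0 (lb κ) = ⊥ := by
    rw [eq_bot_iff]
    intro a ha
    by_contra h0
    exact absurd (degree_nonneg_of_mem_H0 h0 hκ ha).1 (not_le.2 h)
  rw [h0, this, finrank_bot]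

theorem exists_ne_zero_of_h0_pos {κ : Point K → K} (h : 0 < h0 κ) : ∃ a ∈ H0 (lb κ), a ≠ 0 := by
  haveI : Nontrivial (H0 (lb κ)) := Module.nontrivial_of_finrank_pos (R := ℂ) h
  obtain ⟨f, hf⟩ := exists_ne (0 : H0 (lb κ))
  exact ⟨f, f.2, fun h => hf (Subtype.ext h)⟩

/-- A nonzero section of a line bundle of degree one vanishes at one point. -/
theorem exists_ord_eq_of_degree_one {κ : Point K → K} (hκ : IsDiv κ) (h : degree (lb κ) = 1)
    {u : K} (hu : u ≠ 0) (hmem : u ∈ H0 (lb κ)) :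
    ∃ x : Point K, ∀ y : Point K, y.ord ((κ / pt x) y) = y.ord u := by
  have hord : ∀ y : Point K, y.ord (κ y) ≤ y.ord u := fun y =>
    (mem_lb_iff_ord hκ hu).1 (hmem y)
  obtain ⟨x, hx⟩ : ∃ x : Point K, x.ord (κ x) < x.ord u := by
    by_contra hcon
    push Not at hcon
    have h1 := degree_lb hκ
    rw [finsum_congr fun y => le_antisymm (hord y) (hcon y), finsum_ord_eq_zero hu] at h1
    omega
  have hx' := hκ.div (isDiv_pt x)
  have key := degree_lb_le hu (isDiv_one (K := K)) hx' fun y => by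
    rw [Pi.one_apply, mul_one, Pi.div_apply, div_eq_mul_inv,
      y.ord_mul (hκ.ne_zero y) (inv_ne_zero (pt_ne_zero x y)), y.ord_inv]
    rcases eq_or_ne y x with rfl | hy
    · rw [ord_pt_self]; omega
    · rw [ord_pt_of_ne hy]; linarith [hord y]
  refine ⟨x, fun y => ?_⟩
  have := key.2 (by
    rw [degree_lb_div hκ (isDiv_pt x), degree_lb_pt, h, sub_self]
    exact degree_lb_const one_ne_zero) y
  rw [Pi.one_apply, mul_one] at this
  exact this

namespace DetForm

variable [Module ℂ F] [IsScalarTower ℂ K F] {co : Coord K} {E : Stalks K F}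

theorem degree_eq (d : DetForm co E) : degree E = 2 * degree (lb co.κ) := by
  haveI : Nontrivial F := Module.nontrivial_of_finrank_pos (R := K) (by rw [d.finrank_eq]; simp)
  obtain ⟨a, ha⟩ := exists_ne (0 : F)
  obtain ⟨lam, hlam, h⟩ := d.exists_isDiv ha
  have hκ := co.isDiv.mul co.isDiv
  have h1 := degree_sub_add_degree_quot d.isVectorBundle (LinearMap.ker (d.det a))
  rw [← degree_congr (d.subIso ha h) (d.isVectorBundle.sub _),
    degree_congr (d.quotIso ha hlam h) (hκ.div hlam).isVectorBundle,
    degree_lb_div hκ hlam, degree_lb_mul co.isDiv co.isDiv] at h1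
  linarith

theorem degree_lb_lt (d : DetForm co E) (hs : IsStable E) {a : F} (ha : a ≠ 0) {lam : Point K → K}
    (h : ∀ x c, c • a ∈ E x ↔ c ∈ lb lam x) : degree (lb lam) < degree (lb co.κ) := by
  have h1 := d.finrank_ker_det ha
  have h2 := hs (LinearMap.ker (d.det a)) (fun hbot => by rw [hbot, finrank_bot] at h1; omega)
    fun htop => by rw [htop, finrank_top, d.finrank_eq] at h1; omega
  rw [h1, ← degree_congr (d.subIso ha h) (d.isVectorBundle.sub _), d.degree_eq, d.finrank_eq] at h2
  push_cast at h2
  linarith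

theorem homCanonical_eq_bot (d : DetForm co E) (hs : IsStable E) : homCanonical E = ⊥ := by
  rw [eq_bot_iff]
  intro ψ hψ
  haveI := d.isVectorBundle.finite
  by_contra hne
  obtain ⟨a, ha, ha0⟩ : ∃ a ∈ LinearMap.ker (co.e.toLinearMap.comp ψ), a ≠ 0 := by
    refine Submodule.exists_mem_ne_zero_of_ne_bot fun hbot => ?_
    have h1 := LinearMap.finrank_le_finrank_of_injective (LinearMap.ker_eq_bot.1 hbot)
    rw [d.finrank_eq, Module.finrank_self] at h1
    omega
  obtain ⟨b, hb⟩ := d.exists_det_ne_zero ha0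
  obtain ⟨lam, hlam, h⟩ := d.exists_isDiv ha0
  have hκ := co.isDiv.mul co.isDiv
  have ha' : co.e (ψ a) = 0 := ha
  have hc : ∀ f, co.e (ψ f) = co.e (ψ b) / d.det a b * d.det a f := fun f => by
    have h1 := congrArg (fun z => co.e (ψ z)) (d.cramer a b f)
    simp only [map_add, map_sub, map_smul, map_zero, ha', smul_eq_mul] at h1
    field_simp
    linear_combination h1
  have hc0 : co.e (ψ b) / d.det a b ≠ 0 := by
    intro h0
    refine hne ((Submodule.mem_bot ℂ).2 (LinearMap.ext fun f => co.e.injective ?_))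
    rw [hc, h0, zero_mul, LinearMap.zero_apply, map_zero]
  have h2 := (degree_lb_le hc0 (hκ.div hlam) co.isDiv fun x => by
    obtain ⟨f, hf, h3⟩ := (d.exists_det_eq hlam h x _).1 (mem_lb_self _ x)
    rw [← h3, ← hc f]
    refine (mem_lb_iff_ord co.isDiv ?_).1 ((co.mem_iff x _).1 (mem_homCanonical.1 hψ x f hf))
    rw [hc]
    refine mul_ne_zero hc0 ?_
    rw [h3]
    exact (hκ.div hlam).ne_zero x).1
  rw [degree_lb_div hκ hlam, degree_lb_mul co.isDiv co.isDiv] at h2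
  have := d.degree_lb_lt hs ha0 h
  linarith

theorem finrank_H0_eq (d : DetForm co E) (hgenus : genus K = 3) (hs : IsStable E) :
    Module.finrank ℂ (H0 E) = 4 := by
  have := d.isVectorBundle.riemannRoch
  rw [d.homCanonical_eq_bot hs, finrank_bot, d.degree_eq, co.degree_eq, d.finrank_eq, hgenus] at this
  push_cast at this
  linarith

/-- Linearly independent sections of `E` are generically independent. -/
theorem det_ne_zero (d : DetForm co E) (hgenus : genus K = 3) (hnh : ¬ IsHyperelliptic K) (hs : IsStable E)
    (hgg : IsGloballyGenerated E) {a b : F} (ha : a ∈ H0 E) (hb : b ∈ H0 E)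
    (hab : LinearIndependent ℂ ![a, b]) : d.det a b ≠ 0 := by
  intro hzero
  rw [LinearIndependent.pair_iff] at hab
  have ha0 : a ≠ 0 := by
    rintro rfl
    simpa using hab 1 0 (by simp)
  obtain ⟨lam, hlam, h⟩ := d.exists_isDiv ha0
  obtain ⟨c, rfl⟩ := d.mem_ker_det ha0 hzero
  have hκ := co.isDiv.mul co.isDiv
  have hdκ := co.degree_eq
  have hκ3 := co.h0_eq_genus
  rw [hgenus] at hdκ hκ3
  have h2 : 2 ≤ h0 lam := by
    haveI := hlam.finite_H0
    let v : Fin 2 → H0 (lb lam) :=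
      ![⟨1, fun x => (h x 1).1 (by rw [one_smul]; exact ha x)⟩, ⟨c, fun x => (h x c).1 (hb x)⟩]
    have hv : LinearIndependent ℂ v := LinearIndependent.pair_iff.2 fun p q hpq => hab p q (by
      have h1 : p • (1 : K) + q • c = 0 := congrArg Subtype.val hpq
      have h2 := congrArg (fun z : K => z • a) h1
      simpa [add_smul] using h2)
    simpa [h0] using hv.fintype_card_le_finrank
  have h3 := three_le_degree_of_two_le_h0 hnh hlam h2
  have h4 := d.degree_lb_lt hs ha0 h
  have hdlam : degree (lb lam) = 3 := by push_cast at hdκ; omega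
  have hμ := hκ.div hlam
  have hdμ : degree (lb (co.κ * co.κ / lam)) = 5 := by
    rw [degree_lb_div hκ hlam, degree_lb_mul co.isDiv co.isDiv, hdκ, hdlam]; norm_num
  have hμ3 : h0 (co.κ * co.κ / lam) = 3 := by
    have h5 := co.riemannRoch hμ
    rw [h0_eq_zero_of_degree_neg (co.isDiv.div hμ)
      (by rw [degree_lb_div co.isDiv hμ, hdκ, hdμ]; norm_num), hdμ, hgenus] at h5
    push_cast at h5
    linarith
  obtain ⟨u, hu, hu0⟩ : ∃ u ∈ H0 (lb (co.κ / lam)), u ≠ 0 := exists_ne_zero_of_h0_pos (by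
    have h5 := co.riemannRoch hlam
    rw [hdlam, hgenus] at h5
    push_cast at h5
    omega)
  obtain ⟨x, hx⟩ := exists_ord_eq_of_degree_one (co.isDiv.div hlam)
    (by rw [degree_lb_div co.isDiv hlam, hdκ, hdlam]; norm_num) hu0 hu
  have hν := hμ.div (isDiv_pt x)
  have h6 : h0 (co.κ * co.κ / lam / pt x) = h0 co.κ := h0_eq_of_ord hν co.isDiv hu0 fun y => by
    rw [y.ord_mul hu0 (co.isDiv.ne_zero y), ← hx y, ← y.ord_mul
      (((co.isDiv.div hlam).div (isDiv_pt x)).ne_zero y) (co.isDiv.ne_zero y)]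
    congr 1
    simp only [Pi.div_apply, Pi.mul_apply]
    ring
  haveI := hμ.finite_H0
  have h7 : H0 (lb (co.κ * co.κ / lam / pt x)) = H0 (lb (co.κ * co.κ / lam)) :=
    Submodule.eq_of_le_of_finrank_eq (H0_lb_mono hμ hν (ord_div_pt_ge _ hμ x))
      (show h0 _ = h0 _ by rw [h6, hμ3, hκ3])
  have h8 : E x ≤ pullback (d.det a) (lb (co.κ * co.κ / lam / pt x)) x := by
    rw [← hgg x]
    refine spanAt_le.2 fun s hs => ?_
    have h9 : d.det a s ∈ H0 (lb (co.κ * co.κ / lam)) :=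
      fun y => (d.exists_det_eq hlam h y _).2 ⟨s, hs y, rfl⟩
    rw [← h7] at h9
    exact h9 x
  obtain ⟨f, hf, h9⟩ := (d.exists_det_eq hlam h x _).1 (mem_lb_self _ x)
  have h10 : d.det a f ∈ lb (co.κ * co.κ / lam / pt x) x := h8 hf
  rw [h9, mem_lb_iff_ord hν (hμ.ne_zero x), Pi.div_apply _ (pt x), div_eq_mul_inv _ (pt x x),
    x.ord_mul (hμ.ne_zero x) (inv_ne_zero (pt_ne_zero x x)), x.ord_inv, ord_pt_self] at h10
  omega

end DetForm
end Global

section Dual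

variable {K : Type u} [Field K] [Algebra ℂ K] [hK : Fact (IsFunctionField K)]
  {F : Type v} [AddCommGroup F] [Module K F]

/-- A line subbundle, generated by `n` on the generic fibre, of a rank two bundle, and the quotient
by it, generically given by `φ`, both as line bundles of divisors. -/
structure LineSplit (M : Stalks K F) (n : F) (φ : Module.Dual K F) (lam μ : Point K → K) :
    Prop where
  isVectorBundle : IsVectorBundle M
  finrank_eq : Module.finrank K F = 2
  ne_zero : n ≠ 0
  form_ne_zero : φ ≠ 0
  form_apply : φ n = 0
  isDiv_sub : IsDiv lam
  isDiv_quot : IsDiv μ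
  mem_sub : ∀ x c, c • n ∈ M x ↔ c ∈ lb lam x
  mem_quot : ∀ x y, y ∈ lb μ x ↔ ∃ f ∈ M x, φ f = y

theorem finrank_ker_form (hF : Module.finrank K F = 2) {φ : Module.Dual K F} (hφ : φ ≠ 0) :
    Module.finrank K (LinearMap.ker φ) = 1 := by
  haveI : Module.Finite K F := Module.finite_of_finrank_pos (by omega)
  have h1 := LinearMap.finrank_range_add_finrank_ker φ
  rw [LinearMap.range_eq_top.2 (LinearMap.surjective hφ), finrank_top, Module.finrank_self, hF] at h1
  omega

theorem IsVectorBundle.exists_lineSplit {M : Stalks K F} (hM : IsVectorBundle M)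
    (hF : Module.finrank K F = 2) {n : F} (hn : n ≠ 0) {φ : Module.Dual K F} (hφ : φ ≠ 0)
    (hφn : φ n = 0) : ∃ lam μ, LineSplit M n φ lam μ := by
  have hs := LinearMap.surjective hφ
  have h1 := finrank_ker_form hF hφ
  have hn' : (⟨n, hφn⟩ : LinearMap.ker φ) ≠ 0 := fun h => hn (congrArg Subtype.val h)
  obtain ⟨lam, h2, -, h3⟩ := (hM.sub _).exists_isDiv h1 hn'
  let e := φ.quotKerEquivOfSurjective hs
  have h4 : Module.finrank K (F ⧸ LinearMap.ker φ) = 1 := by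
    rw [e.finrank_eq, Module.finrank_self]
  obtain ⟨μ, h5, -, h6⟩ := (hM.quot _).exists_isDiv h4 (f := e.symm 1)
    (fun h => one_ne_zero ((LinearEquiv.map_eq_zero_iff _).1 h))
  refine ⟨lam, μ, hM, hF, hn, hφ, hφn, h2, h5, fun x c => h3 x c, fun x y => ?_⟩
  rw [← h6, ← map_smul, smul_eq_mul, mul_one]
  constructor
  · rintro ⟨f, hf, h⟩
    refine ⟨f, hf, e.symm.injective ?_⟩
    rw [← h]
    exact e.injective (by rw [LinearEquiv.apply_symm_apply]; rfl)
  · rintro ⟨f, hf, rfl⟩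
    exact ⟨f, hf, e.injective (by rw [LinearEquiv.apply_symm_apply]; rfl)⟩

theorem mem_dual_of_basis {M : Stalks K F} {x : Point K} {ι : Type*} [Finite ι] [DecidableEq ι]
    (b : Module.Basis ι K F) (h : M x = spanAt x (Set.range b)) :
    dual M x = spanAt x (Set.range b.dualBasis) := by
  ext f
  rw [mem_spanAt_basis]
  simp only [Module.Basis.dualBasis_repr]
  constructor
  · intro hf i
    exact hf _ (by rw [h]; exact subset_spanAt _ ⟨i, rfl⟩)
  · intro hf a ha
    rw [h] at ha
    have : spanAt x (Set.range b) ≤ pullback f (lb 1) x := by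
      refine spanAt_le.2 ?_
      rintro _ ⟨i, rfl⟩
      exact mem_lb_one.2 (hf i)
    exact mem_lb_one.1 (this ha)

namespace LineSplit

variable {M : Stalks K F} {n : F} {φ : Module.Dual K F} {lam μ : Point K → K}

theorem mem_ker (h : LineSplit M n φ lam μ) {f : F} (hf : φ f = 0) : ∃ c : K, f = c • n := by
  obtain ⟨c, hc⟩ := (finrank_eq_one_iff_of_nonzero' (⟨n, h.form_apply⟩ : LinearMap.ker φ)
    fun h0 => h.ne_zero (congrArg Subtype.val h0)).1
    (finrank_ker_form h.finrank_eq h.form_ne_zero) ⟨f, hf⟩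
  exact ⟨c, (congrArg Subtype.val hc).symm⟩

/-- The subbundle is the line bundle of a divisor. -/
def subIso (h : LineSplit M n φ lam μ) : BundleIso (lb lam) (sub M (LinearMap.ker φ)) where
  equiv := LinearEquiv.ofBijective
    (LinearMap.toSpanSingleton K _ (⟨n, h.form_apply⟩ : LinearMap.ker φ))
    ⟨fun c c' hc => smul_left_injective K h.ne_zero (congrArg Subtype.val hc), fun b => by
      obtain ⟨c, hc⟩ := h.mem_ker b.2
      exact ⟨c, Subtype.ext hc.symm⟩⟩
  mem_iff x c := h.mem_sub x c

/-- The quotient bundle is the line bundle of a divisor. -/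
def quotIso (h : LineSplit M n φ lam μ) : BundleIso (quot M (LinearMap.ker φ)) (lb μ) where
  equiv := φ.quotKerEquivOfSurjective (LinearMap.surjective h.form_ne_zero)
  mem_iff x z := by
    rw [h.mem_quot]
    constructor
    · rintro ⟨f, hf, hz⟩
      refine ⟨f, hf, (φ.quotKerEquivOfSurjective (LinearMap.surjective
        h.form_ne_zero)).injective ?_⟩
      rw [← hz]
      rfl
    · rintro ⟨f, hf, rfl⟩
      exact ⟨f, hf, rfl⟩

theorem exists_basis (h : LineSplit M n φ lam μ) (x : Point K) :
    ∃ b : Module.Basis (Fin 2) K F, b 0 = lam x • n ∧ M x = spanAt x (Set.range b) := by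
  obtain ⟨m, hm, hφm⟩ := (h.mem_quot x _).1 (mem_lb_self μ x)
  have hli : LinearIndependent K ![lam x • n, m] := by
    rw [LinearIndependent.pair_iff]
    intro s t hst
    have h1 := congrArg φ hst
    rw [map_add, map_smul, map_smul, map_smul, h.form_apply, smul_zero, smul_zero, zero_add, hφm,
      map_zero, smul_eq_mul, mul_eq_zero, or_iff_left (h.isDiv_quot.ne_zero x)] at h1
    rw [h1, zero_smul, add_zero, smul_smul, smul_eq_zero, or_iff_left h.ne_zero, mul_eq_zero,
      or_iff_left (h.isDiv_sub.ne_zero x)] at hst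
    exact ⟨hst, h1⟩
  have hb := coe_basisOfLinearIndependentOfCardEqFinrank hli (by simp [h.finrank_eq])
  refine ⟨basisOfLinearIndependentOfCardEqFinrank hli (by simp [h.finrank_eq]), by rw [hb]; rfl, ?_⟩
  rw [hb]
  apply le_antisymm
  · intro f hf
    obtain ⟨g, hg, h2⟩ := mem_spanAt_singleton.1 ((h.mem_quot x _).2 ⟨f, hf, rfl⟩)
    obtain ⟨c, hc⟩ := h.mem_ker (f := f - g • m) (by rw [map_sub, map_smul, hφm, h2, sub_self])
    have h3 : c • n ∈ M x := by
      rw [← hc]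
      exact sub_mem hf (smul_mem_stalk _ hg hm)
    obtain ⟨r, hr, rfl⟩ := mem_spanAt_singleton.1 ((h.mem_sub x c).1 h3)
    rw [sub_eq_iff_eq_add.1 hc, smul_assoc]
    exact add_mem (smul_mem_stalk _ hr (subset_spanAt _ ⟨0, rfl⟩))
      (smul_mem_stalk _ hg (subset_spanAt _ ⟨1, rfl⟩))
  · refine spanAt_le.2 ?_
    rintro _ ⟨i, rfl⟩
    fin_cases i
    · exact (h.mem_sub x _).2 (mem_lb_self lam x)
    · exact hm

theorem isVectorBundle_dual (h : LineSplit M n φ lam μ) : IsVectorBundle (dual M) := by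
  obtain ⟨b, hb⟩ := h.isVectorBundle.exists_basis
  refine .of_basis b.dualBasis (fun x => ?_) (hb.subset fun x hx hcon => hx ?_)
  · obtain ⟨b', -, hb'⟩ := h.exists_basis x
    rw [mem_dual_of_basis b' hb']
    exact isLattice_basis _
  · exact mem_dual_of_basis b hcon

/-- The dual of a line subbundle and of the quotient by it. -/
theorem dual (h : LineSplit M n φ lam μ) :
    LineSplit (dual M) φ (Module.Dual.eval K F n) μ⁻¹ lam⁻¹ where
  isVectorBundle := h.isVectorBundle_dual
  finrank_eq := by rw [Subspace.dual_finrank_eq, h.finrank_eq]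
  ne_zero := h.form_ne_zero
  form_ne_zero h0 := h.ne_zero ((Module.eval_apply_eq_zero_iff K n).1 h0)
  form_apply := h.form_apply
  isDiv_sub := h.isDiv_quot.inv
  isDiv_quot := h.isDiv_sub.inv
  mem_sub x c := by
    rw [mem_lb h.isDiv_quot.inv, Pi.inv_apply, div_inv_eq_mul]
    constructor
    · intro hc
      obtain ⟨m, hm, hφm⟩ := (h.mem_quot x _).1 (mem_lb_self μ x)
      have := hc m hm
      rwa [LinearMap.smul_apply, hφm, smul_eq_mul] at this
    · intro hc a ha
      obtain ⟨g, hg, h2⟩ := mem_spanAt_singleton.1 ((h.mem_quot x _).2 ⟨a, ha, rfl⟩)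
      rw [LinearMap.smul_apply, h2, smul_eq_mul, smul_eq_mul, mul_left_comm]
      exact x.ring.mul_mem _ _ hg hc
  mem_quot x y := by
    rw [mem_lb h.isDiv_sub.inv, Pi.inv_apply, div_inv_eq_mul]
    constructor
    · intro hy
      obtain ⟨b, hb0, hb⟩ := h.exists_basis x
      refine ⟨(y * lam x) • b.dualBasis 0, ?_, ?_⟩
      · rw [mem_dual_of_basis b hb]
        exact smul_mem_stalk _ hy (subset_spanAt _ ⟨0, rfl⟩)
      · have h1 : n = (lam x)⁻¹ • b 0 := by
          rw [hb0, smul_smul, inv_mul_cancel₀ (h.isDiv_sub.ne_zero x), one_smul]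
        rw [Module.Dual.eval_apply, LinearMap.smul_apply, h1, map_smul,
          Module.Basis.dualBasis_apply_self, if_pos rfl, smul_eq_mul, smul_eq_mul, mul_one,
          mul_assoc, mul_inv_cancel₀ (h.isDiv_sub.ne_zero x), mul_one]
    · rintro ⟨f, hf, rfl⟩
      have := hf _ ((h.mem_sub x _).2 (mem_lb_self lam x))
      rwa [map_smul, smul_eq_mul, mul_comm] at this

variable [hg : FiniteDimensional ℂ (H0 (canonical K))] [Module ℂ F] [IsScalarTower ℂ K F]

theorem degree_sub (h : LineSplit M n φ lam μ) :
    degree (sub M (LinearMap.ker φ)) = degree (lb lam) :=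
  (degree_congr h.subIso (h.isVectorBundle.sub _)).symm

theorem degree_eq (h : LineSplit M n φ lam μ) :
    degree M = degree (lb lam) + degree (lb μ) := by
  rw [← degree_sub_add_degree_quot h.isVectorBundle (LinearMap.ker φ), h.degree_sub,
    degree_congr h.quotIso h.isDiv_quot.isVectorBundle]

theorem degree_dual (h : LineSplit M n φ lam μ) : degree (Curve.dual M) = - degree M := by
  rw [h.dual.degree_eq, h.degree_eq, degree_lb_inv h.isDiv_sub, degree_lb_inv h.isDiv_quot]
  ring

end LineSplit

/-- A line in the dual of a plane consists of the forms that vanish at a vector. -/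
theorem exists_eq_ker_eval (hF : Module.finrank K F = 2) {W : Submodule K (Module.Dual K F)}
    (hW : Module.finrank K W = 1) :
    ∃ n : F, n ≠ 0 ∧ ∃ φ : Module.Dual K F, φ ≠ 0 ∧ φ n = 0 ∧
      W = LinearMap.ker (Module.Dual.eval K F n) := by
  haveI : Module.Finite K F := Module.finite_of_finrank_pos (by omega)
  haveI : Nontrivial W := Module.nontrivial_of_finrank_pos (R := K) (by omega)
  obtain ⟨φ, hφ⟩ := exists_ne (0 : W)
  have hφ' : (φ : Module.Dual K F) ≠ 0 := fun h => hφ (Subtype.ext h)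
  have h1 := finrank_ker_form hF hφ'
  haveI : Nontrivial (LinearMap.ker (φ : Module.Dual K F)) :=
    Module.nontrivial_of_finrank_pos (R := K) (by omega)
  obtain ⟨n, hn⟩ := exists_ne (0 : LinearMap.ker (φ : Module.Dual K F))
  have hn' : (n : F) ≠ 0 := fun h => hn (Subtype.ext h)
  refine ⟨n, hn', φ, hφ', n.2, Submodule.eq_of_le_of_finrank_eq ?_ ?_⟩
  · intro f hf
    obtain ⟨c, hc⟩ := (finrank_eq_one_iff_of_nonzero' φ hφ).1 hW ⟨f, hf⟩
    have hc' : c • (φ : Module.Dual K F) = f := congrArg Subtype.val hc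
    rw [LinearMap.mem_ker, Module.Dual.eval_apply, ← hc', LinearMap.smul_apply,
      show (φ : Module.Dual K F) n = 0 from n.2, smul_zero]
  · rw [hW, finrank_ker_form (by rw [Subspace.dual_finrank_eq, hF])
      (fun h0 => hn' ((Module.eval_apply_eq_zero_iff K (n : F)).1 h0))]

/-- A nonzero vector of a plane is the kernel of a linear form. -/
theorem exists_form_apply_eq_zero (hF : Module.finrank K F = 2) (n : F) :
    ∃ φ : Module.Dual K F, φ ≠ 0 ∧ φ n = 0 := by
  haveI : Module.Finite K F := Module.finite_of_finrank_pos (by omega)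
  by_contra hcon
  push Not at hcon
  have h1 : LinearMap.ker (Module.Dual.eval K F n) = ⊥ := by
    rw [eq_bot_iff]
    intro φ hφ
    by_contra h0
    exact hcon φ h0 hφ
  have h2 := LinearMap.finrank_le_finrank_of_injective (LinearMap.ker_eq_bot.1 h1)
  rw [Subspace.dual_finrank_eq, hF, Module.finrank_self] at h2
  omega

/-- A criterion for the semistability of the dual of a rank two bundle. -/
theorem IsVectorBundle.isSemistable_dual [hg : FiniteDimensional ℂ (H0 (canonical K))]
    [Module ℂ F] [IsScalarTower ℂ K F] {M : Stalks K F} (hM : IsVectorBundle M)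
    (hF : Module.finrank K F = 2)
    (h : ∀ n : F, n ≠ 0 → ∀ lam : Point K → K, IsDiv lam →
      (∀ x c, c • n ∈ M x ↔ c ∈ lb lam x) → 2 * degree (lb lam) ≤ degree M) :
    IsSemistable (dual M) := by
  intro W hbot htop
  haveI := hM.finite
  have hF' : Module.finrank K (Module.Dual K F) = 2 := by
    rw [Subspace.dual_finrank_eq, hF]
  have hW : Module.finrank K W = 1 := by
    have h1 := Submodule.finrank_lt htop
    have h2 := Submodule.one_le_finrank_iff.2 hbot
    omega
  obtain ⟨n, hn, φ, hφ, hφn, rfl⟩ := exists_eq_ker_eval hF hW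
  obtain ⟨lam, μ, hl⟩ := hM.exists_lineSplit hF hn hφ hφn
  have h1 := h n hn lam hl.isDiv_sub hl.mem_sub
  have h2 := hl.degree_eq
  rw [hl.dual.degree_sub, hW, hF', hl.degree_dual, degree_lb_inv hl.isDiv_quot]
  push_cast
  linarith

end Dual

section DualSpan

variable {K : Type u} [Field K] [Algebra ℂ K] [hK : Fact (IsFunctionField K)]
  {V : Type w} [AddCommGroup V] [Module ℂ V]

variable (K) in
/-- The contraction of the trivial bundle `V ⊗ 𝒪_C` with a linear form on `V`. -/
def contract (l : Module.Dual ℂ V) : K ⊗[ℂ] V →ₗ[K] K :=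
  ((Algebra.linearMap ℂ K).comp l).liftBaseChange K

theorem contract_tmul (l : Module.Dual ℂ V) (k : K) (v : V) :
    contract K l (k ⊗ₜ v) = l v • k := by
  rw [contract, LinearMap.liftBaseChange_tmul, LinearMap.comp_apply, Algebra.linearMap_apply,
    smul_eq_mul, Algebra.smul_def, mul_comm]

theorem trivialBundle_eq {ι : Type*} [Finite ι] (h : Module.Basis ι ℂ V) :
    trivialBundle K V = freeBundle (K := K) (Algebra.TensorProduct.basis K h) := by
  haveI := Fintype.ofFinite ι
  funext x
  apply le_antisymm
  · refine spanAt_le.2 ?_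
    rintro _ ⟨v, rfl⟩
    change (1 : K) ⊗ₜ[ℂ] v ∈ freeBundle (K := K) (Algebra.TensorProduct.basis K h) x
    rw [← h.sum_repr v, TensorProduct.tmul_sum]
    refine sum_mem fun i _ => ?_
    rw [TensorProduct.tmul_smul, ← algebraMap_smul K]
    refine smul_mem_stalk _ (x.const_mem _) (subset_spanAt _ ⟨i, ?_⟩)
    rw [Algebra.TensorProduct.basis_apply]
  · refine spanAt_le.2 ?_
    rintro _ ⟨i, rfl⟩
    rw [Algebra.TensorProduct.basis_apply]
    exact subset_spanAt _ ⟨h i, rfl⟩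

theorem contract_mem {x : Point K} {z : K ⊗[ℂ] V} (hz : z ∈ trivialBundle K V x)
    (l : Module.Dual ℂ V) : contract K l z ∈ x.ring := by
  have : trivialBundle K V x ≤ pullback (contract K l) (lb 1) x := by
    refine spanAt_le.2 ?_
    rintro _ ⟨v, rfl⟩
    refine mem_lb_one.2 ?_
    change contract K l (1 ⊗ₜ v) ∈ x.ring
    rw [contract_tmul, Algebra.smul_def, mul_one]
    exact x.const_mem _
  exact mem_lb_one.1 (this hz)

theorem tmul_mem_trivialBundle {x : Point K} {k : K} (hk : k ∈ x.ring) (v : V) :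
    k ⊗ₜ[ℂ] v ∈ trivialBundle K V x := by
  rw [show k ⊗ₜ[ℂ] v = k • ((1 : K) ⊗ₜ[ℂ] v) by
    rw [TensorProduct.smul_tmul', smul_eq_mul, mul_one]]
  exact smul_mem_stalk _ hk (subset_spanAt _ ⟨v, rfl⟩)

theorem eq_sum_contract {ι : Type*} [Fintype ι] [DecidableEq ι] (h : Module.Basis ι ℂ V)
    (z : K ⊗[ℂ] V) : z = ∑ i, contract K (h.coord i) z ⊗ₜ[ℂ] h i := by
  induction z with
  | zero => simp
  | add a b ha hb =>
    conv_lhs => rw [ha, hb]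
    simp only [map_add, TensorProduct.add_tmul, Finset.sum_add_distrib]
  | tmul k v =>
    conv_lhs => rw [← h.sum_repr v, TensorProduct.tmul_sum]
    refine Finset.sum_congr rfl fun i _ => ?_
    rw [contract_tmul, TensorProduct.smul_tmul, Module.Basis.coord_apply]

theorem isVectorBundle_trivialBundle [FiniteDimensional ℂ V] :
    IsVectorBundle (trivialBundle K V) := by
  rw [trivialBundle_eq (Module.finBasis ℂ V)]
  exact isVectorBundle_freeBundle _

/-- A space of dimension at most two is spanned by two vectors. -/
theorem exists_pair_of_finrank_le_two [FiniteDimensional ℂ V] (h : Module.finrank ℂ V ≤ 2) :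
    ∃ u v : V, ∀ z, ∃ α β : ℂ, z = α • u + β • v := by
  obtain h | h | h : Module.finrank ℂ V = 0 ∨ Module.finrank ℂ V = 1 ∨ Module.finrank ℂ V = 2 := by
    omega
  · haveI := Module.finrank_zero_iff.1 h
    exact ⟨0, 0, fun z => ⟨0, 0, Subsingleton.elim _ _⟩⟩
  · obtain ⟨u, -, hu⟩ := finrank_eq_one_iff'.1 h
    exact ⟨u, 0, fun z => (hu z).elim fun c hc => ⟨c, 0, by rw [hc, smul_zero, add_zero]⟩⟩
  · let b := Module.finBasisOfFinrankEq ℂ V h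
    exact ⟨b 0, b 1, fun z => ⟨b.repr z 0, b.repr z 1, by
      conv_lhs => rw [← b.sum_repr z]
      rw [Fin.sum_univ_two]⟩⟩

variable {F : Type v} [AddCommGroup F] [Module K F] [Module ℂ F] [IsScalarTower ℂ K F]
  {E : Stalks K F}

theorem evaluation_tmul (k : K) (s : H0 E) : evaluation E (k ⊗ₜ s) = k • (s : F) := by
  rw [evaluation, LinearMap.liftBaseChange_tmul]
  rfl

theorem exists_evaluation_eq (hgg : IsGloballyGenerated E) {x : Point K} {f : F} (hf : f ∈ E x) :
    ∃ z ∈ trivialBundle K (H0 E) x, evaluation E z = f := by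
  have : E x ≤ (trivialBundle K (H0 E) x).map ((evaluation E).restrictScalars x.O) := by
    rw [← hgg x]
    refine spanAt_le.2 fun s hs => ⟨1 ⊗ₜ ⟨s, hs⟩, subset_spanAt _ ⟨_, rfl⟩, ?_⟩
    change evaluation E _ = _
    rw [evaluation_tmul, one_smul]
  obtain ⟨z, hz, h⟩ := this hf
  exact ⟨z, hz, h⟩

theorem evaluation_mem {x : Point K} {z : K ⊗[ℂ] H0 E} (hz : z ∈ trivialBundle K (H0 E) x) :
    evaluation E z ∈ E x := by
  have : trivialBundle K (H0 E) x ≤ pullback (evaluation E) E x := by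
    refine spanAt_le.2 ?_
    rintro _ ⟨s, rfl⟩
    change evaluation E (1 ⊗ₜ s) ∈ E x
    rw [evaluation_tmul, one_smul]
    exact s.2 x
  exact this hz

theorem evaluation_surjective (hE : IsVectorBundle E) (hgg : IsGloballyGenerated E) :
    Function.Surjective (evaluation E) := by
  obtain ⟨x⟩ := exists_point hK.out
  rw [← LinearMap.range_eq_top, eq_top_iff, ← hE.span_eq_top x, Submodule.span_le]
  intro f hf
  obtain ⟨z, -, hz⟩ := exists_evaluation_eq hgg hf
  exact ⟨z, hz⟩

/-- A globally generated bundle is a quotient of the trivial bundle of its sections. -/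
def quotTrivialIso (hE : IsVectorBundle E) (hgg : IsGloballyGenerated E) :
    BundleIso (quot (trivialBundle K (H0 E)) (LinearMap.ker (evaluation E))) E where
  equiv := (evaluation E).quotKerEquivOfSurjective (evaluation_surjective hE hgg)
  mem_iff x z := by
    constructor
    · intro h
      obtain ⟨a, ha, h⟩ := exists_evaluation_eq hgg h
      refine ⟨a, ha, ((evaluation E).quotKerEquivOfSurjective
        (evaluation_surjective hE hgg)).injective ?_⟩
      rw [← h]
      rfl
    · rintro ⟨a, ha, rfl⟩
      exact evaluation_mem ha

variable (E) in
/-- The kernel of the evaluation `H⁰(E) ⊗ 𝒪_C → E`. -/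
def kernelBundle : Stalks K (LinearMap.ker (evaluation E)) :=
  sub (trivialBundle K (H0 E)) (LinearMap.ker (evaluation E))

variable [hg : FiniteDimensional ℂ (H0 (canonical K))]

theorem isVectorBundle_kernelBundle (hE : IsVectorBundle E) : IsVectorBundle (kernelBundle E) := by
  haveI := hE.finiteDimensional_H0
  exact isVectorBundle_trivialBundle.sub _

theorem degree_kernelBundle (hE : IsVectorBundle E) (hgg : IsGloballyGenerated E) :
    degree (kernelBundle E) = - degree E := by
  haveI := hE.finiteDimensional_H0
  have h1 := degree_sub_add_degree_quot (isVectorBundle_trivialBundle (K := K) (V := H0 E))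
    (LinearMap.ker (evaluation E))
  rw [degree_congr (quotTrivialIso hE hgg) hE] at h1
  have h2 : degree (trivialBundle K (H0 E)) = 0 := by
    rw [trivialBundle_eq (Module.finBasis ℂ (H0 E)), degree_freeBundle]
  rw [h2] at h1
  exact eq_neg_of_add_eq_zero_left h1

theorem finrank_ker_evaluation (hE : IsVectorBundle E) (hgg : IsGloballyGenerated E) :
    Module.finrank K (LinearMap.ker (evaluation E)) + Module.finrank K F =
      Module.finrank ℂ (H0 E) := by
  haveI := hE.finiteDimensional_H0
  have h1 := LinearMap.finrank_range_add_finrank_ker (evaluation E)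
  rw [LinearMap.range_eq_top.2 (evaluation_surjective hE hgg), finrank_top,
    Module.finrank_baseChange] at h1
  omega

namespace DetForm

variable {co : Coord K}

theorem finrank_ker_evaluation (d : DetForm co E) (hgenus : genus K = 3) (hs : IsStable E)
    (hgg : IsGloballyGenerated E) : Module.finrank K (LinearMap.ker (evaluation E)) = 2 := by
  have := Curve.finrank_ker_evaluation d.isVectorBundle hgg
  rw [d.finrank_H0_eq hgenus hs, d.finrank_eq] at this
  omega

/-- A tensor of rank at most two in the kernel of the evaluation vanishes. -/
theorem eq_zero_of_pair (d : DetForm co E) (hgenus : genus K = 3) (hnh : ¬ IsHyperelliptic K)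
    (hs : IsStable E) (hgg : IsGloballyGenerated E) {u v : K} {a b : H0 E}
    (h : u • (a : F) + v • (b : F) = 0) : u ⊗ₜ[ℂ] a + v ⊗ₜ[ℂ] b = 0 := by
  by_cases hab : LinearIndependent ℂ ![(a : F), (b : F)]
  · have h1 := d.det_ne_zero hgenus hnh hs hgg a.2 b.2 hab
    have h2 := congrArg (d.det a) h
    have h3 := congrArg (d.det b) h
    rw [map_add, LinearMap.map_smul, LinearMap.map_smul, d.det_self, smul_zero, zero_add,
      map_zero, smul_eq_mul, mul_eq_zero, or_iff_left h1] at h2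
    rw [map_add, LinearMap.map_smul, LinearMap.map_smul, d.det_self, smul_zero, add_zero,
      d.det_swap (a : F), map_zero, smul_eq_mul, mul_eq_zero, or_iff_left (neg_ne_zero.2 h1)] at h3
    rw [h2, h3, TensorProduct.zero_tmul, TensorProduct.zero_tmul, add_zero]
  · rw [LinearIndependent.pair_iff] at hab
    push Not at hab
    obtain ⟨p, q, hpq, hne⟩ := hab
    obtain ⟨s, γ, ε, ha, hb⟩ : ∃ (s : H0 E) (γ ε : ℂ), a = γ • s ∧ b = ε • s := by
      have hpq' : p • a + q • b = 0 := Subtype.ext hpq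
      rcases eq_or_ne p 0 with rfl | hp
      · have hq := hne rfl
        rw [zero_smul, zero_add, smul_eq_zero, or_iff_right hq] at hpq'
        exact ⟨a, 1, 0, (one_smul _ _).symm, by rw [hpq', zero_smul]⟩
      · refine ⟨b, -(p⁻¹ * q), 1, ?_, (one_smul _ _).symm⟩
        rw [neg_smul, mul_smul, ← sub_eq_zero, sub_neg_eq_add]
        apply smul_right_injective _ hp
        simp only [smul_add, smul_smul, mul_inv_cancel_left₀ hp, smul_zero]
        exact hpq'
    have h1 : u ⊗ₜ[ℂ] a + v ⊗ₜ[ℂ] b = (γ • u + ε • v) ⊗ₜ[ℂ] s := by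
      rw [ha, hb, TensorProduct.add_tmul, TensorProduct.smul_tmul, TensorProduct.smul_tmul]
    have h2 : (γ • u + ε • v) • (s : F) = 0 := by
      have : evaluation E (u ⊗ₜ[ℂ] a + v ⊗ₜ[ℂ] b) = 0 := by
        rw [map_add, evaluation_tmul, evaluation_tmul, h]
      rwa [h1, evaluation_tmul] at this
    rw [h1]
    rcases smul_eq_zero.1 h2 with h3 | h3
    · rw [h3, TensorProduct.zero_tmul]
    · rw [show s = 0 from Subtype.ext h3, TensorProduct.tmul_zero]

/-- The coordinates of a generic point of the kernel of the evaluation generate a line bundle of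
degree at least four. -/
theorem degree_le_of_ker (d : DetForm co E) (hgenus : genus K = 3) (hnh : ¬ IsHyperelliptic K)
    (hs : IsStable E) (hgg : IsGloballyGenerated E) {n : LinearMap.ker (evaluation E)}
    (hn : n ≠ 0) {lam : Point K → K} (hlam : IsDiv lam)
    (h : ∀ x c, c • n ∈ kernelBundle E x ↔ c ∈ lb lam x) : degree (lb lam) ≤ -4 := by
  haveI := d.isVectorBundle.finiteDimensional_H0
  haveI := hlam.inv.finite_H0
  have hc : ∀ l : Module.Dual ℂ (H0 E), contract K l (n : K ⊗[ℂ] H0 E) ∈ H0 (lb lam⁻¹) := by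
    intro l x
    rw [mem_lb hlam.inv, Pi.inv_apply, div_inv_eq_mul, mul_comm, ← smul_eq_mul, ← map_smul]
    exact contract_mem ((h x _).2 (mem_lb_self lam x)) l
  have h3 : 3 ≤ h0 lam⁻¹ := by
    by_contra hcon
    obtain ⟨u, v, huv⟩ := exists_pair_of_finrank_le_two (V := H0 (lb lam⁻¹))
      (show h0 lam⁻¹ ≤ 2 by omega)
    let b := Module.finBasis ℂ (H0 E)
    choose α β hαβ using fun i => huv ⟨_, hc (b.coord i)⟩
    have hαβ' : ∀ i, contract K (b.coord i) (n : K ⊗[ℂ] H0 E) = α i • (u : K) + β i • (v : K) :=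
      fun i => congrArg Subtype.val (hαβ i)
    have h1 : (n : K ⊗[ℂ] H0 E) = (u : K) ⊗ₜ[ℂ] (∑ i, α i • b i) + (v : K) ⊗ₜ[ℂ] (∑ i, β i • b i) := by
      rw [eq_sum_contract b (n : K ⊗[ℂ] H0 E), TensorProduct.tmul_sum, TensorProduct.tmul_sum,
        ← Finset.sum_add_distrib]
      refine Finset.sum_congr rfl fun i _ => ?_
      rw [hαβ', TensorProduct.add_tmul, TensorProduct.smul_tmul, TensorProduct.smul_tmul]
    have h2 : evaluation E (n : K ⊗[ℂ] H0 E) = 0 := n.2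
    rw [h1, map_add, evaluation_tmul, evaluation_tmul] at h2
    exact hn (Subtype.ext (h1.trans (d.eq_zero_of_pair hgenus hnh hs hgg h2)))
  have := four_le_degree_of_three_le_h0 hnh hlam.inv h3
  rw [degree_lb_inv hlam] at this
  linarith

theorem isVectorBundle_dualSpan (d : DetForm co E) (hgenus : genus K = 3) (hs : IsStable E)
    (hgg : IsGloballyGenerated E) :
    IsVectorBundle (dualSpan E) ∧ degree (dualSpan E) = 8 := by
  have hF := d.finrank_ker_evaluation hgenus hs hgg
  haveI : Nontrivial (LinearMap.ker (evaluation E)) :=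
    Module.nontrivial_of_finrank_pos (R := K) (by omega)
  obtain ⟨n, hn⟩ := exists_ne (0 : LinearMap.ker (evaluation E))
  obtain ⟨φ, hφ, hφn⟩ := exists_form_apply_eq_zero hF n
  obtain ⟨lam, μ, h⟩ := (isVectorBundle_kernelBundle d.isVectorBundle).exists_lineSplit hF hn hφ hφn
  refine ⟨h.isVectorBundle_dual, ?_⟩
  have := h.degree_dual
  rw [degree_kernelBundle d.isVectorBundle hgg, neg_neg, d.degree_eq, co.degree_eq, hgenus] at this
  exact this.trans (by norm_num)

theorem isSemistable_dualSpan (d : DetForm co E) (hgenus : genus K = 3) (hnh : ¬ IsHyperelliptic K)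
    (hs : IsStable E) (hgg : IsGloballyGenerated E) : IsSemistable (dualSpan E) := by
  have hF := d.finrank_ker_evaluation hgenus hs hgg
  refine (isVectorBundle_kernelBundle d.isVectorBundle).isSemistable_dual hF fun n hn lam hlam h => ?_
  have h1 := d.degree_le_of_ker hgenus hnh hs hgg hn hlam h
  rw [degree_kernelBundle d.isVectorBundle hgg, d.degree_eq, co.degree_eq, hgenus]
  push_cast
  linarith

end DetForm
end DualSpan

section GenusThree

variable {K : Type u} [Field K] [Algebra ℂ K] [hK : Fact (IsFunctionField K)]
  [hg : FiniteDimensional ℂ (H0 (canonical K))] {κ : Point K → K} {co : Coord K}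

theorem h0_le_one_of_degree_le_two (hnh : ¬ IsHyperelliptic K) (hκ : IsDiv κ)
    (h : degree (lb κ) ≤ 2) : h0 κ ≤ 1 := by
  by_contra hcon
  have := three_le_degree_of_two_le_h0 hnh hκ (by omega)
  omega

theorem ord_div_pt_self (hκ : IsDiv κ) (x : Point K) :
    x.ord ((κ / pt x) x) = x.ord (κ x) + 1 := by
  rw [Pi.div_apply, div_eq_mul_inv, x.ord_mul (hκ.ne_zero x) (inv_ne_zero (pt_ne_zero x x)),
    x.ord_inv, ord_pt_self]
  ring

theorem ord_div_pt_of_ne (hκ : IsDiv κ) {x y : Point K} (h : y ≠ x) :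
    y.ord ((κ / pt x) y) = y.ord (κ y) := by
  rw [Pi.div_apply, div_eq_mul_inv, y.ord_mul (hκ.ne_zero y) (inv_ne_zero (pt_ne_zero x y)),
    y.ord_inv, ord_pt_of_ne h]
  ring

theorem mem_H0_div_pt (hκ : IsDiv κ) {x : Point K} {a : K} (ha : a ∈ H0 (lb κ)) (ha0 : a ≠ 0)
    (h : x.ord a ≠ x.ord (κ x)) : a ∈ H0 (lb (κ / pt x)) := by
  intro y
  have h1 := (mem_lb_iff_ord hκ ha0).1 (ha y)
  rw [mem_lb_iff_ord (hκ.div (isDiv_pt x)) ha0]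
  rcases eq_or_ne y x with rfl | hy
  · rw [ord_div_pt_self hκ]; omega
  · rwa [ord_div_pt_of_ne hκ hy]

theorem exists_ord_eq_of_h0_lt (hκ : IsDiv κ) {x : Point K} (h : h0 (κ / pt x) < h0 κ) :
    ∃ a ∈ H0 (lb κ), a ≠ 0 ∧ x.ord a = x.ord (κ x) := by
  by_contra hcon
  push Not at hcon
  have hν := hκ.div (isDiv_pt x)
  haveI := hν.finite_H0
  have : H0 (lb κ) ≤ H0 (lb (κ / pt x)) := by
    intro a ha
    rcases eq_or_ne a 0 with rfl | h0
    · exact zero_mem _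
    · exact mem_H0_div_pt hκ ha h0 (hcon a ha h0)
  exact absurd (Submodule.finrank_mono this) (not_le.2 h)

/-- A section that does not vanish at `x` is a complement to the sections that do. -/
theorem exists_const_sub_mem_H0 (hκ : IsDiv κ) {x : Point K} {v : K} (hv : v ∈ H0 (lb κ))
    (hv0 : v ≠ 0) (hord : x.ord v = x.ord (κ x)) {a : K} (ha : a ∈ H0 (lb κ)) :
    ∃ c : ℂ, a - c • v ∈ H0 (lb (κ / pt x)) := by
  have h1 : a / v ∈ x.ring := by
    rcases eq_or_ne a 0 with rfl | h0
    · rw [zero_div]; exact x.ring.zero_mem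
    · rw [x.div_mem_ring_iff h0 hv0, hord]
      exact (mem_lb_iff_ord hκ h0).1 (ha x)
  obtain ⟨c, hc⟩ := Point.exists_const_sub_mem hK.out x h1
  refine ⟨c, ?_⟩
  have h2 : a - c • v ∈ H0 (lb κ) := sub_mem ha (Submodule.smul_mem _ c hv)
  rcases eq_or_ne (a - c • v) 0 with h0 | h0
  · rw [h0]; exact zero_mem _
  · refine mem_H0_div_pt hκ h2 h0 ?_
    have h3 : a - c • v = v * (a / v - algebraMap ℂ K c) := by
      rw [mul_sub, mul_div_cancel₀ _ hv0, Algebra.smul_def, mul_comm v (algebraMap ℂ K c)]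
    have h4 : a / v - algebraMap ℂ K c ≠ 0 := fun h => h0 (by rw [h3, h, mul_zero])
    have h5 := (x.mem_nonunits_iff_ord h4).1 hc
    rw [h3, x.ord_mul hv0 h4, hord]
    omega

namespace Coord

theorem h0_div_pt (hgenus : genus K = 3) (hnh : ¬ IsHyperelliptic K) (x : Point K) :
    h0 (co.κ / pt x) = 2 := by
  have h1 := co.riemannRoch (isDiv_pt x)
  have h2 := h0_le_one_of_degree_le_two hnh (isDiv_pt x) (by rw [degree_lb_pt]; norm_num)
  have h3 : h0 (1 : Point K → K) ≤ h0 (pt x) := by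
    haveI := (isDiv_pt x).finite_H0
    refine Submodule.finrank_mono (H0_lb_mono (isDiv_pt x) isDiv_one fun y => ?_)
    rw [Pi.one_apply, y.ord_one]
    rcases eq_or_ne y x with rfl | hy
    · rw [ord_pt_self]; norm_num
    · rw [ord_pt_of_ne hy]
  rw [h0_one] at h3
  rw [degree_lb_pt, hgenus] at h1
  push_cast at h1
  omega

theorem h0_div_pt_div_pt (hgenus : genus K = 3) (hnh : ¬ IsHyperelliptic K) (x y : Point K) :
    h0 (co.κ / pt x / pt y) = 1 := by
  have hd := (co.isDiv.div (isDiv_pt x)).div (isDiv_pt y)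
  have hdeg : degree (lb (co.κ / pt x / pt y)) = 2 := by
    rw [degree_lb_div (co.isDiv.div (isDiv_pt x)) (isDiv_pt y),
      degree_lb_div co.isDiv (isDiv_pt x), degree_lb_pt, degree_lb_pt, co.degree_eq, hgenus]
    norm_num
  have h2 := h0_le_one_of_degree_le_two hnh hd (by rw [hdeg])
  have h3 := h0_le_of_le (co.isDiv.div (isDiv_pt x)) hd
    (ord_div_pt_ge _ (co.isDiv.div (isDiv_pt x)) y)
  rw [co.h0_div_pt hgenus hnh, hdeg, degree_lb_div co.isDiv (isDiv_pt x), degree_lb_pt,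
    co.degree_eq, hgenus] at h3
  push_cast at h3
  omega

/-- The canonical bundle is globally generated. -/
theorem exists_ord_eq (hgenus : genus K = 3) (hnh : ¬ IsHyperelliptic K) (x : Point K) :
    ∃ a ∈ H0 (lb co.κ), a ≠ 0 ∧ x.ord a = x.ord (co.κ x) :=
  exists_ord_eq_of_h0_lt co.isDiv (by
    rw [co.h0_div_pt hgenus hnh, co.h0_eq_genus, hgenus]; norm_num)

/-- A function that maps the sections of `ω_C` to `ω_C^{⊗2}` at `x` is in `ω_C` at `x`. -/
theorem mem_lb_of_forall_mul_mem (hgenus : genus K = 3) (hnh : ¬ IsHyperelliptic K) {x : Point K}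
    {c : K} (h : ∀ a ∈ H0 (lb co.κ), c * a ∈ lb (co.κ * co.κ) x) : c ∈ lb co.κ x := by
  rcases eq_or_ne c 0 with rfl | hc
  · exact Submodule.zero_mem _
  obtain ⟨a, ha, ha0, hord⟩ := co.exists_ord_eq hgenus hnh x
  have h1 := h a ha
  rw [mem_lb_iff_ord (co.isDiv.mul co.isDiv) (mul_ne_zero hc ha0), x.ord_mul hc ha0, Pi.mul_apply,
    x.ord_mul (co.isDiv.ne_zero x) (co.isDiv.ne_zero x), hord] at h1
  rw [mem_lb_iff_ord co.isDiv hc]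
  omega

/-- `H⁰(ω_C(x)) = H⁰(ω_C)`. -/
theorem H0_mul_pt (x : Point K) : H0 (lb (co.κ * pt x)) = H0 (lb co.κ) := by
  have hd := co.isDiv.mul (isDiv_pt x)
  haveI := hd.finite_H0
  symm
  refine Submodule.eq_of_le_of_finrank_eq (H0_lb_mono hd co.isDiv fun y => ?_) ?_
  · rw [Pi.mul_apply, y.ord_mul (co.isDiv.ne_zero y) (pt_ne_zero x y)]
    rcases eq_or_ne y x with rfl | hy
    · rw [ord_pt_self]; omega
    · rw [ord_pt_of_ne hy]; omega
  · have h1 := co.riemannRoch hd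
    rw [h0_eq_zero_of_degree_neg (co.isDiv.div hd) (by
      rw [degree_lb_div co.isDiv hd, degree_lb_mul co.isDiv (isDiv_pt x), degree_lb_pt]; omega),
      degree_lb_mul co.isDiv (isDiv_pt x), degree_lb_pt, co.degree_eq] at h1
    change h0 co.κ = h0 (co.κ * pt x)
    have h2 := co.h0_eq_genus
    push_cast at h1
    omega

/-- The canonical curve is not contained in a cubic. -/
theorem no_cubic (hgenus : genus K = 3) (hnh : ¬ IsHyperelliptic K)
    {l φ : K →ₗ[ℂ] ℂ} (hφ : ∀ a ∈ H0 (lb co.κ), ∀ b ∈ H0 (lb co.κ), φ (a * b) = l a * l b)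
    (hspan : ∀ s ∈ H0 (lb (co.κ * co.κ)),
      s ∈ Submodule.span ℂ {z | ∃ a ∈ H0 (lb co.κ), ∃ b ∈ H0 (lb co.κ), z = a * b})
    {ι : Type*} [Fintype ι] {v a : ι → K} (hv : ∀ i, v i ∈ H0 (lb co.κ))
    (ha : ∀ i, a i ∈ H0 (lb (co.κ * co.κ))) (h : ∑ i, v i * a i = 0) :
    ∑ i, l (v i) * φ (a i) = 0 := by
  obtain ⟨x⟩ := exists_point hK.out
  have hx := co.isDiv.div (isDiv_pt x)
  obtain ⟨v2, hv2, hv20, hord⟩ := co.exists_ord_eq hgenus hnh x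
  haveI := hx.finite_H0
  let b := Module.finBasisOfFinrankEq ℂ (H0 (lb (co.κ / pt x))) (co.h0_div_pt hgenus hnh x)
  have hle := H0_lb_mono co.isDiv hx (ord_div_pt_ge _ co.isDiv x)
  obtain ⟨v0, v1, hv0, hv1, hb⟩ : ∃ v0 v1 : K, v0 ∈ H0 (lb (co.κ / pt x)) ∧
      v1 ∈ H0 (lb (co.κ / pt x)) ∧
      ∀ z ∈ H0 (lb (co.κ / pt x)), ∃ α β : ℂ, z = α • v0 + β • v1 := by
    refine ⟨b 0, b 1, (b 0).2, (b 1).2, fun z hz => ⟨b.repr ⟨z, hz⟩ 0, b.repr ⟨z, hz⟩ 1, ?_⟩⟩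
    have := congrArg Subtype.val (b.sum_repr ⟨z, hz⟩)
    rw [Fin.sum_univ_two] at this
    exact this.symm
  have hW : ∀ z ∈ H0 (lb co.κ), ∃ α β γ : ℂ, z = α • v0 + β • v1 + γ • v2 := by
    intro z hz
    obtain ⟨γ, hγ⟩ := exists_const_sub_mem_H0 co.isDiv hv2 hv20 hord hz
    obtain ⟨α, β, hαβ⟩ := hb _ hγ
    exact ⟨α, β, γ, by rw [← hαβ, sub_add_cancel]⟩
  have hprod : ∀ s ∈ H0 (lb (co.κ * co.κ)), ∃ c0 ∈ H0 (lb co.κ), ∃ c1 ∈ H0 (lb co.κ),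
      ∃ c2 ∈ H0 (lb co.κ), s = v0 * c0 + v1 * c1 + v2 * c2 := by
    intro s hs
    refine Submodule.span_induction (p := fun s _ => ∃ c0 ∈ H0 (lb co.κ), ∃ c1 ∈ H0 (lb co.κ),
      ∃ c2 ∈ H0 (lb co.κ), s = v0 * c0 + v1 * c1 + v2 * c2) ?_ ?_ ?_ ?_ (hspan s hs)
    · rintro _ ⟨p, hp, q, hq, rfl⟩
      obtain ⟨α, β, γ, rfl⟩ := hW p hp
      refine ⟨α • q, Submodule.smul_mem _ _ hq, β • q, Submodule.smul_mem _ _ hq, γ • q,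
        Submodule.smul_mem _ _ hq, ?_⟩
      simp only [Algebra.smul_def]
      ring
    · exact ⟨0, zero_mem _, 0, zero_mem _, 0, zero_mem _, by ring⟩
    · rintro _ _ - - ⟨a0, h0, a1, h1, a2, h2, rfl⟩ ⟨b0, h0', b1, h1', b2, h2', rfl⟩
      exact ⟨_, add_mem h0 h0', _, add_mem h1 h1', _, add_mem h2 h2', by ring⟩
    · rintro c _ - ⟨a0, h0, a1, h1, a2, h2, rfl⟩
      refine ⟨c • a0, Submodule.smul_mem _ _ h0, c • a1, Submodule.smul_mem _ _ h1, c • a2,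
        Submodule.smul_mem _ _ h2, ?_⟩
      simp only [Algebra.smul_def]
      ring
  choose α β γ hαβγ using fun i => hW (v i) (hv i)
  have hsum : ∀ δ : ι → ℂ, ∑ i, δ i • a i ∈ H0 (lb (co.κ * co.κ)) := fun δ =>
    sum_mem fun i _ => Submodule.smul_mem _ _ (ha i)
  obtain ⟨a0, ha0, hA0⟩ : ∃ z ∈ H0 (lb (co.κ * co.κ)), z = ∑ i, α i • a i := ⟨_, hsum α, rfl⟩
  obtain ⟨a1, ha1, hA1⟩ : ∃ z ∈ H0 (lb (co.κ * co.κ)), z = ∑ i, β i • a i := ⟨_, hsum β, rfl⟩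
  obtain ⟨a2, ha2, hA2⟩ : ∃ z ∈ H0 (lb (co.κ * co.κ)), z = ∑ i, γ i • a i := ⟨_, hsum γ, rfl⟩
  have hrel : v0 * a0 + v1 * a1 + v2 * a2 = 0 := by
    rw [← h, hA0, hA1, hA2, Finset.mul_sum, Finset.mul_sum, Finset.mul_sum,
      ← Finset.sum_add_distrib, ← Finset.sum_add_distrib]
    refine Finset.sum_congr rfl fun i _ => ?_
    rw [hαβγ i]
    simp only [Algebra.smul_def]
    ring
  have hgoal : ∑ i, l (v i) * φ (a i) = l v0 * φ a0 + l v1 * φ a1 + l v2 * φ a2 := by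
    rw [hA0, hA1, hA2, map_sum, map_sum, map_sum, Finset.mul_sum, Finset.mul_sum, Finset.mul_sum,
      ← Finset.sum_add_distrib, ← Finset.sum_add_distrib]
    refine Finset.sum_congr rfl fun i _ => ?_
    rw [hαβγ i]
    simp only [map_add, map_smul, smul_eq_mul]
    ring
  rw [hgoal]
  have hκκ := co.isDiv.mul co.isDiv
  obtain ⟨b0, hb0, b1, hb1, hab⟩ : ∃ b0 ∈ H0 (lb co.κ), ∃ b1 ∈ H0 (lb co.κ),
      a2 = v0 * b0 + v1 * b1 := by
    obtain ⟨c0, hc0, c1, hc1, c2, hc2, hc⟩ := hprod a2 ha2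
    have hc2' : c2 ∈ H0 (lb (co.κ / pt x)) := by
      rcases eq_or_ne c2 0 with rfl | hc20
      · exact zero_mem _
      refine mem_H0_div_pt co.isDiv hc2 hc20 fun hcon => ?_
      have h1 : v2 * v2 * c2 ∈ lb (co.κ * co.κ * (co.κ / pt x)) x := by
        have h2 : v2 * v2 * c2 = -(a0 * v0 + a1 * v1 + (v2 * c0) * v0 + (v2 * c1) * v1) := by
          rw [hc] at hrel
          linear_combination hrel
        rw [h2]
        have h3 := mul_mem_lb (hv2 x) (hc0 x)
        have h4 := mul_mem_lb (hv2 x) (hc1 x)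
        exact neg_mem (add_mem (add_mem (add_mem (mul_mem_lb (ha0 x) (hv0 x))
          (mul_mem_lb (ha1 x) (hv1 x))) (mul_mem_lb h3 (hv0 x))) (mul_mem_lb h4 (hv1 x)))
      have h5 := mul_ne_zero hv20 hv20
      rw [mem_lb_iff_ord (hκκ.mul hx) (mul_ne_zero h5 hc20), x.ord_mul h5 hc20,
        x.ord_mul hv20 hv20, Pi.mul_apply, x.ord_mul (hκκ.ne_zero x) (hx.ne_zero x),
        ord_div_pt_self co.isDiv, Pi.mul_apply,
        x.ord_mul (co.isDiv.ne_zero x) (co.isDiv.ne_zero x), hord, hcon] at h1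
      omega
    obtain ⟨s, t, rfl⟩ := hb c2 hc2'
    refine ⟨c0 + s • v2, add_mem hc0 (Submodule.smul_mem _ _ hv2), c1 + t • v2,
      add_mem hc1 (Submodule.smul_mem _ _ hv2), ?_⟩
    rw [hc]
    simp only [Algebra.smul_def]
    ring
  have hgen : ∀ y : Point K, ∃ r, (r = v0 ∨ r = v1) ∧ r ≠ 0 ∧ y.ord r = y.ord ((co.κ / pt x) y) := by
    intro y
    obtain ⟨r, hr, hr0, hro⟩ := exists_ord_eq_of_h0_lt hx (x := y) (by
      rw [co.h0_div_pt hgenus hnh, co.h0_div_pt_div_pt hgenus hnh]; norm_num)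
    by_contra hcon
    push Not at hcon
    have key : ∀ z ∈ H0 (lb (co.κ / pt x)), (z = v0 ∨ z = v1) → z ∈ H0 (lb (co.κ / pt x / pt y)) := by
      intro z hz hz'
      rcases eq_or_ne z 0 with rfl | hz0
      · exact zero_mem _
      · exact mem_H0_div_pt hx hz hz0 (hcon z hz' hz0)
    obtain ⟨s, t, rfl⟩ := hb r hr
    have h1 : s • v0 + t • v1 ∈ H0 (lb (co.κ / pt x / pt y)) :=
      add_mem (Submodule.smul_mem _ _ (key _ hv0 (Or.inl rfl)))
        (Submodule.smul_mem _ _ (key _ hv1 (Or.inr rfl)))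
    have h2 := (mem_lb_iff_ord (hx.div (isDiv_pt y)) hr0).1 (h1 y)
    rw [ord_div_pt_self hx] at h2
    omega
  have hv0' := hle hv0
  have hv1' := hle hv1
  have hv10 : v1 ≠ 0 := by
    rintro rfl
    have h1 : h0 (co.κ / pt x) ≤ 1 := finrank_le_one (⟨v0, hv0⟩ : H0 (lb (co.κ / pt x))) fun z => by
      obtain ⟨s, t, hst⟩ := hb z z.2
      exact ⟨s, Subtype.ext (by rw [hst, smul_zero, add_zero]; rfl)⟩
    rw [co.h0_div_pt hgenus hnh] at h1
    omega
  obtain ⟨g, hg0, hg1⟩ : ∃ g : K, a0 + b0 * v2 = g * v1 ∧ a1 + b1 * v2 = -(g * v0) := by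
    refine ⟨(a0 + b0 * v2) / v1, (div_mul_cancel₀ _ hv10).symm, ?_⟩
    rw [hab] at hrel
    field_simp
    linear_combination hrel
  have hgmem : g ∈ H0 (lb co.κ) := by
    rw [← co.H0_mul_pt x]
    intro y
    rcases eq_or_ne g 0 with rfl | hgne
    · exact Submodule.zero_mem _
    obtain ⟨r, hr, hr0, hro⟩ := hgen y
    have h1 : g * r ∈ lb (co.κ * co.κ) y := by
      rcases hr with rfl | rfl
      · rw [← neg_neg (g * r), ← hg1]
        exact neg_mem (add_mem (ha1 y) (mul_mem_lb (hb1 y) (hv2 y)))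
      · rw [← hg0]
        exact add_mem (ha0 y) (mul_mem_lb (hb0 y) (hv2 y))
    rw [mem_lb_iff_ord hκκ (mul_ne_zero hgne hr0), y.ord_mul hgne hr0, hro, Pi.mul_apply,
      y.ord_mul (co.isDiv.ne_zero y) (co.isDiv.ne_zero y), Pi.div_apply, div_eq_mul_inv,
      y.ord_mul (co.isDiv.ne_zero y) (inv_ne_zero (pt_ne_zero x y)), y.ord_inv] at h1
    rw [mem_lb_iff_ord (co.isDiv.mul (isDiv_pt x)) hgne, Pi.mul_apply,
      y.ord_mul (co.isDiv.ne_zero y) (pt_ne_zero x y)]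
    omega
  have e0 : φ a0 = l g * l v1 - l b0 * l v2 := by
    rw [eq_sub_iff_add_eq, ← hφ b0 hb0 v2 hv2, ← map_add, hg0, hφ g hgmem v1 hv1']
  have e1 : φ a1 = - (l g * l v0) - l b1 * l v2 := by
    rw [eq_sub_iff_add_eq, ← hφ b1 hb1 v2 hv2, ← map_add, hg1, map_neg, hφ g hgmem v0 hv0']
  have e2 : φ a2 = l v0 * l b0 + l v1 * l b1 := by
    rw [hab, map_add, hφ v0 hv0' b0 hb0, hφ v1 hv1' b1 hb1]
  rw [e0, e1, e2]
  ring

end Coord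
end GenusThree

section VeroneseSurface

variable {K : Type u} [Field K] [Algebra ℂ K] [hK : Fact (IsFunctionField K)]

/-- The ideal sheaf of a family of functions. -/
theorem exists_isDiv_of_ne_zero {ι : Type*} [Finite ι] {u : ι → K} (hu : u ≠ 0) :
    ∃ lam : Point K → K, IsDiv lam ∧ ∀ x c, c ∈ lb lam x ↔ ∀ i, c * u i ∈ x.ring := by
  let W := Submodule.span K {u}
  have hu' : (⟨u, Submodule.mem_span_singleton_self u⟩ : W) ≠ 0 :=
    fun h => hu (congrArg Subtype.val h)
  obtain ⟨lam, h1, -, h2⟩ := ((isVectorBundle_freeBundle (Pi.basisFun K ι)).sub W).exists_isDiv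
    (finrank_span_singleton hu) hu'
  refine ⟨lam, h1, fun x c => ?_⟩
  rw [← h2]
  exact mem_freeBundle (Pi.basisFun K ι) (a := c • u)

theorem exists_ord_add_eq_zero {ι : Type*} {u : ι → K} {lam : Point K → K} (hlam : IsDiv lam)
    {x : Point K} (h : ∀ c, c ∈ lb lam x ↔ ∀ i, c * u i ∈ x.ring) :
    ∃ i, u i ≠ 0 ∧ x.ord (lam x) + x.ord (u i) = 0 := by
  by_contra hcon
  push Not at hcon
  obtain ⟨π, hπ0, hπ⟩ := x.exists_ord_eq_one
  have hne := mul_ne_zero (inv_ne_zero hπ0) (hlam.ne_zero x)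
  have h1 : π⁻¹ * lam x ∈ lb lam x := by
    rw [h]
    intro i
    rcases eq_or_ne (u i) 0 with h0 | h0
    · rw [h0, mul_zero]; exact x.ring.zero_mem
    · have h2 := (h _).1 (mem_lb_self lam x) i
      rw [x.mem_ring_iff_ord (mul_ne_zero (hlam.ne_zero x) h0), x.ord_mul (hlam.ne_zero x) h0] at h2
      rw [x.mem_ring_iff_ord (mul_ne_zero hne h0), x.ord_mul hne h0,
        x.ord_mul (inv_ne_zero hπ0) (hlam.ne_zero x), x.ord_inv]
      have := hcon i h0
      omega
  rw [mem_lb_iff_ord hlam hne, x.ord_mul (inv_ne_zero hπ0) (hlam.ne_zero x), x.ord_inv] at h1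
  omega

variable [hg : FiniteDimensional ℂ (H0 (canonical K))] {co : Coord K}

/-- A symmetric matrix of rank one of sections of `ω_C^{⊗2}` is the square of a vector of sections
of `ω_C`. -/
theorem Coord.exists_eq_mul (hgenus : genus K = 3) (hnh : ¬ IsHyperelliptic K)
    {r : Fin 3 → Fin 3 → K} (hr : ∀ i j, r i j ∈ H0 (lb (co.κ * co.κ)))
    (hmul : ∀ i j, r i j * r 0 0 = r 0 i * r 0 j)
    (hli : LinearIndependent ℂ (r 0)) :
    ∃ w : Fin 3 → K, (∀ i, w i ∈ H0 (lb co.κ)) ∧ ∀ i j, r i j = w i * w j := by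
  have h00 : r 0 0 ≠ 0 := hli.ne_zero 0
  let u : Fin 3 → K := fun i => r 0 i / r 0 0
  have hru : ∀ i j, r i j = r 0 0 * u i * u j := fun i j => by
    simp only [u]
    field_simp
    linear_combination hmul i j
  have hκκ := co.isDiv.mul co.isDiv
  obtain ⟨lam, hlam, hu⟩ := exists_isDiv_of_ne_zero (u := u) fun h0 =>
    (div_ne_zero h00 h00) (congrFun h0 0)
  have hu' : ∀ i, u i ∈ H0 (lb lam⁻¹) := fun i x => by
    rw [mem_lb hlam.inv, Pi.inv_apply, div_inv_eq_mul, mul_comm]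
    exact (hu x _).1 (mem_lb_self lam x) i
  have h3 : 3 ≤ h0 lam⁻¹ := by
    haveI := hlam.inv.finite_H0
    have huli : LinearIndependent ℂ u := by
      have h1 := hli.map' (LinearMap.mulLeft ℂ (r 0 0)⁻¹)
        (LinearMap.ker_eq_bot.2 (mul_right_injective₀ (inv_ne_zero h00)))
      have h2 : u = LinearMap.mulLeft ℂ (r 0 0)⁻¹ ∘ r 0 := by
        funext i
        simp [u, div_eq_inv_mul]
      rw [h2]
      exact h1
    have hv : LinearIndependent ℂ (fun i => (⟨u i, hu' i⟩ : H0 (lb lam⁻¹))) :=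
      LinearIndependent.of_comp (H0 (lb lam⁻¹)).subtype huli
    simpa [h0] using hv.fintype_card_le_finrank
  have h4 := four_le_degree_of_three_le_h0 hnh hlam.inv h3
  have hdκ := co.degree_eq
  rw [hgenus] at hdκ
  push_cast at hdκ
  obtain ⟨h5, h6⟩ := degree_lb_le h00 (hlam.inv.mul hlam.inv) hκκ fun x => by
    obtain ⟨i, hi0, hi⟩ := exists_ord_add_eq_zero hlam (hu x)
    have h7 := hr i i x
    have h8 := mul_ne_zero (mul_ne_zero h00 hi0) hi0
    have h9 := inv_ne_zero (hlam.ne_zero x)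
    rw [hru, mem_lb_iff_ord hκκ h8, x.ord_mul (mul_ne_zero h00 hi0) hi0, x.ord_mul h00 hi0] at h7
    rw [Pi.mul_apply lam⁻¹, Pi.inv_apply, x.ord_mul h00 (mul_ne_zero h9 h9), x.ord_mul h9 h9, x.ord_inv]
    omega
  rw [degree_lb_mul hlam.inv hlam.inv, degree_lb_mul co.isDiv co.isDiv] at h5 h6
  have h7 : degree (lb lam⁻¹) = 4 := by omega
  have h8 := h6 (by omega)
  obtain ⟨η, hη, hη0⟩ := exists_ne_zero_of_h0_pos (κ := co.κ / lam⁻¹) (by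
    have := co.riemannRoch hlam.inv
    rw [h7, hgenus] at this
    push_cast at this
    omega)
  have hηord := (degree_nonneg_of_mem_H0 hη0 (co.isDiv.div hlam.inv) hη).2
    (by rw [degree_lb_div co.isDiv hlam.inv, h7, hdκ]; norm_num)
  obtain ⟨c, hc⟩ := exists_const_of_forall_mem hK.out (r 0 0 / (η * η)) fun x => by
    have h9 := inv_ne_zero (hlam.ne_zero x)
    have h10 := h8 x
    have h11 := hηord x
    rw [Pi.mul_apply, x.ord_mul (co.isDiv.ne_zero x) (co.isDiv.ne_zero x), Pi.mul_apply,
      Pi.inv_apply, x.ord_mul h00 (mul_ne_zero h9 h9), x.ord_mul h9 h9, x.ord_inv] at h10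
    rw [Pi.div_apply, Pi.inv_apply, div_inv_eq_mul,
      x.ord_mul (co.isDiv.ne_zero x) (hlam.ne_zero x)] at h11
    rw [x.div_mem_ring_iff h00 (mul_ne_zero hη0 hη0), x.ord_mul hη0 hη0]
    omega
  obtain ⟨ε, hε⟩ := IsAlgClosed.exists_pow_nat_eq c (n := 2) (by norm_num)
  refine ⟨fun i => ε • (u i * η), fun i => Submodule.smul_mem _ _ fun x => ?_, fun i j => ?_⟩
  · have := mul_mem_lb (hu' i x) (hη x)
    rwa [hlam.inv.mul_div_cancel] at this
  · rw [div_eq_iff (mul_ne_zero hη0 hη0), ← hε, map_pow] at hc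
    rw [hru, hc]
    simp only [Algebra.smul_def]
    ring

variable (co) in
/-- The bicanonical bundle as the line bundle of a divisor. -/
def Coord.bicanonicalIso : BundleIso (bicanonical K) (lb (co.κ * co.κ)) where
  equiv := co.e₂
  mem_iff x z := (co.mem_bicanonical_iff x z).symm

variable (co) in
/-- The coordinate on the space of sections of the bicanonical bundle. -/
def Coord.section₂ : H0 (bicanonical K) →ₗ[ℂ] K :=
  (co.e₂.toLinearMap.restrictScalars ℂ).comp (H0 (bicanonical K)).subtype

theorem Coord.section₂_apply (s : H0 (bicanonical K)) : co.section₂ s = co.e₂ (s : Ω[K⁄ℂ] ⊗[K] Ω[K⁄ℂ]) :=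
  rfl

theorem Coord.section₂_injective : Function.Injective co.section₂ :=
  fun _ _ h => Subtype.ext (co.e₂.injective h)

theorem Coord.section₂_mem (s : H0 (bicanonical K)) : co.section₂ s ∈ H0 (lb (co.κ * co.κ)) :=
  fun x => (co.mem_bicanonical_iff x _).1 (s.2 x)

theorem Coord.exists_section₂_eq {y : K} (hy : y ∈ H0 (lb (co.κ * co.κ))) :
    ∃ s, co.section₂ s = y :=
  ⟨⟨co.e₂.symm y, fun x => by
    rw [co.mem_bicanonical_iff, LinearEquiv.apply_symm_apply]; exact hy x⟩,
    co.e₂.apply_symm_apply y⟩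

theorem mem_maximalIdeal_smul_iff {F : Type v} [AddCommGroup F] [Module K F] {x : Point K}
    {M : Submodule x.O F} {e : F} (h : M = spanAt x {e}) {z : F} :
    z ∈ IsLocalRing.maximalIdeal x.O • M ↔ ∃ g ∈ x.ring.nonunits, z = g • e := by
  constructor
  · intro hz
    refine Submodule.smul_induction_on hz (fun g hg a ha => ?_) ?_
    · rw [h] at ha
      obtain ⟨g', hg', rfl⟩ := mem_spanAt_singleton.1 ha
      exact ⟨g' * g, Point.mul_mem_nonunits hg' (ValuationSubring.coe_mem_nonunits_iff.2 hg), by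
        rw [mul_comm, mul_smul]; rfl⟩
    · rintro a b ⟨g, hg, rfl⟩ ⟨g', hg', rfl⟩
      exact ⟨g + g', add_mem hg hg', (add_smul _ _ _).symm⟩
  · rintro ⟨g, hg, rfl⟩
    exact Submodule.smul_mem_smul (r := (⟨g, Point.mem_of_mem_nonunits hg⟩ : x.O))
      (ValuationSubring.coe_mem_nonunits_iff.1 hg) (by rw [h]; exact subset_spanAt _ rfl)

theorem lb_eq_one {κ : Point K → K} (hκ : IsDiv κ) {x : Point K} (hx : x.ord (κ x) = 0) :
    lb (κ * κ) x = lb 1 x :=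
  lb_apply_eq_of_ord ((hκ.mul hκ).ne_zero x) one_ne_zero (by
    rw [Pi.mul_apply, x.ord_mul (hκ.ne_zero x) (hκ.ne_zero x), hx, add_zero, Pi.one_apply,
      x.ord_one])

/-- The sections of the bicanonical bundle that vanish at a point where the coordinate is a local
frame. -/
theorem Coord.mem_maximalIdeal_smul_iff {x : Point K} (hx : x.ord (co.κ x) = 0)
    (z : Ω[K⁄ℂ] ⊗[K] Ω[K⁄ℂ]) :
    z ∈ IsLocalRing.maximalIdeal x.O • bicanonical K x ↔ co.e₂ z ∈ x.ring.nonunits := by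
  have h : bicanonical K x = spanAt x {co.e₂.symm 1} := by
    ext z
    rw [co.mem_bicanonical_iff, lb_eq_one co.isDiv hx, mem_lb_one, mem_spanAt_singleton]
    constructor
    · intro hz
      exact ⟨_, hz, co.e₂.injective (by
        rw [map_smul, LinearEquiv.apply_symm_apply, smul_eq_mul, mul_one])⟩
    · rintro ⟨g, hg, rfl⟩
      rwa [map_smul, LinearEquiv.apply_symm_apply, smul_eq_mul, mul_one]
  rw [Curve.mem_maximalIdeal_smul_iff h]
  constructor
  · rintro ⟨g, hg, rfl⟩
    rwa [map_smul, LinearEquiv.apply_symm_apply, smul_eq_mul, mul_one]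
  · intro hz
    exact ⟨_, hz, co.e₂.injective (by
      rw [map_smul, LinearEquiv.apply_symm_apply, smul_eq_mul, mul_one])⟩

/-- The point of the bicanonical curve. -/
theorem Coord.exists_mem_bicanonicalCurve {x : Point K} (hx : x.ord (co.κ x) = 0)
    {v : H0 (bicanonical K)} (hv : co.section₂ v ∉ x.ring.nonunits) :
    ∃ f : BicanonicalDual K, ∃ hf : f ≠ 0, Projectivization.mk ℂ f hf ∈ bicanonicalCurve K ∧
      ∀ s, f s = 0 ↔ co.section₂ s ∈ x.ring.nonunits := by
  let P : Submodule ℂ (H0 (bicanonical K)) :=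
    { carrier := {s | co.section₂ s ∈ x.ring.nonunits}
      add_mem' := fun {a b} ha hb => by
        change co.section₂ (a + b) ∈ x.ring.nonunits
        rw [map_add]; exact add_mem ha hb
      zero_mem' := by
        change co.section₂ 0 ∈ x.ring.nonunits
        rw [map_zero]; exact ZeroMemClass.zero_mem _
      smul_mem' := fun c a ha => by
        change co.section₂ (c • a) ∈ x.ring.nonunits
        rw [map_smul, Algebra.smul_def]
        exact Point.mul_mem_nonunits (x.const_mem c) ha }
  obtain ⟨f, hfv, hle⟩ := Submodule.exists_le_ker_of_notMem (p := P) (v := v) hv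
  have hone : ∀ s, co.section₂ s ∈ x.ring := fun s => by
    have := co.section₂_mem s x
    rwa [lb_eq_one co.isDiv hx, mem_lb_one] at this
  have key : ∀ s, f s = 0 ↔ co.section₂ s ∈ x.ring.nonunits := by
    intro s
    refine ⟨fun hs => ?_, fun hs => hle hs⟩
    obtain ⟨c, hc⟩ := Point.exists_const_sub_mem hK.out x
      (x.ring.mul_mem _ _ (hone s) (Point.inv_mem_of_notMem_nonunits hv))
    have hv0 : co.section₂ v ≠ 0 := fun h0 => hv (by rw [h0]; exact ZeroMemClass.zero_mem _)
    have h1 : s - c • v ∈ P := by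
      change co.section₂ (s - c • v) ∈ x.ring.nonunits
      have : co.section₂ (s - c • v) =
          co.section₂ v * (co.section₂ s * (co.section₂ v)⁻¹ - algebraMap ℂ K c) := by
        rw [map_sub, map_smul, Algebra.smul_def]
        field_simp
      rw [this]
      exact Point.mul_mem_nonunits (hone v) hc
    have h2 : f (s - c • v) = 0 := hle h1
    rw [map_sub, map_smul, hs, zero_sub, neg_eq_zero, smul_eq_mul, mul_eq_zero, or_iff_left hfv] at h2
    rw [h2, zero_smul, sub_zero] at h1
    exact h1
  have hf : f ≠ 0 := fun h0 => hfv (by rw [h0]; rfl)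
  refine ⟨f, hf, ⟨x, fun s => ?_⟩, key⟩
  obtain ⟨a, ha⟩ := Projectivization.exists_smul_eq_mk_rep ℂ f hf
  rw [← ha, co.mem_maximalIdeal_smul_iff hx, ← co.section₂_apply, ← key]
  change (a : ℂ) * f s = 0 ↔ _
  rw [mul_eq_zero, or_iff_right a.ne_zero]

variable (co) in
/-- A basis `w` of `H⁰(ω_C)` whose products are a basis of `H⁰(ω_C^{⊗2})`, and the linear forms
`w_i w_j ↦ z_i z_j` on `H⁰(ω_C^{⊗2})`, extended to `K`. -/
structure Veronese where
  w : Fin 3 → K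
  w_mem : ∀ i, w i ∈ H0 (lb co.κ)
  linearIndependent : LinearIndependent ℂ w
  form : (Fin 3 → ℂ) → K →ₗ[ℂ] ℂ
  form_mul : ∀ z i j, form z (w i * w j) = z i * z j
  span : ∀ s ∈ H0 (lb (co.κ * co.κ)),
    s ∈ Submodule.span ℂ (Set.range fun p : Fin 3 × Fin 3 => w p.1 * w p.2)

/-- The Veronese surface that contains the bicanonical curve consists of the forms
`w_i w_j ↦ z_i z_j`. -/
theorem Coord.exists_veronese (hgenus : genus K = 3) (hnh : ¬ IsHyperelliptic K)
    {S : Set (BicanonicalSpace K)} (hS : IsVeroneseSurface S) (hCS : bicanonicalCurve K ⊆ S) :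
    ∃ V : Veronese co,
      (∀ p ∈ S, ∃ z, ∃ c : ℂ, ∀ s, p.rep s = c * V.form z (co.section₂ s)) ∧
      ∀ z ≠ 0, ∃ p ∈ S, ∃ c : ℂ, c ≠ 0 ∧ ∀ s, p.rep s = c * V.form z (co.section₂ s) := by
  obtain ⟨b, rfl⟩ := hS
  have hκκ := co.isDiv.mul co.isDiv
  haveI : FiniteDimensional ℂ (H0 (bicanonical K)) :=
    (hκκ.isVectorBundle.congr co.bicanonicalIso).finiteDimensional_H0
  let q : Module.Basis (Sym2 (Fin 3)) ℂ (H0 (bicanonical K)) :=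
    b.dualBasis.map (Module.evalEquiv ℂ (H0 (bicanonical K))).symm
  have hq : ∀ (f : BicanonicalDual K) e, f (q e) = b.repr f e := fun f e => by
    rw [Module.Basis.map_apply, Module.apply_evalEquiv_symm_apply, Module.Basis.dualBasis_apply]
  let ψ : (Fin 3 → ℂ) → BicanonicalDual K := fun z => ∑ e : Sym2 (Fin 3), (e.map z).mul • b e
  have hψ : ∀ z i j, ψ z (q s(i, j)) = z i * z j := fun z i j => by
    rw [hq]
    simp only [ψ]
    rw [b.repr_sum_self, Sym2.map_mk, Sym2.mul_mk]
  let r : Fin 3 → Fin 3 → K := fun i j => co.section₂ (q s(i, j))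
  have hr : ∀ i j, r i j ∈ H0 (lb (co.κ * co.κ)) := fun i j => co.section₂_mem _
  have hqli : LinearIndependent ℂ fun e => co.section₂ (q e) :=
    q.linearIndependent.map' _ (LinearMap.ker_eq_bot.2 co.section₂_injective)
  have hli : LinearIndependent ℂ (r 0) := hqli.comp (fun i : Fin 3 => s(0, i)) fun i j hij => by
    simp only [Sym2.eq_iff, true_and] at hij
    rcases hij with h | ⟨h, h'⟩
    · exact h
    · rw [h', ← h]
  have hmul : ∀ i j, r i j * r 0 0 = r 0 i * r 0 j := by
    intro i j
    rw [← sub_eq_zero]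
    by_contra hne
    have h00 : r 0 0 ≠ 0 := hli.ne_zero 0
    haveI := infinite_points hK.out
    obtain ⟨x, hx⟩ := ((co.isDiv.finite.union (finite_ord_ne_zero hne)).union
      (finite_ord_ne_zero h00)).exists_notMem
    simp only [Set.mem_union, Set.mem_ofPred_eq, not_or, not_not] at hx
    obtain ⟨⟨hx1, hx2⟩, hx3⟩ := hx
    have hv : r 0 0 ∉ x.ring.nonunits := fun h => by
      have := (x.mem_nonunits_iff_ord h00).1 h
      omega
    obtain ⟨f, hf, hfC, hfk⟩ := co.exists_mem_bicanonicalCurve hx1 hv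
    obtain ⟨z, hz, hfz⟩ := hCS hfC
    obtain ⟨a, ha⟩ := (Projectivization.mk_eq_mk_iff ℂ _ _ hf hz).1 hfz
    have hfq : ∀ i j, f (q s(i, j)) = a * (z i * z j) := fun i j => by
      rw [← ha, ← hψ]
      rfl
    have hz0 : z 0 ≠ 0 := fun h0 => hv ((hfk _).1 (by rw [hfq, h0]; ring))
    have hring : ∀ i j, r i j ∈ x.ring := fun i j => by
      have := hr i j x
      rwa [lb_eq_one co.isDiv hx1, mem_lb_one] at this
    have hsub : ∀ i j, (z 0 * z 0) • r i j - (z i * z j) • r 0 0 ∈ x.ring.nonunits := fun i j => by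
      have : co.section₂ ((z 0 * z 0) • q s(i, j) - (z i * z j) • q s(0, 0)) =
          (z 0 * z 0) • r i j - (z i * z j) • r 0 0 := by
        rw [map_sub, map_smul, map_smul]
      rw [← this, ← hfk, map_sub, map_smul, map_smul, hfq, hfq, smul_eq_mul, smul_eq_mul]
      ring
    have hfin : algebraMap ℂ K ((z 0 * z 0) * (z 0 * z 0)) * (r i j * r 0 0 - r 0 i * r 0 j) ∈
        x.ring.nonunits := by
      have h1 := Point.mul_mem_nonunits
        (x.ring.mul_mem _ _ (x.const_mem (z 0 * z 0)) (hring 0 0)) (hsub i j)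
      have h2 := Point.mul_mem_nonunits
        (x.ring.mul_mem _ _ (x.const_mem (z 0 * z 0)) (hring 0 j)) (hsub 0 i)
      have h3 := Point.mul_mem_nonunits
        (x.ring.mul_mem _ _ (x.const_mem (z 0 * z i)) (hring 0 0)) (hsub 0 j)
      have h4 := add_mem h1 (add_mem (neg_mem h2) (neg_mem h3))
      convert h4 using 1
      simp only [Algebra.smul_def, map_mul]
      ring
    have hc : algebraMap ℂ K ((z 0 * z 0) * (z 0 * z 0)) ≠ 0 :=
      (_root_.map_ne_zero _).2 (by simp [hz0])
    rw [x.mem_nonunits_iff_ord (mul_ne_zero hc hne), x.ord_mul hc hne, hx2,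
      x.ord_const (by simp [hz0])] at hfin
    omega
  obtain ⟨w, hw, hrw⟩ := co.exists_eq_mul hgenus hnh hr hmul hli
  have hwli : LinearIndependent ℂ w := by
    refine LinearIndependent.of_comp (LinearMap.mulLeft ℂ (w 0)) ?_
    have h2 : LinearMap.mulLeft ℂ (w 0) ∘ w = r 0 := by
      funext i
      exact (hrw 0 i).symm
    rw [h2]
    exact hli
  obtain ⟨L, hL⟩ := LinearMap.exists_leftInverse_of_injective co.section₂
    (LinearMap.ker_eq_bot.2 co.section₂_injective)
  have hL' : ∀ s, L (co.section₂ s) = s := fun s => LinearMap.congr_fun hL s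
  refine ⟨⟨w, hw, hwli, fun z => (ψ z).comp L, fun z i j => ?_, fun s hs => ?_⟩, ?_, ?_⟩
  · rw [LinearMap.comp_apply, ← hrw, hL', hψ]
  · obtain ⟨t, rfl⟩ := co.exists_section₂_eq hs
    rw [← q.sum_repr t, map_sum]
    refine sum_mem fun e _ => ?_
    rw [map_smul]
    refine Submodule.smul_mem _ _ (Submodule.subset_span ?_)
    induction e with
    | h i j => exact ⟨(i, j), (hrw i j).symm⟩
  · rintro p ⟨z, hz, rfl⟩
    obtain ⟨a, ha⟩ := Projectivization.exists_smul_eq_mk_rep ℂ _ hz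
    refine ⟨z, a, fun s => ?_⟩
    rw [← ha, LinearMap.comp_apply, hL']
    rfl
  · intro z hz
    have hz' : ψ z ≠ 0 := by
      intro h0
      obtain ⟨i, hi⟩ := Function.ne_iff.1 hz
      have := hψ z i i
      rw [h0, LinearMap.zero_apply, eq_comm, mul_self_eq_zero] at this
      exact hi this
    obtain ⟨a, ha⟩ := Projectivization.exists_smul_eq_mk_rep ℂ _ hz'
    refine ⟨_, ⟨z, hz', rfl⟩, a, a.ne_zero, fun s => ?_⟩
    rw [← ha, LinearMap.comp_apply, hL']
    rfl

end VeroneseSurface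

section Pencil

/-- The Pfaffian `½ (A ∧ A)(a, b, c, d)` of a bilinear form. -/
def pf {H : Type*} (A : H → H → ℂ) (a b c d : H) : ℂ :=
  A a b * A c d - A a c * A b d + A a d * A b c

variable {H : Type*} [AddCommGroup H] [Module ℂ H]

/-- A degenerate alternating form on a four-dimensional space has two independent vectors in its
kernel. -/
theorem exists_pair_of_pf_eq_zero (hH : Module.finrank ℂ H = 4) {A : H →ₗ[ℂ] H →ₗ[ℂ] ℂ}
    (hpf : ∀ a b c d, pf (fun a b => A a b) a b c d = 0) :
    ∃ a b : H, LinearIndependent ℂ ![a, b] ∧ (∀ c, A a c = 0) ∧ ∀ c, A b c = 0 := by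
  haveI : FiniteDimensional ℂ H := Module.finite_of_finrank_pos (by omega)
  obtain ⟨P, hP, hA⟩ : ∃ P : Submodule ℂ H, 2 ≤ Module.finrank ℂ P ∧ ∀ a ∈ P, ∀ c, A a c = 0 := by
    by_cases h : ∀ e f, A e f = 0
    · exact ⟨⊤, by rw [finrank_top, hH]; norm_num, fun a _ c => h a c⟩
    · push Not at h
      obtain ⟨e, f, hef⟩ := h
      let Ψ : H →ₗ[ℂ] ℂ × ℂ := (A e).prod (A f)
      refine ⟨LinearMap.ker Ψ, ?_, fun a ha c => ?_⟩
      · have h1 := LinearMap.finrank_range_add_finrank_ker Ψ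
        have h2 := Submodule.finrank_le (LinearMap.range Ψ)
        rw [Module.finrank_prod, Module.finrank_self] at h2
        omega
      · have h1 : A e a = 0 := congrArg Prod.fst (LinearMap.mem_ker.1 ha)
        have h2 : A f a = 0 := congrArg Prod.snd (LinearMap.mem_ker.1 ha)
        have h3 := hpf e f a c
        rw [pf, h1, h2, zero_mul, sub_zero, mul_zero, add_zero, mul_eq_zero] at h3
        exact h3.resolve_left hef
  haveI : Nontrivial P := Module.nontrivial_of_finrank_pos (R := ℂ) (by omega)
  obtain ⟨a, ha⟩ := exists_ne (0 : P)
  obtain ⟨b, hb⟩ := exists_linearIndependent_pair_of_one_lt_finrank (R := ℂ)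
    (show 1 < Module.finrank ℂ P by omega) ha
  refine ⟨a, b, ?_, hA a a.2, hA b b.2⟩
  rw [LinearIndependent.pair_iff] at hb ⊢
  exact fun s t hst => hb s t (Subtype.ext hst)

/-- A pencil of quadratic type of degenerate alternating forms on a four-dimensional space has a
kernel vector that depends linearly on the parameter. -/
theorem exists_kernel_of_pencil (hH : Module.finrank ℂ H = 4) {A B C : H →ₗ[ℂ] H →ₗ[ℂ] ℂ}
    (hpf : ∀ s t : ℂ, ∀ a b c d,
      pf (fun a b => s * s * A a b + s * t * B a b + t * t * C a b) a b c d = 0) :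
    ∃ q p : H, (q ≠ 0 ∨ p ≠ 0) ∧ ∀ d, A q d = 0 ∧ A p d + B q d = 0 ∧ B p d + C q d = 0 ∧
      C p d = 0 := by
  haveI : FiniteDimensional ℂ H := Module.finite_of_finrank_pos (by omega)
  obtain ⟨a, b, hab, ha, hb⟩ := exists_pair_of_pf_eq_zero hH (A := A) fun a b c d => by
    simpa [pf] using hpf 1 0 a b c d
  have ha0 : a ≠ 0 := hab.ne_zero 0
  have hcoef : ∀ c d, B a b * A c d = 0 ∧
      C a b * A c d + (B b c * B a d - B a c * B b d + B a b * B c d) = 0 ∧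
      (B a d * C b c - B b d * C a c + B c d * C a b) +
        (C a d * B b c - C b d * B a c + C c d * B a b) = 0 ∧
      C b c * C a d - C a c * C b d + C a b * C c d = 0 := by
    intro c d
    have e1 := hpf 0 1 a b c d
    have e2 := hpf 1 1 a b c d
    have e3 := hpf 1 (-1) a b c d
    have e4 := hpf 1 2 a b c d
    simp only [pf, ha, hb] at e1 e2 e3 e4
    refine ⟨?_, ?_, ?_, ?_⟩
    · linear_combination 2 * e1 + e2 - e3 / 3 - e4 / 6
    · linear_combination -e1 + e2 / 2 + e3 / 2
    · linear_combination -2 * e1 - e2 / 2 - e3 / 6 + e4 / 6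
    · linear_combination e1
  by_cases hex : ∃ c, B b c • a - B a c • b + B a b • c ≠ 0 ∨ C b c • a - C a c • b + C a b • c ≠ 0
  · obtain ⟨c, hc⟩ := hex
    refine ⟨_, _, hc, fun d => ?_⟩
    obtain ⟨h1, h2, h3, h4⟩ := hcoef c d
    simp only [map_add, map_sub, map_smul, LinearMap.add_apply, LinearMap.sub_apply,
      LinearMap.smul_apply, smul_eq_mul, ha, hb]
    exact ⟨by linear_combination h1, by linear_combination h2, by linear_combination h3,
      by linear_combination h4⟩
  · push Not at hex
    obtain ⟨e, he⟩ : ∃ e, e ∉ Submodule.span ℂ {a, b} := by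
      classical
      by_contra hcon
      push Not at hcon
      have h1 := finrank_span_finset_le_card (R := ℂ) ({a, b} : Finset H) (M := H)
      have h2 : Submodule.span ℂ (({a, b} : Finset H) : Set H) = ⊤ := by
        rw [eq_top_iff]
        intro z _
        simpa using hcon z
      rw [Set.finrank, h2, finrank_top, hH] at h1
      have h3 : ({a, b} : Finset H).card ≤ 2 := Finset.card_le_two
      omega
    rw [LinearIndependent.pair_iff] at hab
    have key : ∀ {x y z : ℂ} {c : H}, c ∉ Submodule.span ℂ {a, b} → x • a - y • b + z • c = 0 →
        x = 0 ∧ y = 0 ∧ z = 0 := by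
      intro x y z c hc h
      have hz : z = 0 := by
        by_contra hz
        refine hc (Submodule.mem_span_pair.2 ⟨-(z⁻¹ * x), z⁻¹ * y, ?_⟩)
        have h1 : c = z⁻¹ • (z • c) := by rw [smul_smul, inv_mul_cancel₀ hz, one_smul]
        have h2 : z • c = y • b - x • a := by
          rw [← sub_eq_zero, ← h]
          abel
        rw [h1, h2, smul_sub, smul_smul, smul_smul, neg_smul]
        abel
      rw [hz, zero_smul, add_zero, sub_eq_add_neg, ← neg_smul] at h
      exact ⟨(hab _ _ h).1, neg_eq_zero.1 (hab _ _ h).2, hz⟩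
    have hB := key he (hex e).1
    have hC := key he (hex e).2
    have hker : ∀ c, B a c = 0 ∧ C a c = 0 := by
      intro c
      by_cases hc : c ∈ Submodule.span ℂ {a, b}
      · obtain ⟨x, y, rfl⟩ := Submodule.mem_span_pair.1 hc
        have hce : x • a + y • b + e ∉ Submodule.span ℂ {a, b} := fun h =>
          he (by simpa using sub_mem h hc)
        have h1 := (key hce (hex _).1).2.1
        have h2 := (key hce (hex _).2).2.1
        rw [map_add, hB.2.1, add_zero] at h1
        rw [map_add, hC.2.1, add_zero] at h2
        exact ⟨h1, h2⟩
      · exact ⟨(key hc (hex c).1).2.1, (key hc (hex c).2).2.1⟩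
    refine ⟨a, 0, Or.inl ha0, fun d => ?_⟩
    simp [ha, hker]

/-- An alternating form on a four-dimensional space with a kernel vector is degenerate. -/
theorem pf_eq_zero_of_kernel (hH : Module.finrank ℂ H = 4) {A : H →ₗ[ℂ] H →ₗ[ℂ] ℂ}
    (hA : ∀ a, A a a = 0) {n : H} (hn : n ≠ 0) (hker : ∀ d, A n d = 0) (a b c d : H) :
    pf (fun a b => A a b) a b c d = 0 := by
  haveI : FiniteDimensional ℂ H := Module.finite_of_finrank_pos (by omega)
  have hswap : ∀ a b, A b a = - A a b := fun a b => by
    have h := hA (a + b)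
    simp only [map_add, LinearMap.add_apply, hA] at h
    linear_combination h
  let N := Submodule.span ℂ {n}
  have hN : Module.finrank ℂ (H ⧸ N) = 3 := by
    have h1 := N.finrank_quotient_add_finrank
    rw [finrank_span_singleton hn, hH] at h1
    omega
  have hdep : ¬ LinearIndependent ℂ (N.mkQ ∘ ![a, b, c, d]) := fun h => by
    have := h.fintype_card_le_finrank
    simp [hN] at this
  rw [Fintype.not_linearIndependent_iff] at hdep
  obtain ⟨g, hg, i, hi⟩ := hdep
  have hrel : ∀ e, g 0 * A a e + g 1 * A b e + g 2 * A c e + g 3 * A d e = 0 := by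
    have h1 : N.mkQ (g 0 • a + g 1 • b + g 2 • c + g 3 • d) = 0 := by
      rw [← hg, Fin.sum_univ_four]
      simp
    obtain ⟨k, hk⟩ := Submodule.mem_span_singleton.1 ((Submodule.Quotient.mk_eq_zero N).1 h1)
    intro e
    have h2 := congrArg (fun z => A z e) hk
    simpa [hker] using h2.symm
  have ra := hrel a
  have rb := hrel b
  have rc := hrel c
  have rd := hrel d
  simp only [hA, hswap a b, hswap a c, hswap a d, hswap b c, hswap b d, hswap c d] at ra rb rc rd
  simp only [pf]
  apply mul_left_cancel₀ hi
  fin_cases i <;> simp only [Fin.zero_eta, Fin.mk_one, Fin.reduceFinMk]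
  · linear_combination rb * A c d - rc * A b d + rd * A b c
  · linear_combination -ra * A c d + rc * A a d - rd * A a c
  · linear_combination ra * A b d - rb * A a d + rd * A a b
  · linear_combination -ra * A b c + rb * A a c - rc * A a b

end Pencil

section Kernel

variable {K : Type u} [Field K] [Algebra ℂ K] [hK : Fact (IsFunctionField K)]
  {F : Type v} [AddCommGroup F] [Module K F] [Module ℂ F] [IsScalarTower ℂ K F] {E : Stalks K F}
  {co : Coord K}

/-- The alternating form on `H⁰(E)` given by a linear form on `H⁰(ω_C^{⊗2})`. -/
def DetForm.pairing (d : DetForm co E) (φ : K →ₗ[ℂ] ℂ) : H0 E →ₗ[ℂ] H0 E →ₗ[ℂ] ℂ :=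
  LinearMap.mk₂ ℂ (fun a b => φ (d.det a b)) (fun a a' b => by simp)
    (fun c a b => by
      rw [Submodule.coe_smul, ← algebraMap_smul K c (a : F), LinearMap.map_smul,
        LinearMap.smul_apply, algebraMap_smul, φ.map_smul])
    (fun a b b' => by simp)
    (fun c a b => by
      rw [Submodule.coe_smul, ← algebraMap_smul K c (b : F), LinearMap.map_smul, algebraMap_smul,
        φ.map_smul])

theorem DetForm.pairing_apply (d : DetForm co E) (φ : K →ₗ[ℂ] ℂ) (a b : H0 E) :
    d.pairing φ a b = φ (d.det a b) := rfl

theorem DetForm.det_mem_H0 (d : DetForm co E) (a b : H0 E) :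
    d.det a b ∈ H0 (lb (co.κ * co.κ)) := fun x => d.det_mem x _ (a.2 x) _ (b.2 x)

/-- Membership in a globally generated bundle can be tested on global sections. -/
theorem DetForm.mem_H0_of_forall_det (d : DetForm co E) (hgg : IsGloballyGenerated E) {v : F}
    (h : ∀ s : H0 E, d.det s v ∈ H0 (lb (co.κ * co.κ))) : v ∈ H0 E := by
  intro x
  refine d.mem_of_forall_det fun a ha => ?_
  have h1 : E x ≤ pullback (d.det.flip v) (lb (co.κ * co.κ)) x := by
    rw [← hgg x]
    exact spanAt_le.2 fun s hs => h ⟨s, hs⟩ x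
  exact h1 ha

namespace Veronese

variable (V : Veronese co)

theorem eq_zero_of_sum {α β γ : ℂ} (h : α • V.w 0 + β • V.w 1 + γ • V.w 2 = 0) :
    α = 0 ∧ β = 0 ∧ γ = 0 := by
  have h1 := Fintype.linearIndependent_iff.1 V.linearIndependent ![α, β, γ] (by
    rw [Fin.sum_univ_three]; exact h)
  exact ⟨h1 0, h1 1, h1 2⟩

/-- The restriction of a quadric to the line `w₀ = 0`. -/
theorem exists_restrict : ∃ φ ψ χ : K →ₗ[ℂ] ℂ, ∀ s ∈ H0 (lb (co.κ * co.κ)),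
    (∀ x y : ℂ, V.form ![0, x, y] s = x * x * φ s + x * y * ψ s + y * y * χ s) ∧
    ∃ c ∈ H0 (lb co.κ), s = φ s • (V.w 1 * V.w 1) + ψ s • (V.w 1 * V.w 2) +
      χ s • (V.w 2 * V.w 2) + V.w 0 * c := by
  refine ⟨V.form ![0, 1, 0], V.form ![0, 1, 1] - V.form ![0, 1, 0] - V.form ![0, 0, 1],
    V.form ![0, 0, 1], fun s hs => ?_⟩
  refine Submodule.span_induction (p := fun s _ =>
    (∀ x y : ℂ, V.form ![0, x, y] s = x * x * V.form ![0, 1, 0] s +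
      x * y * (V.form ![0, 1, 1] - V.form ![0, 1, 0] - V.form ![0, 0, 1]) s +
      y * y * V.form ![0, 0, 1] s) ∧
    ∃ c ∈ H0 (lb co.κ), s = V.form ![0, 1, 0] s • (V.w 1 * V.w 1) +
      (V.form ![0, 1, 1] - V.form ![0, 1, 0] - V.form ![0, 0, 1]) s • (V.w 1 * V.w 2) +
      V.form ![0, 0, 1] s • (V.w 2 * V.w 2) + V.w 0 * c) ?_ ?_ ?_ ?_ (V.span s hs)
  · rintro _ ⟨⟨i, j⟩, rfl⟩
    constructor
    · intro x y
      simp only [LinearMap.sub_apply, V.form_mul]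
      fin_cases i <;> fin_cases j <;> simp [mul_comm]
    · simp only [LinearMap.sub_apply, V.form_mul]
      have hcase : ∀ i j : Fin 3, i = 0 ∨ j = 0 ∨ (i ≠ 0 ∧ j ≠ 0) := by decide
      rcases hcase i j with rfl | rfl | ⟨hi, hj⟩
      · exact ⟨V.w j, V.w_mem j, by simp⟩
      · exact ⟨V.w i, V.w_mem i, by simp [mul_comm]⟩
      · refine ⟨0, zero_mem _, ?_⟩
        fin_cases i <;> fin_cases j <;> simp_all [mul_comm]
  · exact ⟨fun x y => by simp, 0, zero_mem _, by simp⟩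
  · rintro a b - - ⟨h1, c, hc, h2⟩ ⟨h1', c', hc', h2'⟩
    refine ⟨fun x y => ?_, c + c', add_mem hc hc', ?_⟩
    · rw [map_add, h1, h1']
      simp only [map_add]
      ring
    · simp only [map_add, add_smul]
      conv_lhs => rw [h2, h2']
      ring
  · rintro k a - ⟨h1, c, hc, h2⟩
    refine ⟨fun x y => ?_, k • c, Submodule.smul_mem _ _ hc, ?_⟩
    · rw [map_smul, h1]
      simp only [map_smul, smul_eq_mul]
      ring
    · conv_lhs => rw [h2]
      simp only [map_smul, smul_eq_mul, mul_smul, smul_add, mul_smul_comm]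

variable [hg : FiniteDimensional ℂ (H0 (canonical K))]

theorem mem_span (hgenus : genus K = 3) {a : K} (ha : a ∈ H0 (lb co.κ)) :
    ∃ c : Fin 3 → ℂ, a = ∑ i, c i • V.w i := by
  haveI := co.isDiv.finite_H0
  have hv : LinearIndependent ℂ (fun i => (⟨V.w i, V.w_mem i⟩ : H0 (lb co.κ))) :=
    LinearIndependent.of_comp (H0 (lb co.κ)).subtype V.linearIndependent
  let b := basisOfLinearIndependentOfCardEqFinrank hv (by
    change _ = h0 co.κ
    rw [co.h0_eq_genus, hgenus, Fintype.card_fin])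
  refine ⟨fun i => b.repr ⟨a, ha⟩ i, ?_⟩
  have h1 := congrArg Subtype.val (b.sum_repr ⟨a, ha⟩)
  refine h1.symm.trans ?_
  rw [Submodule.coe_sum]
  refine Finset.sum_congr rfl fun i _ => ?_
  rw [coe_basisOfLinearIndependentOfCardEqFinrank]
  rfl

/-- If the Veronese surface is contained in the quadric, then the evaluation has a kernel element
of canonical type. -/
theorem exists_relation_of_pf_eq_zero (d : DetForm co E) (hgenus : genus K = 3) (hs : IsStable E)
    (hgg : IsGloballyGenerated E)
    (h : ∀ z ≠ 0, ∀ a b c e, pf (fun a b => d.pairing (V.form z) a b) a b c e = 0) :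
    ∃ g : Fin 3 → H0 E, g ≠ 0 ∧ ∑ i, V.w i • (g i : F) = 0 := by
  obtain ⟨φ, ψ, χ, hφ⟩ := V.exists_restrict
  obtain ⟨q, p, hqp, hker⟩ := exists_kernel_of_pencil (d.finrank_H0_eq hgenus hs)
    (A := d.pairing φ) (B := d.pairing ψ) (C := d.pairing χ) fun x y a b c e => by
      simp only [pf, d.pairing_apply]
      by_cases hxy : x = 0 ∧ y = 0
      · simp [hxy.1, hxy.2]
      · have h1 := h ![0, x, y] (fun h0 => hxy ⟨congrFun h0 1, congrFun h0 2⟩) a b c e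
        simp only [pf, d.pairing_apply] at h1
        simp only [(hφ _ (d.det_mem_H0 _ _)).1] at h1
        exact h1
  have hw0 : V.w 0 ≠ 0 := V.linearIndependent.ne_zero 0
  obtain ⟨v, hv⟩ : ∃ v : F, V.w 0 • v = V.w 1 • (q : F) + V.w 2 • (p : F) :=
    ⟨(V.w 0)⁻¹ • (V.w 1 • (q : F) + V.w 2 • (p : F)), by
      rw [smul_smul, mul_inv_cancel₀ hw0, one_smul]⟩
  have hvmem : v ∈ H0 E := by
    refine d.mem_H0_of_forall_det hgg fun s => ?_
    obtain ⟨-, c, hc, h1⟩ := hφ _ (d.det_mem_H0 q s)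
    obtain ⟨-, c', hc', h2⟩ := hφ _ (d.det_mem_H0 p s)
    obtain ⟨k1, k2, k3, k4⟩ := hker s
    simp only [d.pairing_apply] at k1 k2 k3 k4
    have h3 : d.det s v = -(V.w 1 * c + V.w 2 * c') := by
      apply mul_left_cancel₀ hw0
      have h4 := congrArg (fun z => d.det z (s : F)) hv
      simp only [map_add, map_smul, LinearMap.add_apply, LinearMap.smul_apply, smul_eq_mul] at h4
      rw [d.det_swap v (s : F), ← neg_mul_comm]
      rw [h1, h2] at h4
      have k2' := congrArg (algebraMap ℂ K) k2
      have k3' := congrArg (algebraMap ℂ K) k3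
      rw [map_add, map_zero] at k2' k3'
      rw [k1, k4] at h4
      simp only [Algebra.smul_def, map_zero] at h4
      linear_combination -h4 - (V.w 1 * V.w 1 * V.w 2) * k2' - (V.w 1 * V.w 2 * V.w 2) * k3'
    rw [h3]
    exact neg_mem (add_mem (fun x => mul_mem_lb (V.w_mem 1 x) (hc x))
      fun x => mul_mem_lb (V.w_mem 2 x) (hc' x))
  refine ⟨![-⟨v, hvmem⟩, q, p], fun h0 => ?_, ?_⟩
  · exact hqp.elim (fun hq => hq (congrFun h0 1)) fun hp => hp (congrFun h0 2)
  · rw [Fin.sum_univ_three]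
    change V.w 0 • (-v) + V.w 1 • (q : F) + V.w 2 • (p : F) = 0
    rw [smul_neg, hv]
    abel

variable {V}

theorem eq_zero_of_tensor {v : Fin 3 → K}
    (hli : ∀ α β γ : ℂ, α • v 0 + β • v 1 + γ • v 2 = 0 → α = 0 ∧ β = 0 ∧ γ = 0)
    (d : DetForm co E) (hgenus : genus K = 3)
    (hnh : ¬ IsHyperelliptic K) (hs : IsStable E) (hgg : IsGloballyGenerated E) {g : Fin 3 → H0 E}
    (hg : v 0 • (g 0 : F) + v 1 • (g 1 : F) + v 2 • (g 2 : F) = 0) {x y : ℂ}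
    (hz : g 2 = x • g 0 + y • g 1) : g = 0 := by
  have h1 : (v 0 + x • v 2) • (g 0 : F) + (v 1 + y • v 2) • (g 1 : F) = 0 := by
    rw [hz] at hg
    rw [← hg]
    simp only [Submodule.coe_add, Submodule.coe_smul, Algebra.smul_def, add_smul, mul_smul,
      smul_add, algebraMap_smul, smul_comm (v 2)]
    abel
  have h2 := d.eq_zero_of_pair hgenus hnh hs hgg h1
  have h3 : ∀ l : Module.Dual ℂ (H0 E), l (g 0) = 0 ∧ l (g 1) = 0 := by
    intro l
    have h4 := congrArg (contract K l) h2
    rw [map_add, contract_tmul, contract_tmul, map_zero] at h4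
    have h5 := hli (l (g 0)) (l (g 1)) (l (g 0) * x + l (g 1) * y) (by
      rw [← h4, smul_add, smul_add, add_smul, mul_smul, mul_smul]
      abel)
    exact ⟨h5.1, h5.2.1⟩
  have h00 : g 0 = 0 := (Module.forall_dual_apply_eq_zero_iff ℂ _).1 fun l => (h3 l).1
  have h01 : g 1 = 0 := (Module.forall_dual_apply_eq_zero_iff ℂ _).1 fun l => (h3 l).2
  rw [h00, h01, smul_zero, smul_zero, add_zero] at hz
  funext i
  fin_cases i
  · exact h00
  · exact h01
  · exact hz

/-- The sections in a kernel element of canonical type are independent. -/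
theorem linearIndependent_of_relation (V : Veronese co) (d : DetForm co E) (hgenus : genus K = 3)
    (hnh : ¬ IsHyperelliptic K) (hs : IsStable E) (hgg : IsGloballyGenerated E) {g : Fin 3 → H0 E}
    (hg0 : g ≠ 0) (hg : ∑ i, V.w i • (g i : F) = 0) : LinearIndependent ℂ g := by
  rw [Fintype.linearIndependent_iff]
  intro z hz i
  by_contra hi
  rw [Fin.sum_univ_three] at hg hz
  have hdiv : ∀ {s a b : H0 E} {r x y : ℂ}, r ≠ 0 → r • s + x • a + y • b = 0 →
      s = (-(r⁻¹ * x)) • a + (-(r⁻¹ * y)) • b := by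
    intro s a b r x y hr h
    have h1 : s = r⁻¹ • (r • s) := by rw [smul_smul, inv_mul_cancel₀ hr, one_smul]
    have h2 : r • s = -(x • a) - y • b := by
      rw [← sub_eq_zero, ← h]
      abel
    rw [h1, h2, smul_sub, smul_neg, smul_smul, smul_smul, neg_smul, neg_smul]
    abel
  apply hg0
  fin_cases i
  · have := eq_zero_of_tensor (v := ![V.w 1, V.w 2, V.w 0]) (g := ![g 1, g 2, g 0])
      (fun α β γ h => by
        obtain ⟨h1, h2, h3⟩ := V.eq_zero_of_sum (α := γ) (β := α) (γ := β) (by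
          rw [← h]
          change _ = α • V.w 1 + β • V.w 2 + γ • V.w 0
          abel)
        exact ⟨h2, h3, h1⟩) d hgenus hnh hs hgg (by
        rw [← hg]
        change V.w 1 • (g 1 : F) + V.w 2 • (g 2 : F) + V.w 0 • (g 0 : F) = _
        abel) (hdiv hi hz)
    funext i
    fin_cases i
    · exact congrFun this 2
    · exact congrFun this 0
    · exact congrFun this 1
  · have := eq_zero_of_tensor (v := ![V.w 0, V.w 2, V.w 1]) (g := ![g 0, g 2, g 1])
      (fun α β γ h => by
        obtain ⟨h1, h2, h3⟩ := V.eq_zero_of_sum (α := α) (β := γ) (γ := β) (by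
          rw [← h]
          change _ = α • V.w 0 + β • V.w 2 + γ • V.w 1
          abel)
        exact ⟨h1, h3, h2⟩) d hgenus hnh hs hgg (by
        rw [← hg]
        change V.w 0 • (g 0 : F) + V.w 2 • (g 2 : F) + V.w 1 • (g 1 : F) = _
        abel) (hdiv (s := g 1) (a := g 0) (b := g 2)
          (r := z 1) (x := z 0) (y := z 2) hi (by rw [← hz]; abel))
    funext i
    fin_cases i
    · exact congrFun this 0
    · exact congrFun this 2
    · exact congrFun this 1
  · exact eq_zero_of_tensor (fun α β γ h => V.eq_zero_of_sum h) d hgenus hnh hs hgg hg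
      (hdiv (r := z 2) (x := z 0) (y := z 1) hi (by rw [← hz]; abel))

end Veronese
end Kernel

section SEquivalence

variable {K : Type u} [Field K] [Algebra ℂ K] [hK : Fact (IsFunctionField K)]
  {F : Type v} [AddCommGroup F] [Module K F] {F' : Type w} [AddCommGroup F'] [Module K F']

/-- The composition of isomorphisms of bundles. -/
def BundleIso.trans {F'' : Type*} [AddCommGroup F''] [Module K F''] {E : Stalks K F}
    {E' : Stalks K F'} {E'' : Stalks K F''} (i : BundleIso E E') (j : BundleIso E' E'') :
    BundleIso E E'' where
  equiv := i.equiv.trans j.equiv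
  mem_iff x a := (j.mem_iff x _).trans (i.mem_iff x a)

/-- The direct sum of isomorphisms of bundles. -/
def BundleIso.directSum {G G' : Type*} [AddCommGroup G] [Module K G] [AddCommGroup G']
    [Module K G'] {E : Stalks K F} {E' : Stalks K F'} {D : Stalks K G} {D' : Stalks K G'}
    (i : BundleIso E D) (j : BundleIso E' D') :
    BundleIso (directSum E E') (directSum D D') where
  equiv := i.equiv.prodCongr j.equiv
  mem_iff x a := and_congr (i.mem_iff x a.1) (j.mem_iff x a.2)

/-- Multiplication by a function as an isomorphism of line bundles. -/
def mulIso {κ μ : Point K → K} (hκ : IsDiv κ) (hμ : IsDiv μ) {a : K} (ha : a ≠ 0)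
    (h : ∀ x : Point K, x.ord (μ x) = x.ord (a * κ x)) : BundleIso (lb κ) (lb μ) where
  equiv := LinearEquiv.smulOfNeZero K K a ha
  mem_iff x c := by
    rw [LinearEquiv.smulOfNeZero_apply, smul_eq_mul]
    rcases eq_or_ne c 0 with rfl | hc
    · rw [mul_zero]; exact ⟨fun _ => zero_mem _, fun _ => zero_mem _⟩
    · rw [mem_lb_iff_ord hμ (mul_ne_zero ha hc), mem_lb_iff_ord hκ hc, h, x.ord_mul ha hc,
        x.ord_mul ha (hκ.ne_zero x)]
      omega

theorem IsVectorBundle.directSum {E : Stalks K F} {E' : Stalks K F'} (hE : IsVectorBundle E)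
    (hE' : IsVectorBundle E') : IsVectorBundle (directSum E E') := by
  obtain ⟨b, hb⟩ := hE.exists_basis
  obtain ⟨b', hb'⟩ := hE'.exists_basis
  refine .of_basis (b.prod b') (fun x => ⟨(hE.fg x).prod (hE'.fg x), ?_⟩)
    ((hb.union hb').subset fun x hx => ?_)
  · rw [eq_top_iff]
    rintro ⟨a, a'⟩ -
    have h1 : ∀ a, (a, (0 : F')) ∈
        Submodule.span K (Curve.directSum E E' x : Set (F × F')) := fun a => by
      have h2 : a ∈ Submodule.span K (E x : Set F) := by rw [hE.span_eq_top]; trivial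
      have h3 := Submodule.mem_map_of_mem (f := LinearMap.inl K F F') h2
      rw [Submodule.map_span] at h3
      refine Submodule.span_mono ?_ h3
      rintro _ ⟨c, hc, rfl⟩
      exact ⟨hc, zero_mem _⟩
    have h1' : ∀ a, ((0 : F), a) ∈
        Submodule.span K (Curve.directSum E E' x : Set (F × F')) := fun a => by
      have h2 : a ∈ Submodule.span K (E' x : Set F') := by rw [hE'.span_eq_top]; trivial
      have h3 := Submodule.mem_map_of_mem (f := LinearMap.inr K F F') h2
      rw [Submodule.map_span] at h3
      refine Submodule.span_mono ?_ h3
      rintro _ ⟨c, hc, rfl⟩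
      exact ⟨zero_mem _, hc⟩
    have := add_mem (h1 a) (h1' a')
    rwa [Prod.mk_add_mk, add_zero, zero_add] at this
  · by_contra hcon
    simp only [Set.mem_union, Set.mem_ofPred_eq, not_or, not_not] at hcon
    refine hx ?_
    ext ⟨a, a'⟩
    rw [mem_freeBundle]
    change a ∈ E x ∧ a' ∈ E' x ↔ _
    rw [hcon.1, hcon.2, mem_freeBundle, mem_freeBundle]
    constructor
    · rintro ⟨h1, h2⟩ (i | i)
      · simpa using h1 i
      · simpa using h2 i
    · intro h
      exact ⟨fun i => by simpa using h (Sum.inl i), fun i => by simpa using h (Sum.inr i)⟩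

variable {co : Coord K}

variable (co) in
theorem Coord.lineSplit_bundleEo : LineSplit (bundleEo K) (co.e.symm 1, 0)
    (co.e.toLinearMap.comp (LinearMap.snd K _ _)) co.κ co.κ where
  isVectorBundle := canonical_isVectorBundle.directSum canonical_isVectorBundle
  finrank_eq := by
    haveI : Module.Finite K Ω[K⁄ℂ] := (canonical_isVectorBundle (K := K)).finite
    rw [Module.finrank_prod, finrank_kaehler]
  ne_zero h := one_ne_zero ((LinearEquiv.map_eq_zero_iff co.e.symm).1 (congrArg Prod.fst h))
  form_ne_zero h := by
    have := LinearMap.congr_fun h (0, co.e.symm 1)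
    simp at this
  form_apply := by simp
  isDiv_sub := co.isDiv
  isDiv_quot := co.isDiv
  mem_sub x c := by
    change c • co.e.symm 1 ∈ canonical K x ∧ c • (0 : Ω[K⁄ℂ]) ∈ canonical K x ↔ _
    rw [co.mem_iff, map_smul, LinearEquiv.apply_symm_apply, smul_eq_mul, mul_one, smul_zero]
    exact and_iff_left (zero_mem _)
  mem_quot x y := by
    constructor
    · intro hy
      refine ⟨(0, co.e.symm y), ⟨zero_mem _, ?_⟩, by simp⟩
      change co.e.symm y ∈ canonical K x
      rwa [co.mem_iff, LinearEquiv.apply_symm_apply]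
    · rintro ⟨f, hf, rfl⟩
      exact (co.mem_iff x _).1 hf.2

variable [hg : FiniteDimensional ℂ (H0 (canonical K))]
  [Module ℂ F] [IsScalarTower ℂ K F]

theorem LineSplit.isJordanHolderStep {M : Stalks K F} {n : F} {φ : Module.Dual K F}
    {lam μ : Point K → K} (h : LineSplit M n φ lam μ) (hdeg : degree (lb lam) = degree (lb μ)) :
    IsJordanHolderStep M (LinearMap.ker φ) := by
  refine ⟨finrank_ker_form h.finrank_eq h.form_ne_zero, ?_⟩
  rw [h.degree_sub, h.degree_eq, hdeg]
  ring

theorem LineSplit.not_isStable {M : Stalks K F} {n : F} {φ : Module.Dual K F}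
    {lam μ : Point K → K} (h : LineSplit M n φ lam μ) (hdeg : degree (lb lam) = degree (lb μ)) :
    ¬ IsStable M := by
  intro hs
  obtain ⟨h1, h2⟩ := h.isJordanHolderStep hdeg
  have h3 := hs (LinearMap.ker φ) (fun hb => by rw [hb, finrank_bot] at h1; omega)
    fun ht => by rw [ht, finrank_top, h.finrank_eq] at h1; omega
  rw [h1, h.finrank_eq] at h3
  push_cast at h3
  linarith

/-- A bundle with canonical line subbundle and quotient is S-equivalent to `ω_C ⊕ ω_C`. -/
theorem LineSplit.sEquivalent {M : Stalks K F} {n : F} {φ : Module.Dual K F}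
    {lam μ : Point K → K} (h : LineSplit M n φ lam μ) {a b : K} (ha : a ≠ 0) (hb : b ≠ 0)
    (hlam : ∀ x : Point K, x.ord (co.κ x) = x.ord (a * lam x))
    (hμ : ∀ x : Point K, x.ord (co.κ x) = x.ord (b * μ x)) :
    SEquivalent M (bundleEo K) := by
  let i := mulIso h.isDiv_sub co.isDiv ha hlam
  let j := mulIso h.isDiv_quot co.isDiv hb hμ
  have hdeg : degree (lb lam) = degree (lb μ) := by
    rw [degree_congr i co.isDiv.isVectorBundle, degree_congr j co.isDiv.isVectorBundle]
  exact Or.inr ⟨_, _, h.isJordanHolderStep hdeg, co.lineSplit_bundleEo.isJordanHolderStep rfl,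
    ⟨((h.subIso.symm.trans i).trans co.lineSplit_bundleEo.subIso).directSum
      ((h.quotIso.trans j).trans co.lineSplit_bundleEo.quotIso.symm)⟩⟩

/-- The sections of a direct sum. -/
theorem finrank_H0_directSum [Module ℂ F'] [IsScalarTower ℂ K F'] {E : Stalks K F}
    {E' : Stalks K F'} (hE : IsVectorBundle E) (hE' : IsVectorBundle E') :
    Module.finrank ℂ (H0 (directSum E E')) =
      Module.finrank ℂ (H0 E) + Module.finrank ℂ (H0 E') := by
  haveI := hE.finiteDimensional_H0
  haveI := hE'.finiteDimensional_H0
  rw [← Module.finrank_prod]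
  exact LinearEquiv.finrank_eq
    { toFun := fun s => (⟨s.1.1, fun x => (s.2 x).1⟩, ⟨s.1.2, fun x => (s.2 x).2⟩)
      map_add' := fun _ _ => rfl
      map_smul' := fun _ _ => rfl
      invFun := fun s => ⟨(s.1, s.2), fun x => ⟨s.1.2 x, s.2.2 x⟩⟩
      left_inv := fun _ => rfl
      right_inv := fun _ => rfl }

theorem finrank_H0_congr [Module ℂ F'] [IsScalarTower ℂ K F'] {E : Stalks K F}
    {E' : Stalks K F'} (i : BundleIso E E') : Module.finrank ℂ (H0 E) = Module.finrank ℂ (H0 E') :=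
  LinearEquiv.finrank_eq (LinearEquiv.ofBijective
    (((i.equiv.toLinearMap.restrictScalars ℂ).comp (H0 E).subtype).codRestrict (H0 E')
      fun s x => (i.mem_iff x _).2 (s.2 x))
    ⟨fun a b h => Subtype.ext (i.equiv.injective (congrArg Subtype.val h)), fun a =>
      ⟨⟨i.equiv.symm a, fun x => (i.mem_iff x _).1 (by
        rw [LinearEquiv.apply_symm_apply]; exact a.2 x)⟩,
        Subtype.ext (i.equiv.apply_symm_apply _)⟩⟩)

theorem finrank_H0_le_three (hgenus : genus K = 3) {L : Stalks K F} (hL : IsVectorBundle L)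
    (hF : Module.finrank K F = 1) (hdeg : degree L = 4) :
    Module.finrank ℂ (H0 L) ≤ 3 := by
  haveI : Nontrivial F := Module.nontrivial_of_finrank_pos (R := K) (by omega)
  obtain ⟨f, hf⟩ := exists_ne (0 : F)
  obtain ⟨lam, hlam, -, h⟩ := hL.exists_isDiv hF hf
  let i : BundleIso (lb lam) L :=
    { equiv := LinearEquiv.ofBijective (LinearMap.toSpanSingleton K F f)
        ⟨smul_left_injective K hf, fun b => (finrank_eq_one_iff_of_nonzero' f hf).1 hF b⟩
      mem_iff := fun x c => h x c }
  rw [← finrank_H0_congr i]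
  rw [← degree_congr i hL] at hdeg
  obtain ⟨co⟩ := exists_coord (K := K)
  have h2 := co.riemannRoch hlam
  have hd := co.isDiv.div hlam
  have h3 : h0 (co.κ / lam) ≤ 1 := by
    by_contra hcon
    obtain ⟨u, hu, hu0⟩ := exists_ne_zero_of_h0_pos (κ := co.κ / lam) (by omega)
    have hdeg' : degree (lb (co.κ / lam)) = 0 := by
      rw [degree_lb_div co.isDiv hlam, hdeg, co.degree_eq, hgenus]; norm_num
    have h4 := (degree_nonneg_of_mem_H0 hu0 hd hu).2 hdeg'
    have h5 : h0 (co.κ / lam) = h0 (1 : Point K → K) := h0_eq_of_ord hd isDiv_one hu0 fun x => by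
      rw [h4, Pi.one_apply, mul_one]
    rw [h0_one] at h5
    omega
  rw [hdeg, hgenus] at h2
  change h0 lam ≤ 3
  push_cast at h2
  omega

/-- A bundle that is S-equivalent to `ω_C ⊕ ω_C` has a nonzero map to `ω_C`. -/
theorem exists_mem_homCanonical (hgenus : genus K = 3) {G : Stalks K F} (hG : IsVectorBundle G)
    (hF : Module.finrank K F = 2) (hdeg : degree G = 8) (h : SEquivalent G (bundleEo K)) :
    ∃ ψ ∈ homCanonical G, ψ ≠ 0 := by
  rcases h with ⟨⟨i⟩⟩ | ⟨W, W', ⟨hW, hdW⟩, -, ⟨i⟩⟩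
  · refine ⟨(LinearMap.fst K _ _).comp i.equiv.toLinearMap, ?_, fun h0 => ?_⟩
    · rw [mem_homCanonical]
      exact fun x a ha => ((i.mem_iff x a).2 ha).1
    · obtain ⟨co⟩ := exists_coord (K := K)
      have := LinearMap.congr_fun h0 (i.equiv.symm (co.e.symm 1, 0))
      simp at this
  · have hEo : IsVectorBundle (bundleEo K) :=
      canonical_isVectorBundle.directSum canonical_isVectorBundle
    haveI := hG.finite
    have hQ : Module.finrank K (F ⧸ W) = 1 := by
      have := W.finrank_quotient_add_finrank
      omega
    have h1 := finrank_H0_le_sub_add_quot hEo W'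
    rw [← finrank_H0_directSum (hEo.sub W') (hEo.quot W'), ← finrank_H0_congr i,
      finrank_H0_directSum (hG.sub W) (hG.quot W)] at h1
    have h2 : Module.finrank ℂ (H0 (bundleEo K)) = 6 := by
      have h3 := finrank_H0_directSum (canonical_isVectorBundle (K := K))
        (canonical_isVectorBundle (K := K))
      have h4 : Module.finrank ℂ (H0 (canonical K)) = 3 := hgenus
      rw [h4] at h3
      exact h3
    have h3 := degree_sub_add_degree_quot hG W
    have h4 := finrank_H0_le_three hgenus (hG.sub W) hW (by omega)
    have h5 := (hG.quot W).riemannRoch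
    have h6 : 0 < Module.finrank ℂ (homCanonical (quot G W)) := by
      rw [hQ, hgenus] at h5
      push_cast at h5
      omega
    haveI := Module.nontrivial_of_finrank_pos h6
    obtain ⟨ψ, hψ⟩ := exists_ne (0 : homCanonical (quot G W))
    refine ⟨(ψ : F ⧸ W →ₗ[K] Ω[K⁄ℂ]).comp W.mkQ, ?_, fun h0 => hψ (Subtype.ext ?_)⟩
    · rw [mem_homCanonical]
      exact fun x a ha => mem_homCanonical.1 ψ.2 x _ ⟨a, ha, rfl⟩
    · refine LinearMap.ext fun z => ?_
      obtain ⟨a, rfl⟩ := W.mkQ_surjective z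
      exact LinearMap.congr_fun h0 a

/-- A nonzero map from a dual bundle to `ω_C` is the evaluation at a vector. -/
theorem exists_apply_mem_of_homCanonical {M : Stalks K F} [Module.Finite K F]
    {ψ : Module.Dual K F →ₗ[K] Ω[K⁄ℂ]} (hψ : ψ ∈ homCanonical (dual M)) (h0 : ψ ≠ 0) :
    ∃ n : F, n ≠ 0 ∧ ∀ x, ∀ f ∈ dual M x, f n ∈ lb co.κ x := by
  refine ⟨(Module.evalEquiv K F).symm (co.e.toLinearMap.comp ψ), fun h => h0 ?_, fun x f hf => ?_⟩
  · rw [LinearEquiv.map_eq_zero_iff] at h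
    exact LinearMap.ext fun f => co.e.injective (by
      rw [LinearMap.zero_apply, map_zero]; exact LinearMap.congr_fun h f)
  · rw [Module.apply_evalEquiv_symm_apply]
    exact (co.mem_iff x _).1 (mem_homCanonical.1 hψ x f hf)

end SEquivalence

section Main

variable {K : Type u} [Field K] [Algebra ℂ K] [hK : Fact (IsFunctionField K)]
  {F : Type v} [AddCommGroup F] [Module K F] [Module ℂ F] [IsScalarTower ℂ K F] {E : Stalks K F}
  {co : Coord K}

/-- The kernel element of the evaluation given by the three-term relation of three sections. -/
def DetForm.triple (d : DetForm co E) (a b c : H0 E) : LinearMap.ker (evaluation E) :=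
  ⟨d.det b c ⊗ₜ a - d.det a c ⊗ₜ b + d.det a b ⊗ₜ c, by
    rw [LinearMap.mem_ker, map_add, map_sub, evaluation_tmul, evaluation_tmul, evaluation_tmul]
    exact d.cramer a b c⟩

theorem DetForm.coe_triple (d : DetForm co E) (a b c : H0 E) :
    (d.triple a b c : K ⊗[ℂ] H0 E) = d.det b c ⊗ₜ a - d.det a c ⊗ₜ b + d.det a b ⊗ₜ c := rfl

theorem mem_kernelBundle {x : Point K} {n : LinearMap.ker (evaluation E)} :
    n ∈ kernelBundle E x ↔ (n : K ⊗[ℂ] H0 E) ∈ trivialBundle K (H0 E) x := Iff.rfl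

theorem DetForm.apply_triple_mem (d : DetForm co E) {x : Point K}
    {f : Module.Dual K (LinearMap.ker (evaluation E))} (hf : f ∈ dual (kernelBundle E) x)
    (a b c : H0 E) : f (d.triple a b c) ∈ lb (co.κ * co.κ) x := by
  have hκκ := co.isDiv.mul co.isDiv
  rw [mem_lb hκκ, div_eq_inv_mul, ← smul_eq_mul, ← map_smul]
  refine hf _ (mem_kernelBundle.2 ?_)
  rw [Submodule.coe_smul, d.coe_triple, smul_add, smul_sub]
  simp only [TensorProduct.smul_tmul', smul_eq_mul, ← div_eq_inv_mul]
  have h : ∀ a b : H0 E, d.det a b / (co.κ * co.κ) x ∈ x.ring := fun a b =>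
    (mem_lb hκκ).1 (d.det_mem_H0 a b x)
  exact add_mem (sub_mem (tmul_mem_trivialBundle (h b c) a) (tmul_mem_trivialBundle (h a c) b))
    (tmul_mem_trivialBundle (h a b) c)

/-- The kernel element of the evaluation given by a relation `∑ w_i g_i = 0`. -/
def Veronese.relation (V : Veronese co) {g : Fin 3 → H0 E} (hg : ∑ i, V.w i • (g i : F) = 0) :
    LinearMap.ker (evaluation E) :=
  ⟨∑ i, V.w i ⊗ₜ g i, by
    rw [LinearMap.mem_ker, map_sum, ← hg]
    exact Finset.sum_congr rfl fun i _ => evaluation_tmul _ _⟩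

theorem Veronese.coe_relation (V : Veronese co) {g : Fin 3 → H0 E}
    (hg : ∑ i, V.w i • (g i : F) = 0) :
    (V.relation hg : K ⊗[ℂ] H0 E) = ∑ i, V.w i ⊗ₜ g i := rfl

theorem DetForm.sum_smul_triple (d : DetForm co E) (V : Veronese co) {g : Fin 3 → H0 E}
    (hg : ∑ i, V.w i • (g i : F) = 0) (b c : H0 E) :
    ∑ i, V.w i • d.triple (g i) b c = d.det b c • V.relation hg := by
  have h : ∀ c : H0 E, ∑ i, V.w i * d.det (g i) c = 0 := fun c => by
    have := congrArg (fun z => d.det z (c : F)) hg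
    simpa using this
  apply Subtype.ext
  rw [Submodule.coe_sum, Submodule.coe_smul, V.coe_relation, Finset.smul_sum]
  have h1 : ∀ i, ((V.w i • d.triple (g i) b c : LinearMap.ker (evaluation E)) : K ⊗[ℂ] H0 E) =
      d.det b c • V.w i ⊗ₜ[ℂ] g i - (V.w i * d.det (g i) c) ⊗ₜ b +
        (V.w i * d.det (g i) b) ⊗ₜ c := fun i => by
    rw [Submodule.coe_smul, d.coe_triple, smul_add, smul_sub]
    simp only [TensorProduct.smul_tmul', smul_eq_mul, mul_comm (V.w i) (d.det b c)]
  simp only [h1, Finset.sum_add_distrib, Finset.sum_sub_distrib, ← TensorProduct.sum_tmul, h,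
    TensorProduct.zero_tmul, sub_zero, add_zero]

theorem contract_relation (V : Veronese co) {g : Fin 3 → H0 E}
    (hg : ∑ i, V.w i • (g i : F) = 0) (l : Module.Dual ℂ (H0 E)) :
    contract K l (V.relation hg : K ⊗[ℂ] H0 E) = ∑ i, l (g i) • V.w i := by
  rw [V.coe_relation, map_sum]
  exact Finset.sum_congr rfl fun i _ => contract_tmul _ _ _

theorem Veronese.relation_ne_zero (V : Veronese co) {g : Fin 3 → H0 E} (hg0 : g ≠ 0)
    (hg : ∑ i, V.w i • (g i : F) = 0) : V.relation hg ≠ 0 := by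
  intro h
  refine hg0 (funext fun i => (Module.forall_dual_apply_eq_zero_iff ℂ _).1 fun l => ?_)
  have h1 := contract_relation V hg l
  rw [h, Submodule.coe_zero, map_zero] at h1
  exact Fintype.linearIndependent_iff.1 V.linearIndependent (fun i => l (g i)) h1.symm i

/-- A basis of sections that extends three independent ones. -/
theorem exists_basis_of_linearIndependent {H : Type*} [AddCommGroup H] [Module ℂ H]
    (hH : Module.finrank ℂ H = 4) {g : Fin 3 → H} (hg : LinearIndependent ℂ g) :
    ∃ b : Module.Basis (Fin 4) ℂ H, b 0 = g 0 ∧ b 1 = g 1 ∧ b 2 = g 2 := by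
  haveI : FiniteDimensional ℂ H := Module.finite_of_finrank_pos (by omega)
  obtain ⟨e, he⟩ : ∃ e, e ∉ Submodule.span ℂ (Set.range g) := by
    by_contra hcon
    push Not at hcon
    have h1 := finrank_span_eq_card hg
    rw [(Submodule.eq_top_iff'.2 hcon), finrank_top, hH, Fintype.card_fin] at h1
    omega
  have hli : LinearIndependent ℂ (Fin.snoc g e : Fin 4 → H) := hg.finSnoc he
  have hb := coe_basisOfLinearIndependentOfCardEqFinrank hli (by simp [hH])
  exact ⟨basisOfLinearIndependentOfCardEqFinrank hli (by simp [hH]),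
    by rw [hb]; rfl, by rw [hb]; rfl, by rw [hb]; rfl⟩

variable [hgn : FiniteDimensional ℂ (H0 (canonical K))]

/-- A kernel element of canonical type makes the dual span S-equivalent to `ω_C ⊕ ω_C`. -/
theorem DetForm.sEquivalent_of_relation (d : DetForm co E) (V : Veronese co) (hgenus : genus K = 3)
    (hnh : ¬ IsHyperelliptic K) (hs : IsStable E) (hgg : IsGloballyGenerated E) {g : Fin 3 → H0 E}
    (hg0 : g ≠ 0) (hg : ∑ i, V.w i • (g i : F) = 0) :
    ¬ IsStable (dualSpan E) ∧ SEquivalent (dualSpan E) (bundleEo K) := by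
  have hF := d.finrank_ker_evaluation hgenus hs hgg
  have hn := V.relation_ne_zero hg0 hg
  obtain ⟨φ, hφ, hφn⟩ := exists_form_apply_eq_zero hF (V.relation hg)
  obtain ⟨lam, μ, h⟩ := (isVectorBundle_kernelBundle d.isVectorBundle).exists_lineSplit hF hn hφ hφn
  have hdκ := co.degree_eq
  rw [hgenus] at hdκ
  push_cast at hdκ
  have hdlam := d.degree_le_of_ker hgenus hnh hs hgg hn h.isDiv_sub h.mem_sub
  obtain ⟨h1, h2⟩ := degree_lb_le one_ne_zero co.isDiv.inv h.isDiv_sub fun x => by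
    rw [one_mul]
    refine (mem_lb_iff_ord h.isDiv_sub (co.isDiv.inv.ne_zero x)).1 ((h.mem_sub x _).1
      (mem_kernelBundle.2 ?_))
    rw [Submodule.coe_smul, V.coe_relation, Finset.smul_sum]
    refine sum_mem fun i _ => ?_
    rw [TensorProduct.smul_tmul', smul_eq_mul, Pi.inv_apply, ← div_eq_inv_mul]
    exact tmul_mem_trivialBundle ((mem_lb co.isDiv).1 (V.w_mem i x)) _
  rw [degree_lb_inv co.isDiv, hdκ] at h1 h2
  have hdlam' : degree (lb lam) = -4 := by omega
  have hlam := h2 (by omega)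
  have hdμ : degree (lb μ) = -4 := by
    have h3 := h.degree_eq
    rw [degree_kernelBundle d.isVectorBundle hgg, d.degree_eq] at h3
    omega
  obtain ⟨b, hb0, hb1, hb2⟩ := exists_basis_of_linearIndependent (d.finrank_H0_eq hgenus hs)
    (V.linearIndependent_of_relation d hgenus hnh hs hgg hg0 hg)
  have hrel : ∀ a c, V.w 0 * φ (d.triple (b 0) a c) + V.w 1 * φ (d.triple (b 1) a c) +
      V.w 2 * φ (d.triple (b 2) a c) = 0 := by
    intro a c
    have h3 := congrArg φ (d.sum_smul_triple V hg a c)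
    rw [map_sum, Fin.sum_univ_three, LinearMap.map_smul, LinearMap.map_smul, LinearMap.map_smul,
      LinearMap.map_smul, hφn, smul_zero] at h3
    rw [hb0, hb1, hb2]
    exact h3
  have hself : ∀ a c, d.triple a a c = 0 := fun a c => Subtype.ext (by
    rw [d.coe_triple, d.det_self, TensorProduct.zero_tmul, sub_self, add_zero]; rfl)
  have hswap : ∀ a b c, d.triple b a c = - d.triple a b c := fun a b c => Subtype.ext (by
    rw [Submodule.coe_neg, d.coe_triple, d.coe_triple, d.det_swap (a : F) (b : F),
      TensorProduct.neg_tmul]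
    abel)
  have hw0 : V.w 0 ≠ 0 := V.linearIndependent.ne_zero 0
  obtain ⟨Z, hZ⟩ : ∃ Z : K, Z * V.w 0 = φ (d.triple (b 1) (b 2) (b 3)) :=
    ⟨_, div_mul_cancel₀ _ hw0⟩
  have hZ1 : Z * V.w 1 = - φ (d.triple (b 0) (b 2) (b 3)) := by
    have h3 := hrel (b 2) (b 3)
    rw [hself, φ.map_zero, mul_zero, add_zero, ← hZ] at h3
    apply mul_left_cancel₀ hw0
    linear_combination h3
  have hZ2 : Z * V.w 2 = φ (d.triple (b 0) (b 1) (b 3)) := by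
    have h3 := hrel (b 1) (b 3)
    have hneg : φ (d.triple (b 2) (b 1) (b 3)) = -φ (d.triple (b 1) (b 2) (b 3)) := by
      rw [hswap (b 1) (b 2), ← neg_one_smul K (d.triple (b 1) (b 2) (b 3)), LinearMap.map_smul,
        neg_one_smul]
    rw [hself, φ.map_zero, mul_zero, add_zero, hneg, ← hZ] at h3
    apply mul_left_cancel₀ hw0
    linear_combination -h3
  have hZ0 : Z ≠ 0 := by
    rintro rfl
    rw [zero_mul, eq_comm] at hZ
    obtain ⟨c, hc⟩ := h.mem_ker hZ
    have hc' : (d.triple (b 1) (b 2) (b 3) : K ⊗[ℂ] H0 E) = c • (V.relation hg : K ⊗[ℂ] H0 E) :=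
      congrArg Subtype.val hc
    have h3 := congrArg (contract K (b.coord 0)) hc'
    rw [LinearMap.map_smul, contract_relation, Fin.sum_univ_three, ← hb0, ← hb1, ← hb2,
      d.coe_triple, map_add, map_sub] at h3
    simp only [contract_tmul, Module.Basis.coord_apply, Module.Basis.repr_self] at h3
    simp [hw0] at h3
    rw [h3, zero_smul, d.coe_triple] at hc'
    have h4 := congrArg (contract K (b.coord 1)) hc'
    rw [map_add, map_sub] at h4
    simp only [contract_tmul, Module.Basis.coord_apply, Module.Basis.repr_self] at h4
    simp at h4
    refine d.det_ne_zero hgenus hnh hs hgg (b 2).2 (b 3).2 ?_ h4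
    have h5 := b.linearIndependent.comp ![2, 3] (by decide)
    rw [LinearIndependent.pair_iff]
    intro s t hst
    have h6 := Fintype.linearIndependent_iff.1 h5 ![s, t] (by
      rw [Fin.sum_univ_two]
      exact Subtype.ext hst)
    exact ⟨h6 0, h6 1⟩
  have hmem : ∀ x, ∀ c ∈ lb μ⁻¹ x, c * Z ∈ lb co.κ x := by
    intro x c hc
    have hcφ := (h.dual.mem_sub x c).2 hc
    have key : ∀ i, c * Z * V.w i ∈ lb (co.κ * co.κ) x := by
      have h3 : ∀ a b e, c * φ (d.triple a b e) ∈ lb (co.κ * co.κ) x := fun a b e =>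
        d.apply_triple_mem hcφ a b e
      intro i
      rw [mul_assoc]
      fin_cases i
      · change c * (Z * V.w 0) ∈ _
        rw [hZ]; exact h3 _ _ _
      · change c * (Z * V.w 1) ∈ _
        rw [hZ1, mul_neg]; exact neg_mem (h3 _ _ _)
      · change c * (Z * V.w 2) ∈ _
        rw [hZ2]; exact h3 _ _ _
    refine co.mem_lb_of_forall_mul_mem hgenus hnh fun a ha => ?_
    obtain ⟨k, rfl⟩ := V.mem_span hgenus ha
    rw [Finset.mul_sum]
    refine sum_mem fun i _ => ?_
    rw [mul_smul_comm]
    exact const_smul_mem_stalk _ _ (key i)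
  have hμ := (degree_lb_le hZ0 h.isDiv_quot.inv co.isDiv fun x => by
    have h3 := hmem x _ (mem_lb_self _ x)
    rw [mul_comm] at h3
    exact (mem_lb_iff_ord co.isDiv (mul_ne_zero hZ0 (h.isDiv_quot.inv.ne_zero x))).1 h3).2 (by
      rw [degree_lb_inv h.isDiv_quot, hdμ, hdκ]; norm_num)
  have hdeg : degree (lb μ⁻¹) = degree (lb lam⁻¹) := by
    rw [degree_lb_inv h.isDiv_quot, degree_lb_inv h.isDiv_sub, hdμ, hdlam']
  exact ⟨h.dual.not_isStable hdeg, h.dual.sEquivalent hZ0 one_ne_zero hμ fun x => by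
    have h3 := hlam x
    rw [one_mul, Pi.inv_apply, x.ord_inv] at h3
    rw [one_mul, Pi.inv_apply, x.ord_inv]
    omega⟩

/-- If the dual span is S-equivalent to `ω_C ⊕ ω_C`, then the evaluation has a kernel element of
canonical type. -/
theorem DetForm.exists_relation_of_sEquivalent (d : DetForm co E) (V : Veronese co)
    (hgenus : genus K = 3) (hs : IsStable E) (hgg : IsGloballyGenerated E)
    (h : SEquivalent (dualSpan E) (bundleEo K)) :
    ∃ g : Fin 3 → H0 E, g ≠ 0 ∧ ∑ i, V.w i • (g i : F) = 0 := by
  have hF := d.finrank_ker_evaluation hgenus hs hgg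
  have hM := isVectorBundle_kernelBundle d.isVectorBundle
  haveI : Module.Finite K (LinearMap.ker (evaluation E)) := hM.finite
  haveI := d.isVectorBundle.finiteDimensional_H0
  obtain ⟨hG, hdeg⟩ := d.isVectorBundle_dualSpan hgenus hs hgg
  have hF' : Module.finrank K (Module.Dual K (LinearMap.ker (evaluation E))) = 2 :=
    (Subspace.dual_finrank_eq (K := K) (V := LinearMap.ker (evaluation E))).trans hF
  obtain ⟨ψ, hψ, hψ0⟩ := exists_mem_homCanonical hgenus hG hF' hdeg h
  obtain ⟨n, hn, hmem⟩ := exists_apply_mem_of_homCanonical (co := co) (M := kernelBundle E) hψ hψ0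
  let b := Module.finBasis ℂ (H0 E)
  have hc : ∀ l : Module.Dual ℂ (H0 E), contract K l (n : K ⊗[ℂ] H0 E) ∈ H0 (lb co.κ) := by
    intro l x
    exact hmem x ((contract K l).comp (LinearMap.ker (evaluation E)).subtype)
      fun a ha => contract_mem ha l
  choose k hk using fun j => V.mem_span hgenus (hc (b.coord j))
  have hsum : (n : K ⊗[ℂ] H0 E) = ∑ i, V.w i ⊗ₜ[ℂ] (∑ j, k j i • b j) := by
    rw [eq_sum_contract b (n : K ⊗[ℂ] H0 E)]
    simp only [hk, TensorProduct.sum_tmul, TensorProduct.tmul_sum, TensorProduct.smul_tmul]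
    exact Finset.sum_comm
  refine ⟨fun i => ∑ j, k j i • b j, fun h0 => hn (Subtype.ext ?_), ?_⟩
  · rw [hsum]
    refine Finset.sum_eq_zero fun i _ => ?_
    rw [show ∑ j, k j i • b j = 0 from congrFun h0 i, TensorProduct.tmul_zero]
  · have h1 : evaluation E (n : K ⊗[ℂ] H0 E) = 0 := n.2
    rw [hsum, map_sum] at h1
    rw [← h1]
    exact Finset.sum_congr rfl fun i _ => (evaluation_tmul _ _).symm

/-- A kernel element of canonical type makes all forms of the Veronese surface degenerate. -/
theorem DetForm.pf_eq_zero_of_relation (d : DetForm co E) (V : Veronese co) (hgenus : genus K = 3)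
    (hnh : ¬ IsHyperelliptic K) (hs : IsStable E) (hgg : IsGloballyGenerated E) {g : Fin 3 → H0 E}
    (hg0 : g ≠ 0) (hg : ∑ i, V.w i • (g i : F) = 0) {z : Fin 3 → ℂ} (hz : z ≠ 0)
    (a b c e : H0 E) : pf (fun a b => d.pairing (V.form z) a b) a b c e = 0 := by
  have hli := V.linearIndependent_of_relation d hgenus hnh hs hgg hg0 hg
  refine pf_eq_zero_of_kernel (d.finrank_H0_eq hgenus hs) (fun a => ?_) (n := ∑ i, z i • g i)
    (fun h0 => hz (funext fun i => Fintype.linearIndependent_iff.1 hli z h0 i)) (fun s => ?_) a b c e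
  · rw [d.pairing_apply, d.det_self, map_zero]
  obtain ⟨L, hL⟩ := LinearMap.exists_leftInverse_of_injective (Fintype.linearCombination ℂ V.w)
    (LinearMap.ker_eq_bot.2 (linearIndependent_iff_injective_fintypeLinearCombination.1
      V.linearIndependent))
  let l : K →ₗ[ℂ] ℂ := (Fintype.linearCombination ℂ z).comp L
  have hl : ∀ i, l (V.w i) = z i := fun i => by
    have h1 := LinearMap.congr_fun hL (Pi.single i 1)
    rw [LinearMap.comp_apply, Fintype.linearCombination_apply_single, one_smul] at h1
    rw [LinearMap.comp_apply, h1, LinearMap.id_apply, Fintype.linearCombination_apply_single,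
      one_smul]
  have hmul : ∀ a ∈ H0 (lb co.κ), ∀ b ∈ H0 (lb co.κ), V.form z (a * b) = l a * l b := by
    intro a ha b hb
    obtain ⟨p, rfl⟩ := V.mem_span hgenus ha
    obtain ⟨q, rfl⟩ := V.mem_span hgenus hb
    simp only [Finset.sum_mul_sum, map_sum, smul_mul_smul_comm, map_smul, V.form_mul, hl,
      smul_eq_mul]
    refine Finset.sum_congr rfl fun i _ => Finset.sum_congr rfl fun j _ => ?_
    ring
  have h1 := co.no_cubic hgenus hnh hmul (fun s hs => Submodule.span_mono (by
      rintro _ ⟨⟨i, j⟩, rfl⟩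
      exact ⟨_, V.w_mem i, _, V.w_mem j, rfl⟩) (V.span s hs))
    (v := V.w) (a := fun i => d.det (g i) s) V.w_mem (fun i => d.det_mem_H0 _ _) (by
      have := congrArg (fun z => d.det z (s : F)) hg
      simpa using this)
  simp only [hl] at h1
  rw [map_sum, LinearMap.sum_apply, ← h1]
  refine Finset.sum_congr rfl fun i _ => ?_
  rw [map_smul, LinearMap.smul_apply, d.pairing_apply, smul_eq_mul]

/-- The Veronese surface is contained in the Plücker quadric if and only if all its forms are
degenerate. -/
theorem Coord.exists_subset_pluckerQuadric_iff (co : Coord K) (hgenus : genus K = 3)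
    (hnh : ¬ IsHyperelliptic K) {S : Set (BicanonicalSpace K)} (hS : IsVeroneseSurface S)
    (hCS : bicanonicalCurve K ⊆ S) (hE : IsVectorBundle E) (hF : Module.finrank K F = 2)
    (δ : BundleIso (wedgeTwo E) (bicanonical K)) :
    ∃ V : Veronese co, S ⊆ pluckerQuadric E δ ↔ ∀ z ≠ 0, ∀ a b c e,
      pf (fun a b => (DetForm.ofIso co hE hF δ).pairing (V.form z) a b) a b c e = 0 := by
  obtain ⟨V, h1, h2⟩ := co.exists_veronese hgenus hnh hS hCS
  have hdet : ∀ (φ : K →ₗ[ℂ] ℂ) (a b : H0 E),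
      (DetForm.ofIso co hE hF δ).pairing φ a b = φ (co.section₂ (detMap E δ a b)) :=
    fun φ a b => rfl
  refine ⟨V, fun h z hz a b c e => ?_, fun h p hp a b c e => ?_⟩
  · obtain ⟨p, hp, k, hk, hpk⟩ := h2 z hz
    have h3 := h hp a b c e
    simp only [hpk] at h3
    simp only [pf, hdet]
    apply mul_left_cancel₀ (mul_ne_zero hk hk)
    linear_combination h3
  · obtain ⟨z, k, hpk⟩ := h1 p hp
    rcases eq_or_ne z 0 with rfl | hz
    · have h0 : ∀ s, p.rep s = 0 := fun s => by
        rw [hpk]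
        refine mul_eq_zero_of_right _ ?_
        refine Submodule.span_induction (p := fun y _ => V.form 0 y = 0) ?_ (map_zero _)
          (fun x y _ _ hx hy => by rw [map_add, hx, hy, add_zero])
          (fun c x _ hx => by rw [map_smul, hx, smul_zero]) (V.span _ (co.section₂_mem s))
        rintro _ ⟨⟨i, j⟩, rfl⟩
        rw [V.form_mul, Pi.zero_apply, zero_mul]
      simp only [h0]
      ring
    · have h3 := h z hz a b c e
      simp only [pf, hdet] at h3
      simp only [hpk]
      linear_combination k * k * h3

end Main

end Curve

end

/-- Let `C` be a smooth projective complex non-hyperelliptic curve of genus three (with function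
field `K`), let `E` be a stable, globally generated rank two bundle on `C` with an isomorphism
`δ : det E ≅ ω_C^{⊗2}` and `[E] ≠ [E_o]`, and let `S ⊂ ℙ⁵ = ℙH⁰(ω_C^{⊗2})*` be the Veronese surface
that contains the bicanonical curve. Then `S` is contained in the quadric `G = γ([E])` if and only
if the dual span `Ē` of `E` is strictly semistable with `[Ē] = [E_o] = [ω_C ⊕ ω_C]`. -/
theorem veronese_in_quadric_iff
    {K : Type*} [Field K] [Algebra ℂ K]
    (hK : Curve.IsFunctionField K)
    (hgenus : Curve.genus K = 3)
    (hhyp : ¬ Curve.IsHyperelliptic K)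
    {F : Type*} [AddCommGroup F] [Module K F] [Module ℂ F] [IsScalarTower ℂ K F]
    (E : Curve.Stalks K F)
    (hE : Curve.IsVectorBundle E)
    (hrank : Module.finrank K F = 2)
    (δ : Curve.BundleIso (Curve.wedgeTwo E) (Curve.bicanonical K))
    (hstable : Curve.IsStable E)
    (hgg : Curve.IsGloballyGenerated E)
    (hne : ¬ Curve.SEquivalent E (Curve.bundleEo K))
    (S : Set (Curve.BicanonicalSpace K))
    (hS : Curve.IsVeroneseSurface S)
    (hCS : Curve.bicanonicalCurve K ⊆ S) :
    S ⊆ Curve.pluckerQuadric E δ ↔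
      Curve.IsStrictlySemistable (Curve.dualSpan E) ∧
        Curve.SEquivalent (Curve.dualSpan E) (Curve.bundleEo K) := by
  have : Fact (Curve.IsFunctionField K) := ⟨hK⟩
  have : FiniteDimensional ℂ (Curve.H0 (Curve.canonical K)) :=
    Module.finite_of_finrank_pos (by
      change 0 < Curve.genus K
      omega)
  obtain ⟨co⟩ := Curve.exists_coord (K := K)
  obtain ⟨V, hV⟩ := co.exists_subset_pluckerQuadric_iff hgenus hhyp hS hCS hE hrank δ
  let d := Curve.DetForm.ofIso co hE hrank δ
  rw [hV]
  constructor
  · intro h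
    obtain ⟨g, hg0, hg⟩ := V.exists_relation_of_pf_eq_zero d hgenus hstable hgg h
    obtain ⟨h1, h2⟩ := d.sEquivalent_of_relation V hgenus hhyp hstable hgg hg0 hg
    exact ⟨⟨d.isSemistable_dualSpan hgenus hhyp hstable hgg, h1⟩, h2⟩
  · rintro ⟨-, h⟩ z hz
    obtain ⟨g, hg0, hg⟩ := d.exists_relation_of_sEquivalent V hgenus hstable hgg h
    exact d.pf_eq_zero_of_relation V hgenus hhyp hstable hgg hg0 hg hz
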